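/- For every integer d ≥ 3 and every θ ∈ (0,1): if {f_n} is a sequence of nonnegative functions with ‖f_n‖_{L^{p_θ}(ℝ^d)} = 1 for all n and ‖Xf_n‖_{L^{q_θ}_t L^{r_θ}_y} → A_θ as n → ∞, then there exist symmetries φ_n ∈ G_d such that a subsequence of {φ_n*(f_n)} converges in the L^{p_θ}(ℝ^d) norm to a function f with ‖f‖_{L^{p_θ}} = 1 and ‖Xf‖_{L^{q_θ}_t L^{r_θ}_y} = A_θ. -/

import Mathlib

open MeasureTheory ENNReal Set Filter
noncomputable section

/-- Points of `ℝ^d` written as `(s, x)` with `s ∈ ℝ`, `x ∈ ℝ^(d-1)` (here `n = d-1`). -/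
abbrev Pt (n : ℕ) := ℝ × (Fin n → ℝ)

/-- The moment curve `γ(t) = (t, t², …, t^n)` in `ℝ^n`. -/
def mom (n : ℕ) (t : ℝ) : Fin n → ℝ := fun i => t ^ (i.1 + 1)

/-- The restricted X-ray transform `Xf(t,y) = ∫ f(s, y + s·γ(t)) ds` of a
nonnegative function `f` on `ℝ^d`. -/
def Xray (n : ℕ) (f : Pt n → ℝ) (z : Pt n) : ℝ≥0∞ :=
  ∫⁻ s : ℝ, ENNReal.ofReal (f (s, z.2 + s • mom n z.1))

/-- Mixed norm `‖g‖_{L^q_t L^r_y}` for an `ℝ≥0∞`-valued function on `ℝ × Y`. -/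
def mixedNormG {Y : Type*} [MeasurableSpace Y] (ν : Measure Y) (q r : ℝ)
    (g : ℝ × Y → ℝ≥0∞) : ℝ≥0∞ :=
  (∫⁻ t : ℝ, (∫⁻ y, g (t, y) ^ r ∂ν) ^ (q / r)) ^ (1 / q)

/-- Mixed norm `‖g‖_{L^q_t L^r_y}` on `ℝ^d = ℝ × ℝ^(d-1)`, `ℝ≥0∞`-valued functions. -/
def mixedNorm (n : ℕ) (q r : ℝ) (g : Pt n → ℝ≥0∞) : ℝ≥0∞ :=
  mixedNormG volume q r g

/-- Mixed norm of a real-valued function. -/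
def mixedNormR (n : ℕ) (q r : ℝ) (g : Pt n → ℝ) : ℝ≥0∞ :=
  mixedNorm n q r fun z => ENNReal.ofReal |g z|

/-- The `L^p` norm of a real-valued function on `ℝ^d`. -/
def LpN (n : ℕ) (p : ℝ) (f : Pt n → ℝ) : ℝ≥0∞ :=
  (∫⁻ z : Pt n, ENNReal.ofReal |f z| ^ p) ^ (1 / p)

/-- The `L^p` norm restricted to a set. -/
def LpNOn (n : ℕ) (p : ℝ) (f : Pt n → ℝ) (S : Set (Pt n)) : ℝ≥0∞ :=
  (∫⁻ z in S, ENNReal.ofReal |f z| ^ p) ^ (1 / p)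

/-- `p_θ`, defined by `1/p_θ = 1 - θ + θd/(d+2)`. -/
def pExp (d : ℕ) (θ : ℝ) : ℝ := (1 - θ + θ * d / (d + 2))⁻¹

/-- `q_θ`, defined by `1/q_θ = θd/(d+2)`. -/
def qExp (d : ℕ) (θ : ℝ) : ℝ := (θ * d / (d + 2))⁻¹

/-- `r_θ`, defined by `1/r_θ = 1 - θ + θ(d²-d-2)/(d²+d-2)`. -/
def rExp (d : ℕ) (θ : ℝ) : ℝ :=
  (1 - θ + θ * ((d:ℝ)^2 - d - 2) / ((d:ℝ)^2 + d - 2))⁻¹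

/-- Dual exponent `p' = p/(p-1)`. -/
def dualExp (p : ℝ) : ℝ := p / (p - 1)

/-- `θ₀ = (d²+d-2)/(d²+d)`, the exponent where `q_θ = r_θ`. -/
def theta0 (d : ℕ) : ℝ := ((d:ℝ)^2 + d - 2) / ((d:ℝ)^2 + d)

/-- The mixed norm `‖Xf‖_{L^{q_θ}_t L^{r_θ}_y}`. -/
def XNorm (d : ℕ) (θ : ℝ) (f : Pt (d-1) → ℝ) : ℝ≥0∞ :=
  mixedNorm (d-1) (qExp d θ) (rExp d θ) (Xray (d-1) f)

/-- The source norm `‖f‖_{L^{p_θ}}`. -/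
def srcNorm (d : ℕ) (θ : ℝ) (f : Pt (d-1) → ℝ) : ℝ≥0∞ := LpN (d-1) (pExp d θ) f

/-- The dual mixed norm `‖g‖_{L^{q_θ'}_t L^{r_θ'}_y}`. -/
def dualNorm (d : ℕ) (θ : ℝ) (g : Pt (d-1) → ℝ) : ℝ≥0∞ :=
  mixedNormR (d-1) (dualExp (qExp d θ)) (dualExp (rExp d θ)) g

/-- The operator norm `A_θ` of `X : L^{p_θ} → L^{q_θ}_t L^{r_θ}_y` (restricted to
nonnegative functions). -/
def Aconst (d : ℕ) (θ : ℝ) : ℝ≥0∞ :=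
  sSup { M | ∃ f : Pt (d-1) → ℝ, Measurable f ∧ 0 ≤ f ∧
    srcNorm d θ f = 1 ∧ M = XNorm d θ f }

/-- The bilinear pairing `𝒳(f,g) = ∫ Xf · g`. -/
def pairing (n : ℕ) (f g : Pt n → ℝ) : ℝ≥0∞ :=
  ∫⁻ z : Pt n, Xray n f z * ENNReal.ofReal (g z)

/-- Indicator function of a set, as a real-valued function. -/
def ind (n : ℕ) (E : Set (Pt n)) : Pt n → ℝ := E.indicator fun _ => (1:ℝ)

/-- `𝒳(E,F) = ∫ X1_E · 1_F`. -/
def pairSet (n : ℕ) (E F : Set (Pt n)) : ℝ≥0∞ := pairing n (ind n E) (ind n F)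

/-- Dyadic level set `E_j = {z : 2^j ≤ f(z) < 2^(j+1)}`. -/
def lev (n : ℕ) (f : Pt n → ℝ) (j : ℤ) : Set (Pt n) :=
  {z | (2:ℝ) ^ j ≤ f z ∧ f z < (2:ℝ) ^ (j + 1)}

/-- The measure of the slice `{y : (t,y) ∈ F}`. -/
def sliceVol (n : ℕ) (F : Set (Pt n)) (t : ℝ) : ℝ≥0∞ :=
  volume {y : Fin n → ℝ | (t, y) ∈ F}

/-- `F_k^l = F_k ∩ π⁻¹{t : 2^l ≤ |{y : (t,y) ∈ F_k}| < 2^(l+1)}` where `F_k` is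
the `k`-th level set of `g`. -/
def Fkl (n : ℕ) (g : Pt n → ℝ) (k l : ℤ) : Set (Pt n) :=
  lev n g k ∩ {z | (2:ℝ≥0∞) ^ l ≤ sliceVol n (lev n g k) z.1 ∧
    sliceVol n (lev n g k) z.1 < (2:ℝ≥0∞) ^ (l + 1)}

/-- `F_{kl}^m`: the `k`-th level set of `g`, restricted to `t` with
`2^l ≤ ∫ g(t,y)^{r'} dy < 2^(l+1)` and `2^m ≤ |{y : (t,y) ∈ F_k}| < 2^(m+1)`. -/
def Fklm (n : ℕ) (r' : ℝ) (g : Pt n → ℝ) (k l m : ℤ) : Set (Pt n) :=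
  lev n g k ∩
  {z | (2:ℝ≥0∞) ^ l ≤ (∫⁻ y, ENNReal.ofReal (g (z.1, y)) ^ r') ∧
    (∫⁻ y, ENNReal.ofReal (g (z.1, y)) ^ r') < (2:ℝ≥0∞) ^ (l + 1)} ∩
  {z | (2:ℝ≥0∞) ^ m ≤ sliceVol n (lev n g k) z.1 ∧
    sliceVol n (lev n g k) z.1 < (2:ℝ≥0∞) ^ (m + 1)}

/-- The lower-triangular matrix `G_{t₀}` with entries `C(m,i)·t₀^(m-i)`, acting on `ℝ^(d-1)`. -/
def Gmat (n : ℕ) (t₀ : ℝ) (x : Fin n → ℝ) : Fin n → ℝ := fun m =>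
  ∑ i ∈ Finset.univ.filter (fun i : Fin n => i ≤ m),
    ((Nat.choose (m.1+1) (i.1+1)) : ℝ) * t₀ ^ (m.1 - i.1) * x i

/-- The symmetry group `G_d` of the restricted X-ray transform, with the (constant)
Jacobian determinant carried along: `IsSymJ n φ J` means `φ ∈ G_d` with Jacobian `J`. -/
inductive IsSymJ (n : ℕ) : (Pt n → Pt n) → ℝ → Prop
  | translation (v : Fin n → ℝ) : IsSymJ n (fun p => (p.1, p.2 + v)) 1
  | scaling (α β : ℝ) (hα : 0 < α) (hβ : 0 < β) :
      IsSymJ n (fun p => (α * p.1, fun i => α * β ^ (i.1 + 1) * p.2 i))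
        (α ^ (n+1) * β ^ (n * (n+1) / 2))
  | shift (s₀ t₀ : ℝ) :
      IsSymJ n (fun p => (p.1 + s₀, Gmat n t₀ p.2 + (p.1 + s₀) • mom n t₀)) 1
  | comp (φ ψ : Pt n → Pt n) (J₁ J₂ : ℝ) :
      IsSymJ n φ J₁ → IsSymJ n ψ J₂ → IsSymJ n (φ ∘ ψ) (J₁ * J₂)

/-- The `L^p`-normalized action `φ*f = J^(1/p) · (f ∘ φ)` of a symmetry on functions. -/
def symAct (n : ℕ) (p : ℝ) (J : ℝ) (φ : Pt n → Pt n) (f : Pt n → ℝ) : Pt n → ℝ :=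
  fun z => J ^ (1/p) * f (φ z)

/-- Lorentz norm `‖h‖_{L^{p,s}}` (up to equivalence), via dyadic level sets. -/
def lorentzNorm {α : Type*} [MeasurableSpace α] (μ : Measure α) (p s : ℝ)
    (h : α → ℝ≥0∞) : ℝ≥0∞ :=
  (∑' j : ℤ, ((2:ℝ≥0∞) ^ j *
      μ {z | (2:ℝ≥0∞) ^ j ≤ h z ∧ h z < (2:ℝ≥0∞) ^ (j+1)} ^ (1/p)) ^ s) ^ (1/s)

/-- Weak `L^{p,∞}` norm. -/
def weakNorm {α : Type*} [MeasurableSpace α] (μ : Measure α) (p : ℝ)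
    (h : α → ℝ≥0∞) : ℝ≥0∞ :=
  ⨆ l : ℝ≥0∞, l * μ {z | l < h z} ^ (1/p)

/-- Mixed Lorentz norm `‖g‖_{L^{q,s}_t L^r_y}` (up to equivalence). -/
def mixedLorentzG {Y : Type*} [MeasurableSpace Y] (ν : Measure Y) (q s r : ℝ)
    (g : ℝ × Y → ℝ≥0∞) : ℝ≥0∞ :=
  (∑' l : ℤ, (mixedNormG ν q r
      (Set.indicator {z : ℝ × Y | (2:ℝ≥0∞) ^ l ≤ (∫⁻ y, g (z.1, y) ^ r ∂ν) ∧
        (∫⁻ y, g (z.1, y) ^ r ∂ν) < (2:ℝ≥0∞) ^ (l+1)} g)) ^ s) ^ (1/s)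

/-- Weak mixed norm `‖g‖_{L^{q,∞}_t L^r_y}`. -/
def weakMixedG {Y : Type*} [MeasurableSpace Y] (ν : Measure Y) (q r : ℝ)
    (g : ℝ × Y → ℝ≥0∞) : ℝ≥0∞ :=
  ⨆ l : ℝ≥0∞, l * (volume {t : ℝ | l < (∫⁻ y, g (t, y) ^ r ∂ν) ^ (1/r)}) ^ (1/q)

/-- The paraball `B(s₀,t₀,ȳ,α,β)`. -/
def paraball (n : ℕ) (s₀ t₀ : ℝ) (ybar : Fin n → ℝ) (α β : ℝ) : Set (Pt n) :=
  {z | |z.1 - s₀| < α ∧ ∀ m : Fin n,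
    |(∑ i ∈ Finset.univ.filter (fun i : Fin n => i ≤ m),
        ((Nat.choose (m.1+1) (i.1+1)) : ℝ) * (-t₀) ^ (m.1 - i.1) *
          (z.2 i - (ybar + s₀ • mom n t₀) i))
      + (-t₀) ^ (m.1+1) * (z.1 + s₀)| ≤ β ^ (m.1+1) * α}

/-- The dual paraball `B*(s₀,t₀,ȳ,α,β)`. -/
def dualParaball (n : ℕ) (s₀ t₀ : ℝ) (ybar : Fin n → ℝ) (α β : ℝ) : Set (Pt n) :=
  {z | |z.1 - t₀| < β ∧ ∀ m : Fin n,
    |(∑ i ∈ Finset.univ.filter (fun i : Fin n => i ≤ m),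
        ((Nat.choose (m.1+1) (i.1+1)) : ℝ) * (-t₀) ^ (m.1 - i.1) * (z.2 i - ybar i))
      + s₀ * (z.1 ^ (m.1+1) + (-t₀) ^ (m.1+1))| ≤ β ^ (m.1+1) * α}

/-- The mock-distance between two paraballs. -/
def mockDist (n : ℕ) (sa ta : ℝ) (ya : Fin n → ℝ) (aa ba : ℝ)
    (sb tb : ℝ) (yb : Fin n → ℝ) (ab bb : ℝ) : ℝ :=
  (max (aa ^ n * ba ^ (n * (n+1) / 2)) (ab ^ n * bb ^ (n * (n+1) / 2)) /
    min (aa ^ n * ba ^ (n * (n+1) / 2)) (ab ^ n * bb ^ (n * (n+1) / 2)))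
  + (aa / ab + ab / aa) + (ba / bb + bb / ba)
  + |sa - sb| * (1/aa + 1/ab) + |ta - tb| * (1/ba + 1/bb)
  + ∑ m : Fin n,
      |(∑ i ∈ Finset.univ.filter (fun i : Fin n => i ≤ m),
          ((Nat.choose (m.1+1) (i.1+1)) : ℝ) * (-ta) ^ (m.1 - i.1) *
            ((yb + sb • mom n tb) i - (ya + sa • mom n ta) i))
        + (-ta) ^ (m.1+1) * (sb + sa)| / (aa * ba ^ (m.1+1))
  + ∑ m : Fin n,
      |(∑ i ∈ Finset.univ.filter (fun i : Fin n => i ≤ m),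
          ((Nat.choose (m.1+1) (i.1+1)) : ℝ) * (-tb) ^ (m.1 - i.1) *
            ((ya + sa • mom n ta) i - (yb + sb • mom n tb) i))
        + (-tb) ^ (m.1+1) * (sa + sb)| / (ab * bb ^ (m.1+1))
  + ∑ m : Fin n,
      |(∑ i ∈ Finset.univ.filter (fun i : Fin n => i ≤ m),
          ((Nat.choose (m.1+1) (i.1+1)) : ℝ) * (-sa) ^ (m.1 - i.1) * (yb i - ya i))
        + sa * (tb ^ (m.1+1) + (-ta) ^ (m.1+1))| / (aa * ba ^ (m.1+1))
  + ∑ m : Fin n,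
      |(∑ i ∈ Finset.univ.filter (fun i : Fin n => i ≤ m),
          ((Nat.choose (m.1+1) (i.1+1)) : ℝ) * (-sb) ^ (m.1 - i.1) * (ya i - yb i))
        + sb * (ta ^ (m.1+1) + (-tb) ^ (m.1+1))| / (ab * bb ^ (m.1+1))

/-- singular kernel -/
def rk (b x : ℝ) : ℝ≥0∞ := ENNReal.ofReal |x| ^ (-b)

@[fun_prop]
theorem measurable_rk (b : ℝ) : Measurable (rk b) := by
  unfold rk; fun_prop

def gk (b e y : ℝ) : ℝ≥0∞ := if |y| ≤ 1 then rk b y else rk e y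

theorem measurable_gk (b e : ℝ) : Measurable (gk b e) := by
  unfold gk
  exact Measurable.ite (measurableSet_le (by fun_prop) (by fun_prop)) (by fun_prop) (by fun_prop)

theorem rk_of_pos {b x : ℝ} (hx : 0 < x) : rk b x = ENNReal.ofReal (x ^ (-b)) := by
  unfold rk; rw [abs_of_pos hx, ENNReal.ofReal_rpow_of_pos hx]

theorem rk_neg (b x : ℝ) : rk b (-x) = rk b x := by simp [rk]
theorem gk_neg (b e x : ℝ) : gk b e (-x) = gk b e x := by simp [gk, rk_neg]

theorem lintegral_gk_lt_top {b e : ℝ} (hb : b < 1) (he : 1 < e) :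
    ∫⁻ y, gk b e y < ⊤ := by
  have h1 : ∫⁻ y in Ioi (0:ℝ), gk b e y < ⊤ := by
    have hu : Ioi (0:ℝ) = Ioc 0 1 ∪ Ioi 1 := by
      rw [Ioc_union_Ioi_eq_Ioi]; norm_num
    rw [hu]
    refine lt_of_le_of_lt (lintegral_union_le _ _ _) ?_
    refine ENNReal.add_lt_top.2 ⟨?_, ?_⟩
    · have : ∫⁻ y in Ioc (0:ℝ) 1, gk b e y = ∫⁻ y in Ioc (0:ℝ) 1, ENNReal.ofReal (y ^ (-b)) := by
        refine setLIntegral_congr_fun measurableSet_Ioc fun y hy => ?_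
        simp only [gk]
        rw [if_pos (by rw [abs_of_pos hy.1]; exact hy.2), rk_of_pos hy.1]
      rw [this]
      have hi : IntegrableOn (fun y : ℝ => y ^ (-b)) (Ioc 0 1) := by
        have := (intervalIntegral.intervalIntegrable_rpow' (a := 0) (b := 1) (r := -b) (by linarith))
        rwa [intervalIntegrable_iff_integrableOn_Ioc_of_le (by norm_num)] at this
      exact hi.lintegral_lt_top
    · have : ∫⁻ y in Ioi (1:ℝ), gk b e y = ∫⁻ y in Ioi (1:ℝ), ENNReal.ofReal (y ^ (-e)) := by
        refine setLIntegral_congr_fun measurableSet_Ioi fun y hy => ?_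
        have hy0 : (0:ℝ) < y := lt_trans zero_lt_one hy
        simp only [gk]
        rw [if_neg (by rw [abs_of_pos hy0]; exact not_le.2 hy), rk_of_pos hy0]
      rw [this]
      exact (integrableOn_Ioi_rpow_of_lt (by linarith) one_pos).lintegral_lt_top
  have h2 : ∫⁻ y in Iio (0:ℝ), gk b e y = ∫⁻ y in Ioi (0:ℝ), gk b e y := by
    have := (Measure.measurePreserving_neg (volume : Measure ℝ)).setLIntegral_comp_preimage
      (s := Ioi 0) measurableSet_Ioi (measurable_gk b e)
    simpa [gk_neg] using this
  rw [← lintegral_add_compl _ (measurableSet_Ioi (a := (0:ℝ))), compl_Ioi,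
    ← setLIntegral_congr Iio_ae_eq_Iic, h2]
  exact ENNReal.add_lt_top.2 ⟨h1, h1⟩

theorem rk_mul (b P x : ℝ) (hP : 0 < P) : rk b (P * x) = ENNReal.ofReal P ^ (-b) * rk b x := by
  unfold rk
  rw [abs_mul, abs_of_pos hP, ENNReal.ofReal_mul hP.le,
    ENNReal.mul_rpow_of_ne_top ENNReal.ofReal_ne_top ENNReal.ofReal_ne_top]

/-- normalised pointwise bound -/
theorem hls_pt {a a' : ℝ} (ha : 0 < a) (ha' : 0 < a') (hab : a + a' < 1)
    {u : ℝ≥0∞} (hu : u ≤ 1) (y : ℝ) :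
    u ^ (1 - a') * rk (a + a') y ≤ u + gk (a + a') ((a + a') / a') y := by
  unfold gk
  split_ifs with h
  · refine le_trans ?_ le_add_self
    calc _ ≤ 1 * rk (a + a') y := by
          gcongr; exact ENNReal.rpow_le_one hu (by linarith)
      _ = _ := one_mul _
  · set w := rk ((a + a') / a') y
    have hw : rk (a + a') y = w ^ a' := by
      simp only [w, rk]
      rw [← ENNReal.rpow_mul]; congr 1; field_simp
    rw [hw]
    have : u ^ (1 - a') * w ^ a' ≤ (max u w) ^ (1 - a') * (max u w) ^ a' := by
      gcongr
      · linarith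
      · exact le_max_left _ _
      · exact le_max_right _ _
    refine this.trans ?_
    rw [← ENNReal.rpow_add_of_nonneg _ _ (by linarith) ha'.le]
    simp only [sub_add_cancel, ENNReal.rpow_one]
    exact max_le_add_of_nonneg (zero_le) (zero_le)

theorem lintegral_comp_mul_pos (g : ℝ → ℝ≥0∞) (hg : Measurable g) {P : ℝ} (hP : 0 < P) (t : ℝ) :
    ∫⁻ x, g (P * (t - x)) = ENNReal.ofReal P⁻¹ * ∫⁻ x, g x := by
  have h1 : ∫⁻ x, g (P * (t - x)) = ∫⁻ x, g (P * x) :=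
    lintegral_sub_left_eq_self (fun x => g (P * x)) t
  rw [h1, ← lintegral_map (f := g) (g := fun x => P * x) hg (by fun_prop), Real.map_volume_mul_left hP.ne',
    lintegral_smul_measure, abs_of_pos (inv_pos.2 hP), smul_eq_mul]

def hlsC (a a' : ℝ) : ℝ≥0∞ := 1 + ∫⁻ y, gk (a + a') ((a + a') / a') y

theorem hlsC_lt_top {a a' : ℝ} (ha : 0 < a) (ha' : 0 < a') (hab : a + a' < 1) : hlsC a a' < ⊤ := by
  unfold hlsC
  refine ENNReal.add_lt_top.2 ⟨by simp, lintegral_gk_lt_top hab ?_⟩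
  rw [lt_div_iff₀ ha']; linarith

theorem hls_half {a a' : ℝ} (ha : 0 < a) (ha' : 0 < a') (hab : a + a' < 1)
    {p p' : ℝ → ℝ≥0∞} (hp : Measurable p) (hp' : Measurable p')
    (h1 : ∫⁻ t, p t ≤ 1) (h1' : ∫⁻ t, p' t ≤ 1) :
    ∫⁻ t, ∫⁻ t', {t' | p' t' ≤ p t}.indicator
      (fun t' => p t ^ (1 - a) * p' t' ^ (1 - a') * rk (a + a') (t - t')) t' ≤ hlsC a a' := by
  have hae : ∀ᵐ t, p t < ⊤ := ae_lt_top hp (ne_top_of_le_ne_top one_ne_top h1)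
  have key : ∀ᵐ t, ∫⁻ t', {t' | p' t' ≤ p t}.indicator
      (fun t' => p t ^ (1 - a) * p' t' ^ (1 - a') * rk (a + a') (t - t')) t' ≤ p t * hlsC a a' := by
    filter_upwards [hae] with t ht
    by_cases h0 : p t = 0
    · rw [h0, ENNReal.zero_rpow_of_pos (by linarith)]; simp
    obtain ⟨P, hP0, hP⟩ : ∃ P : ℝ, 0 < P ∧ p t = ENNReal.ofReal P :=
      ⟨(p t).toReal, ENNReal.toReal_pos h0 ht.ne, (ENNReal.ofReal_toReal ht.ne).symm⟩
    have pt : ∀ t', {t' | p' t' ≤ p t}.indicator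
      (fun t' => p t ^ (1 - a) * p' t' ^ (1 - a') * rk (a + a') (t - t')) t' ≤
        p t * (p' t' + p t * gk (a + a') ((a + a') / a') (P * (t - t'))) := by
      intro t'
      by_cases hle : p' t' ≤ p t
      · rw [indicator_of_mem (by exact hle)]
        have := hls_pt ha ha' hab (u := p' t' / p t) (ENNReal.div_le_of_le_mul (by simpa using hle))
          (P * (t - t'))
        have h3 := mul_le_mul_right this (p t * p t)
        have hpt : p t ≠ ⊤ := ht.ne
        convert h3 using 1
        · rw [rk_mul _ _ _ hP0, ← hP, ENNReal.div_rpow_of_nonneg _ _ (by linarith),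
            div_eq_mul_inv, ← ENNReal.rpow_neg]
          have e1 : p t * p t = p t ^ (2:ℝ) := by
            rw [show (2:ℝ) = (2:ℕ) by norm_num, ENNReal.rpow_natCast, pow_two]
          have e2 : p t ^ (1 - a) = p t ^ (2:ℝ) * p t ^ (-(1 - a')) * p t ^ (-(a + a')) := by
            rw [← ENNReal.rpow_add _ _ h0 hpt, ← ENNReal.rpow_add _ _ h0 hpt]; congr 1; ring
          rw [e1, e2]; ring
        · rw [mul_add, mul_add, mul_assoc, ENNReal.mul_div_cancel h0 hpt, mul_assoc]
      · rw [indicator_of_notMem (by exact hle)]; exact zero_le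
    calc _ ≤ ∫⁻ t', p t * (p' t' + p t * gk (a + a') ((a + a') / a') (P * (t - t'))) :=
          lintegral_mono pt
      _ = p t * ((∫⁻ t', p' t') + p t * ∫⁻ t', gk (a + a') ((a + a') / a') (P * (t - t'))) := by
          have mg := measurable_gk (a + a') ((a + a') / a')
          rw [lintegral_const_mul _ (by fun_prop), lintegral_add_left hp',
            lintegral_const_mul _ (by fun_prop)]
      _ ≤ p t * hlsC a a' := by
          rw [lintegral_comp_mul_pos _ (measurable_gk _ _) hP0, hP, ← mul_assoc,
            ← ENNReal.ofReal_mul hP0.le, mul_inv_cancel₀ hP0.ne', ENNReal.ofReal_one, one_mul]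
          unfold hlsC; gcongr
  calc _ ≤ ∫⁻ t, p t * hlsC a a' := lintegral_mono_ae key
    _ = (∫⁻ t, p t) * hlsC a a' := lintegral_mul_const _ hp
    _ ≤ 1 * hlsC a a' := by gcongr
    _ = _ := one_mul _

theorem hls {a a' : ℝ} (ha : 0 < a) (ha' : 0 < a') (hab : a + a' < 1)
    {p p' : ℝ → ℝ≥0∞} (hp : Measurable p) (hp' : Measurable p')
    (h1 : ∫⁻ t, p t ≤ 1) (h1' : ∫⁻ t, p' t ≤ 1) :
    ∫⁻ t, ∫⁻ t', p t ^ (1 - a) * p' t' ^ (1 - a') * rk (a + a') (t - t')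
      ≤ hlsC a a' + hlsC a' a := by
  have A := hls_half ha ha' hab hp hp' h1 h1'
  have B := hls_half ha' ha (by linarith) hp' hp h1' h1
  have hm : Measurable (fun z : ℝ × ℝ => p z.1 ^ (1 - a) * p' z.2 ^ (1 - a') * rk (a + a') (z.1 - z.2)) := by
    fun_prop
  have hset : MeasurableSet {z : ℝ × ℝ | p' z.2 ≤ p z.1} := measurableSet_le (by fun_prop) (by fun_prop)
  have hset' : MeasurableSet {z : ℝ × ℝ | p z.1 ≤ p' z.2} := measurableSet_le (by fun_prop) (by fun_prop)
  have hm1 := hm.indicator hset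
  have hm2 := hm.indicator hset'
  rw [lintegral_lintegral_swap (by
    have hm' : Measurable (fun z : ℝ × ℝ => p' z.1 ^ (1 - a') * p z.2 ^ (1 - a) * rk (a' + a) (z.1 - z.2)) := by
      fun_prop
    exact (hm'.indicator (measurableSet_le (f := fun z : ℝ × ℝ => p z.2) (g := fun z : ℝ × ℝ => p' z.1)
      (by fun_prop) (by fun_prop))).aemeasurable)] at B
  refine le_trans ?_ (add_le_add A B)
  rw [← lintegral_add_left (by exact hm1.lintegral_prod_right')]
  refine lintegral_mono fun t => ?_
  rw [← lintegral_add_left (by exact hm1.comp measurable_prodMk_left)]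
  refine lintegral_mono fun t' => ?_
  rcases le_total (p' t') (p t) with h | h
  · refine le_trans ?_ le_self_add
    rw [indicator_of_mem (by exact h)]
  · refine le_trans ?_ le_add_self
    rw [indicator_of_mem (by exact h)]
    rw [show t' - t = -(t - t') by ring, rk_neg, add_comm a' a, mul_comm (p' t' ^ (1 - a'))]

/-- version with arbitrary finite mass of the second density -/
theorem hls_mass {a a' : ℝ} (ha : 0 < a) (ha' : 0 < a') (hab : a + a' < 1)
    {p p' : ℝ → ℝ≥0∞} (hp : Measurable p) (hp' : Measurable p')
    (h1 : ∫⁻ t, p t ≤ 1) (h1' : ∫⁻ t, p' t ≠ ⊤) :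
    ∫⁻ t', ∫⁻ t, p t ^ (1 - a) * p' t' ^ (1 - a') * rk (a + a') (t - t')
      ≤ (hlsC a a' + hlsC a' a) * (∫⁻ t, p' t) ^ (1 - a') := by
  have hm : Measurable (fun z : ℝ × ℝ => p z.1 ^ (1 - a) * p' z.2 ^ (1 - a') * rk (a + a') (z.1 - z.2)) := by
    fun_prop
  rw [← lintegral_lintegral_swap (by exact hm.aemeasurable)]
  set S := ∫⁻ t, p' t with hS
  by_cases h0 : S = 0
  · have : p' =ᵐ[volume] 0 := (lintegral_eq_zero_iff hp').1 h0
    have : ∫⁻ t, ∫⁻ t', p t ^ (1 - a) * p' t' ^ (1 - a') * rk (a + a') (t - t') = 0 := by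
      refine (lintegral_congr fun t => ?_).trans lintegral_zero
      refine (lintegral_congr_ae ?_).trans lintegral_zero
      filter_upwards [this] with t' ht'
      rw [ht']; simp [ENNReal.zero_rpow_of_pos (show 0 < 1 - a' by linarith)]
    rw [this]; exact zero_le
  have hp'' : Measurable (fun t => S⁻¹ * p' t) := by fun_prop
  have h2 : ∫⁻ t, S⁻¹ * p' t ≤ 1 := by
    rw [lintegral_const_mul _ hp', ← hS, ENNReal.inv_mul_cancel h0 h1']
  have := mul_le_mul_right (hls ha ha' hab hp hp'' h1 h2) (S ^ (1 - a'))
  rw [mul_comm (hlsC a a' + hlsC a' a)]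
  refine le_trans (le_of_eq ?_) this
  rw [← lintegral_const_mul]
  swap
  · exact Measurable.lintegral_prod_right' (f := fun z : ℝ × ℝ => p z.1 ^ (1 - a) * (S⁻¹ * p' z.2) ^ (1 - a') * rk (a + a') (z.1 - z.2)) (by fun_prop)
  refine lintegral_congr fun t => ?_
  rw [← lintegral_const_mul _ (by fun_prop)]
  refine lintegral_congr fun t' => ?_
  have e : S ^ (1 - a') * S⁻¹ ^ (1 - a') = 1 := by
    rw [← ENNReal.mul_rpow_of_nonneg _ _ (by linarith), ENNReal.mul_inv_cancel h0 h1']; simp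
  rw [ENNReal.mul_rpow_of_nonneg _ _ (by linarith)]
  calc _ = 1 * (p t ^ (1 - a) * p' t' ^ (1 - a') * rk (a + a') (t - t')) := (one_mul _).symm
    _ = _ := by rw [← e]; ring

/-- potential of `ρ ^ c1` -/
def Psi (c1 c2 : ℝ) (ρ : ℝ → ℝ≥0∞) (t0 : ℝ) : ℝ≥0∞ := ∫⁻ t, ρ t ^ c1 * rk c2 (t0 - t)

theorem measurable_Psi (c1 c2 : ℝ) {ρ : ℝ → ℝ≥0∞} (hρ : Measurable ρ) : Measurable (Psi c1 c2 ρ) :=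
  Measurable.lintegral_prod_right' (f := fun z : ℝ × ℝ => ρ z.2 ^ c1 * rk c2 (z.1 - z.2)) (by fun_prop)

def starK (n : ℕ) (η0 : ℝ) : ℝ≥0∞ :=
  hlsC (1 - (η0 + 1/2) / n) (1 / (2 * n)) + hlsC (1 / (2 * n)) (1 - (η0 + 1/2) / n)

theorem star_params {n : ℕ} (hn : 2 ≤ n) {η0 : ℝ} (h0 : 0 < η0) (h1 : η0 ≤ 1/2) :
    0 < 1 - (η0 + 1/2) / n ∧ 0 < (1 / (2 * n) : ℝ) ∧ (1 - (η0 + 1/2) / n) + (1 / (2 * n) : ℝ) < 1 ∧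
      (1 - (η0 + 1/2) / n) + (1 / (2 * n) : ℝ) = 1 - η0 / n := by
  have hn' : (2:ℝ) ≤ n := by exact_mod_cast hn
  have hn0 : (0:ℝ) < n := by linarith
  have e : (1 - (η0 + 1/2) / n) + (1 / (2 * n) : ℝ) = 1 - η0 / n := by field_simp; ring
  refine ⟨?_, by positivity, ?_, e⟩
  · have : (η0 + 1/2) / n < 1 := by rw [div_lt_one hn0]; linarith
    linarith
  · rw [e]; have : 0 < η0 / n := by positivity
    linarith

theorem starK_lt_top {n : ℕ} (hn : 2 ≤ n) {η0 : ℝ} (h0 : 0 < η0) (h1 : η0 ≤ 1/2) :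
    starK n η0 < ⊤ := by
  obtain ⟨a, b, c, -⟩ := star_params hn h0 h1
  exact ENNReal.add_lt_top.2 ⟨hlsC_lt_top a b c, hlsC_lt_top b a (by linarith)⟩

theorem Psi_pow {n : ℕ} (hn : 2 ≤ n) {η0 : ℝ} (h0 : 0 < η0) (h1 : η0 ≤ 1/2)
    {ρ : ℝ → ℝ≥0∞} (hρ : Measurable ρ) (hi : ∫⁻ t, ρ t ≤ 1) :
    ∫⁻ t, Psi ((η0 + 1/2) / n) (1 - η0 / n) ρ t ^ (2 * n) ≤ starK n η0 ^ (2 * n) := by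
  obtain ⟨ha, hb, hc, he⟩ := star_params hn h0 h1
  set Ψ := Psi ((η0 + 1/2) / n) (1 - η0 / n) ρ with hΨ
  have hΨm : Measurable Ψ := measurable_Psi _ _ hρ
  let T : ℕ → ℝ → ℝ≥0∞ := fun k => (Icc (-k:ℝ) k).indicator (fun t => min (Ψ t) k)
  have hTm : ∀ k, Measurable (T k) := fun k =>
    Measurable.indicator (by fun_prop) measurableSet_Icc
  have hTle : ∀ k t, T k t ≤ Ψ t := fun k t => by
    simp only [T]; exact (indicator_le_self _ _ t).trans (min_le_left _ _)
  have hfin : ∀ k, ∫⁻ t, T k t ^ (2 * n) ≠ ⊤ := by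
    intro k
    refine ne_top_of_le_ne_top (b := ∫⁻ t in Icc (-k:ℝ) k, (k:ℝ≥0∞) ^ (2 * n)) ?_ ?_
    · rw [lintegral_const]
      exact ENNReal.mul_ne_top (by simp) (by simp)
    · rw [← lintegral_indicator measurableSet_Icc]
      refine lintegral_mono fun t => ?_
      by_cases h : t ∈ Icc (-k:ℝ) k
      · simp only [T, indicator_of_mem h]; gcongr; exact min_le_right _ _
      · simp only [T, indicator_of_notMem h]; rw [zero_pow (by omega)]
  have hk : ∀ k, ∫⁻ t, T k t ^ (2 * n) ≤ starK n η0 ^ (2 * n) := by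
    intro k
    have H := hls_mass ha hb hc hρ (p' := fun t => T k t ^ (2 * n)) ((hTm k).pow_const _) hi (hfin k)
    set S := ∫⁻ t, T k t ^ (2 * n) with hS
    have hn0 : (0:ℝ) < n := by have : 0 < n := by omega
                               exact_mod_cast this
    have H2 : S ≤ starK n η0 * S ^ (1 - (1 / (2 * n) : ℝ)) := by
      refine le_trans ?_ H
      refine lintegral_mono fun t' => ?_
      have e1 : (T k t' ^ (2 * n)) ^ (1 - (1 / (2 * n) : ℝ)) = T k t' ^ (2 * n - 1) := by
        rw [← ENNReal.rpow_natCast, ← ENNReal.rpow_natCast, ← ENNReal.rpow_mul]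
        congr 1
        rw [Nat.cast_sub (by omega)]; push_cast; field_simp
      have e2 : ∀ t, rk (1 - (η0 + 1/2) / n + 1 / (2 * n)) (t - t') = rk (1 - η0 / n) (t' - t) := by
        intro t; rw [he, ← rk_neg]; congr 1; ring
      simp only [e1, e2]
      calc T k t' ^ (2 * n) = T k t' ^ (2 * n - 1) * T k t' := by
            rw [← pow_succ]; congr 1; omega
        _ ≤ T k t' ^ (2 * n - 1) * Ψ t' := by gcongr; exact hTle k t'
        _ = _ := by
          rw [hΨ, Psi, ← lintegral_const_mul _ (by fun_prop)]
          refine lintegral_congr fun t => ?_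
          rw [_root_.sub_sub_cancel]; ring
    by_cases hS0 : S = 0
    · rw [hS0]; exact zero_le
    have hS1 : S ^ (1 / (2 * n) : ℝ) ≤ starK n η0 := by
      have hne : S ^ (1 - (1 / (2 * n) : ℝ)) ≠ 0 := by
        simp [ENNReal.rpow_eq_zero_iff, hS0, hfin k]
        intro h; exact absurd h (hfin k)
      have hnt : S ^ (1 - (1 / (2 * n) : ℝ)) ≠ ⊤ := by
        simp [ENNReal.rpow_eq_top_iff, hS0]
        intro h; exact absurd h (hfin k)
      rw [← ENNReal.mul_le_mul_iff_left hne hnt, ← ENNReal.rpow_add _ _ hS0 (hfin k)]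
      simpa using H2
    calc S = (S ^ (1 / (2 * n) : ℝ)) ^ (2 * n) := by
          rw [← ENNReal.rpow_natCast, ← ENNReal.rpow_mul]
          have : (1 / (2 * n) : ℝ) * ((2 * n : ℕ) : ℝ) = 1 := by push_cast; field_simp
          rw [this, ENNReal.rpow_one]
      _ ≤ _ := by gcongr
  have hmono : Monotone fun k => fun t => T k t ^ (2 * n) := by
    intro k l hkl t
    have hkl' : (k:ℝ) ≤ l := by exact_mod_cast hkl
    have hkl'' : (k:ℝ≥0∞) ≤ l := by exact_mod_cast hkl
    simp only [T]
    gcongr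
    refine (indicator_le_indicator_of_subset (Icc_subset_Icc (neg_le_neg hkl') hkl') (fun _ => zero_le) t).trans ?_
    exact indicator_le_indicator (min_le_min le_rfl hkl'')
  have hlim : ∀ t, Tendsto (fun k => T k t ^ (2 * n)) atTop (nhds (Ψ t ^ (2 * n))) := by
    intro t
    refine ENNReal.Tendsto.pow ?_
    have : Tendsto (fun k : ℕ => min (Ψ t) (k:ℝ≥0∞)) atTop (nhds (min (Ψ t) ⊤)) :=
      tendsto_const_nhds.min ENNReal.tendsto_nat_nhds_top
    rw [min_eq_left le_top] at this
    refine this.congr' ?_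
    obtain ⟨N, hN⟩ := exists_nat_ge |t|
    filter_upwards [eventually_ge_atTop N] with k hk
    have hk' : (N:ℝ) ≤ k := by exact_mod_cast hk
    simp only [T]
    rw [indicator_of_mem]
    exact abs_le.1 (hN.trans hk')
  exact le_of_tendsto (lintegral_tendsto_of_tendsto_of_monotone (fun k => ((hTm k).pow_const _).aemeasurable)
    (ae_of_all _ fun t => fun k l h => hmono h t) (ae_of_all _ hlim)) (Eventually.of_forall hk)

theorem star_bound {n : ℕ} (hn : 2 ≤ n) {η0 : ℝ} (h0 : 0 < η0) (h1 : η0 ≤ 1/2)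
    {ρ : ℝ → ℝ≥0∞} (hρ : Measurable ρ) (hi : ∫⁻ t, ρ t ≤ 1) :
    ∫⁻ t, ρ t ^ (1/2 : ℝ) * Psi ((η0 + 1/2) / n) (1 - η0 / n) ρ t ^ n ≤ 1 + starK n η0 ^ (2 * n) := by
  have hm := measurable_Psi ((η0 + 1/2) / n) (1 - η0 / n) hρ
  calc _ ≤ ∫⁻ t, ρ t + Psi ((η0 + 1/2) / n) (1 - η0 / n) ρ t ^ (2 * n) := by
        refine lintegral_mono fun t => ?_
        set u := ρ t
        set w := Psi ((η0 + 1/2) / n) (1 - η0 / n) ρ t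
        have e : w ^ n = (w ^ (2 * n)) ^ (1/2 : ℝ) := by
          rw [← ENNReal.rpow_natCast, ← ENNReal.rpow_natCast, ← ENNReal.rpow_mul]
          congr 1; push_cast; ring
        rw [e]
        set x := w ^ (2 * n)
        calc u ^ (1/2:ℝ) * x ^ (1/2:ℝ) ≤ (max u x) ^ (1/2:ℝ) * (max u x) ^ (1/2:ℝ) := by
              gcongr
              · exact le_max_left _ _
              · exact le_max_right _ _
          _ = max u x := by
              rw [← ENNReal.rpow_add_of_nonneg _ _ (by norm_num) (by norm_num)]; norm_num
          _ ≤ _ := max_le_add_of_nonneg zero_le zero_le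
    _ = _ := lintegral_add_left hρ _
    _ ≤ _ := add_le_add hi (Psi_pow hn h0 h1 hρ hi)

/-- direction vector -/
def ev (n : ℕ) (t : ℝ) : Pt n := (1, mom n t)

@[fun_prop]
theorem continuous_mom (n : ℕ) : Continuous (mom n) := by
  unfold mom; fun_prop
@[fun_prop]
theorem continuous_ev (n : ℕ) : Continuous (ev n) := by
  unfold ev; fun_prop
@[fun_prop]
theorem measurable_mom (n : ℕ) : Measurable (mom n) := (continuous_mom n).measurable
@[fun_prop]
theorem measurable_ev (n : ℕ) : Measurable (ev n) := (continuous_ev n).measurable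

instance haarPt (n : ℕ) : (volume : Measure (Pt n)).IsAddHaarMeasure := by
  rw [Measure.volume_eq_prod]; infer_instance

/-- a step `b = (t, σ)` -/
def stp (n : ℕ) (b : ℝ × ℝ) : Pt n := b.2 • ev n b.1
@[fun_prop]
theorem continuous_stp (n : ℕ) : Continuous (stp n) := by
  unfold stp; fun_prop
@[fun_prop]
theorem measurable_stp (n : ℕ) : Measurable (stp n) := (continuous_stp n).measurable

section paths
variable {n : ℕ}

def muF (m : Pt n × ℝ → ℝ≥0∞) (z : Pt n) : ℝ≥0∞ := ∫⁻ t, m (z, t)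
def rhoF (m : Pt n × ℝ → ℝ≥0∞) (t : ℝ) : ℝ≥0∞ := ∫⁻ z, m (z, t)
def LF (m : Pt n × ℝ → ℝ≥0∞) (u : Pt n × ℝ) : ℝ≥0∞ := ∫⁻ σ : ℝ, m (u.1 + stp n (u.2, σ), u.2)
def pF (m : Pt n × ℝ → ℝ≥0∞) (u : Pt n × ℝ) : ℝ≥0∞ := m u / muF m u.1
def kern (m : Pt n × ℝ → ℝ≥0∞) (z : Pt n) (b : ℝ × ℝ) : ℝ≥0∞ :=
  pF m (z, b.1) * (m (z + stp n b, b.1) / LF m (z, b.1))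
def qF (m : Pt n × ℝ → ℝ≥0∞) (z : Pt n) (b : ℝ × ℝ) : ℝ≥0∞ :=
  m (z, b.1) * (m (z + stp n b, b.1) / LF m (z, b.1))

def pos {j : ℕ} (z : Pt n) (a : Fin j → ℝ × ℝ) (i : ℕ) : Pt n :=
  z + ∑ l : Fin j, if l.1 < i then stp n (a l) else 0

theorem pos_zero {j : ℕ} (z : Pt n) (a : Fin j → ℝ × ℝ) : pos z a 0 = z := by simp [pos]

theorem pos_cons {j : ℕ} (z : Pt n) (b : ℝ × ℝ) (a : Fin j → ℝ × ℝ) (i : ℕ) :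
    pos z (Fin.cons b a : Fin (j+1) → ℝ × ℝ) (i+1) = pos (z + stp n b) a i := by
  simp [pos, Fin.sum_univ_succ, add_assoc]

@[fun_prop]
theorem measurable_pos {j : ℕ} (i : ℕ) : Measurable (fun x : Pt n × (Fin j → ℝ × ℝ) => pos x.1 x.2 i) := by
  unfold pos
  refine measurable_fst.add (Finset.measurable_sum _ fun l _ => ?_)
  split_ifs <;> fun_prop

def Wt (m : Pt n × ℝ → ℝ≥0∞) {j : ℕ} (z : Pt n) (a : Fin j → ℝ × ℝ) : ℝ≥0∞ :=
  ∏ l : Fin j, kern m (pos z a l.1) (a l)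

theorem Wt_cons (m : Pt n × ℝ → ℝ≥0∞) {j : ℕ} (z : Pt n) (b : ℝ × ℝ) (a : Fin j → ℝ × ℝ) :
    Wt m z (Fin.cons b a : Fin (j+1) → ℝ × ℝ) = kern m z b * Wt m (z + stp n b) a := by
  simp [Wt, Fin.prod_univ_succ, pos_cons, pos_zero]

section meas
variable {m : Pt n × ℝ → ℝ≥0∞}

theorem measurable_muF (hm : Measurable m) : Measurable (muF m) := hm.lintegral_prod_right'
theorem measurable_rhoF (hm : Measurable m) : Measurable (rhoF m) := hm.lintegral_prod_left'
theorem measurable_LF (hm : Measurable m) : Measurable (LF m) :=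
  Measurable.lintegral_prod_right' (f := fun x : (Pt n × ℝ) × ℝ => m (x.1.1 + stp n (x.1.2, x.2), x.1.2))
    (by fun_prop)
theorem measurable_pF (hm : Measurable m) : Measurable (pF m) := by
  have := measurable_muF hm
  unfold pF; fun_prop
theorem measurable_kern (hm : Measurable m) : Measurable (fun x : Pt n × (ℝ × ℝ) => kern m x.1 x.2) := by
  have := measurable_pF hm
  have := measurable_LF hm
  unfold kern; fun_prop
theorem measurable_qF (hm : Measurable m) : Measurable (fun x : Pt n × (ℝ × ℝ) => qF m x.1 x.2) := by
  have := measurable_LF hm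
  unfold qF; fun_prop
theorem measurable_Wt (hm : Measurable m) (j : ℕ) : Measurable (fun x : Pt n × (Fin j → ℝ × ℝ) => Wt m x.1 x.2) := by
  have := measurable_kern hm
  unfold Wt
  refine Finset.measurable_prod _ fun l _ => ?_
  exact this.comp ((measurable_pos l.1).prodMk (by fun_prop))
end meas

end paths

theorem lintegral_cons {β : Type*} [MeasureSpace β] [SigmaFinite (volume : Measure β)] {j : ℕ}
    (F : (Fin (j+1) → β) → ℝ≥0∞) (hF : Measurable F) :
    ∫⁻ a, F a = ∫⁻ b : β, ∫⁻ a' : Fin j → β, F (Fin.cons b a' : Fin (j+1) → β) := by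
  have := (volume_preserving_piFinSuccAbove (fun _ : Fin (j+1) => β) 0).symm
  rw [← this.lintegral_comp hF]
  change ∫⁻ x, F ((MeasurableEquiv.piFinSuccAbove (fun _ : Fin (j+1) => β) 0).symm x) ∂((volume : Measure β).prod volume) = _
  rw [lintegral_prod _ (by fun_prop)]
  refine lintegral_congr fun b => lintegral_congr fun a' => ?_
  change F (Fin.insertNth 0 b a') = _
  rw [Fin.insertNth_zero]
  rfl

section paths
variable {n : ℕ} {m : Pt n × ℝ → ℝ≥0∞}

/-- base regularity -/
structure Reg (m : Pt n × ℝ → ℝ≥0∞) : Prop where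
  meas : Measurable m
  mass : ∫⁻ z, muF m z = 1
  mutop : ∀ z, muF m z ≠ ⊤
  L0 : ∀ u, m u ≠ 0 → LF m u ≠ 0
  Lt : ∀ u, m u ≠ 0 → LF m u ≠ ⊤

theorem stp_add (t σ σ' : ℝ) : stp n (t, σ + σ') = stp n (t, σ) + stp n (t, σ') := by
  simp [stp, add_smul]
theorem stp_neg (t σ : ℝ) : stp n (t, -σ) = - stp n (t, σ) := by
  simp [stp]

theorem LF_shift (m : Pt n × ℝ → ℝ≥0∞) (z : Pt n) (t σ : ℝ) : LF m (z + stp n (t, σ), t) = LF m (z, t) := by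
  simp only [LF, add_assoc, ← stp_add]
  exact lintegral_add_left_eq_self (fun x => m (z + stp n (t, x), t)) σ

theorem lintegral_div_LF_le (hm : Measurable m) (z : Pt n) (t : ℝ) :
    ∫⁻ σ, m (z + stp n (t, σ), t) / LF m (z, t) ≤ 1 := by
  simp only [div_eq_mul_inv]
  rw [lintegral_mul_const _ (by fun_prop)]
  exact ENNReal.div_self_le_one

theorem Reg.lintegral_div_LF (h : Reg m) (z : Pt n) (t : ℝ) (h0 : m (z, t) ≠ 0) :
    ∫⁻ σ, m (z + stp n (t, σ), t) / LF m (z, t) = 1 := by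
  have := h.meas
  simp only [div_eq_mul_inv]
  rw [lintegral_mul_const _ (by fun_prop)]
  exact ENNReal.mul_inv_cancel (h.L0 _ h0) (h.Lt _ h0)

theorem lintegral_pF_le (hm : Measurable m) (z : Pt n) : ∫⁻ t, pF m (z, t) ≤ 1 := by
  simp only [pF, div_eq_mul_inv]
  rw [lintegral_mul_const _ (by fun_prop)]
  exact ENNReal.div_self_le_one

theorem Reg.mu_mul_pF (h : Reg m) (z : Pt n) : ∀ᵐ t, muF m z * pF m (z, t) = m (z, t) := by
  have hm := h.meas
  by_cases h0 : muF m z = 0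
  · have := (lintegral_eq_zero_iff (show Measurable fun t => m (z, t) by fun_prop)).1 h0
    filter_upwards [this] with t ht
    simp only [Pi.zero_apply] at ht
    simp [ht, h0]
  · refine ae_of_all _ fun t => ?_
    exact ENNReal.mul_div_cancel h0 (h.mutop z)

theorem Reg.mu_mul_kern (h : Reg m) (z : Pt n) : ∀ᵐ b : ℝ × ℝ, muF m z * kern m z b = qF m z b := by
  have h1 := h.mu_mul_pF z
  have h2 : ∀ᵐ b : ℝ × ℝ, muF m z * pF m (z, b.1) = m (z, b.1) :=
    Measure.quasiMeasurePreserving_fst.ae h1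
  filter_upwards [h2] with b hb
  rw [kern, ← mul_assoc, hb, qF]

/-- (S1) -/
theorem Reg.S1 (h : Reg m) (G : Pt n × ℝ → ℝ≥0∞) (hG : Measurable G) :
    ∫⁻ z, ∫⁻ b : ℝ × ℝ, qF m z b * G (z, b.1) = ∫⁻ z, ∫⁻ t, m (z, t) * G (z, t) := by
  have hm := h.meas
  have hL := measurable_LF hm
  refine lintegral_congr fun z => ?_
  rw [Measure.volume_eq_prod, lintegral_prod _ (by unfold qF; fun_prop)]
  refine lintegral_congr fun t => ?_
  by_cases h0 : m (z, t) = 0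
  · simp [qF, h0]
  · calc _ = ∫⁻ σ, (m (z, t) * G (z, t)) * (m (z + stp n (t, σ), t) / LF m (z, t)) := by
          refine lintegral_congr fun σ => ?_
          simp only [qF]; ring
      _ = _ := by
          rw [lintegral_const_mul _ (by fun_prop), h.lintegral_div_LF z t h0, mul_one]

/-- reversibility -/
theorem Reg.rev (h : Reg m) (G : Pt n × (ℝ × ℝ) → ℝ≥0∞) (hG : Measurable G) :
    ∫⁻ z, ∫⁻ b : ℝ × ℝ, qF m z b * G (z + stp n b, (b.1, - b.2)) =
      ∫⁻ z, ∫⁻ b : ℝ × ℝ, qF m z b * G (z, b) := by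
  have hm := h.meas
  have hL := measurable_LF hm
  have hq := measurable_qF hm
  have s1 := lintegral_lintegral_swap (μ := (volume : Measure (Pt n))) (ν := (volume : Measure (ℝ × ℝ)))
    (f := fun z b => qF m z b * G (z + stp n b, (b.1, - b.2))) (by unfold Function.uncurry; fun_prop)
  have s2 := lintegral_lintegral_swap (μ := (volume : Measure (Pt n))) (ν := (volume : Measure (ℝ × ℝ)))
    (f := fun z b => qF m z b * G (z, b)) (by unfold Function.uncurry; fun_prop)
  rw [s1, s2]
  have hf : Measurable fun b : ℝ × ℝ => ∫⁻ z, qF m z b * G (z, b) :=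
    Measurable.lintegral_prod_right' (f := fun x : (ℝ × ℝ) × Pt n => qF m x.2 x.1 * G (x.2, x.1)) (by fun_prop)
  have hf' : Measurable fun b : ℝ × ℝ => ∫⁻ z, qF m z b * G (z + stp n b, (b.1, - b.2)) :=
    Measurable.lintegral_prod_right'
      (f := fun x : (ℝ × ℝ) × Pt n => qF m x.2 x.1 * G (x.2 + stp n x.1, (x.1.1, -x.1.2))) (by fun_prop)
  rw [Measure.volume_eq_prod ℝ ℝ, lintegral_prod _ hf.aemeasurable, lintegral_prod _ hf'.aemeasurable]
  refine lintegral_congr fun t => ?_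
  rw [← lintegral_neg_eq_self]
  refine lintegral_congr fun σ => ?_
  rw [← lintegral_add_right_eq_self _ (stp n (t, σ))]
  refine lintegral_congr fun z => ?_
  simp only [qF, stp_neg, add_neg_cancel_right, neg_neg, LF_shift]
  congr 1
  simp only [div_eq_mul_inv]; ring

/-- (S2) -/
theorem Reg.S2 (h : Reg m) (G : Pt n × ℝ → ℝ≥0∞) (hG : Measurable G) :
    ∫⁻ z, ∫⁻ b : ℝ × ℝ, qF m z b * G (z + stp n b, b.1) = ∫⁻ z, ∫⁻ t, m (z, t) * G (z, t) := by
  rw [← h.S1 G hG, ← h.rev (fun x => G (x.1, x.2.1)) (by fun_prop)]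

/-- path expectation -/
def PE (m : Pt n × ℝ → ℝ≥0∞) (j : ℕ) (G : Pt n × (Fin j → ℝ × ℝ) → ℝ≥0∞) : ℝ≥0∞ :=
  ∫⁻ z, ∫⁻ a, muF m z * Wt m z a * G (z, a)

theorem measurable_cons {j : ℕ} :
    Measurable (fun x : (Pt n × (ℝ × ℝ)) × (Fin j → ℝ × ℝ) =>
      (x.1.1, (Fin.cons x.1.2 x.2 : Fin (j+1) → ℝ × ℝ))) := by
  refine Measurable.prodMk (by fun_prop) (measurable_pi_iff.2 fun i => ?_)
  refine Fin.cases ?_ (fun i => ?_) i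
  · simp only [Fin.cons_zero]; fun_prop
  · simp only [Fin.cons_succ]; fun_prop

theorem Reg.PE_cons (h : Reg m) {j : ℕ} (G : Pt n × (Fin (j+1) → ℝ × ℝ) → ℝ≥0∞) (hG : Measurable G) :
    PE m (j+1) G = ∫⁻ z, ∫⁻ b : ℝ × ℝ, qF m z b *
      ∫⁻ a : Fin j → ℝ × ℝ, Wt m (z + stp n b) a * G (z, (Fin.cons b a : Fin (j+1) → ℝ × ℝ)) := by
  have hm := h.meas
  have hW := measurable_Wt hm (j+1)
  have hW' := measurable_Wt hm j
  have hmu := measurable_muF hm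
  refine lintegral_congr fun z => ?_
  rw [lintegral_cons _ (by fun_prop)]
  refine lintegral_congr_ae ?_
  filter_upwards [h.mu_mul_kern z] with b hb
  have hGc := hG.comp (measurable_cons (n := n) (j := j))
  rw [← lintegral_const_mul _ (by
    refine Measurable.mul (by fun_prop) ?_
    exact hGc.comp (measurable_prodMk_left (x := (z, b))))]
  refine lintegral_congr fun a => ?_
  rw [Wt_cons, ← mul_assoc (muF m z), hb]; ring

/-- (T1) -/
theorem Reg.T1 (h : Reg m) {j : ℕ} (G : Pt n × (Fin j → ℝ × ℝ) → ℝ≥0∞) (hG : Measurable G) :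
    PE m (j+1) (fun x => G (x.1 + stp n (x.2 0), Fin.tail x.2)) = PE m j G := by
  have hm := h.meas
  have hW := measurable_Wt hm j
  rw [h.PE_cons _ (by
    have : Measurable (fun x : Pt n × (Fin (j+1) → ℝ × ℝ) => Fin.tail x.2) :=
      measurable_pi_iff.2 fun i => by unfold Fin.tail; fun_prop
    fun_prop)]
  simp only [Fin.cons_zero, Fin.tail_cons]
  have hH : Measurable fun z : Pt n => ∫⁻ a : Fin j → ℝ × ℝ, Wt m z a * G (z, a) :=
    Measurable.lintegral_prod_right' (f := fun x : Pt n × (Fin j → ℝ × ℝ) => Wt m x.1 x.2 * G x) (by fun_prop)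
  rw [h.S2 (fun u => ∫⁻ a : Fin j → ℝ × ℝ, Wt m u.1 a * G (u.1, a)) (by fun_prop)]
  refine lintegral_congr fun z => ?_
  dsimp only
  rw [lintegral_mul_const _ (by fun_prop), ← muF, ← lintegral_const_mul _ (by fun_prop)]
  refine lintegral_congr fun a => ?_
  ring

theorem Reg.PE_one (h : Reg m) (j : ℕ) : PE m j (fun _ => 1) = 1 := by
  induction j with
  | zero =>
    simp only [PE, mul_one, Wt]
    rw [← h.mass]
    refine lintegral_congr fun z => ?_
    simp [volume_pi]
  | succ j ih =>
    have := h.T1 (j := j) (fun _ => 1) measurable_const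
    rw [ih] at this; exact this

theorem lintegral_kern_le (hm : Measurable m) (z : Pt n) (Ξ : ℝ → ℝ≥0∞) (hΞ : Measurable Ξ) :
    ∫⁻ b : ℝ × ℝ, kern m z b * Ξ b.1 ≤ ∫⁻ t, pF m (z, t) * Ξ t := by
  have hL := measurable_LF hm
  have hp := measurable_pF hm
  rw [Measure.volume_eq_prod, lintegral_prod _ (by unfold kern; fun_prop)]
  refine lintegral_mono fun t => ?_
  calc _ = ∫⁻ σ, (pF m (z, t) * Ξ t) * (m (z + stp n (t, σ), t) / LF m (z, t)) := by
        refine lintegral_congr fun σ => ?_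
        simp only [kern]; ring
    _ = (pF m (z, t) * Ξ t) * ∫⁻ σ, (m (z + stp n (t, σ), t) / LF m (z, t)) :=
        lintegral_const_mul _ (by fun_prop)
    _ ≤ (pF m (z, t) * Ξ t) * 1 := by gcongr; exact lintegral_div_LF_le hm z t
    _ = _ := mul_one _

theorem lintegral_kern_le_one (hm : Measurable m) (z : Pt n) : ∫⁻ b : ℝ × ℝ, kern m z b ≤ 1 := by
  have := lintegral_kern_le hm z (fun _ => 1) measurable_const
  simp only [mul_one] at this
  exact this.trans (lintegral_pF_le hm z)

theorem lintegral_Wt_cons (hm : Measurable m) {j : ℕ} (z : Pt n) (G : (Fin (j+1) → ℝ × ℝ) → ℝ≥0∞)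
    (hG : Measurable G) : ∫⁻ a, Wt m z a * G a = ∫⁻ b : ℝ × ℝ, kern m z b *
      ∫⁻ a : Fin j → ℝ × ℝ, Wt m (z + stp n b) a * G (Fin.cons b a : Fin (j+1) → ℝ × ℝ) := by
  have hW := measurable_Wt hm (j+1)
  have hW' := measurable_Wt hm j
  rw [lintegral_cons _ (by fun_prop)]
  refine lintegral_congr fun b => ?_
  have hGc := (hG.comp measurable_snd).comp (measurable_cons (n := n) (j := j))
  rw [← lintegral_const_mul _ (by
    refine Measurable.mul (by fun_prop) ?_
    exact hGc.comp (measurable_prodMk_left (x := (z, b))))]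
  refine lintegral_congr fun a => ?_
  rw [Wt_cons]; ring

/-- (T2) -/
theorem T2 (hm : Measurable m) (j : ℕ) (z : Pt n) : ∫⁻ a : Fin j → ℝ × ℝ, Wt m z a ≤ 1 := by
  induction j generalizing z with
  | zero => simp [Wt, volume_pi]
  | succ j ih =>
    have := lintegral_Wt_cons hm (j := j) z (fun _ => 1) measurable_const
    simp only [mul_one] at this
    rw [this]
    calc _ ≤ ∫⁻ b, kern m z b * 1 := by gcongr; exact ih _
      _ ≤ 1 := by simpa using lintegral_kern_le_one hm z

/-- (T4) -/
theorem T4 (hm : Measurable m) (Ξ : Pt n × ℝ → ℝ≥0∞) (hΞ : Measurable Ξ) (B : ℝ≥0∞)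
    (hB : ∀ z', ∫⁻ t, pF m (z', t) * Ξ (z', t) ≤ B) {j : ℕ} (k : Fin j) (z : Pt n) :
    ∫⁻ a : Fin j → ℝ × ℝ, Wt m z a * Ξ (pos z a k.1, (a k).1) ≤ B := by
  induction j generalizing z with
  | zero => exact k.elim0
  | succ j ih =>
    have hpos : Measurable fun a : Fin (j+1) → ℝ × ℝ => pos z a k.1 :=
      (measurable_pos k.1).comp measurable_prodMk_left
    rw [lintegral_Wt_cons hm z _ (by fun_prop)]
    refine Fin.cases ?_ (fun k' => ?_) k
    · simp only [Fin.val_zero, pos_zero, Fin.cons_zero]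
      refine le_trans ?_ ((lintegral_kern_le hm z (fun t => Ξ (z, t)) (by fun_prop)).trans (hB z))
      refine lintegral_mono fun b => ?_
      have hW := measurable_Wt hm j
      rw [lintegral_mul_const _ (by fun_prop)]
      calc _ ≤ kern m z b * (1 * Ξ (z, b.1)) := by gcongr; exact T2 hm j _
        _ = _ := by rw [one_mul]
    · simp only [Fin.val_succ, pos_cons, Fin.cons_succ]
      calc _ ≤ ∫⁻ b, kern m z b * B := by gcongr; exact ih k' _
        _ = (∫⁻ b, kern m z b) * B := by
          have := measurable_kern hm
          rw [lintegral_mul_const _ (by fun_prop)]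
        _ ≤ 1 * B := by gcongr; exact lintegral_kern_le_one hm z
        _ = B := one_mul B

theorem measurable_tail {j : ℕ} :
    Measurable (fun x : Pt n × (Fin (j+1) → ℝ × ℝ) => (x.1 + stp n (x.2 0), Fin.tail x.2)) := by
  have : Measurable (fun x : Pt n × (Fin (j+1) → ℝ × ℝ) => Fin.tail x.2) :=
    measurable_pi_iff.2 fun i => by unfold Fin.tail; fun_prop
  fun_prop

theorem pos_tail {j : ℕ} (z : Pt n) (a : Fin (j+1) → ℝ × ℝ) (i : ℕ) :
    pos (z + stp n (a 0)) (Fin.tail a) i = pos z a (i+1) := by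
  rw [← pos_cons, Fin.cons_self_tail]

theorem PE_mono {j : ℕ} {G G' : Pt n × (Fin j → ℝ × ℝ) → ℝ≥0∞} (h : ∀ x, G x ≤ G' x) :
    PE m j G ≤ PE m j G' := by
  unfold PE; gcongr; exact h _

/-- one-point law, upper bound -/
theorem Reg.law_le (h : Reg m) {j : ℕ} (i : Fin j) (g : Pt n × (ℝ × ℝ) → ℝ≥0∞) (hg : Measurable g) :
    PE m j (fun x => g (pos x.1 x.2 i.1, x.2 i)) ≤ ∫⁻ z, ∫⁻ b : ℝ × ℝ, qF m z b * g (z, b) := by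
  have hm := h.meas
  induction j with
  | zero => exact i.elim0
  | succ j ih =>
    refine Fin.cases ?_ (fun i' => ?_) i
    · have hW := measurable_Wt hm j
      rw [h.PE_cons _ (by fun_prop)]
      gcongr with z b
      simp only [Fin.val_zero, pos_zero, Fin.cons_zero]
      rw [lintegral_mul_const _ (by fun_prop)]
      calc _ ≤ 1 * g (z, b) := by gcongr; exact T2 hm j _
        _ = _ := one_mul _
    · refine le_trans (le_of_eq ?_) (ih i')
      rw [← h.T1 (fun x => g (pos x.1 x.2 i'.1, x.2 i')) (by fun_prop)]
      simp only [Fin.val_succ, pos_tail]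
      rfl

/-- two-point bound -/
theorem Reg.pair_le (h : Reg m) (Θ : (Pt n × ℝ) × (Pt n × ℝ) → ℝ≥0∞) (hΘ : Measurable Θ) (B : ℝ≥0∞)
    (hB : ∀ z z', ∫⁻ t', pF m (z', t') * ∫⁻ t, pF m (z, t) * Θ ((z, t), (z', t')) ≤ B)
    {j : ℕ} (i k : Fin j) (hik : i < k) :
    PE m j (fun x => Θ ((pos x.1 x.2 (i.1+1), (x.2 i).1), (pos x.1 x.2 k.1, (x.2 k).1))) ≤ B := by
  have hm := h.meas
  have hp := measurable_pF hm
  induction j with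
  | zero => exact i.elim0
  | succ j ih =>
    obtain ⟨k', rfl⟩ : ∃ k' : Fin j, k = k'.succ := ⟨k.pred (Fin.ne_zero_of_lt hik), by simp⟩
    revert hik
    refine Fin.cases (fun _ => ?_) (fun i' hik => ?_) i
    · have hW := measurable_Wt hm j
      have hmu := measurable_muF hm
      rw [h.PE_cons _ (by fun_prop)]
      simp only [Fin.val_zero, Fin.val_succ, pos_cons, Fin.cons_succ, Fin.cons_zero, pos_zero]
      have hI : Measurable fun u : Pt n × ℝ => ∫⁻ a : Fin j → ℝ × ℝ, Wt m u.1 a * Θ (u, (pos u.1 a k'.1, (a k').1)) :=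
        Measurable.lintegral_prod_right' (f := fun x : (Pt n × ℝ) × (Fin j → ℝ × ℝ) =>
          Wt m x.1.1 x.2 * Θ (x.1, (pos x.1.1 x.2 k'.1, (x.2 k').1))) (by fun_prop)
      rw [h.S2 (fun u => ∫⁻ a : Fin j → ℝ × ℝ, Wt m u.1 a * Θ (u, (pos u.1 a k'.1, (a k').1))) hI]
      calc _ ≤ ∫⁻ z, muF m z * B := by
            refine lintegral_mono fun z => ?_
            have hXi : Measurable fun w : Pt n × ℝ => ∫⁻ t, pF m (z, t) * Θ ((z, t), w) :=
              Measurable.lintegral_prod_right' (f := fun x : (Pt n × ℝ) × ℝ => pF m (z, x.2) * Θ ((z, x.2), x.1))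
                (by fun_prop)
            have key := T4 hm (fun w => ∫⁻ t, pF m (z, t) * Θ ((z, t), w)) hXi B (fun z' => hB z z') k' z
            refine le_trans (le_of_eq ?_) (mul_le_mul_right key (muF m z))
            calc _ = ∫⁻ t, muF m z * (pF m (z, t) *
                  ∫⁻ a : Fin j → ℝ × ℝ, Wt m z a * Θ ((z, t), (pos z a k'.1, (a k').1))) := by
                  refine lintegral_congr_ae ?_
                  filter_upwards [h.mu_mul_pF z] with t ht
                  rw [← mul_assoc, ht]
              _ = muF m z * ∫⁻ t, (pF m (z, t) *
                  ∫⁻ a : Fin j → ℝ × ℝ, Wt m z a * Θ ((z, t), (pos z a k'.1, (a k').1))) :=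
                  lintegral_const_mul _ (by fun_prop)
              _ = _ := by
                  congr 1
                  calc _ = ∫⁻ t, ∫⁻ a : Fin j → ℝ × ℝ, pF m (z, t) * (Wt m z a * Θ ((z, t), (pos z a k'.1, (a k').1))) := by
                        refine lintegral_congr fun t => ?_
                        have : Measurable fun a : Fin j → ℝ × ℝ => pos z a k'.1 :=
                          (measurable_pos k'.1).comp measurable_prodMk_left
                        rw [lintegral_const_mul _ (by fun_prop)]
                    _ = _ := by
                        have hpz : Measurable fun x : ℝ × (Fin j → ℝ × ℝ) => pos z x.2 k'.1 :=
                          (measurable_pos k'.1).comp (by fun_prop : Measurable fun x : ℝ × (Fin j → ℝ × ℝ) => (z, x.2))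
                        rw [lintegral_lintegral_swap (by unfold Function.uncurry; fun_prop)]
                        refine lintegral_congr fun a => ?_
                        rw [← lintegral_const_mul _ (by fun_prop)]
                        refine lintegral_congr fun t => ?_
                        ring
        _ = (∫⁻ z, muF m z) * B := lintegral_mul_const _ hmu
        _ = B := by rw [h.mass, one_mul]
    · refine le_trans (le_of_eq ?_) (ih i' k' (by simpa using hik))
      rw [← h.T1 (fun x => Θ ((pos x.1 x.2 (i'.1+1), (x.2 i').1), (pos x.1 x.2 k'.1, (x.2 k').1))) (by fun_prop)]
      simp only [Fin.val_succ, pos_tail]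
      rfl
end paths

/-- log of an extended nonnegative number -/
def lg (x : ℝ≥0∞) : ℝ := Real.log x.toReal
def Fp (x : ℝ≥0∞) : Prop := x ≠ 0 ∧ x ≠ ⊤

theorem Fp.pos {x : ℝ≥0∞} (h : Fp x) : 0 < x.toReal := ENNReal.toReal_pos h.1 h.2
theorem Fp.mul {x y : ℝ≥0∞} (h : Fp x) (h' : Fp y) : Fp (x * y) :=
  ⟨mul_ne_zero h.1 h'.1, ENNReal.mul_ne_top h.2 h'.2⟩
theorem Fp.inv {x : ℝ≥0∞} (h : Fp x) : Fp x⁻¹ :=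
  ⟨ENNReal.inv_ne_zero.2 h.2, ENNReal.inv_ne_top.2 h.1⟩
theorem Fp.div {x y : ℝ≥0∞} (h : Fp x) (h' : Fp y) : Fp (x / y) := h.mul h'.inv
theorem Fp.rpow {x : ℝ≥0∞} (h : Fp x) (a : ℝ) : Fp (x ^ a) :=
  ⟨(ENNReal.rpow_pos (pos_iff_ne_zero.2 h.1) h.2).ne', fun e => by
    rcases ENNReal.rpow_eq_top_iff.1 e with e | e
    · exact h.1 e.1
    · exact h.2 e.1⟩
theorem Fp.prod {ι : Type*} {s : Finset ι} {f : ι → ℝ≥0∞} (h : ∀ i ∈ s, Fp (f i)) : Fp (∏ i ∈ s, f i) :=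
  ⟨Finset.prod_ne_zero_iff.2 fun i hi => (h i hi).1, ENNReal.prod_ne_top fun i hi => (h i hi).2⟩
theorem Fp_ofReal {x : ℝ} (h : 0 < x) : Fp (ENNReal.ofReal x) := ⟨by simpa using h, by simp⟩
theorem lg_mul {x y : ℝ≥0∞} (h : Fp x) (h' : Fp y) : lg (x * y) = lg x + lg y := by
  unfold lg; rw [ENNReal.toReal_mul, Real.log_mul h.pos.ne' h'.pos.ne']
theorem lg_inv (x : ℝ≥0∞) : lg x⁻¹ = - lg x := by
  unfold lg; rw [ENNReal.toReal_inv, Real.log_inv]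
theorem lg_div {x y : ℝ≥0∞} (h : Fp x) (h' : Fp y) : lg (x / y) = lg x - lg y := by
  rw [div_eq_mul_inv, lg_mul h h'.inv, lg_inv, sub_eq_add_neg]
theorem lg_rpow {x : ℝ≥0∞} (h : Fp x) (a : ℝ) : lg (x ^ a) = a * lg x := by
  unfold lg; rw [← ENNReal.toReal_rpow, Real.log_rpow h.pos]
theorem lg_prod {ι : Type*} {s : Finset ι} {f : ι → ℝ≥0∞} (h : ∀ i ∈ s, Fp (f i)) :
    lg (∏ i ∈ s, f i) = ∑ i ∈ s, lg (f i) := by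
  unfold lg; rw [ENNReal.toReal_prod, Real.log_prod (fun i hi => (h i hi).pos.ne')]
theorem lg_one : lg 1 = 0 := by simp [lg]
theorem Fp_one : Fp 1 := by simp [Fp]
theorem lg_le {x : ℝ≥0∞} : lg x ≤ x.toReal := by
  unfold lg
  exact (Real.log_le_self ENNReal.toReal_nonneg)
@[fun_prop]
theorem measurable_lg : Measurable lg := by unfold lg; fun_prop

theorem lg_mono {x y : ℝ≥0∞} (h : Fp x) (hy : y ≠ ⊤) (hxy : x ≤ y) : lg x ≤ lg y :=
  Real.log_le_log h.pos (ENNReal.toReal_mono hy hxy)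

theorem lg_pin {x : ℝ≥0∞} (h : Fp x) {δ : ℝ} (hδ : 0 < δ) (hx : x < ENNReal.ofReal δ) :
    lg x + Real.log (1 / δ) ≤ x.toReal := by
  have h1 : x.toReal ≤ δ := by
    have := ENNReal.toReal_mono (by simp) hx.le
    rwa [ENNReal.toReal_ofReal hδ.le] at this
  have : lg x ≤ Real.log δ := Real.log_le_log h.pos h1
  rw [one_div, Real.log_inv]
  linarith [ENNReal.toReal_nonneg (a := x)]

theorem pin {Ω ι : Type*} [MeasurableSpace Ω] (P : Measure Ω) [IsProbabilityMeasure P]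
    (X0 : Ω → ℝ≥0∞) (X : ι → Ω → ℝ≥0∞) (s : Finset ι) (w : ι → ℝ) (hw : ∀ i ∈ s, 0 ≤ w i)
    (Λ : Ω → ℝ) (hΛ : Integrable Λ P) (hX0m : AEMeasurable X0 P) (hXm : ∀ i ∈ s, Measurable (X i))
    (hX0 : ∀ᵐ x ∂P, Fp (X0 x)) (hX : ∀ i ∈ s, ∀ᵐ x ∂P, Fp (X i x))
    (hid : ∀ᵐ x ∂P, Λ x = lg (X0 x) + ∑ i ∈ s, w i * lg (X i x))
    (C0 : ℝ≥0∞) (C : ι → ℝ≥0∞) (hC0 : C0 ≠ ⊤) (hC : ∀ i ∈ s, C i ≠ ⊤)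
    (hI0 : ∫⁻ x, X0 x ∂P ≤ C0) (hI : ∀ i ∈ s, ∫⁻ x, X i x ∂P ≤ C i)
    (k : ι) (hk : k ∈ s) {δ : ℝ} (hδ : 0 < δ) :
    ∫ x, Λ x ∂P + w k * Real.log (1 / δ) * (P {x | X k x < ENNReal.ofReal δ}).toReal
      ≤ C0.toReal + ∑ i ∈ s, w i * (C i).toReal := by
  have hset : MeasurableSet {x | X k x < ENNReal.ofReal δ} :=
    measurableSet_lt (hXm k hk) measurable_const
  have hr0 : Integrable (fun x => (X0 x).toReal) P :=
    integrable_toReal_of_lintegral_ne_top hX0m (ne_top_of_le_ne_top hC0 hI0)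
  have hr : ∀ i ∈ s, Integrable (fun x => (X i x).toReal) P := fun i hi =>
    integrable_toReal_of_lintegral_ne_top (hXm i hi).aemeasurable (ne_top_of_le_ne_top (hC i hi) (hI i hi))
  have hv0 : ∫ x, (X0 x).toReal ∂P ≤ C0.toReal := by
    rw [integral_toReal hX0m (hX0.mono fun x hx => hx.2.lt_top)]
    exact ENNReal.toReal_mono hC0 hI0
  have hv : ∀ i ∈ s, ∫ x, (X i x).toReal ∂P ≤ (C i).toReal := fun i hi => by
    rw [integral_toReal (hXm i hi).aemeasurable ((hX i hi).mono fun x hx => hx.2.lt_top)]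
    exact ENNReal.toReal_mono (hC i hi) (hI i hi)
  have hind : Integrable ({x | X k x < ENNReal.ofReal δ}.indicator (fun _ => w k * Real.log (1/δ))) P :=
    (integrable_const _).indicator hset
  have e1 : ∫ x, Λ x ∂P + w k * Real.log (1 / δ) * (P {x | X k x < ENNReal.ofReal δ}).toReal =
      ∫ x, (Λ x + {x | X k x < ENNReal.ofReal δ}.indicator (fun _ => w k * Real.log (1/δ)) x) ∂P := by
    rw [integral_add hΛ hind, integral_indicator_const _ hset]
    simp [Measure.real, mul_comm]
  have hsum : Integrable (fun x => ∑ i ∈ s, w i * (X i x).toReal) P :=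
    integrable_finsetSum _ fun i hi => (hr i hi).const_mul _
  rw [e1]
  calc _ ≤ ∫ x, ((X0 x).toReal + ∑ i ∈ s, w i * (X i x).toReal) ∂P := by
        refine integral_mono_ae (hΛ.add hind) (hr0.add hsum) ?_
        have hall : ∀ᵐ x ∂P, ∀ i ∈ s, Fp (X i x) := (Finset.eventually_all s).2 hX
        filter_upwards [hid, hall] with x hx hF
        simp only [hx]
        classical
        rw [add_assoc, ← Finset.add_sum_erase s _ hk, ← Finset.add_sum_erase s (fun i => w i * (X i x).toReal) hk]
        have h1 : ∑ i ∈ s.erase k, w i * lg (X i x) ≤ ∑ i ∈ s.erase k, w i * (X i x).toReal :=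
          Finset.sum_le_sum fun i hi =>
            mul_le_mul_of_nonneg_left lg_le (hw i (Finset.mem_of_mem_erase hi))
        have h2 : w k * lg (X k x) + {x | X k x < ENNReal.ofReal δ}.indicator (fun _ => w k * Real.log (1/δ)) x
            ≤ w k * (X k x).toReal := by
          by_cases hx' : X k x < ENNReal.ofReal δ
          · rw [indicator_of_mem (by exact hx'), ← mul_add]
            exact mul_le_mul_of_nonneg_left (lg_pin (hF k hk) hδ hx') (hw k hk)
          · rw [indicator_of_notMem (by exact hx'), add_zero]
            exact mul_le_mul_of_nonneg_left lg_le (hw k hk)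
        have h0 : lg (X0 x) ≤ (X0 x).toReal := lg_le
        linarith
    _ = ∫ x, (X0 x).toReal ∂P + ∑ i ∈ s, w i * ∫ x, (X i x).toReal ∂P := by
        rw [integral_add hr0 hsum, integral_finsetSum _ fun i hi => (hr i hi).const_mul _]
        simp_rw [integral_const_mul]
    _ ≤ _ := add_le_add hv0 (Finset.sum_le_sum fun i hi => mul_le_mul_of_nonneg_left (hv i hi) (hw i hi))

/-- single-variable version -/
theorem pin1 {Ω : Type*} [MeasurableSpace Ω] (P : Measure Ω) [IsProbabilityMeasure P]
    (X : Ω → ℝ≥0∞) (hXm : Measurable X) (hX : ∀ᵐ x ∂P, Fp (X x))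
    (Λ : Ω → ℝ) (hΛ : Integrable Λ P) (hid : ∀ᵐ x ∂P, Λ x = lg (X x))
    (hI : ∫⁻ x, X x ∂P ≤ 1) {δ : ℝ} (hδ : 0 < δ) :
    ∫ x, Λ x ∂P + Real.log (1 / δ) * (P {x | X x < ENNReal.ofReal δ}).toReal ≤ 2 := by
  have := pin P (fun _ => 1) (fun _ : Unit => X) Finset.univ (fun _ => 1) (by simp) Λ hΛ aemeasurable_const
    (fun _ _ => hXm) (ae_of_all _ fun _ => Fp_one) (fun _ _ => hX) (by simpa [lg_one] using hid) 1 (fun _ => 1)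
    (by simp) (by simp) (by simp) (fun _ _ => hI) () (by simp) hδ
  simp only [one_mul, Finset.sum_const, toReal_one] at this
  simp at this ⊢
  linarith

section laws
variable {n : ℕ} {m : Pt n × ℝ → ℝ≥0∞}

def Pm (m : Pt n × ℝ → ℝ≥0∞) (j : ℕ) : Measure (Pt n × (Fin j → ℝ × ℝ)) :=
  (volume.prod volume).withDensity (fun x => muF m x.1 * Wt m x.1 x.2)
def nu1 (m : Pt n × ℝ → ℝ≥0∞) : Measure (Pt n × (ℝ × ℝ)) :=
  (volume.prod volume).withDensity (fun x => qF m x.1 x.2)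
def nu (m : Pt n × ℝ → ℝ≥0∞) : Measure (Pt n × ℝ) := (volume.prod volume).withDensity m

theorem measurable_dens (hm : Measurable m) (j : ℕ) :
    Measurable (fun x : Pt n × (Fin j → ℝ × ℝ) => muF m x.1 * Wt m x.1 x.2) := by
  have := measurable_Wt hm j
  have := measurable_muF hm
  fun_prop

theorem lintegral_Pm (hm : Measurable m) (j : ℕ) (G : Pt n × (Fin j → ℝ × ℝ) → ℝ≥0∞) (hG : Measurable G) :
    ∫⁻ x, G x ∂(Pm m j) = PE m j G := by
  have this := measurable_dens hm j
  have h2 := (this.mul hG).aemeasurable (μ := volume.prod volume)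
  rw [Pm, lintegral_withDensity_eq_lintegral_mul _ this hG, lintegral_prod _ h2]
  simp only [PE, Pi.mul_apply, mul_assoc]
theorem lintegral_nu1 (hm : Measurable m) (G : Pt n × (ℝ × ℝ) → ℝ≥0∞) (hG : Measurable G) :
    ∫⁻ x, G x ∂(nu1 m) = ∫⁻ z, ∫⁻ b : ℝ × ℝ, qF m z b * G (z, b) := by
  have this := measurable_qF hm
  have h2 := (this.mul hG).aemeasurable (μ := volume.prod volume)
  rw [nu1, lintegral_withDensity_eq_lintegral_mul _ this hG, lintegral_prod _ h2]
  simp only [Pi.mul_apply]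
theorem lintegral_nu (hm : Measurable m) (G : Pt n × ℝ → ℝ≥0∞) (hG : Measurable G) :
    ∫⁻ x, G x ∂(nu m) = ∫⁻ z, ∫⁻ t, m (z, t) * G (z, t) := by
  have h2 := (hm.mul hG).aemeasurable (μ := volume.prod volume)
  rw [nu, lintegral_withDensity_eq_lintegral_mul _ hm hG, lintegral_prod _ h2]
  simp only [Pi.mul_apply]

theorem Reg.prob_Pm (h : Reg m) (j : ℕ) : IsProbabilityMeasure (Pm m j) := ⟨by
  rw [← lintegral_one, lintegral_Pm h.meas _ _ measurable_const, h.PE_one]⟩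
theorem Reg.prob_nu (h : Reg m) : IsProbabilityMeasure (nu m) := ⟨by
  rw [← lintegral_one, lintegral_nu h.meas _ measurable_const]
  simp only [mul_one]
  exact h.mass⟩
theorem Reg.prob_nu1 (h : Reg m) : IsProbabilityMeasure (nu1 m) := ⟨by
  rw [← lintegral_one, lintegral_nu1 h.meas _ measurable_const, h.S1 (fun _ => 1) measurable_const]
  simp only [mul_one]
  exact h.mass⟩

theorem Reg.mp_step (h : Reg m) {j : ℕ} (i : Fin j) :
    MeasurePreserving (fun x : Pt n × (Fin j → ℝ × ℝ) => (pos x.1 x.2 i.1, x.2 i)) (Pm m j) (nu1 m) := by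
  have hme : Measurable (fun x : Pt n × (Fin j → ℝ × ℝ) => (pos x.1 x.2 i.1, x.2 i)) := by fun_prop
  refine ⟨hme, ?_⟩
  have := h.prob_Pm j
  have := h.prob_nu1
  have := Measure.isProbabilityMeasure_map (μ := Pm m j) hme.aemeasurable
  refine Measure.eq_of_le_of_isProbabilityMeasure ?_
  refine Measure.le_iff.2 fun s hs => ?_
  rw [← lintegral_indicator_one hs, ← lintegral_indicator_one hs,
    lintegral_map (measurable_one.indicator hs) hme, lintegral_nu1 h.meas _ (measurable_one.indicator hs),
    lintegral_Pm h.meas _ (fun x => s.indicator 1 (pos x.1 x.2 i.1, x.2 i)) ((measurable_one.indicator hs).comp hme)]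
  exact h.law_le i _ (measurable_one.indicator hs)

theorem Reg.mp_fst (h : Reg m) :
    MeasurePreserving (fun x : Pt n × (ℝ × ℝ) => (x.1, x.2.1)) (nu1 m) (nu m) := by
  have hme : Measurable (fun x : Pt n × (ℝ × ℝ) => (x.1, x.2.1)) := by fun_prop
  refine ⟨hme, ?_⟩
  refine Measure.ext fun s hs => ?_
  rw [← lintegral_indicator_one hs, ← lintegral_indicator_one hs,
    lintegral_map (measurable_one.indicator hs) hme, lintegral_nu h.meas _ (measurable_one.indicator hs),
    lintegral_nu1 h.meas (fun x => s.indicator 1 (x.1, x.2.1)) ((measurable_one.indicator hs).comp hme)]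
  exact h.S1 _ (measurable_one.indicator hs)

theorem Reg.mp_snd (h : Reg m) :
    MeasurePreserving (fun x : Pt n × (ℝ × ℝ) => (x.1 + stp n x.2, x.2.1)) (nu1 m) (nu m) := by
  have hme : Measurable (fun x : Pt n × (ℝ × ℝ) => (x.1 + stp n x.2, x.2.1)) := by fun_prop
  refine ⟨hme, ?_⟩
  refine Measure.ext fun s hs => ?_
  rw [← lintegral_indicator_one hs, ← lintegral_indicator_one hs,
    lintegral_map (measurable_one.indicator hs) hme, lintegral_nu h.meas _ (measurable_one.indicator hs),
    lintegral_nu1 h.meas (fun x => s.indicator 1 (x.1 + stp n x.2, x.2.1)) ((measurable_one.indicator hs).comp hme)]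
  exact h.S2 _ (measurable_one.indicator hs)

theorem pos_succ {j : ℕ} (z : Pt n) (a : Fin j → ℝ × ℝ) (i : Fin j) :
    pos z a (i.1+1) = pos z a i.1 + stp n (a i) := by
  unfold pos
  rw [add_assoc]; congr 1
  have : ∀ l : Fin j, (if l.1 < i.1 + 1 then stp n (a l) else 0) =
      (if l.1 < i.1 then stp n (a l) else 0) + (if l = i then stp n (a l) else 0) := by
    intro l
    by_cases h1 : l.1 < i.1
    · have : l ≠ i := fun h => by simp [h] at h1
      simp [h1, this, Nat.lt_succ_of_lt h1]
    · by_cases h2 : l = i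
      · subst h2; simp
      · have : ¬ l.1 < i.1 + 1 := fun h => h2 (Fin.ext (by omega))
        simp [h1, h2, this]
  simp_rw [this]
  rw [Finset.sum_add_distrib]; simp

/-- evaluation points -/
def uP {j : ℕ} (i : Fin j) (x : Pt n × (Fin j → ℝ × ℝ)) : Pt n × ℝ := (pos x.1 x.2 i.1, (x.2 i).1)
def vP {j : ℕ} (i : Fin j) (x : Pt n × (Fin j → ℝ × ℝ)) : Pt n × ℝ := (pos x.1 x.2 (i.1+1), (x.2 i).1)
@[fun_prop]
theorem measurable_uP {j : ℕ} (i : Fin j) : Measurable (uP (n := n) i) := by unfold uP; fun_prop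
@[fun_prop]
theorem measurable_vP {j : ℕ} (i : Fin j) : Measurable (vP (n := n) i) := by unfold vP; fun_prop

theorem Reg.mp_u (h : Reg m) {j : ℕ} (i : Fin j) : MeasurePreserving (uP i) (Pm m j) (nu m) :=
  h.mp_fst.comp (h.mp_step i)
theorem Reg.mp_v (h : Reg m) {j : ℕ} (i : Fin j) : MeasurePreserving (vP i) (Pm m j) (nu m) := by
  have := h.mp_snd.comp (h.mp_step i)
  convert this using 1
  funext x
  simp [vP, pos_succ]
end laws

section lin
variable {n : ℕ}
/-- sum of steps -/
def stepSum (n : ℕ) (t σ : Fin (n+1) → ℝ) : Pt n := ∑ i, stp n (t i, σ i)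
def VV (n : ℕ) (t : Fin (n+1) → ℝ) : ℝ≥0∞ := ENNReal.ofReal |(Matrix.vandermonde t).det|

theorem stepSum_eq (t σ : Fin (n+1) → ℝ) :
    stepSum n t σ = MeasurableEquiv.piFinSuccAbove (fun _ : Fin (n+1) => ℝ) 0
      (Matrix.toLin' (Matrix.vandermonde t).transpose σ) := by
  unfold stepSum
  refine Prod.ext ?_ ?_
  · simp [stp, ev, Prod.fst_sum, Matrix.mulVec, dotProduct, Matrix.vandermonde]
  · funext k
    simp [stp, ev, Prod.snd_sum, Matrix.mulVec, dotProduct, Matrix.vandermonde, mom, mul_comm, Fin.tail]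

theorem lin_eq (t : Fin (n+1) → ℝ) (hd : (Matrix.vandermonde t).det ≠ 0) (z : Pt n) (g : Pt n → ℝ≥0∞)
    (hg : Measurable g) : VV n t * ∫⁻ σ : Fin (n+1) → ℝ, g (z + stepSum n t σ) = ∫⁻ w, g w := by
  have hmp := (volume_preserving_piFinSuccAbove (fun _ : Fin (n+1) => ℝ) 0)
  set E := MeasurableEquiv.piFinSuccAbove (fun _ : Fin (n+1) => ℝ) 0 with hE
  have hd' : (Matrix.vandermonde t).transpose.det ≠ 0 := by rwa [Matrix.det_transpose]
  have h1 := Real.map_matrix_volume_pi_eq_smul_volume_pi hd'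
  simp_rw [stepSum_eq]
  have hgm : Measurable (fun y => g (z + E y)) := hg.comp ((measurable_const_add z).comp E.measurable)
  have hl : Measurable (Matrix.toLin' (Matrix.vandermonde t).transpose) :=
    (LinearMap.continuous_of_finiteDimensional _).measurable
  rw [← lintegral_map (f := fun y => g (z + E y)) hgm hl, h1, lintegral_smul_measure,
    hmp.lintegral_comp (f := fun y => g (z + y)) (hg.comp (measurable_const_add z)),
    lintegral_add_left_eq_self (fun y => g y) z, Matrix.det_transpose, smul_eq_mul, ← mul_assoc, VV,
    ← ENNReal.ofReal_mul (abs_nonneg _), ← abs_mul, mul_inv_cancel₀ hd]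
  simp

theorem lin_le (t : Fin (n+1) → ℝ) (z : Pt n) (g : Pt n → ℝ≥0∞)
    (hg : Measurable g) : VV n t * ∫⁻ σ : Fin (n+1) → ℝ, g (z + stepSum n t σ) ≤ ∫⁻ w, g w := by
  by_cases hd : (Matrix.vandermonde t).det = 0
  · simp [VV, hd]
  · exact (lin_eq t hd z g hg).le

theorem VV_eq (t : Fin (n+1) → ℝ) :
    VV n t = ∏ i, ∏ k ∈ Finset.Ioi i, ENNReal.ofReal |t i - t k| := by
  unfold VV
  rw [Matrix.det_vandermonde, Finset.abs_prod, ENNReal.ofReal_prod_of_nonneg (fun _ _ => abs_nonneg _)]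
  refine Finset.prod_congr rfl fun i _ => ?_
  rw [Finset.abs_prod, ENNReal.ofReal_prod_of_nonneg (fun _ _ => abs_nonneg _)]
  refine Finset.prod_congr rfl fun k _ => ?_
  rw [abs_sub_comm]

@[fun_prop]
theorem measurable_VV : Measurable (VV n) := by
  have : VV n = fun t : Fin (n+1) → ℝ => ∏ i, ∏ k ∈ Finset.Ioi i, ENNReal.ofReal |t i - t k| := by
    funext t; exact VV_eq t
  rw [this]
  refine Finset.measurable_prod _ fun i _ => Finset.measurable_prod _ fun k _ => ?_
  fun_prop

theorem lintegral_split {j : ℕ} (F : (Fin j → ℝ × ℝ) → ℝ≥0∞) (hF : Measurable F) :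
    ∫⁻ a, F a = ∫⁻ t : Fin j → ℝ, ∫⁻ σ : Fin j → ℝ, F (fun i => (t i, σ i)) := by
  have h := (volume_measurePreserving_arrowProdEquivProdArrow ℝ ℝ (Fin j)).symm
  rw [← h.lintegral_comp hF, Measure.volume_eq_prod, lintegral_prod]
  · rfl
  · exact (hF.comp (MeasurableEquiv.arrowProdEquivProdArrow ℝ ℝ (Fin j)).symm.measurable).aemeasurable

theorem pos_last (z : Pt n) (a : Fin (n+1) → ℝ × ℝ) :
    pos z a (n+1) = z + stepSum n (fun i => (a i).1) (fun i => (a i).2) := by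
  unfold pos stepSum
  congr 1
  refine Finset.sum_congr rfl fun i _ => ?_
  rw [if_pos i.2]
end lin

/-! star product -/
theorem lintegral_pi_prod {n : ℕ} (f : ℝ → ℝ≥0∞) (hf : Measurable f) :
    ∫⁻ t : Fin n → ℝ, ∏ j, f (t j) = (∫⁻ x, f x) ^ n := by
  induction n with
  | zero => simp [volume_pi]
  | succ n ih =>
    have hm : Measurable (fun t : Fin (n+1) → ℝ => ∏ j, f (t j)) :=
      Finset.measurable_prod _ fun j _ => by fun_prop
    have hm' : Measurable (fun t : Fin n → ℝ => ∏ j, f (t j)) :=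
      Finset.measurable_prod _ fun j _ => by fun_prop
    rw [lintegral_cons _ hm]
    simp only [Fin.prod_univ_succ, Fin.cons_zero, Fin.cons_succ]
    simp_rw [lintegral_const_mul _ hm', ih]
    rw [lintegral_mul_const _ hf, pow_succ']

section Q
variable {n : ℕ} {m : Pt n × ℝ → ℝ≥0∞}

def RR (n : ℕ) (η0 : ℝ) (ρ : ℝ → ℝ≥0∞) (t : Fin (n+1) → ℝ) : ℝ≥0∞ :=
  ρ (t 0) ^ (1/2 : ℝ) * ∏ j : Fin n, (ρ (t j.succ) ^ ((η0 + 1/2) / n) * rk (1 - η0 / n) (t 0 - t j.succ))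

theorem measurable_RR (η0 : ℝ) {ρ : ℝ → ℝ≥0∞} (hρ : Measurable ρ) : Measurable (RR n η0 ρ) := by
  unfold RR
  refine Measurable.mul (by fun_prop) (Finset.measurable_prod _ fun j _ => ?_)
  fun_prop

theorem lintegral_RR (hn : 2 ≤ n) {η0 : ℝ} (h0 : 0 < η0) (h1 : η0 ≤ 1/2)
    {ρ : ℝ → ℝ≥0∞} (hρ : Measurable ρ) (hi : ∫⁻ t, ρ t ≤ 1) :
    ∫⁻ t, RR n η0 ρ t ≤ 1 + starK n η0 ^ (2 * n) := by
  refine le_trans (le_of_eq ?_) (star_bound hn h0 h1 hρ hi)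
  rw [lintegral_cons _ (measurable_RR η0 hρ)]
  refine lintegral_congr fun t0 => ?_
  simp only [RR, Fin.cons_zero, Fin.cons_succ]
  have hf : Measurable (fun x => ρ x ^ ((η0 + 1/2) / n) * rk (1 - η0 / n) (t0 - x)) := by fun_prop
  have hm' : Measurable (fun t : Fin n → ℝ => ∏ j, (ρ (t j) ^ ((η0 + 1/2) / n) * rk (1 - η0 / n) (t0 - t j))) :=
      Finset.measurable_prod _ fun j _ => by fun_prop
  rw [lintegral_const_mul _ hm', lintegral_pi_prod (fun x => ρ x ^ ((η0 + 1/2) / n) * rk (1 - η0 / n) (t0 - x)) hf]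
  rfl

def tv {j : ℕ} (x : Pt n × (Fin j → ℝ × ℝ)) : Fin j → ℝ := fun i => (x.2 i).1
@[fun_prop]
theorem measurable_tv {j : ℕ} : Measurable (tv (n := n) (j := j)) := by
  unfold tv; fun_prop

def QQ (m : Pt n × ℝ → ℝ≥0∞) (η0 : ℝ) (x : Pt n × (Fin (n+1) → ℝ × ℝ)) : ℝ≥0∞ :=
  (m (uP 0 x) / rhoF m (tv x 0)) * (m (vP (Fin.last n) x) / rhoF m (tv x (Fin.last n))) *
    VV n (tv x) * RR n η0 (rhoF m) (tv x)

theorem measurable_QQ (hm : Measurable m) (η0 : ℝ) : Measurable (QQ m η0) := by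
  have := measurable_rhoF hm
  have := measurable_RR (n := n) η0 this
  unfold QQ
  fun_prop

theorem lintegral_rho (h : Reg m) : ∫⁻ t, rhoF m t = 1 := by
  rw [← h.mass]
  unfold rhoF muF
  rw [lintegral_lintegral_swap]
  exact (h.meas.comp measurable_swap).aemeasurable

theorem lintegral_rhat_le (hm : Measurable m) (t : ℝ) : ∫⁻ z, m (z, t) / rhoF m t ≤ 1 := by
  simp only [div_eq_mul_inv]
  rw [lintegral_mul_const _ (by fun_prop)]
  exact ENNReal.div_self_le_one

theorem lintegral_QQ (h : Reg m) (hn : 2 ≤ n) {η0 : ℝ} (h0 : 0 < η0) (h1 : η0 ≤ 1/2) :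
    ∫⁻ z, ∫⁻ a, QQ m η0 (z, a) ≤ 1 + starK n η0 ^ (2 * n) := by
  have hm := h.meas
  have hρ := measurable_rhoF hm
  have hR := measurable_RR (n := n) η0 hρ
  have hQ := measurable_QQ hm η0
  have e1 : ∀ z, ∫⁻ a, QQ m η0 (z, a) = ∫⁻ t : Fin (n+1) → ℝ, ∫⁻ σ : Fin (n+1) → ℝ,
      QQ m η0 (z, fun i => (t i, σ i)) := fun z => lintegral_split _ (by fun_prop)
  simp_rw [e1]
  have hbig : Measurable (fun x : Pt n × (Fin (n+1) → ℝ) =>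
      ∫⁻ σ : Fin (n+1) → ℝ, QQ m η0 (x.1, fun i => (x.2 i, σ i))) :=
    Measurable.lintegral_prod_right' (f := fun y : (Pt n × (Fin (n+1) → ℝ)) × (Fin (n+1) → ℝ) =>
      QQ m η0 (y.1.1, fun i => (y.1.2 i, y.2 i))) (by fun_prop)
  rw [lintegral_lintegral_swap hbig.aemeasurable]
  refine le_trans (lintegral_mono fun t => ?_) (lintegral_RR hn h0 h1 hρ (lintegral_rho h).le)
  have e2 : ∀ z, ∫⁻ σ : Fin (n+1) → ℝ, QQ m η0 (z, fun i => (t i, σ i)) ≤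
      RR n η0 (rhoF m) t * (m (z, t 0) / rhoF m (t 0)) := by
    intro z
    have hmm : Measurable (fun w => m (w, t (Fin.last n)) / rhoF m (t (Fin.last n))) := by fun_prop
    have hs : Measurable (fun σ : Fin (n+1) → ℝ => z + stepSum n t σ) := by unfold stepSum; fun_prop
    calc _ = ∫⁻ σ : Fin (n+1) → ℝ, (RR n η0 (rhoF m) t * (m (z, t 0) / rhoF m (t 0))) *
          (VV n t * (m (z + stepSum n t σ, t (Fin.last n)) / rhoF m (t (Fin.last n)))) := by
          refine lintegral_congr fun σ => ?_
          have : pos z (fun i => (t i, σ i)) (n+1) = z + stepSum n t σ := pos_last z _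
          have e3 : tv (z, fun i => (t i, σ i)) = t := rfl
          simp only [QQ, uP, vP, e3, Fin.val_zero, pos_zero, Fin.val_last, this]
          ring
      _ = (RR n η0 (rhoF m) t * (m (z, t 0) / rhoF m (t 0))) *
          (VV n t * ∫⁻ σ : Fin (n+1) → ℝ, (m (z + stepSum n t σ, t (Fin.last n)) / rhoF m (t (Fin.last n)))) := by
          rw [lintegral_const_mul, lintegral_const_mul]
          · exact hmm.comp hs
          · exact (hmm.comp hs).const_mul _
      _ ≤ (RR n η0 (rhoF m) t * (m (z, t 0) / rhoF m (t 0))) * 1 := by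
          gcongr
          exact (lin_le t z _ hmm).trans (lintegral_rhat_le hm _)
      _ = _ := mul_one _
  calc _ ≤ ∫⁻ z, RR n η0 (rhoF m) t * (m (z, t 0) / rhoF m (t 0)) := lintegral_mono e2
    _ ≤ RR n η0 (rhoF m) t * 1 := by
      rw [lintegral_const_mul _ (by fun_prop)]
      gcongr
      exact lintegral_rhat_le hm _
    _ = _ := mul_one _

def X1F (m : Pt n × ℝ → ℝ≥0∞) (η0 : ℝ) (x : Pt n × (Fin (n+1) → ℝ × ℝ)) : ℝ≥0∞ :=
  QQ m η0 x / (muF m x.1 * Wt m x.1 x.2)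
theorem measurable_X1F (hm : Measurable m) (η0 : ℝ) : Measurable (X1F m η0) :=
  (measurable_QQ hm η0).div (measurable_dens hm _)

theorem lintegral_X1F (h : Reg m) (hn : 2 ≤ n) {η0 : ℝ} (h0 : 0 < η0) (h1 : η0 ≤ 1/2) :
    ∫⁻ x, X1F m η0 x ∂(Pm m (n+1)) ≤ 1 + starK n η0 ^ (2 * n) := by
  rw [lintegral_Pm h.meas _ _ (measurable_X1F h.meas η0)]
  refine le_trans ?_ (lintegral_QQ h hn h0 h1)
  unfold PE X1F
  gcongr
  exact ENNReal.mul_div_le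

/-- the pair variables -/
def XP (m : Pt n × ℝ → ℝ≥0∞) {j : ℕ} (a b : ℝ) (i k : Fin j) (x : Pt n × (Fin j → ℝ × ℝ)) : ℝ≥0∞ :=
  rk (a + b) (tv x i - tv x k) * (pF m (vP i x) ^ (-a) * pF m (uP k x) ^ (-b))

theorem measurable_XP (hm : Measurable m) {j : ℕ} (a b : ℝ) (i k : Fin j) : Measurable (XP m a b i k) := by
  have := measurable_pF hm
  unfold XP; fun_prop

theorem mul_rpow_neg_le (p : ℝ≥0∞) {a : ℝ} (ha : 0 < a) (h1 : a < 1) : p * p ^ (-a) ≤ p ^ (1 - a) := by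
  rcases eq_or_ne p 0 with rfl | h0
  · simp
  rcases eq_or_ne p ⊤ with rfl | ht
  · rw [ENNReal.top_rpow_of_pos (y := 1 - a) (by linarith)]; exact le_top
  · rw [sub_eq_add_neg, ENNReal.rpow_add _ _ h0 ht, ENNReal.rpow_one]

theorem lintegral_XP (h : Reg m) {j : ℕ} {a b : ℝ} (ha : 0 < a) (hb : 0 < b) (hab : a + b < 1)
    (i k : Fin j) (hik : i < k) : ∫⁻ x, XP m a b i k x ∂(Pm m j) ≤ hlsC b a + hlsC a b := by
  have hm := h.meas
  have hp := measurable_pF hm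
  rw [lintegral_Pm hm _ _ (measurable_XP hm a b i k)]
  refine h.pair_le (fun y => rk (a + b) (y.1.2 - y.2.2) * (pF m y.1 ^ (-a) * pF m y.2 ^ (-b))) (by fun_prop) _ ?_ i k hik
  intro z z'
  refine le_trans ?_ (hls (p := fun t => pF m (z', t)) (p' := fun t => pF m (z, t)) hb ha (by linarith)
    (by fun_prop) (by fun_prop) (lintegral_pF_le hm _) (lintegral_pF_le hm _))
  refine lintegral_mono fun t' => ?_
  rw [← lintegral_const_mul _ (by fun_prop)]
  refine lintegral_mono fun t => ?_
  have e1 := mul_rpow_neg_le (pF m (z', t')) hb (by linarith)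
  have e2 := mul_rpow_neg_le (pF m (z, t)) ha (by linarith)
  calc _ = (pF m (z', t') * pF m (z', t') ^ (-b)) * (pF m (z, t) * pF m (z, t) ^ (-a)) * rk (a + b) (t - t') := by
        ring
    _ ≤ _ := by
        rw [add_comm b a, ← neg_sub t' t]
        have : rk (a+b) (-(t' - t)) = rk (a+b) (t' - t) := by
          unfold rk; rw [abs_neg]
        rw [this]
        gcongr
end Q

def HE {Ω : Type*} [MeasurableSpace Ω] (P : Measure Ω) (f : Ω → ℝ) (c : ℝ) : Prop :=
  Integrable f P ∧ ∫ x, f x ∂P = c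
section HEs
variable {Ω : Type*} [MeasurableSpace Ω] {P : Measure Ω} {f g : Ω → ℝ} {c d : ℝ}
theorem HE.add (h : HE P f c) (h' : HE P g d) : HE P (fun x => f x + g x) (c + d) :=
  ⟨h.1.add h'.1, by rw [integral_add h.1 h'.1, h.2, h'.2]⟩
theorem HE.sub (h : HE P f c) (h' : HE P g d) : HE P (fun x => f x - g x) (c - d) :=
  ⟨h.1.sub h'.1, by rw [integral_sub h.1 h'.1, h.2, h'.2]⟩
theorem HE.smul (h : HE P f c) (a : ℝ) : HE P (fun x => a * f x) (a * c) :=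
  ⟨h.1.const_mul a, by rw [integral_const_mul, h.2]⟩
theorem HE.sum {ι : Type*} {s : Finset ι} {f : ι → Ω → ℝ} {c : ι → ℝ} (h : ∀ i ∈ s, HE P (f i) (c i)) :
    HE P (fun x => ∑ i ∈ s, f i x) (∑ i ∈ s, c i) :=
  ⟨integrable_finsetSum _ fun i hi => (h i hi).1, by
    rw [integral_finsetSum _ fun i hi => (h i hi).1]
    exact Finset.sum_congr rfl fun i hi => (h i hi).2⟩
theorem HE.comp {Ω' : Type*} [MeasurableSpace Ω'] {P' : Measure Ω'} (h : HE P f c) {φ : Ω' → Ω}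
    (hφ : MeasurePreserving φ P' P) : HE P' (fun x => f (φ x)) c :=
  ⟨hφ.integrable_comp_of_integrable h.1, by
    rw [← h.2, ← hφ.map_eq, integral_map hφ.measurable.aemeasurable]
    rw [hφ.map_eq]; exact h.1.aestronglyMeasurable⟩
end HEs

section core
variable {n : ℕ} {m : Pt n × ℝ → ℝ≥0∞}

structure LI (m : Pt n × ℝ → ℝ≥0∞) : Prop extends Reg m where
  fm : ∀ᵐ u ∂(nu m), Fp (m u)
  fL : ∀ᵐ u ∂(nu m), Fp (LF m u)
  fr : ∀ᵐ u ∂(nu m), Fp (rhoF m u.2)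
  fu : ∀ᵐ u ∂(nu m), Fp (muF m u.1)
  Im : Integrable (fun u => lg (m u)) (nu m)
  IL : Integrable (fun u => lg (LF m u)) (nu m)
  Ir : Integrable (fun u => lg (rhoF m u.2)) (nu m)
  Iu : Integrable (fun u => lg (muF m u.1)) (nu m)

def wt (n : ℕ) (η0 : ℝ) (i : Fin (n+1)) : ℝ := if i = 0 then η0 / n else 1

theorem wsum (hn : 2 ≤ n) (η0 : ℝ) : ∑ i : Fin (n+1), ∑ _k ∈ Finset.Ioi i, wt n η0 i = η0 + n * (n - 1) / 2 := by
  have hn0 : (n:ℝ) ≠ 0 := by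
    have : n ≠ 0 := by omega
    exact_mod_cast this
  simp only [Finset.sum_const, Fin.card_Ioi, nsmul_eq_mul]
  rw [Fin.sum_univ_succ]
  have e : ∀ j : Fin n, ((n + 1 - 1 - (j.succ : Fin (n+1)).1 : ℕ) : ℝ) * wt n η0 j.succ = ((n - 1 - j.1 : ℕ) : ℝ) := by
    intro j
    have : (n + 1 - 1 - (j.succ : Fin (n+1)).1 : ℕ) = n - 1 - j.1 := by simp; omega
    rw [this]; simp [wt, Fin.succ_ne_zero]
  simp_rw [e]
  rw [Fin.sum_univ_eq_sum_range (fun j => ((n - 1 - j : ℕ) : ℝ)) n,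
    Finset.sum_range_reflect (fun j => (j : ℝ)) n]
  have h2 : ∑ j ∈ Finset.range n, (j:ℝ) = n * (n - 1) / 2 := by
    have := Finset.sum_range_id_mul_two n
    have h3 : ((∑ j ∈ Finset.range n, j : ℕ) : ℝ) * 2 = n * (n - 1 : ℕ) := by exact_mod_cast this
    rw [Nat.cast_sum, Nat.cast_sub (by omega)] at h3
    push_cast at h3
    linarith
  rw [h2]
  simp [wt]
  field_simp

/-- exponents of the pair variables -/
def ea (e : Bool) : ℝ := if e then 1/3 else 1/6
theorem ea_pos (e : Bool) : 0 < ea e := by unfold ea; split_ifs <;> norm_num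
theorem ea_sum (e : Bool) : ea e + ea (!e) = 1/2 := by cases e <;> norm_num [ea]

def coreC (n : ℕ) (η0 : ℝ) : ℝ := (1 + starK n η0 ^ (2*n)).toReal +
  ∑ i ∈ (Finset.univ : Finset Bool) ×ˢ (Finset.univ.sigma fun i : Fin (n+1) => Finset.Ioi i),
    wt n η0 i.2.1 * (hlsC (ea (!i.1)) (ea i.1) + hlsC (ea i.1) (ea (!i.1))).toReal

/-- the log sum -/
def Lam (m : Pt n × ℝ → ℝ≥0∞) (η0 : ℝ) (x : Pt n × (Fin (n+1) → ℝ × ℝ)) : ℝ :=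
  (lg (m (uP 0 x)) - lg (rhoF m (uP 0 x).2)) + (lg (m (vP (Fin.last n) x)) - lg (rhoF m (vP (Fin.last n) x).2))
   + ((1/2) * lg (rhoF m (uP 0 x).2) + ∑ j : Fin n, ((η0 + 1/2)/n) * lg (rhoF m (uP j.succ x).2))
   - (lg (muF m (uP 0 x).1) + ∑ l : Fin (n+1), ((lg (m (uP l x)) - lg (muF m (uP l x).1)) +
      (lg (m (vP l x)) - lg (LF m (uP l x)))))
   - (1/2) * ∑ i : Fin (n+1), ∑ k ∈ Finset.Ioi i, wt n η0 i *
      ((lg (m (vP i x)) - lg (muF m (vP i x).1)) + (lg (m (uP k x)) - lg (muF m (uP k x).1)))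

theorem LI.Lam_HE (h : LI m) (hn : 2 ≤ n) (η0 : ℝ) : HE (Pm m (n+1)) (Lam m η0)
    ((n+1) * ∫ u, lg (LF m u) ∂(nu m) + (n*(n+1)/2 + η0) * ∫ u, lg (muF m u.1) ∂(nu m)
      - (n + (n*(n+1)/2 + η0)) * ∫ u, lg (m u) ∂(nu m) - (1 - η0) * ∫ u, lg (rhoF m u.2) ∂(nu m)) := by
  have Hm : HE (nu m) (fun u => lg (m u)) _ := ⟨h.Im, rfl⟩
  have HL : HE (nu m) (fun u => lg (LF m u)) _ := ⟨h.IL, rfl⟩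
  have Hr : HE (nu m) (fun u => lg (rhoF m u.2)) _ := ⟨h.Ir, rfl⟩
  have Hu : HE (nu m) (fun u => lg (muF m u.1)) _ := ⟨h.Iu, rfl⟩
  set Em := ∫ u, lg (m u) ∂(nu m)
  set EL := ∫ u, lg (LF m u) ∂(nu m)
  set Er := ∫ u, lg (rhoF m u.2) ∂(nu m)
  set Eu := ∫ u, lg (muF m u.1) ∂(nu m)
  have key : HE (Pm m (n+1)) (Lam m η0) ((Em - Er) + (Em - Er) + ((1/2) * Er + ∑ j : Fin n, ((η0 + 1/2)/n) * Er)
     - (Eu + ∑ l : Fin (n+1), ((Em - Eu) + (Em - EL)))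
     - (1/2) * ∑ i : Fin (n+1), ∑ k ∈ Finset.Ioi i, wt n η0 i * ((Em - Eu) + (Em - Eu))) := by
    have mu := fun i : Fin (n+1) => h.mp_u i
    have mv := fun i : Fin (n+1) => h.mp_v i
    refine HE.sub (HE.sub (HE.add (HE.add ((Hm.comp (mu 0)).sub (Hr.comp (mu 0)))
      ((Hm.comp (mv (Fin.last n))).sub (Hr.comp (mv (Fin.last n)))))
      (((Hr.comp (mu 0)).smul _).add (HE.sum fun j _ => (Hr.comp (mu j.succ)).smul _)))
      ((Hu.comp (mu 0)).add (HE.sum fun l _ => ((Hm.comp (mu l)).sub (Hu.comp (mu l))).add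
        ((Hm.comp (mv l)).sub (HL.comp (mu l))))))
      (HE.smul (HE.sum fun i _ => HE.sum fun k _ => HE.smul (((Hm.comp (mv i)).sub (Hu.comp (mv i))).add
        ((Hm.comp (mu k)).sub (Hu.comp (mu k)))) _) _)
  convert key using 1
  simp_rw [← Finset.sum_mul]
  rw [wsum hn]
  simp only [Finset.sum_const, Finset.card_univ, Fintype.card_fin, nsmul_eq_mul]
  have hn0 : (n:ℝ) ≠ 0 := by
    have : n ≠ 0 := by omega
    exact_mod_cast this
  push_cast
  field_simp
  ring

theorem Fp_dist {x : ℝ} (h : x ≠ 0) : Fp (ENNReal.ofReal |x|) := Fp_ofReal (abs_pos.2 h)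

theorem lg_rk {x : ℝ} (h : x ≠ 0) (b : ℝ) : lg (rk b x) = - b * lg (ENNReal.ofReal |x|) :=
  lg_rpow (Fp_dist h) _

/-- everything is fine at the path x -/
def Good0 (m : Pt n × ℝ → ℝ≥0∞) {j : ℕ} (x : Pt n × (Fin j → ℝ × ℝ)) : Prop :=
  (∀ i, Fp (m (uP i x)) ∧ Fp (m (vP i x)) ∧ Fp (LF m (uP i x)) ∧ Fp (rhoF m (tv x i)) ∧
    Fp (muF m (uP i x).1) ∧ Fp (muF m (vP i x).1)) ∧ ∀ i k, i < k → tv x i - tv x k ≠ 0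

theorem LI.ae_good0 (h : LI m) (j : ℕ) : ∀ᵐ x ∂(Pm m j), Good0 m x := by
  have h1 : ∀ i : Fin j, ∀ᵐ x ∂(Pm m j), Fp (m (uP i x)) ∧ Fp (m (vP i x)) ∧ Fp (LF m (uP i x)) ∧ Fp (rhoF m (tv x i)) ∧
    Fp (muF m (uP i x).1) ∧ Fp (muF m (vP i x).1) := by
    intro i
    have mu := (h.mp_u i).quasiMeasurePreserving
    have mv := (h.mp_v i).quasiMeasurePreserving
    filter_upwards [mu.ae h.fm, mv.ae h.fm, mu.ae h.fL, mu.ae h.fr, mu.ae h.fu, mv.ae h.fu] with x a b c d e f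
    exact ⟨a, b, c, d, e, f⟩
  have h1' := ae_all_iff.2 h1
  have h2 : ∀ i k : Fin j, ∀ᵐ x ∂(Pm m j), i < k → XP m (1/3) (1/6) i k x < ⊤ := by
    intro i k
    by_cases hik : i < k
    · have := lintegral_XP h.toReg (a := 1/3) (b := 1/6) (by norm_num) (by norm_num) (by norm_num) i k hik
      have hC : hlsC (1/6) (1/3) + hlsC (1/3) (1/6) < ⊤ := ENNReal.add_lt_top.2
        ⟨hlsC_lt_top (by norm_num) (by norm_num) (by norm_num), hlsC_lt_top (by norm_num) (by norm_num) (by norm_num)⟩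
      filter_upwards [ae_lt_top (measurable_XP h.meas _ _ i k) (this.trans_lt hC).ne] with x hx _ using hx
    · exact ae_of_all _ fun x hx => absurd hx hik
  have h2' := ae_all_iff.2 fun i => ae_all_iff.2 (h2 i)
  filter_upwards [h1', h2'] with x hx hx2
  refine ⟨hx, fun i k hik h0 => ?_⟩
  have := hx2 i k hik
  have f1 : Fp (pF m (vP i x) ^ (-(1/3):ℝ)) := ((hx i).2.1.div (hx i).2.2.2.2.2).rpow _
  have f2 : Fp (pF m (uP k x) ^ (-(1/6):ℝ)) := ((hx k).1.div (hx k).2.2.2.2.1).rpow _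
  unfold XP rk at this
  rw [h0, abs_zero, ENNReal.ofReal_zero, ENNReal.zero_rpow_of_neg (by norm_num), ENNReal.top_mul (f1.mul f2).1] at this
  exact lt_irrefl _ this

theorem Good0.pFv {j : ℕ} {x : Pt n × (Fin j → ℝ × ℝ)} (g : Good0 m x) (i : Fin j) : Fp (pF m (vP i x)) :=
  (g.1 i).2.1.div (g.1 i).2.2.2.2.2
theorem Good0.pFu {j : ℕ} {x : Pt n × (Fin j → ℝ × ℝ)} (g : Good0 m x) (i : Fin j) : Fp (pF m (uP i x)) :=
  (g.1 i).1.div (g.1 i).2.2.2.2.1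

theorem Good0.XP {j : ℕ} {x : Pt n × (Fin j → ℝ × ℝ)} (g : Good0 m x) (a b : ℝ) {i k : Fin j} (hik : i < k) :
    Fp (XP m a b i k x) ∧ lg (XP m a b i k x) = - (a + b) * lg (ENNReal.ofReal |tv x i - tv x k|)
      - a * (lg (m (vP i x)) - lg (muF m (vP i x).1)) - b * (lg (m (uP k x)) - lg (muF m (uP k x).1)) := by
  have f0 : Fp (rk (a + b) (tv x i - tv x k)) := (Fp_dist (g.2 i k hik)).rpow _
  have f1 := (g.pFv i).rpow (-a)
  have f2 := (g.pFu k).rpow (-b)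
  refine ⟨f0.mul (f1.mul f2), ?_⟩
  unfold _root_.XP
  rw [lg_mul f0 (f1.mul f2), lg_mul f1 f2, lg_rk (g.2 i k hik), lg_rpow (g.pFv i), lg_rpow (g.pFu k)]
  have e1 : lg (pF m (vP i x)) = lg (m (vP i x)) - lg (muF m (vP i x).1) := lg_div (g.1 i).2.1 (g.1 i).2.2.2.2.2
  have e2 : lg (pF m (uP k x)) = lg (m (uP k x)) - lg (muF m (uP k x).1) := lg_div (g.1 k).1 (g.1 k).2.2.2.2.1
  rw [e1, e2]; ring

theorem Good0.Wt {j : ℕ} {x : Pt n × (Fin j → ℝ × ℝ)} (g : Good0 m x) :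
    Fp (Wt m x.1 x.2) ∧ lg (Wt m x.1 x.2) = ∑ l : Fin j, ((lg (m (uP l x)) - lg (muF m (uP l x).1)) +
      (lg (m (vP l x)) - lg (LF m (uP l x)))) := by
  have f : ∀ l ∈ (Finset.univ : Finset (Fin j)), Fp (kern m (pos x.1 x.2 l.1) (x.2 l)) ∧
      lg (kern m (pos x.1 x.2 l.1) (x.2 l)) = ((lg (m (uP l x)) - lg (muF m (uP l x).1)) +
      (lg (m (vP l x)) - lg (LF m (uP l x)))) := by
    intro l _
    have e : kern m (pos x.1 x.2 l.1) (x.2 l) = pF m (uP l x) * (m (vP l x) / LF m (uP l x)) := by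
      unfold kern vP uP; rw [pos_succ]
    have f2 := (g.1 l).2.1.div (g.1 l).2.2.1
    rw [e, lg_mul (g.pFu l) f2, lg_div (g.1 l).2.1 (g.1 l).2.2.1]
    have e2 : lg (pF m (uP l x)) = lg (m (uP l x)) - lg (muF m (uP l x).1) := lg_div (g.1 l).1 (g.1 l).2.2.2.2.1
    rw [e2]
    exact ⟨(g.pFu l).mul f2, rfl⟩
  refine ⟨Fp.prod fun l hl => (f l hl).1, ?_⟩
  unfold _root_.Wt
  rw [lg_prod fun l hl => (f l hl).1]
  exact Finset.sum_congr rfl fun l hl => (f l hl).2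

theorem Good0.X1 {x : Pt n × (Fin (n+1) → ℝ × ℝ)} (g : Good0 m x) (η0 : ℝ) :
    Fp (X1F m η0 x) ∧ lg (X1F m η0 x) =
  (lg (m (uP 0 x)) - lg (rhoF m (uP 0 x).2)) + (lg (m (vP (Fin.last n) x)) - lg (rhoF m (vP (Fin.last n) x).2))
   + (∑ i : Fin (n+1), ∑ k ∈ Finset.Ioi i, lg (ENNReal.ofReal |tv x i - tv x k|))
   + ((1/2) * lg (rhoF m (uP 0 x).2) + ∑ j : Fin n, (((η0 + 1/2)/n) * lg (rhoF m (uP j.succ x).2)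
      + -(1 - η0 / n) * lg (ENNReal.ofReal |tv x 0 - tv x j.succ|)))
   - (lg (muF m (uP 0 x).1) + ∑ l : Fin (n+1), ((lg (m (uP l x)) - lg (muF m (uP l x).1)) +
      (lg (m (vP l x)) - lg (LF m (uP l x))))) := by
  have fr : ∀ i, Fp (rhoF m (tv x i)) := fun i => (g.1 i).2.2.2.1
  have fV : Fp (VV n (tv x)) ∧ lg (VV n (tv x)) = ∑ i : Fin (n+1), ∑ k ∈ Finset.Ioi i, lg (ENNReal.ofReal |tv x i - tv x k|) := by
    have a : ∀ i : Fin (n+1), ∀ k ∈ Finset.Ioi i, Fp (ENNReal.ofReal |tv x i - tv x k|) := fun i k hk =>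
      Fp_dist (g.2 i k (Finset.mem_Ioi.1 hk))
    rw [VV_eq]
    refine ⟨Fp.prod fun i _ => Fp.prod fun k hk => a i k hk, ?_⟩
    rw [lg_prod fun i _ => Fp.prod fun k hk => a i k hk]
    exact Finset.sum_congr rfl fun i _ => lg_prod fun k hk => a i k hk
  have fR : Fp (RR n η0 (rhoF m) (tv x)) ∧ lg (RR n η0 (rhoF m) (tv x)) =
      (1/2) * lg (rhoF m (uP 0 x).2) + ∑ j : Fin n, (((η0 + 1/2)/n) * lg (rhoF m (uP j.succ x).2)
      + -(1 - η0 / n) * lg (ENNReal.ofReal |tv x 0 - tv x j.succ|)) := by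
    have b : ∀ j : Fin n, tv x 0 - tv x j.succ ≠ 0 := fun j => g.2 0 j.succ (Fin.succ_pos j)
    have a : ∀ j ∈ (Finset.univ : Finset (Fin n)), Fp (rhoF m (tv x j.succ) ^ ((η0 + 1/2) / n) * rk (1 - η0 / n) (tv x 0 - tv x j.succ)) :=
      fun j _ => ((fr _).rpow _).mul ((Fp_dist (b j)).rpow _)
    refine ⟨((fr 0).rpow _).mul (Fp.prod a), ?_⟩
    unfold RR
    rw [lg_mul ((fr 0).rpow _) (Fp.prod a), lg_rpow (fr 0), lg_prod a]
    congr 1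
    refine Finset.sum_congr rfl fun j hj => ?_
    have fk : Fp (rk (1 - η0 / n) (tv x 0 - tv x j.succ)) := (Fp_dist (b j)).rpow _
    rw [lg_mul ((fr _).rpow _) fk, lg_rpow (fr _), lg_rk (b j)]
    rfl
  have f0 := (g.1 0).1.div (fr 0)
  have f1 := (g.1 (Fin.last n)).2.1.div (fr (Fin.last n))
  have fu : Fp (muF m x.1) ∧ lg (muF m x.1) = lg (muF m (uP 0 x).1) := by
    have := (g.1 0).2.2.2.2.1
    have e : (uP 0 x).1 = x.1 := by simp [uP, pos_zero]
    rw [e] at this ⊢; exact ⟨this, rfl⟩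
  have fQ : Fp (QQ m η0 x) := ((f0.mul f1).mul fV.1).mul fR.1
  refine ⟨fQ.div (fu.1.mul g.Wt.1), ?_⟩
  unfold X1F
  rw [lg_div fQ (fu.1.mul g.Wt.1), lg_mul fu.1 g.Wt.1, g.Wt.2, fu.2]
  congr 1
  unfold QQ
  rw [lg_mul ((f0.mul f1).mul fV.1) fR.1, fR.2, lg_mul (f0.mul f1) fV.1, fV.2, lg_mul f0 f1,
    lg_div (g.1 0).1 (fr 0), lg_div (g.1 (Fin.last n)).2.1 (fr (Fin.last n))]
  rfl

theorem LI.core (h : LI m) (hn : 2 ≤ n) {η0 : ℝ} (h0 : 0 < η0) (h1 : η0 ≤ 1/2) (e : Bool)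
    {i k : Fin (n+1)} (hik : i < k) {δ : ℝ} (hδ : 0 < δ) :
    ((n+1) * ∫ u, lg (LF m u) ∂(nu m) + (n*(n+1)/2 + η0) * ∫ u, lg (muF m u.1) ∂(nu m)
      - (n + (n*(n+1)/2 + η0)) * ∫ u, lg (m u) ∂(nu m) - (1 - η0) * ∫ u, lg (rhoF m u.2) ∂(nu m))
    + wt n η0 i * Real.log (1/δ) * ((Pm m (n+1)) {x | XP m (ea e) (ea (!e)) i k x < ENNReal.ofReal δ}).toReal
    ≤ coreC n η0 := by
  have HL := h.Lam_HE hn η0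
  rw [← HL.2]
  have := h.prob_Pm (n+1)
  have hg := h.ae_good0 (n+1)
  have hn0 : (0:ℝ) < n := by
    have : 0 < n := by omega
    exact_mod_cast this
  have hea : ∀ e, hlsC (ea (!e)) (ea e) + hlsC (ea e) (ea (!e)) < ⊤ := fun e => ENNReal.add_lt_top.2
    ⟨hlsC_lt_top (ea_pos _) (ea_pos _) (by linarith [ea_sum e]), hlsC_lt_top (ea_pos _) (ea_pos _) (by linarith [ea_sum e])⟩
  refine pin (Pm m (n+1)) (X1F m η0) (fun q : Bool × (Σ _ : Fin (n+1), Fin (n+1)) => XP m (ea q.1) (ea (!q.1)) q.2.1 q.2.2)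
    ((Finset.univ : Finset Bool) ×ˢ (Finset.univ.sigma fun i : Fin (n+1) => Finset.Ioi i))
    (fun q => wt n η0 q.2.1) ?_ _ HL.1 (measurable_X1F h.meas η0).aemeasurable (fun q _ => measurable_XP h.meas _ _ _ _)
    (hg.mono fun x hx => (hx.X1 η0).1) ?_ ?_ (1 + starK n η0 ^ (2*n))
    (fun q => hlsC (ea (!q.1)) (ea q.1) + hlsC (ea q.1) (ea (!q.1))) ?_ (fun q _ => (hea q.1).ne)
    (lintegral_X1F h.toReg hn h0 h1) ?_ (e, ⟨i, k⟩) ?_ hδ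
  · intro q _
    unfold wt; split_ifs <;> positivity
  · intro q hq
    have hq' : q.2.1 < q.2.2 := by simpa using hq
    exact hg.mono fun x hx => (hx.XP _ _ hq').1
  · filter_upwards [hg] with x hx
    rw [(hx.X1 η0).2, Finset.sum_product, Finset.sum_comm, Finset.sum_sigma]
    have e1 : ∀ i : Fin (n+1), ∀ k ∈ Finset.Ioi i, ∑ e : Bool, wt n η0 i * lg (XP m (ea e) (ea (!e)) i k x) =
        - (wt n η0 i * lg (ENNReal.ofReal |tv x i - tv x k|)) - (1/2) * (wt n η0 i *
      ((lg (m (vP i x)) - lg (muF m (vP i x).1)) + (lg (m (uP k x)) - lg (muF m (uP k x).1)))) := by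
      intro i k hk
      have hk := Finset.mem_Ioi.1 hk
      simp only [Fintype.sum_bool, (hx.XP _ _ hk).2, ea]
      norm_num
      ring
    have e2 := Finset.sum_congr (rfl : (Finset.univ : Finset (Fin (n+1))) = Finset.univ) (fun i _ => Finset.sum_congr rfl (e1 i))
    have e3 : ∑ i : Fin (n+1), ∑ k ∈ Finset.Ioi i, wt n η0 i * lg (ENNReal.ofReal |tv x i - tv x k|) =
        ∑ i : Fin (n+1), ∑ k ∈ Finset.Ioi i, lg (ENNReal.ofReal |tv x i - tv x k|)
        + ∑ j : Fin n, -(1 - η0 / n) * lg (ENNReal.ofReal |tv x 0 - tv x j.succ|) := by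
      rw [Fin.sum_univ_succ, Fin.sum_univ_succ (fun i => ∑ k ∈ Finset.Ioi i, lg (ENNReal.ofReal |tv x i - tv x k|))]
      simp only [Fin.sum_Ioi_zero, wt, if_true, Fin.succ_ne_zero, if_false, one_mul, ← Finset.mul_sum]
      ring
    refine Eq.trans ?_ (congrArg₂ (· + ·) rfl e2.symm)
    simp only [← Finset.mul_sum] at e3
    unfold Lam
    simp only [Finset.sum_sub_distrib, Finset.sum_neg_distrib, ← Finset.mul_sum, Finset.sum_add_distrib]
    linear_combination e3
  · exact ENNReal.add_ne_top.2 ⟨by simp, ENNReal.pow_ne_top (starK_lt_top hn h0 h1).ne⟩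
  · intro q hq
    have hq' : q.2.1 < q.2.2 := by simpa using hq
    exact lintegral_XP h.toReg (ea_pos _) (ea_pos _) (by linarith [ea_sum q.1]) _ _ hq'
  · simpa using hik
end core

section total
variable {n : ℕ} {m : Pt n × ℝ → ℝ≥0∞}

def XI (m : Pt n × ℝ → ℝ≥0∞) (u : Pt n × ℝ) : ℝ≥0∞ := rhoF m u.2 * muF m u.1 / m u
def XZ (m : Pt n × ℝ → ℝ≥0∞) (F : Pt n → ℝ≥0∞) (u : Pt n × ℝ) : ℝ≥0∞ := F u.1 / muF m u.1

theorem measurable_XI (hm : Measurable m) : Measurable (XI m) := by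
  have := measurable_rhoF hm
  have := measurable_muF hm
  unfold XI; fun_prop
theorem measurable_XZ (hm : Measurable m) {F : Pt n → ℝ≥0∞} (hF : Measurable F) : Measurable (XZ m F) := by
  have := measurable_muF hm
  unfold XZ; fun_prop

theorem Reg.lintegral_XI (h : Reg m) : ∫⁻ u, XI m u ∂(nu m) ≤ 1 := by
  have hm := h.meas
  have hr := measurable_rhoF hm
  have hu := measurable_muF hm
  rw [lintegral_nu hm _ (measurable_XI hm)]
  calc _ ≤ ∫⁻ z, ∫⁻ t, rhoF m t * muF m z := by
        refine lintegral_mono fun z => lintegral_mono fun t => ?_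
        exact ENNReal.mul_div_le
    _ = 1 := by
        simp_rw [lintegral_mul_const _ hr, lintegral_rho h, one_mul]
        exact h.mass

theorem Reg.lintegral_XZ (h : Reg m) {F : Pt n → ℝ≥0∞} (hF : Measurable F) (h1 : ∫⁻ z, F z ≤ 1) :
    ∫⁻ u, XZ m F u ∂(nu m) ≤ 1 := by
  have hm := h.meas
  have hu := measurable_muF hm
  rw [lintegral_nu hm _ (measurable_XZ hm hF)]
  refine le_trans (lintegral_mono fun z => ?_) h1
  simp only [XZ]
  rw [lintegral_mul_const _ (by fun_prop)]
  exact ENNReal.mul_div_le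

def totE (η : ℝ) : ℝ := min η 1 / 2
theorem totE_pos {η : ℝ} (h : 0 < η) : 0 < totE η := by unfold totE; positivity
theorem totE_le (η : ℝ) : totE η ≤ 1/2 := by unfold totE; linarith [min_le_right η 1]
theorem totE_lt {η : ℝ} (h : 0 < η) : totE η < η := by unfold totE; linarith [min_le_left η 1]
def totC (n : ℕ) (η : ℝ) : ℝ := coreC n (totE η) + 2 * (η - totE η) + 2 * (n*(n+1)/2 + η)

theorem wt_pos (hn : 2 ≤ n) {η0 : ℝ} (h : 0 < η0) (i : Fin (n+1)) : 0 < wt n η0 i := by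
  have hn0 : (0:ℝ) < n := by
    have : 0 < n := by omega
    exact_mod_cast this
  unfold wt; split_ifs <;> positivity

theorem LI.total (h : LI m) (hn : 2 ≤ n) {η : ℝ} (hη : 0 < η) {F : Pt n → ℝ≥0∞} (hF : Measurable F)
    (hF1 : ∫⁻ z, F z ≤ 1) (fF : ∀ᵐ u ∂(nu m), Fp (F u.1)) (IF : Integrable (fun u => lg (F u.1)) (nu m))
    (e : Bool) {i k : Fin (n+1)} (hik : i < k) {δ : ℝ} (hδ : 0 < δ) :
    ((n+1) * ∫ u, lg (LF m u) ∂(nu m) - (n + (n*(n+1)/2 + η)) * ∫ u, lg (m u) ∂(nu m)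
      - (1 - η) * ∫ u, lg (rhoF m u.2) ∂(nu m) + (n*(n+1)/2 + η) * ∫ u, lg (F u.1) ∂(nu m))
    + wt n (totE η) i * (Real.log (1/δ) * ((Pm m (n+1)) {x | XP m (ea e) (ea (!e)) i k x < ENNReal.ofReal δ}).toReal)
    + (η - totE η) * (Real.log (1/δ) * ((nu m) {u | XI m u < ENNReal.ofReal δ}).toReal)
    + (n*(n+1)/2 + η) * (Real.log (1/δ) * ((nu m) {u | XZ m F u < ENNReal.ofReal δ}).toReal)
    ≤ totC n η := by
  have := h.prob_nu
  have h1 := h.core hn (totE_pos hη) (totE_le η) e hik hδ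
  have Hm : HE (nu m) (fun u => lg (m u)) _ := ⟨h.Im, rfl⟩
  have HF : HE (nu m) (fun u => lg (F u.1)) _ := ⟨IF, rfl⟩
  have Hr : HE (nu m) (fun u => lg (rhoF m u.2)) _ := ⟨h.Ir, rfl⟩
  have Hu : HE (nu m) (fun u => lg (muF m u.1)) _ := ⟨h.Iu, rfl⟩
  have HI := (Hr.add Hu).sub Hm
  have HZ := HF.sub Hu
  have h2 := pin1 (nu m) (XI m) (measurable_XI h.meas) (by
    filter_upwards [h.fm, h.fr, h.fu] with u a b c using (b.mul c).div a) _ HI.1 (by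
    filter_upwards [h.fm, h.fr, h.fu] with u a b c
    unfold XI; rw [lg_div (b.mul c) a, lg_mul b c]) h.lintegral_XI hδ
  have h3 := pin1 (nu m) (XZ m F) (measurable_XZ h.meas hF) (by
    filter_upwards [fF, h.fu] with u a b using a.div b) _ HZ.1 (by
    filter_upwards [fF, h.fu] with u a b
    unfold XZ; rw [lg_div a b]) (h.lintegral_XZ hF hF1) hδ
  rw [HI.2] at h2
  rw [HZ.2] at h3
  have h2' := mul_le_mul_of_nonneg_left h2 (sub_nonneg.2 (totE_lt hη).le)
  have h3' := mul_le_mul_of_nonneg_left h3 (show 0 ≤ (n*(n+1)/2 + η : ℝ) by positivity)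
  unfold totC
  nlinarith [h1, h2', h3']
end total

/-! upper bound of the log of μ -/
theorem mul_abs_lg_le (x : ℝ≥0∞) (hx : x ≠ ⊤) : x * ENNReal.ofReal |lg x| ≤ 1 + x * x := by
  lift x to NNReal using hx
  rcases eq_or_ne x 0 with rfl | h0
  · simp
  have hx : (0:ℝ) < x := by positivity
  have e : (x:ℝ≥0∞) = ENNReal.ofReal x := by simp
  have h1 : (x:ℝ) * |Real.log x| ≤ 1 + x * x := by
    have a1 := Real.log_le_sub_one_of_pos hx
    have a2 := Real.log_le_sub_one_of_pos (inv_pos.2 hx)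
    rw [Real.log_inv] at a2
    rcases abs_cases (Real.log x) with ⟨h, _⟩ | ⟨h, _⟩
    · rw [h]; nlinarith
    · rw [h]
      have : (x:ℝ) * (-Real.log x) ≤ x * ((x:ℝ)⁻¹ - 1) := mul_le_mul_of_nonneg_left a2 hx.le
      rw [mul_sub, mul_inv_cancel₀ hx.ne'] at this
      nlinarith
  rw [e, show lg (ENNReal.ofReal x) = Real.log x by simp [lg], ← ENNReal.ofReal_mul hx.le, ← ENNReal.ofReal_mul hx.le,
    ← ENNReal.ofReal_one, ← ENNReal.ofReal_add (by norm_num) (by positivity)]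
  exact ENNReal.ofReal_le_ofReal h1

theorem lg_bdd {c C x : ℝ≥0∞} (hc : c ≠ 0) (hC : C ≠ ⊤) (h1 : c ≤ x) (h2 : x ≤ C) :
    Fp x ∧ |lg x| ≤ |lg c| + |lg C| := by
  have fx : Fp x := ⟨fun h => hc (le_zero_iff.1 (h ▸ h1)), ne_top_of_le_ne_top hC h2⟩
  have fc : Fp c := ⟨hc, ne_top_of_le_ne_top fx.2 h1⟩
  refine ⟨fx, ?_⟩
  have a := lg_mono fc fx.2 h1
  have b := lg_mono fx hC h2
  rw [abs_le]
  constructor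
  · linarith [neg_abs_le (lg c), abs_nonneg (lg C)]
  · linarith [le_abs_self (lg C), abs_nonneg (lg c)]

section nice
variable {n : ℕ} {m : Pt n × ℝ → ℝ≥0∞}

theorem LI.of_nice (hm : Measurable m) (mass : ∫⁻ z, muF m z = 1) {c C : ℝ≥0∞} (hc : c ≠ 0) (hC : C ≠ ⊤)
    {S : Set (Pt n)} (hS : MeasurableSet S) (hSv : volume S ≠ ⊤) (hmS : ∀ u, m u ≠ 0 → u.1 ∈ S)
    (hmu : ∀ z, muF m z ≤ C)
    (hb : ∀ u, m u ≠ 0 → (c ≤ m u ∧ m u ≤ C) ∧ (c ≤ LF m u ∧ LF m u ≤ C) ∧ (c ≤ rhoF m u.2 ∧ rhoF m u.2 ≤ C)) :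
    LI m := by
  have R : Reg m := ⟨hm, mass, fun z => ne_top_of_le_ne_top hC (hmu z),
    fun u hu h0 => hc (le_zero_iff.1 (h0 ▸ (hb u hu).2.1.1)), fun u hu => ne_top_of_le_ne_top hC (hb u hu).2.1.2⟩
  have := R.prob_nu
  have hne : ∀ᵐ u ∂(nu m), m u ≠ 0 := by
    have h1 : MeasurableSet {u | m u ≠ 0} := (hm (measurableSet_singleton 0)).compl
    unfold nu
    rw [ae_withDensity_iff hm]
    exact ae_of_all _ fun u hu => hu
  have hL := measurable_LF hm
  have hr := measurable_rhoF hm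
  have hu := measurable_muF hm
  have bd : ∀ g : Pt n × ℝ → ℝ≥0∞, Measurable g → (∀ u, m u ≠ 0 → c ≤ g u ∧ g u ≤ C) →
      (∀ᵐ u ∂(nu m), Fp (g u)) ∧ Integrable (fun u => lg (g u)) (nu m) := by
    intro g hg hgb
    refine ⟨hne.mono fun u hu => (lg_bdd hc hC (hgb u hu).1 (hgb u hu).2).1, ?_⟩
    refine Integrable.of_bound (measurable_lg.comp hg).aestronglyMeasurable (|lg c| + |lg C|) ?_
    filter_upwards [hne] with u hu
    exact (lg_bdd hc hC (hgb u hu).1 (hgb u hu).2).2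
  have b1 := bd m hm fun u hu => (hb u hu).1
  have b2 := bd (LF m) hL fun u hu => (hb u hu).2.1
  have b3 := bd (fun u => rhoF m u.2) (by fun_prop) fun u hu => (hb u hu).2.2
  have b4 : ∀ᵐ u ∂(nu m), Fp (muF m u.1) := by
    have h0 : ∀ᵐ u ∂(nu m), muF m u.1 ≠ 0 := by
      rw [ae_iff]
      simp only [not_not]
      have hs : MeasurableSet {u : Pt n × ℝ | muF m u.1 = 0} :=
        (hu.comp measurable_fst) (measurableSet_singleton 0)
      rw [← lintegral_indicator_one hs, lintegral_nu hm _ (measurable_one.indicator hs)]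
      have : ∀ z, ∫⁻ t, m (z, t) * {u : Pt n × ℝ | muF m u.1 = 0}.indicator 1 (z, t) = 0 := by
        intro z
        by_cases hz : muF m z = 0
        · refine le_antisymm ?_ zero_le
          calc _ ≤ ∫⁻ t, m (z, t) := by
                gcongr with t
                exact mul_le_of_le_one_right zero_le (indicator_le_self' (fun _ _ => zero_le) _ |>.trans (by simp))
            _ = 0 := hz
        · simp [indicator, hz]
      simp [this]
    exact h0.mono fun u hu => ⟨hu, R.mutop _⟩
  refine ⟨R, b1.1, b2.1, b3.1, b4, b1.2, b2.2, b3.2, ?_⟩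
  refine ⟨(measurable_lg.comp (hu.comp measurable_fst)).aestronglyMeasurable, ?_⟩
  rw [hasFiniteIntegral_iff_norm]
  have hmeas : Measurable (fun u : Pt n × ℝ => ENNReal.ofReal ‖lg (muF m u.1)‖) := by fun_prop
  rw [lintegral_nu hm _ hmeas]
  calc _ ≤ ∫⁻ z, S.indicator (fun _ => 1 + C * C) z := by
        refine lintegral_mono fun z => ?_
        simp only [Real.norm_eq_abs]
        rw [lintegral_mul_const _ (by fun_prop)]
        by_cases hz : z ∈ S
        · rw [indicator_of_mem hz]
          refine (mul_abs_lg_le _ (R.mutop z)).trans ?_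
          gcongr <;> exact hmu z
        · have : ∫⁻ t, m (z, t) = 0 := by
            have : ∀ t, m (z, t) = 0 := fun t => by
              by_contra h; exact hz (hmS _ h)
            simp [this]
          rw [this]; simp
    _ = (1 + C * C) * volume S := lintegral_indicator_const hS _
    _ < ⊤ := ENNReal.mul_lt_top (ENNReal.add_lt_top.2 ⟨by simp, ENNReal.mul_lt_top hC.lt_top hC.lt_top⟩) hSv.lt_top
end nice

section app
variable {n : ℕ}

def hX (f : Pt n → ℝ≥0∞) (u : Pt n × ℝ) : ℝ≥0∞ := ∫⁻ σ : ℝ, f (u.1 + stp n (u.2, σ))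

theorem measurable_hX {f : Pt n → ℝ≥0∞} (hf : Measurable f) : Measurable (hX f) :=
  Measurable.lintegral_prod_right' (f := fun x : (Pt n × ℝ) × ℝ => f (x.1.1 + stp n (x.1.2, x.2))) (by fun_prop)

theorem hX_shift (f : Pt n → ℝ≥0∞) (z : Pt n) (t σ : ℝ) : hX f (z + stp n (t, σ), t) = hX f (z, t) := by
  simp only [hX, add_assoc, ← stp_add]
  exact lintegral_add_left_eq_self (fun x => f (z + stp n (t, x))) σ

def Scut (f : Pt n → ℝ≥0∞) (j : ℕ) : Set (Pt n × ℝ) := {u | (j:ℝ≥0∞)⁻¹ ≤ hX f u ∧ |u.2| ≤ j}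
theorem measurableSet_Scut {f : Pt n → ℝ≥0∞} (hf : Measurable f) (j : ℕ) : MeasurableSet (Scut f j) := by
  have := measurable_hX hf
  exact (measurableSet_le measurable_const this).inter (measurableSet_le (f := fun u : Pt n × ℝ => |u.2|) (by fun_prop) measurable_const)

theorem Scut_shift (f : Pt n → ℝ≥0∞) (j : ℕ) (z : Pt n) (t σ : ℝ) :
    (z + stp n (t, σ), t) ∈ Scut f j ↔ (z, t) ∈ Scut f j := by
  simp only [Scut, mem_ofPred_eq, hX_shift]

def hj (f : Pt n → ℝ≥0∞) (r : ℝ) (j : ℕ) : Pt n × ℝ → ℝ≥0∞ := (Scut f j).indicator (fun u => hX f u ^ (r-1))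
theorem measurable_hj {f : Pt n → ℝ≥0∞} (hf : Measurable f) (r : ℝ) (j : ℕ) : Measurable (hj f r j) := by
  have := measurable_hX hf
  exact Measurable.indicator (by fun_prop) (measurableSet_Scut hf j)
theorem hj_shift (f : Pt n → ℝ≥0∞) (r : ℝ) (j : ℕ) (z : Pt n) (t σ : ℝ) :
    hj f r j (z + stp n (t, σ), t) = hj f r j (z, t) := by
  by_cases h : (z, t) ∈ Scut f j
  · rw [hj, indicator_of_mem h, indicator_of_mem ((Scut_shift f j z t σ).2 h), hX_shift]
  · rw [hj, indicator_of_notMem h, indicator_of_notMem (fun h' => h ((Scut_shift f j z t σ).1 h'))]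

def Nj (f : Pt n → ℝ≥0∞) (r : ℝ) (j : ℕ) (t : ℝ) : ℝ≥0∞ := ∫⁻ z, f z * hj f r j (z, t)
theorem measurable_Nj {f : Pt n → ℝ≥0∞} (hf : Measurable f) (r : ℝ) (j : ℕ) : Measurable (Nj f r j) := by
  have := measurable_hj hf r j
  exact Measurable.lintegral_prod_left' (f := fun x : Pt n × ℝ => f x.1 * hj f r j x) (by fun_prop)
def Tcut (f : Pt n → ℝ≥0∞) (r : ℝ) (j : ℕ) : Set ℝ := {t | (j:ℝ≥0∞)⁻¹ ≤ Nj f r j t}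
theorem measurableSet_Tcut {f : Pt n → ℝ≥0∞} (hf : Measurable f) (r : ℝ) (j : ℕ) : MeasurableSet (Tcut f r j) :=
  measurableSet_le measurable_const (measurable_Nj hf r j)
def NT (f : Pt n → ℝ≥0∞) (r : ℝ) (j : ℕ) (e : ℝ) : ℝ → ℝ≥0∞ := (Tcut f r j).indicator (fun t => Nj f r j t ^ e)
theorem measurable_NT {f : Pt n → ℝ≥0∞} (hf : Measurable f) (r : ℝ) (j : ℕ) (e : ℝ) : Measurable (NT f r j e) := by
  have := measurable_Nj hf r j
  exact Measurable.indicator (by fun_prop) (measurableSet_Tcut hf r j)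
def Mj (f : Pt n → ℝ≥0∞) (r e : ℝ) (j : ℕ) : ℝ≥0∞ := ∫⁻ t, NT f r j e t
def mj (f : Pt n → ℝ≥0∞) (r e : ℝ) (j : ℕ) (u : Pt n × ℝ) : ℝ≥0∞ :=
  f u.1 * hj f r j u * (NT f r j (e-1) u.2 * (Mj f r e j)⁻¹)
theorem measurable_mj {f : Pt n → ℝ≥0∞} (hf : Measurable f) (r e : ℝ) (j : ℕ) : Measurable (mj f r e j) := by
  have := measurable_hj hf r j
  have := measurable_NT hf r j (e-1)
  unfold mj; fun_prop

theorem LF_mj {f : Pt n → ℝ≥0∞} (hf : Measurable f) (r e : ℝ) (j : ℕ) (u : Pt n × ℝ) :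
    LF (mj f r e j) u = hX f u * hj f r j u * (NT f r j (e-1) u.2 * (Mj f r e j)⁻¹) := by
  obtain ⟨z, t⟩ := u
  simp only [LF, mj, hj_shift]
  rw [lintegral_mul_const _ (by fun_prop), lintegral_mul_const _ (by fun_prop)]
  rfl
theorem rhoF_mj {f : Pt n → ℝ≥0∞} (hf : Measurable f) (r e : ℝ) (j : ℕ) (t : ℝ) :
    rhoF (mj f r e j) t = Nj f r j t * (NT f r j (e-1) t * (Mj f r e j)⁻¹) := by
  have := measurable_hj hf r j
  simp only [rhoF, mj]
  rw [lintegral_mul_const _ (by fun_prop)]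
  rfl

structure Nice (f : Pt n → ℝ≥0∞) (c C : ℝ≥0∞) (R : ℝ) : Prop where
  meas : Measurable f
  c0 : c ≠ 0
  Ct : C ≠ ⊤
  bd : ∀ z, f z ≠ 0 → c ≤ f z ∧ f z ≤ C ∧ ‖z‖ ≤ R

variable {f : Pt n → ℝ≥0∞} {c C : ℝ≥0∞} {R : ℝ}

theorem Nice.le (h : Nice f c C R) (z : Pt n) : f z ≤ C := by
  by_cases h0 : f z = 0
  · simp [h0]
  · exact (h.bd z h0).2.1

theorem Nice.hX_le (h : Nice f c C R) (u : Pt n × ℝ) : hX f u ≤ C * ENNReal.ofReal (2*R) := by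
  calc hX f u ≤ ∫⁻ σ, (Icc (-R - u.1.1) (R - u.1.1)).indicator (fun _ => C) σ := by
        refine lintegral_mono fun σ => ?_
        by_cases h0 : f (u.1 + stp n (u.2, σ)) = 0
        · simp [h0]
        · have := (h.bd _ h0)
          rw [indicator_of_mem]
          · exact this.2.1
          · have h2 := (norm_fst_le _).trans this.2.2
            simp only [stp, ev, Prod.fst_add, Prod.smul_fst, smul_eq_mul, mul_one, Real.norm_eq_abs] at h2
            rw [abs_le] at h2
            constructor <;> linarith
    _ = C * ENNReal.ofReal (2*R) := by
        rw [lintegral_indicator_const measurableSet_Icc, Real.volume_Icc]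
        congr 2; ring

theorem Nice.hX_top (h : Nice f c C R) (u : Pt n × ℝ) : hX f u ≠ ⊤ :=
  ne_top_of_le_ne_top (ENNReal.mul_ne_top h.Ct ENNReal.ofReal_ne_top) (h.hX_le u)

theorem Nice.Nj_le (h : Nice f c C R) {r : ℝ} (hr : 1 ≤ r) (j : ℕ) (t : ℝ) :
    Nj f r j t ≤ C * (C * ENNReal.ofReal (2*R)) ^ (r-1) * volume (Metric.closedBall (0:Pt n) R) := by
  rw [← lintegral_indicator_const measurableSet_closedBall]
  refine lintegral_mono fun z => ?_
  by_cases h0 : f z = 0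
  · simp [h0]
  rw [indicator_of_mem (by simpa using (h.bd z h0).2.2)]
  refine mul_le_mul' (h.le z) ?_
  refine (indicator_le_self' (fun _ _ => zero_le) _).trans ?_
  exact ENNReal.rpow_le_rpow (h.hX_le _) (by linarith)

theorem Nice.Nj_top (h : Nice f c C R) {r : ℝ} (hr : 1 ≤ r) (j : ℕ) (t : ℝ) : Nj f r j t ≠ ⊤ := by
  refine ne_top_of_le_ne_top ?_ (h.Nj_le hr j t)
  refine ENNReal.mul_ne_top (ENNReal.mul_ne_top h.Ct ?_) measure_closedBall_lt_top.ne
  exact ENNReal.rpow_ne_top_of_nonneg (by linarith) (ENNReal.mul_ne_top h.Ct ENNReal.ofReal_ne_top)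

theorem Tcut_abs {r : ℝ} {j : ℕ} {t : ℝ} (ht : t ∈ Tcut f r j) : |t| ≤ j := by
  by_contra h
  have : Nj f r j t = 0 := by
    have : ∀ z, hj f r j (z, t) = 0 := fun z => indicator_of_notMem (fun hs => h hs.2) _
    simp [Nj, this]
  simp only [Tcut, mem_ofPred_eq, this, nonpos_iff_eq_zero, ENNReal.inv_eq_zero] at ht
  simp at ht

theorem Tcut_N0 {r : ℝ} {j : ℕ} {t : ℝ} (ht : t ∈ Tcut f r j) : Nj f r j t ≠ 0 := by
  intro h
  simp only [Tcut, mem_ofPred_eq, h, nonpos_iff_eq_zero, ENNReal.inv_eq_zero] at ht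
  simp at ht

theorem Nice.N_mul (h : Nice f c C R) {r : ℝ} (hr : 1 ≤ r) (j : ℕ) (e : ℝ) (t : ℝ) :
    Nj f r j t * NT f r j (e-1) t = NT f r j e t := by
  unfold NT
  by_cases ht : t ∈ Tcut f r j
  · rw [indicator_of_mem ht, indicator_of_mem ht]
    nth_rewrite 1 [← ENNReal.rpow_one (Nj f r j t)]
    rw [← ENNReal.rpow_add _ _ (Tcut_N0 ht) (h.Nj_top hr j t)]
    congr 1; ring
  · simp [ht]

theorem rpow_between {a b : ℝ≥0∞} (ha : a ≠ 0) (hb : b ≠ ⊤) (e : ℝ) :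
    ∃ a' b' : ℝ≥0∞, a' ≠ 0 ∧ b' ≠ ⊤ ∧ ∀ x, a ≤ x → x ≤ b → a' ≤ x ^ e ∧ x ^ e ≤ b' := by
  by_cases hab : a ≤ b
  swap
  · exact ⟨1, 1, by simp, by simp, fun x h1 h2 => absurd (h1.trans h2) hab⟩
  have at' : a ≠ ⊤ := ne_top_of_le_ne_top hb hab
  have b0 : b ≠ 0 := fun h => ha (le_zero_iff.1 (h ▸ hab))
  have fa := ENNReal.rpow_ne_top_of_ne_zero (y := e) ha at'
  have fb := ENNReal.rpow_ne_top_of_ne_zero (y := e) b0 hb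
  have za := (ENNReal.rpow_pos (p := e) (pos_iff_ne_zero.2 ha) at').ne'
  have zb := (ENNReal.rpow_pos (p := e) (pos_iff_ne_zero.2 b0) hb).ne'
  rcases le_total 0 e with he | he
  · exact ⟨a^e, b^e, za, fb, fun x h1 h2 => ⟨ENNReal.rpow_le_rpow h1 he, ENNReal.rpow_le_rpow h2 he⟩⟩
  · refine ⟨b^e, a^e, zb, fa, fun x h1 h2 => ⟨?_, ?_⟩⟩
    · rw [← neg_neg e, ENNReal.rpow_neg, ENNReal.rpow_neg x, ENNReal.inv_le_inv]
      exact ENNReal.rpow_le_rpow h2 (by linarith)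
    · rw [← neg_neg e, ENNReal.rpow_neg, ENNReal.rpow_neg a, ENNReal.inv_le_inv]
      exact ENNReal.rpow_le_rpow h1 (by linarith)

theorem mj_ne {r e : ℝ} {j : ℕ} {u : Pt n × ℝ} (hu : mj f r e j u ≠ 0) :
    f u.1 ≠ 0 ∧ u ∈ Scut f j ∧ u.2 ∈ Tcut f r j := by
  simp only [mj, mul_ne_zero_iff] at hu
  exact ⟨hu.1.1, mem_of_indicator_ne_zero hu.1.2, mem_of_indicator_ne_zero hu.2.1⟩

theorem Nice.mass (h : Nice f c C R) {r e : ℝ} (hr : 1 ≤ r) (j : ℕ) (M0 : Mj f r e j ≠ 0) (Mt : Mj f r e j ≠ ⊤) :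
    ∫⁻ z, muF (mj f r e j) z = 1 := by
  have hm := measurable_mj h.meas r e j
  have h1 : ∫⁻ z, muF (mj f r e j) z = ∫⁻ t, rhoF (mj f r e j) t := by
    unfold muF rhoF
    exact lintegral_lintegral_swap (f := fun z t => mj f r e j (z, t)) hm.aemeasurable
  rw [h1]
  simp only [rhoF_mj h.meas, ← mul_assoc, h.N_mul hr]
  rw [lintegral_mul_const _ (measurable_NT h.meas r j e)]
  exact ENNReal.mul_inv_cancel M0 Mt

theorem Nice.NT_bd (h : Nice f c C R) {r : ℝ} (hr : 1 ≤ r) (j : ℕ) (e : ℝ) :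
    ∃ a b : ℝ≥0∞, a ≠ 0 ∧ b ≠ ⊤ ∧ ∀ t ∈ Tcut f r j, a ≤ Nj f r j t ^ e ∧ Nj f r j t ^ e ≤ b := by
  have hb : C * (C * ENNReal.ofReal (2*R)) ^ (r-1) * volume (Metric.closedBall (0:Pt n) R) ≠ ⊤ := by
    refine ENNReal.mul_ne_top (ENNReal.mul_ne_top h.Ct ?_) measure_closedBall_lt_top.ne
    exact ENNReal.rpow_ne_top_of_nonneg (by linarith) (ENNReal.mul_ne_top h.Ct ENNReal.ofReal_ne_top)
  obtain ⟨a, b, h1, h2, h3⟩ := rpow_between (a := (j:ℝ≥0∞)⁻¹) (by simp) hb e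
  exact ⟨a, b, h1, h2, fun t ht => h3 _ ht (h.Nj_le hr j t)⟩

theorem Nice.hX_bd (h : Nice f c C R) (j : ℕ) (e : ℝ) :
    ∃ a b : ℝ≥0∞, a ≠ 0 ∧ b ≠ ⊤ ∧ ∀ u ∈ Scut f j, a ≤ hX f u ^ e ∧ hX f u ^ e ≤ b := by
  obtain ⟨a, b, h1, h2, h3⟩ := rpow_between (a := (j:ℝ≥0∞)⁻¹) (by simp)
    (ENNReal.mul_ne_top h.Ct (ENNReal.ofReal_ne_top (r := 2*R))) e
  exact ⟨a, b, h1, h2, fun u hu => h3 _ hu.1 (h.hX_le u)⟩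

theorem Nice.Mj_top (h : Nice f c C R) {r e : ℝ} (hr : 1 ≤ r) (j : ℕ) : Mj f r e j ≠ ⊤ := by
  obtain ⟨a, b, h1, h2, h3⟩ := h.NT_bd hr j e
  refine ne_top_of_le_ne_top (b := b * volume (Icc (-(j:ℝ)) j)) (ENNReal.mul_ne_top h2 (by simp)) ?_
  rw [← lintegral_indicator_const measurableSet_Icc]
  refine lintegral_mono fun t => ?_
  by_cases ht : t ∈ Tcut f r j
  · rw [NT, indicator_of_mem ht, indicator_of_mem (show t ∈ Icc (-(j:ℝ)) j from abs_le.1 (Tcut_abs ht))]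
    exact (h3 t ht).2
  · simp [NT, ht]

theorem Nice.LI (h : Nice f c C R) {r e : ℝ} (hr : 1 ≤ r) (j : ℕ) (M0 : Mj f r e j ≠ 0) : LI (mj f r e j) := by
  have Mt := h.Mj_top (e := e) hr j
  have hm := measurable_mj h.meas r e j
  obtain ⟨a1, b1, a10, b1t, k1⟩ := h.NT_bd hr j (e-1)
  obtain ⟨a2, b2, a20, b2t, k2⟩ := h.NT_bd hr j 1
  obtain ⟨a3, b3, a30, b3t, k3⟩ := h.hX_bd j (r-1)
  obtain ⟨a4, b4, a40, b4t, k4⟩ := h.hX_bd j 1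
  simp only [ENNReal.rpow_one] at k2 k4
  set I := (Mj f r e j)⁻¹ with hI
  have I0 : I ≠ 0 := ENNReal.inv_ne_zero.2 Mt
  have It : I ≠ ⊤ := ENNReal.inv_ne_top.2 M0
  set ca := min (c * a3 * (a1 * I)) (min (a4 * a3 * (a1 * I)) (a2 * (a1 * I))) with hca
  set cb := max (C * b3 * (b1 * I)) (max (b4 * b3 * (b1 * I)) (b2 * (b1 * I))) with hcb
  have ca0 : ca ≠ 0 := by
    have : 0 < ca := by
      simp only [hca, lt_min_iff, pos_iff_ne_zero, mul_ne_zero_iff]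
      simp [h.c0, *]
    exact this.ne'
  have cbt : cb ≠ ⊤ := by
    have : cb < ⊤ := by
      refine max_lt (ENNReal.mul_ne_top (ENNReal.mul_ne_top h.Ct b3t) (ENNReal.mul_ne_top b1t It)).lt_top
        (max_lt (ENNReal.mul_ne_top (ENNReal.mul_ne_top b4t b3t) (ENNReal.mul_ne_top b1t It)).lt_top
          (ENNReal.mul_ne_top b2t (ENNReal.mul_ne_top b1t It)).lt_top)
    exact this.ne
  have bm : ∀ u, mj f r e j u ≠ 0 → ca ≤ mj f r e j u ∧ mj f r e j u ≤ cb := by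
    intro u hu
    obtain ⟨f0, hS, hT⟩ := mj_ne hu
    have hf := h.bd _ f0
    rw [mj, hj, NT, indicator_of_mem hS, indicator_of_mem hT]
    constructor
    · refine (min_le_left _ _).trans ?_
      gcongr
      exacts [hf.1, (k3 u hS).1, (k1 _ hT).1]
    · refine le_trans ?_ (le_max_left _ _)
      gcongr
      exacts [hf.2.1, (k3 u hS).2, (k1 _ hT).2]
  set cc := cb * volume (Icc (-(j:ℝ)) j) with hcc
  have cct : cc ≠ ⊤ := ENNReal.mul_ne_top cbt (by simp)
  have hCb : cb ≤ max cb cc := le_max_left _ _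
  refine LI.of_nice hm (h.mass hr j M0 Mt) (c := ca) (C := max cb cc) ca0 (by
      have := max_lt cbt.lt_top cct.lt_top
      exact this.ne)
    (S := Metric.closedBall 0 R) measurableSet_closedBall measure_closedBall_lt_top.ne ?_ ?_ ?_
  · intro u hu
    simpa using (h.bd _ (mj_ne hu).1).2.2
  · intro z
    refine le_trans ?_ (le_max_right _ _)
    rw [hcc, ← lintegral_indicator_const measurableSet_Icc]
    refine lintegral_mono fun t => ?_
    by_cases hu : mj f r e j (z, t) = 0
    · simp [hu]
    · rw [indicator_of_mem (show t ∈ Icc (-(j:ℝ)) j from abs_le.1 (Tcut_abs (mj_ne hu).2.2))]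
      exact (bm _ hu).2
  · intro u hu
    obtain ⟨f0, hS, hT⟩ := mj_ne hu
    refine ⟨⟨(bm u hu).1, (bm u hu).2.trans hCb⟩, ?_, ?_⟩
    · rw [LF_mj h.meas, hj, NT, indicator_of_mem hS, indicator_of_mem hT]
      constructor
      · refine (min_le_right _ _).trans ((min_le_left _ _).trans ?_)
        gcongr
        exacts [(k4 u hS).1, (k3 u hS).1, (k1 _ hT).1]
      · refine le_trans ?_ hCb
        refine le_trans ?_ (le_max_right _ _)
        refine le_trans ?_ (le_max_left _ _)
        gcongr
        exacts [(k4 u hS).2, (k3 u hS).2, (k1 _ hT).2]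
    · rw [rhoF_mj h.meas, NT, indicator_of_mem hT]
      constructor
      · refine (min_le_right _ _).trans ((min_le_right _ _).trans ?_)
        gcongr
        exacts [(k2 _ hT).1, (k1 _ hT).1]
      · refine le_trans ?_ hCb
        refine le_trans ?_ (le_max_right _ _)
        refine le_trans ?_ (le_max_right _ _)
        gcongr
        exacts [(k2 _ hT).2, (k1 _ hT).2]

/-- the logarithmic identities on the support -/
structure Lid (f : Pt n → ℝ≥0∞) (r e : ℝ) (j : ℕ) (u : Pt n × ℝ) : Prop where
  ff : Fp (f u.1)
  fh : Fp (hX f u)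
  fN : Fp (Nj f r j u.2)
  lm : lg (mj f r e j u) = lg (f u.1) + (r-1) * lg (hX f u) + (e-1) * lg (Nj f r j u.2) - lg (Mj f r e j)
  lL : lg (LF (mj f r e j) u) = r * lg (hX f u) + (e-1) * lg (Nj f r j u.2) - lg (Mj f r e j)
  lr : lg (rhoF (mj f r e j) u.2) = e * lg (Nj f r j u.2) - lg (Mj f r e j)

theorem Nice.lid (h : Nice f c C R) {r e : ℝ} (hr : 1 ≤ r) (j : ℕ) (M0 : Mj f r e j ≠ 0) {u : Pt n × ℝ}
    (hu : mj f r e j u ≠ 0) : Lid f r e j u := by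
  obtain ⟨f0, hS, hT⟩ := mj_ne hu
  have Mt := h.Mj_top (e := e) hr j
  have fM : Fp (Mj f r e j) := ⟨M0, Mt⟩
  have ff : Fp (f u.1) := ⟨f0, ne_top_of_le_ne_top h.Ct (h.le _)⟩
  have fh : Fp (hX f u) := ⟨fun h0 => by
    have := hS.1
    rw [h0] at this
    simp at this, h.hX_top u⟩
  have fN : Fp (Nj f r j u.2) := ⟨Tcut_N0 hT, h.Nj_top hr j _⟩
  refine ⟨ff, fh, fN, ?_, ?_, ?_⟩
  · rw [mj, hj, NT, indicator_of_mem hS, indicator_of_mem hT,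
      lg_mul (ff.mul (fh.rpow _)) ((fN.rpow _).mul fM.inv), lg_mul ff (fh.rpow _), lg_mul (fN.rpow _) fM.inv,
      lg_rpow fh, lg_rpow fN, lg_inv]
    ring
  · rw [LF_mj h.meas, hj, NT, indicator_of_mem hS, indicator_of_mem hT,
      lg_mul (fh.mul (fh.rpow _)) ((fN.rpow _).mul fM.inv), lg_mul fh (fh.rpow _), lg_mul (fN.rpow _) fM.inv,
      lg_rpow fh, lg_rpow fN, lg_inv]
    ring
  · rw [rhoF_mj h.meas, NT, indicator_of_mem hT,
      lg_mul fN ((fN.rpow _).mul fM.inv), lg_mul (fN.rpow _) fM.inv, lg_rpow fN, lg_inv]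
    ring

def D0 (n : ℕ) : ℝ := n*(n+1)/2
def pp (n : ℕ) (s : ℝ) : ℝ := (s+n)/s
def rr (n : ℕ) (s : ℝ) : ℝ := (s+n)/(s-1)
def ee (n : ℕ) (s : ℝ) : ℝ := (s-1)/D0 n

theorem D0_ge {n : ℕ} (hn : 2 ≤ n) : n + 1 ≤ D0 n := by
  have : (2:ℝ) ≤ n := by exact_mod_cast hn
  unfold D0; nlinarith

theorem rr_gt {n : ℕ} (hn : 2 ≤ n) {s : ℝ} (hs : D0 n < s) : 1 < rr n s := by
  have := D0_ge hn
  have : (2:ℝ) ≤ n := by exact_mod_cast hn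
  unfold rr; rw [lt_div_iff₀] <;> linarith

theorem nu_ne {m : Pt n × ℝ → ℝ≥0∞} (hm : Measurable m) : ∀ᵐ u ∂(nu m), m u ≠ 0 := by
  unfold nu
  rw [ae_withDensity_iff hm]
  exact ae_of_all _ fun u hu => hu

theorem integral_const_mul_one_eq {Ω : Type*} [MeasurableSpace Ω] (P : Measure Ω) [IsProbabilityMeasure P] (a : ℝ) :
    ∫ _, a ∂P = a := by simp

theorem Nice.total (h : Nice f c C R) (hn : 2 ≤ n) {s : ℝ} (hs : D0 n < s) (h1 : ∫⁻ z, f z ^ pp n s ≤ 1)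
    {j : ℕ} {m : Pt n × ℝ → ℝ≥0∞} (hmj : m = mj f (rr n s) (ee n s) j) (M0 : Mj f (rr n s) (ee n s) j ≠ 0)
    (e : Bool) {i k : Fin (n+1)} (hik : i < k) {δ : ℝ} (hδ : 0 < δ) :
    D0 n * lg (Mj f (rr n s) (ee n s) j)
    + wt n (totE (s - D0 n)) i * (Real.log (1/δ) * ((Pm m (n+1)) {x | XP m (ea e) (ea (!e)) i k x < ENNReal.ofReal δ}).toReal)
    + (s - D0 n - totE (s - D0 n)) * (Real.log (1/δ) * ((nu m) {u | XI m u < ENNReal.ofReal δ}).toReal)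
    + s * (Real.log (1/δ) * ((nu m) {u | XZ m (fun z => f z ^ pp n s) u < ENNReal.ofReal δ}).toReal)
    ≤ totC n (s - D0 n) := by
  subst hmj
  have hn2 : (2:ℝ) ≤ n := by exact_mod_cast hn
  have hD := D0_ge hn
  have hr := (rr_gt hn hs).le
  have hL := h.LI hr j M0
  have hm := hL.meas
  have P := hL.prob_nu
  have hid := (nu_ne hm).mono fun u hu => h.lid hr j M0 hu
  have IF : Integrable (fun u => lg (f u.1 ^ pp n s)) (nu (mj f (rr n s) (ee n s) j)) := by
    refine Integrable.of_bound (Measurable.aestronglyMeasurable ?_) (|pp n s| * (|lg c| + |lg C|)) ?_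
    · have := h.meas
      exact measurable_lg.comp (by fun_prop)
    · filter_upwards [nu_ne hm, hid] with u hu hu'
      have hb := h.bd _ (mj_ne hu).1
      rw [lg_rpow hu'.ff, Real.norm_eq_abs, abs_mul]
      gcongr
      exact (lg_bdd h.c0 h.Ct hb.1 hb.2.1).2
  have key := hL.total hn (η := s - D0 n) (by linarith) (F := fun z => f z ^ pp n s)
    (h.meas.pow_const _) h1 (hid.mono fun u hu => hu.ff.rpow _) IF e hik hδ
  have e1 : (n*(n+1)/2 + (s - D0 n) : ℝ) = s := by unfold D0; ring
  rw [e1] at key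
  refine le_trans (le_of_eq ?_) key
  congr 3
  set m := mj f (rr n s) (ee n s) j with hmdef
  have H1 : HE (nu m) (fun u => lg (LF m u)) _ := ⟨hL.IL, rfl⟩
  have H2 : HE (nu m) (fun u => lg (m u)) _ := ⟨hL.Im, rfl⟩
  have H3 : HE (nu m) (fun u => lg (rhoF m u.2)) _ := ⟨hL.Ir, rfl⟩
  have H4 : HE (nu m) (fun u => lg (f u.1 ^ pp n s)) _ := ⟨IF, rfl⟩
  have H := ((((H1.smul (n+1)).sub (H2.smul (n+s))).sub (H3.smul (1 - (s - D0 n)))).add (H4.smul s)).2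
  rw [← H]
  rw [← integral_const_mul_one_eq (nu m) (D0 n * lg (Mj f (rr n s) (ee n s) j))]
  refine integral_congr_ae ?_
  filter_upwards [hid] with u hu
  rw [hu.lm, hu.lL, hu.lr, lg_rpow hu.ff]
  have hs1 : s - 1 ≠ 0 := by linarith
  have hs0 : s ≠ 0 := by linarith
  have hD0 : D0 n ≠ 0 := by linarith
  unfold pp rr ee
  field_simp
  ring
end app

section pinned
variable {n : ℕ} {f : Pt n → ℝ≥0∞} {c C : ℝ≥0∞} {R : ℝ}

theorem Nice.M_le (h : Nice f c C R) (hn : 2 ≤ n) {s : ℝ} (hs : D0 n < s) (h1 : ∫⁻ z, f z ^ pp n s ≤ 1) (j : ℕ) :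
    Mj f (rr n s) (ee n s) j ≤ ENNReal.ofReal (Real.exp (totC n (s - D0 n) / D0 n)) := by
  by_cases M0 : Mj f (rr n s) (ee n s) j = 0
  · simp [M0]
  have hD := D0_ge hn
  have hn2 : (2:ℝ) ≤ n := by exact_mod_cast hn
  have hr := (rr_gt hn hs).le
  have Mt := h.Mj_top (e := ee n s) hr j
  have := h.total hn hs h1 rfl M0 true (i := 0) (k := Fin.last n) (by
    rw [Fin.lt_def]; simp; omega) (δ := 1) one_pos
  simp only [div_one, Real.log_one, zero_mul, mul_zero, add_zero] at this
  rw [← ENNReal.ofReal_toReal Mt]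
  refine ENNReal.ofReal_le_ofReal ?_
  rw [← Real.log_le_iff_le_exp (ENNReal.toReal_pos M0 Mt), le_div_iff₀ (by linarith)]
  unfold lg at this
  linarith

theorem tail_of {Ω : Type*} [MeasurableSpace Ω] (P : Measure Ω) [IsProbabilityMeasure P] (X : Ω → ℝ≥0∞)
    (hX : Measurable X) (fX : ∀ᵐ x ∂P, Fp (X x)) {C0 : ℝ} (hC0 : 0 ≤ C0) (hE : ∫⁻ x, X x ∂P ≤ ENNReal.ofReal C0)
    {K Λ : ℝ} (hΛ : 0 < Λ) (hK : Λ * (P {x | X x < ENNReal.ofReal (Real.exp (-Λ))}).toReal ≤ K) :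
    P {x | Λ < |lg (X x)|} ≤ ENNReal.ofReal ((K + C0)/Λ) := by
  have K0 : 0 ≤ K := le_trans (by positivity) hK
  have h1 : P {x | X x < ENNReal.ofReal (Real.exp (-Λ))} ≤ ENNReal.ofReal (K/Λ) := by
    rw [← ENNReal.ofReal_toReal (measure_ne_top P _)]
    refine ENNReal.ofReal_le_ofReal ?_
    rw [le_div_iff₀ hΛ]; linarith
  have h2 : P {x | ENNReal.ofReal (Real.exp Λ) ≤ X x} ≤ ENNReal.ofReal (C0/Λ) := by
    have := meas_ge_le_lintegral_div hX.aemeasurable (μ := P) (ε := ENNReal.ofReal (Real.exp Λ))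
      (by simp [Real.exp_pos]) (by simp)
    refine this.trans ?_
    rw [ENNReal.ofReal_div_of_pos hΛ]
    gcongr
    linarith [Real.add_one_le_exp Λ]
  rw [add_div, ENNReal.ofReal_add (by positivity) (by positivity)]
  refine le_trans (le_trans (measure_mono_ae ?_) (measure_union_le _ _)) (add_le_add h1 h2)
  filter_upwards [fX] with x hx hl
  have hl : Λ < |lg (X x)| := hl
  have hp := hx.pos
  rcases lt_abs.1 hl with h | h
  · right
    change _ ≤ X x
    rw [← ENNReal.ofReal_toReal hx.2]
    exact ENNReal.ofReal_le_ofReal ((Real.le_log_iff_exp_le hp).1 h.le)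
  · left
    change X x < _
    rw [← ENNReal.ofReal_toReal hx.2]
    rw [ENNReal.ofReal_lt_ofReal_iff (Real.exp_pos _)]
    exact (Real.log_lt_iff_lt_exp hp).1 (by unfold lg at h; linarith)

/-- the good event, in terms of the pinned quantities -/
def GoodL (m : Pt n × ℝ → ℝ≥0∞) (F : Pt n → ℝ≥0∞) (Λ : ℝ) (x : Pt n × (Fin (n+1) → ℝ × ℝ)) : Prop :=
  Good0 m x ∧ (∀ i k : Fin (n+1), i < k → ∀ e : Bool, |lg (XP m (ea e) (ea (!e)) i k x)| ≤ Λ) ∧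
   (∀ i : Fin (n+1), |lg (XI m (uP i x))| ≤ Λ) ∧ (∀ i : Fin (n+1), |lg (XI m (vP i x))| ≤ Λ) ∧
   (∀ i : Fin (n+1), |lg (XZ m F (uP i x))| ≤ Λ) ∧ (∀ i : Fin (n+1), |lg (XZ m F (vP i x))| ≤ Λ)

theorem measurable_Fp {Ω : Type*} [MeasurableSpace Ω] {X : Ω → ℝ≥0∞} (hX : Measurable X) : Measurable fun x => Fp (X x) := by
  unfold Fp
  exact Measurable.and (measurableSet_setOfPred.1 (hX (measurableSet_singleton 0)).compl)
    (measurableSet_setOfPred.1 (hX (measurableSet_singleton ⊤)).compl)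

theorem measurable_le_prop {Ω : Type*} [MeasurableSpace Ω] {X : Ω → ℝ} (hX : Measurable X) (Λ : ℝ) :
    Measurable fun x => |X x| ≤ Λ := by
  have : Measurable fun x => |X x| := by fun_prop
  exact measurableSet_setOfPred.1 (measurableSet_le this measurable_const)

theorem measurable_Good0 {m : Pt n × ℝ → ℝ≥0∞} (hm : Measurable m) {j : ℕ} :
    Measurable (fun x : Pt n × (Fin j → ℝ × ℝ) => Good0 m x) := by
  have h1 := measurable_LF hm
  have h2 := measurable_rhoF hm
  have h3 := measurable_muF hm
  unfold Good0
  refine Measurable.and (Measurable.forall fun i => ?_) (Measurable.forall fun i => Measurable.forall fun k => ?_)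
  · refine (measurable_Fp (by fun_prop)).and ((measurable_Fp (by fun_prop)).and ((measurable_Fp (by fun_prop)).and
      ((measurable_Fp (by fun_prop)).and ((measurable_Fp (by fun_prop)).and (measurable_Fp (by fun_prop))))))
  · refine Measurable.imp measurable_const (measurableSet_setOfPred.1 ?_)
    have : Measurable (fun x : Pt n × (Fin j → ℝ × ℝ) => tv x i - tv x k) := by fun_prop
    exact (this (measurableSet_singleton 0)).compl

theorem measurable_GoodL {m : Pt n × ℝ → ℝ≥0∞} (hm : Measurable m) {F : Pt n → ℝ≥0∞} (hF : Measurable F) (Λ : ℝ) :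
    MeasurableSet {x | GoodL m F Λ x} := by
  rw [measurableSet_setOfPred]
  have h1 := measurable_XI hm
  have h2 := measurable_XZ hm hF
  have l := measurable_lg
  unfold GoodL
  refine (measurable_Good0 hm).and (Measurable.and ?_ (Measurable.and ?_ (Measurable.and ?_ (Measurable.and ?_ ?_))))
  · refine Measurable.forall fun i => Measurable.forall fun k => Measurable.imp measurable_const (Measurable.forall fun e => ?_)
    exact measurable_le_prop (l.comp (measurable_XP hm _ _ i k)) Λ
  all_goals
    refine Measurable.forall fun i => measurable_le_prop ?_ Λ
    fun_prop

def hlsR : ℝ := (hlsC (1/3) (1/6) + hlsC (1/6) (1/3)).toReal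

def pinK (n : ℕ) (s B : ℝ) : ℝ :=
  max 0 ((totC n (s - D0 n) + D0 n * B) / min (min (totE (s - D0 n) / n) 1) (min (s - D0 n - totE (s - D0 n)) s)) + (hlsR + 1)

theorem Nice.pinned (h : Nice f c C R) (hn : 2 ≤ n) {s : ℝ} (hs : D0 n < s) (h1 : ∫⁻ z, f z ^ pp n s ≤ 1)
    {j : ℕ} {m : Pt n × ℝ → ℝ≥0∞} (hmj : m = mj f (rr n s) (ee n s) j) (M0 : Mj f (rr n s) (ee n s) j ≠ 0)
    {B : ℝ} (hB : - B ≤ lg (Mj f (rr n s) (ee n s) j)) {Λ : ℝ} (hΛ : 0 < Λ) :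
    (∀ i k : Fin (n+1), i < k → ∀ e : Bool, Pm m (n+1) {x | Λ < |lg (XP m (ea e) (ea (!e)) i k x)|} ≤ ENNReal.ofReal (pinK n s B / Λ))
    ∧ nu m {u | Λ < |lg (XI m u)|} ≤ ENNReal.ofReal (pinK n s B / Λ)
    ∧ nu m {u | Λ < |lg (XZ m (fun z => f z ^ pp n s) u)|} ≤ ENNReal.ofReal (pinK n s B / Λ) := by
  have hn2 : (2:ℝ) ≤ n := by exact_mod_cast hn
  have hD := D0_ge hn
  have hr := (rr_gt hn hs).le
  have hL : _root_.LI m := hmj ▸ h.LI hr j M0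
  have hm := hL.meas
  have P1 := hL.prob_nu
  have P2 := hL.prob_Pm (n+1)
  have tt := fun e i k hik => h.total hn hs h1 hmj M0 e (i := i) (k := k) hik (δ := Real.exp (-Λ)) (Real.exp_pos _)
  have el : Real.log (1 / Real.exp (-Λ)) = Λ := by rw [Real.log_div one_ne_zero (Real.exp_ne_zero _)]; simp
  rw [el] at tt
  have hE := totE_pos (η := s - D0 n) (by linarith)
  have hE2 := totE_lt (η := s - D0 n) (by linarith)
  set w := min (min (totE (s - D0 n) / n) 1) (min (s - D0 n - totE (s - D0 n)) s) with hw
  have w0 : 0 < w := by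
    simp only [hw, lt_min_iff]
    exact ⟨⟨by positivity, one_pos⟩, by linarith, by linarith⟩
  set Q := max 0 ((totC n (s - D0 n) + D0 n * B) / w) with hQ
  have hQ2 : totC n (s - D0 n) + D0 n * B ≤ Q * w := by
    rw [← div_le_iff₀ w0]; exact le_max_right _ _
  have hDB : -(D0 n * B) ≤ D0 n * lg (Mj f (rr n s) (ee n s) j) := by
    rw [← mul_neg]; exact mul_le_mul_of_nonneg_left hB (by linarith)
  have wt_ge : ∀ i, w ≤ wt n (totE (s - D0 n)) i := by
    intro i
    unfold wt
    split_ifs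
    · exact (min_le_left _ _).trans (min_le_left _ _)
    · exact (min_le_left _ _).trans (min_le_right _ _)
  have w2 : w ≤ s - D0 n - totE (s - D0 n) := (min_le_right _ _).trans (min_le_left _ _)
  have w3 : w ≤ s := (min_le_right _ _).trans (min_le_right _ _)
  have bound : ∀ a b : ℝ, w ≤ a → 0 ≤ b → a * b ≤ totC n (s - D0 n) + D0 n * B → b ≤ Q := by
    intro a b ha hb hab
    have : w * b ≤ Q * w := (mul_le_mul_of_nonneg_right ha hb).trans (hab.trans hQ2)
    rw [mul_comm] at this
    exact le_of_mul_le_mul_right this w0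
  have nn : ∀ (a b : ℝ), 0 ≤ a → 0 ≤ b → 0 ≤ a * (Λ * b) := fun a b ha hb => by positivity
  have hlsfin : hlsC (1/3) (1/6) + hlsC (1/6) (1/3) ≠ ⊤ := (ENNReal.add_lt_top.2
    ⟨hlsC_lt_top (by norm_num) (by norm_num) (by norm_num), hlsC_lt_top (by norm_num) (by norm_num) (by norm_num)⟩).ne
  have hls0 : 0 ≤ hlsR := ENNReal.toReal_nonneg
  have mono : ∀ C0, C0 ≤ hlsR + 1 → ENNReal.ofReal ((Q + C0)/Λ) ≤ ENNReal.ofReal (pinK n s B / Λ) := by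
    intro C0 hC
    refine ENNReal.ofReal_le_ofReal ?_
    unfold pinK
    gcongr
  have hi0 : (0 : Fin (n+1)) < Fin.last n := by rw [Fin.lt_def]; simp; omega
  refine ⟨fun i k hik e => ?_, ?_, ?_⟩
  · refine (tail_of (Pm m (n+1)) _ (measurable_XP hm _ _ i k) ((hL.ae_good0 _).mono fun x g => (g.XP _ _ hik).1) hls0
      ?_ hΛ (K := Q) ?_).trans (mono _ (by linarith))
    · refine (lintegral_XP hL.toReg (ea_pos _) (ea_pos _) ?_ i k hik).trans ?_
      · cases e <;> norm_num [ea]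
      · rw [hlsR, ENNReal.ofReal_toReal hlsfin]
        cases e <;> simp [ea, add_comm]
    · refine bound _ _ (wt_ge i) (by positivity) ?_
      have := tt e i k hik
      have a1 := nn _ ((nu m) {u | XI m u < ENNReal.ofReal (Real.exp (-Λ))}).toReal (w0.le.trans w2) ENNReal.toReal_nonneg
      have a2 := nn _ ((nu m) {u | XZ m (fun z => f z ^ pp n s) u < ENNReal.ofReal (Real.exp (-Λ))}).toReal (w0.le.trans w3) ENNReal.toReal_nonneg
      linarith
  · refine (tail_of (nu m) _ (measurable_XI hm) (by
        filter_upwards [hL.fm, hL.fr, hL.fu] with u a b c using (b.mul c).div a) zero_le_one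
      (by simpa using hL.lintegral_XI) hΛ (K := Q) ?_).trans (mono _ (by linarith))
    refine bound _ _ w2 (by positivity) ?_
    have := tt true 0 (Fin.last n) hi0
    have a1 := nn _ ((Pm m (n+1)) {x | XP m (ea true) (ea (!true)) 0 (Fin.last n) x < ENNReal.ofReal (Real.exp (-Λ))}).toReal (w0.le.trans (wt_ge 0)) ENNReal.toReal_nonneg
    have a2 := nn _ ((nu m) {u | XZ m (fun z => f z ^ pp n s) u < ENNReal.ofReal (Real.exp (-Λ))}).toReal (w0.le.trans w3) ENNReal.toReal_nonneg
    linarith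
  · have fF : ∀ᵐ u ∂(nu m), Fp (f u.1 ^ pp n s) := by
      subst hmj
      exact (nu_ne hm).mono fun u hu => (h.lid hr j M0 hu).ff.rpow _
    have hF : Measurable (fun z => f z ^ pp n s) := h.meas.pow_const _
    refine (tail_of (nu m) _ (measurable_XZ hm hF) (by
        filter_upwards [fF, hL.fu] with u a b using a.div b) zero_le_one
      (by simpa using hL.lintegral_XZ hF h1) hΛ (K := Q) ?_).trans (mono _ (by linarith))
    refine bound _ _ w3 (by positivity) ?_
    have := tt true 0 (Fin.last n) hi0
    have a1 := nn _ ((Pm m (n+1)) {x | XP m (ea true) (ea (!true)) 0 (Fin.last n) x < ENNReal.ofReal (Real.exp (-Λ))}).toReal (w0.le.trans (wt_ge 0)) ENNReal.toReal_nonneg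
    have a2 := nn _ ((nu m) {u | XI m u < ENNReal.ofReal (Real.exp (-Λ))}).toReal (w0.le.trans w2) ENNReal.toReal_nonneg
    linarith

theorem Nice.bad (h : Nice f c C R) (hn : 2 ≤ n) {s : ℝ} (hs : D0 n < s) (h1 : ∫⁻ z, f z ^ pp n s ≤ 1)
    {j : ℕ} {m : Pt n × ℝ → ℝ≥0∞} (hmj : m = mj f (rr n s) (ee n s) j) (M0 : Mj f (rr n s) (ee n s) j ≠ 0)
    {B : ℝ} (hB : - B ≤ lg (Mj f (rr n s) (ee n s) j)) {Λ : ℝ} (hΛ : 0 < Λ) :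
    Pm m (n+1) {x | GoodL m (fun z => f z ^ pp n s) Λ x}ᶜ ≤ ENNReal.ofReal ((2*(n+1)^2 + 4*(n+1)) * (pinK n s B / Λ)) := by
  obtain ⟨k1, k2, k3⟩ := h.pinned hn hs h1 hmj M0 hB hΛ
  have hr := (rr_gt hn hs).le
  have hL : _root_.LI m := hmj ▸ h.LI hr j M0
  have hm := hL.meas
  have hF : Measurable (fun z => f z ^ pp n s) := h.meas.pow_const _
  set F : Pt n → ℝ≥0∞ := (fun z => f z ^ pp n s)
  set κ := ENNReal.ofReal (pinK n s B / Λ)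
  set A : (Fin (n+1) × Fin (n+1) × Bool) → Set (Pt n × (Fin (n+1) → ℝ × ℝ)) := fun a =>
    {x | a.1 < a.2.1 ∧ Λ < |lg (XP m (ea a.2.2) (ea (!a.2.2)) a.1 a.2.1 x)|} with hA
  have mA : ∀ a, Pm m (n+1) (A a) ≤ κ := by
    intro a
    by_cases ha : a.1 < a.2.1
    · refine le_trans (measure_mono fun x hx => hx.2) (k1 _ _ ha a.2.2)
    · have : A a = ∅ := by ext x; simp [hA, ha]
      simp [this]
  have mI := measurable_XI hm
  have mZ := measurable_XZ hm hF
  have sI : MeasurableSet {u | Λ < |lg (XI m u)|} := measurableSet_lt measurable_const (measurable_lg.comp mI).abs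
  have sZ : MeasurableSet {u | Λ < |lg (XZ m F u)|} := measurableSet_lt measurable_const (measurable_lg.comp mZ).abs
  have e1 : ∀ i, Pm m (n+1) (uP i ⁻¹' {u | Λ < |lg (XI m u)|}) ≤ κ := fun i => by
    rw [(hL.mp_u i).measure_preimage sI.nullMeasurableSet]; exact k2
  have e2 : ∀ i, Pm m (n+1) (vP i ⁻¹' {u | Λ < |lg (XI m u)|}) ≤ κ := fun i => by
    rw [(hL.mp_v i).measure_preimage sI.nullMeasurableSet]; exact k2
  have e3 : ∀ i, Pm m (n+1) (uP i ⁻¹' {u | Λ < |lg (XZ m F u)|}) ≤ κ := fun i => by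
    rw [(hL.mp_u i).measure_preimage sZ.nullMeasurableSet]; exact k3
  have e4 : ∀ i, Pm m (n+1) (vP i ⁻¹' {u | Λ < |lg (XZ m F u)|}) ≤ κ := fun i => by
    rw [(hL.mp_v i).measure_preimage sZ.nullMeasurableSet]; exact k3
  have sub : {x | GoodL m F Λ x}ᶜ ⊆ {x | ¬ Good0 m x} ∪ ((⋃ a, A a) ∪ ((⋃ i, uP i ⁻¹' {u | Λ < |lg (XI m u)|}) ∪
     ((⋃ i, vP i ⁻¹' {u | Λ < |lg (XI m u)|}) ∪ ((⋃ i, uP i ⁻¹' {u | Λ < |lg (XZ m F u)|}) ∪ (⋃ i, vP i ⁻¹' {u | Λ < |lg (XZ m F u)|}))))) := by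
    intro x hx
    by_contra hcon
    simp only [hA, mem_union, mem_iUnion, mem_preimage, mem_ofPred_eq, not_or, not_exists, not_and, not_lt, not_not] at hcon
    obtain ⟨c0, c1, c2, c3, c4, c5⟩ := hcon
    exact hx ⟨c0, fun i k hik e => c1 (i, k, e) hik, c2, c3, c4, c5⟩
  refine (measure_mono sub).trans ?_
  have g0 : Pm m (n+1) {x | ¬ Good0 m x} = 0 := hL.ae_good0 (n+1)
  have U : ∀ {ι : Type} [Fintype ι] (E : ι → Set (Pt n × (Fin (n+1) → ℝ × ℝ))), (∀ i, Pm m (n+1) (E i) ≤ κ) →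
      Pm m (n+1) (⋃ i, E i) ≤ Fintype.card ι * κ := by
    intro ι _ E hE
    refine (measure_iUnion_fintype_le _ _).trans ((Finset.sum_le_sum fun i _ => hE i).trans ?_)
    simp
  refine (measure_union_le _ _).trans ?_
  rw [g0, zero_add]
  refine (measure_union_le _ _).trans ((add_le_add (U _ mA) ((measure_union_le _ _).trans (add_le_add (U _ e1)
    ((measure_union_le _ _).trans (add_le_add (U _ e2) ((measure_union_le _ _).trans (add_le_add (U _ e3) (U _ e4)))))))).trans ?_)
  rw [ENNReal.ofReal_mul (by positivity)]
  simp only [Fintype.card_prod, Fintype.card_fin, Fintype.card_bool]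
  rw [← add_mul, ← add_mul, ← add_mul, ← add_mul]
  refine mul_le_mul_left ?_ _
  rw [show (2*(n+1)^2 + 4*(n+1) : ℝ) = ((2*(n+1)^2 + 4*(n+1) : ℕ) : ℝ) by push_cast; ring, ENNReal.ofReal_natCast]
  norm_cast
  nlinarith
end pinned

section geom
variable {n : ℕ} {f : Pt n → ℝ≥0∞} {c C : ℝ≥0∞} {R : ℝ}

/-- the good event, in geometric terms -/
structure GG (f : Pt n → ℝ≥0∞) (m : Pt n × ℝ → ℝ≥0∞) (p κ : ℝ) (x : Pt n × (Fin (n+1) → ℝ × ℝ)) : Prop where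
  g0 : Good0 m x
  ff : ∀ k : ℕ, k ≤ n+1 → Fp (f (pos x.1 x.2 k))
  fh : ∀ i : Fin (n+1), Fp (hX f (uP i x))
  df : ∀ k : ℕ, k ≤ n+1 → |lg (f (pos x.1 x.2 k)) - lg (f x.1)| ≤ κ
  dh : ∀ i : Fin (n+1), |lg (hX f (uP i x)) - lg (hX f (uP 0 x))| ≤ κ
  dp : ∀ i : Fin (n+1), |lg (m (uP i x)) - lg (muF m (uP i x).1) - lg (rhoF m (tv x 0))| ≤ κ
  dt : ∀ i k : Fin (n+1), i < k → |lg (ENNReal.ofReal |tv x i - tv x k|) + lg (rhoF m (tv x 0))| ≤ κ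
  sc : |(n+1) * (lg (hX f (uP 0 x)) - lg (f x.1)) + p * lg (f x.1) - D0 n * lg (rhoF m (tv x 0))| ≤ κ
  mL : ∀ i : Fin (n+1), lg (m (vP i x)) - lg (LF m (uP i x)) = lg (f (pos x.1 x.2 (i.1+1))) - lg (hX f (uP i x))

def ggK (n : ℕ) (s Λ B : ℝ) : ℝ :=
  (n+1) * (4*Λ/(n/s)) + 21 * Λ + 2 * (s-1)*Λ + D0 n * B
   + (((n:ℝ)/s) * ((n+1) * (4*Λ/(n/s))) + (18*Λ) * (D0 n/(s-1)) + 4 * Λ) / ((n+1)/(s-1))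

theorem Nice.GG (h : Nice f c C R) (hn : 2 ≤ n) {s : ℝ} (hs : D0 n < s)
    {j : ℕ} {m : Pt n × ℝ → ℝ≥0∞} (hmj : m = mj f (rr n s) (ee n s) j) (M0 : Mj f (rr n s) (ee n s) j ≠ 0)
    {B : ℝ} (hB : |lg (Mj f (rr n s) (ee n s) j)| ≤ B) {Λ : ℝ} (hΛ : 0 < Λ) {x : Pt n × (Fin (n+1) → ℝ × ℝ)}
    (hx : GoodL m (fun z => f z ^ pp n s) Λ x) : _root_.GG f m (pp n s) (ggK n s Λ B) x := by
  have hn2 : (2:ℝ) ≤ n := by exact_mod_cast hn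
  have hD := D0_ge hn
  have hr := (rr_gt hn hs).le
  have hs1 : 0 < s - 1 := by linarith
  have hs0 : 0 < s := by linarith
  have hB0 : 0 ≤ B := (abs_nonneg _).trans hB
  obtain ⟨g0, gP, gIu, gIv, gZu, gZv⟩ := hx
  have Lu : ∀ i, Lid f (rr n s) (ee n s) j (uP i x) := fun i => h.lid hr j M0 (hmj ▸ (g0.1 i).1.1)
  have Lv : ∀ i, Lid f (rr n s) (ee n s) j (vP i x) := fun i => h.lid hr j M0 (hmj ▸ (g0.1 i).2.1.1)
  have hv : ∀ i, hX f (vP i x) = hX f (uP i x) := by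
    intro i
    simp only [vP, uP, pos_succ]
    exact hX_shift f _ _ _
  have p1 : pp n s = 1 + n/s := by unfold pp; field_simp
  have r1 : rr n s - 1 = (n+1)/(s-1) := by unfold rr; field_simp; ring
  have e1 : ee n s ≠ 0 := by unfold ee; exact div_ne_zero hs1.ne' (by linarith)
  -- basic identities
  have mu_m : ∀ i, lg (m (vP i x)) - lg (m (uP i x)) = lg (f (vP i x).1) - lg (f (uP i x).1) := by
    intro i
    have a := (Lu i).lm
    have b := (Lv i).lm
    rw [hv] at b
    rw [← hmj] at a b
    have : (vP i x).2 = (uP i x).2 := rfl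
    rw [this] at b
    rw [a, b]; ring
  have Zu : ∀ i, |pp n s * lg (f (uP i x).1) - lg (muF m (uP i x).1)| ≤ Λ := by
    intro i
    have := gZu i
    rwa [XZ, lg_div ((Lu i).ff.rpow _) (g0.1 i).2.2.2.2.1, lg_rpow (Lu i).ff] at this
  have Zv : ∀ i, |pp n s * lg (f (vP i x).1) - lg (muF m (vP i x).1)| ≤ Λ := by
    intro i
    have := gZv i
    rwa [XZ, lg_div ((Lv i).ff.rpow _) (g0.1 i).2.2.2.2.2, lg_rpow (Lv i).ff] at this
  have Iu : ∀ i, |lg (rhoF m (tv x i)) + lg (muF m (uP i x).1) - lg (m (uP i x))| ≤ Λ := by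
    intro i
    have := gIu i
    have fr : Fp (rhoF m (uP i x).2) := (g0.1 i).2.2.2.1
    rwa [XI, lg_div (fr.mul (g0.1 i).2.2.2.2.1) (g0.1 i).1, lg_mul fr (g0.1 i).2.2.2.2.1] at this
  have Iv : ∀ i, |lg (rhoF m (tv x i)) + lg (muF m (vP i x).1) - lg (m (vP i x))| ≤ Λ := by
    intro i
    have := gIv i
    have fr : Fp (rhoF m (vP i x).2) := (g0.1 i).2.2.2.1
    rwa [XI, lg_div (fr.mul (g0.1 i).2.2.2.2.2) (g0.1 i).2.1, lg_mul fr (g0.1 i).2.2.2.2.2] at this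
  have hP : ∀ i k, i < k → |lg (rhoF m (tv x i)) - lg (rhoF m (tv x k))| ≤ 18 * Λ ∧
      |lg (ENNReal.ofReal |tv x i - tv x k|) + (lg (rhoF m (tv x i)) + lg (rhoF m (tv x k)))/2| ≤ 3 * Λ := by
    intro i k hik
    have a := gP i k hik true
    have b := gP i k hik false
    rw [(g0.XP _ _ hik).2] at a b
    simp only [ea, Bool.not_true, Bool.not_false] at a b
    have c1 := Iv i
    have c2 := Iu k
    norm_num at a b
    rw [abs_le] at a b c1 c2
    constructor <;> rw [abs_le] <;> constructor <;> linarith [a.1, a.2, b.1, b.2, c1.1, c1.2, c2.1, c2.2]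
  have hρ : ∀ i, |lg (rhoF m (tv x i)) - lg (rhoF m (tv x 0))| ≤ 18 * Λ := by
    intro i
    rcases eq_or_ne i 0 with rfl | h0
    · simp; positivity
    · rw [abs_sub_comm]; exact (hP 0 i (Fin.pos_iff_ne_zero.2 h0)).1
  have hns : (0:ℝ) < n/s := by positivity
  have stepφ : ∀ i, |lg (f (vP i x).1) - lg (f (uP i x).1)| ≤ 4*Λ/(n/s) := by
    intro i
    have a := mu_m i
    have b1 := abs_le.1 (Zu i)
    have b2 := abs_le.1 (Zv i)
    have b3 := abs_le.1 (Iu i)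
    have b4 := abs_le.1 (Iv i)
    rw [le_div_iff₀ hns, ← abs_of_pos hns, ← abs_mul, abs_le]
    rw [p1] at b1 b2
    constructor <;> nlinarith [a, b1.1, b1.2, b2.1, b2.2, b3.1, b3.2, b4.1, b4.2]
  have e4 : 0 < 4*Λ/(n/s) := by positivity
  have df0 : ∀ k : ℕ, k ≤ n+1 → |lg (f (pos x.1 x.2 k)) - lg (f x.1)| ≤ k * (4*Λ/(n/s)) := by
    intro k
    induction k with
    | zero => intro _; simp [pos_zero]
    | succ k ih =>
      intro hk
      have a := ih (by omega)
      have b := stepφ ⟨k, by omega⟩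
      simp only [vP, uP] at b
      have := abs_sub_le (lg (f (pos x.1 x.2 (k+1)))) (lg (f (pos x.1 x.2 k))) (lg (f x.1))
      push_cast
      linarith
  have df1 : ∀ k : ℕ, k ≤ n+1 → |lg (f (pos x.1 x.2 k)) - lg (f x.1)| ≤ (n+1) * (4*Λ/(n/s)) := by
    intro k hk
    refine (df0 k hk).trans ?_
    gcongr
    exact_mod_cast hk
  have Hid : ∀ i, |(n+1)/(s-1) * lg (hX f (uP i x)) - n/s * lg (f (uP i x).1) - D0 n/(s-1) * lg (rhoF m (tv x i))
      - D0 n/(s-1) * lg (Mj f (rr n s) (ee n s) j)| ≤ 2 * Λ := by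
    intro i
    have b1 := Zu i
    have b3 := Iu i
    have lm := (Lu i).lm
    have lr := (Lu i).lr
    rw [← hmj] at lm lr
    have hN : lg (Nj f (rr n s) j (uP i x).2) = (lg (rhoF m (tv x i)) + lg (Mj f (rr n s) (ee n s) j)) * (D0 n/(s-1)) := by
      have : lg (rhoF m (tv x i)) = lg (rhoF m (uP i x).2) := rfl
      rw [this, lr]
      unfold ee
      have : D0 n ≠ 0 := by linarith
      field_simp
      ring
    rw [r1, hN, show (ee n s - 1) * ((lg (rhoF m (tv x i)) + lg (Mj f (rr n s) (ee n s) j)) * (D0 n/(s-1)))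
      = (lg (rhoF m (tv x i)) + lg (Mj f (rr n s) (ee n s) j)) * (1 - D0 n/(s-1)) by
        unfold ee
        have : D0 n ≠ 0 := by linarith
        field_simp] at lm
    rw [lm] at b3
    rw [p1] at b1
    rw [abs_le] at b1 b3 ⊢
    constructor <;> nlinarith [b1.1, b1.2, b3.1, b3.2]
  have Dp : 0 < D0 n / (s-1) := div_pos (by linarith) hs1
  have np : (0:ℝ) < (n+1)/(s-1) := by positivity
  have nonneg1 : 0 ≤ (n+1) * (4*Λ/(n/s)) := by positivity
  have nonneg2 : 0 ≤ 2 * (s-1)*Λ := by positivity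
  have nonneg3 : 0 ≤ D0 n * B := mul_nonneg (by linarith) hB0
  have nonneg4 : 0 ≤ (((n:ℝ)/s) * ((n+1) * (4*Λ/(n/s))) + (18*Λ) * (D0 n/(s-1)) + 4 * Λ) / ((n+1)/(s-1)) := by positivity
  refine ⟨g0, ?_, fun i => (Lu i).fh, ?_, ?_, ?_, ?_, ?_, ?_⟩
  · intro k hk
    rcases k with _ | k
    · have := (Lu 0).ff
      exact this
    · exact (Lv ⟨k, by omega⟩).ff
  · intro k hk
    refine (df1 k hk).trans ?_
    unfold ggK; linarith
  · intro i
    have : |lg (hX f (uP i x)) - lg (hX f (uP 0 x))| ≤ (((n:ℝ)/s) * ((n+1) * (4*Λ/(n/s))) + (18*Λ) * (D0 n/(s-1)) + 4 * Λ) / ((n+1)/(s-1)) := by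
      rw [le_div_iff₀ np, ← abs_of_pos np, ← abs_mul, abs_le]
      have b1 := abs_le.1 (Hid i)
      have b2 := abs_le.1 (Hid 0)
      have b3 := abs_le.1 (hρ i)
      have b4 := abs_le.1 (df1 i.1 i.2.le)
      have u0 : (uP 0 x).1 = x.1 := by simp [uP, pos_zero]
      have ui : (uP i x).1 = pos x.1 x.2 i.1 := rfl
      rw [ui] at b1
      rw [u0] at b2
      have b5 := mul_le_mul_of_nonneg_left b3.1 Dp.le
      have b6 := mul_le_mul_of_nonneg_left b3.2 Dp.le
      have b7 := mul_le_mul_of_nonneg_left b4.1 hns.le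
      have b8 := mul_le_mul_of_nonneg_left b4.2 hns.le
      constructor <;> linarith [b1.1, b1.2, b2.1, b2.2]
    refine this.trans ?_
    unfold ggK; linarith
  · intro i
    have b3 := abs_le.1 (hρ i)
    have b1 := abs_le.1 (Iu i)
    have : |lg (m (uP i x)) - lg (muF m (uP i x).1) - lg (rhoF m (tv x 0))| ≤ 21 * Λ := by
      rw [abs_le]; constructor <;> linarith [b1.1, b1.2, b3.1, b3.2]
    refine this.trans ?_
    unfold ggK; linarith
  · intro i k hik
    have b1 := abs_le.1 (hP i k hik).2
    have b2 := abs_le.1 (hρ i)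
    have b3 := abs_le.1 (hρ k)
    have : |lg (ENNReal.ofReal |tv x i - tv x k|) + lg (rhoF m (tv x 0))| ≤ 21 * Λ := by
      rw [abs_le]; constructor <;> linarith [b1.1, b1.2, b3.1, b3.2, b2.1, b2.2]
    refine this.trans ?_
    unfold ggK; linarith
  · have b := Hid 0
    have u0 : (uP 0 x).1 = x.1 := by simp [uP, pos_zero]
    rw [u0] at b
    have b' : |(n+1) * (lg (hX f (uP 0 x)) - lg (f x.1)) + pp n s * lg (f x.1) - D0 n * lg (rhoF m (tv x 0))
       - D0 n * lg (Mj f (rr n s) (ee n s) j)| ≤ 2*(s-1)*Λ := by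
      have : (n+1) * (lg (hX f (uP 0 x)) - lg (f x.1)) + pp n s * lg (f x.1) - D0 n * lg (rhoF m (tv x 0))
       - D0 n * lg (Mj f (rr n s) (ee n s) j) = (s-1) * ((n+1)/(s-1) * lg (hX f (uP 0 x)) - n/s * lg (f x.1) - D0 n/(s-1) * lg (rhoF m (tv x 0))
      - D0 n/(s-1) * lg (Mj f (rr n s) (ee n s) j)) := by
        unfold pp; field_simp; ring
      rw [this, abs_mul, abs_of_pos hs1]
      nlinarith
    have hM : |D0 n * lg (Mj f (rr n s) (ee n s) j)| ≤ D0 n * B := by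
      rw [abs_mul, abs_of_pos (show 0 < D0 n by linarith)]
      exact mul_le_mul_of_nonneg_left hB (by linarith)
    rw [abs_le] at b' hM
    have : |(n+1) * (lg (hX f (uP 0 x)) - lg (f x.1)) + pp n s * lg (f x.1) - D0 n * lg (rhoF m (tv x 0))| ≤ 2*(s-1)*Λ + D0 n * B := by
      rw [abs_le]; constructor <;> linarith [b'.1, b'.2, hM.1, hM.2]
    refine this.trans ?_
    unfold ggK; linarith
  · intro i
    have a := (Lv i).lm
    have b := (Lu i).lL
    rw [hv] at a
    rw [← hmj] at a b
    have : (vP i x).2 = (uP i x).2 := rfl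
    rw [this] at a
    rw [a, b]
    simp only [vP]
    ring
end geom

/-- finite-difference operators dual to multiplication by linear factors -/
def DD : (N : ℕ) → (Fin N → ℝ) → (ℕ → ℝ) → ℕ → ℝ
  | 0, _, w => w
  | N+1, τ, w => fun i => DD N (Fin.tail τ) w (i+1) - τ 0 * DD N (Fin.tail τ) w i

def cd {n : ℕ} (w : Pt n) (k : ℕ) : ℝ := if k = 0 then w.1 else if h : k - 1 < n then w.2 ⟨k-1, h⟩ else 0

theorem DD_sum {ι : Type*} (s : Finset ι) (c : ι → ℝ) (w : ι → ℕ → ℝ) : ∀ (N : ℕ) (τ : Fin N → ℝ) (i : ℕ),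
    DD N τ (fun k => ∑ l ∈ s, c l * w l k) i = ∑ l ∈ s, c l * DD N τ (w l) i := by
  intro N
  induction N with
  | zero => intro τ i; rfl
  | succ N ih =>
    intro τ i
    simp only [DD, ih]
    rw [Finset.mul_sum, ← Finset.sum_sub_distrib]
    refine Finset.sum_congr rfl fun l _ => ?_
    ring

theorem DD_pow (t : ℝ) (w : ℕ → ℝ) : ∀ (N : ℕ) (τ : Fin N → ℝ) (i : ℕ), (∀ k ≤ i + N, w k = t ^ k) →
    DD N τ w i = (∏ j, (t - τ j)) * t ^ i := by
  intro N
  induction N with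
  | zero => intro τ i h; simp [DD, h i (by omega)]
  | succ N ih =>
    intro τ i h
    simp only [DD]
    rw [ih _ _ fun k hk => h k (by omega), ih _ _ fun k hk => h k (by omega), Fin.prod_univ_succ]
    simp only [Fin.tail]
    ring

theorem measurable_cd {n : ℕ} (k : ℕ) : Measurable (fun w : Pt n => cd w k) := by
  unfold cd
  split_ifs <;> fun_prop

theorem measurable_DD {n : ℕ} : ∀ (N i : ℕ), Measurable (fun x : (Fin N → ℝ) × Pt n => DD N x.1 (cd x.2) i) := by
  intro N
  induction N with
  | zero => intro i; exact (measurable_cd i).comp measurable_snd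
  | succ N ih =>
    intro i
    have m1 : Measurable (fun x : (Fin (N+1) → ℝ) × Pt n => ((Fin.tail x.1 : Fin N → ℝ), x.2)) := by
      refine Measurable.prodMk ?_ measurable_snd
      refine measurable_pi_lambda _ fun j => ?_
      simp only [Fin.tail]; fun_prop
    have a := (ih (i+1)).comp m1
    have b := (ih i).comp m1
    simp only [DD]
    refine a.sub (Measurable.mul ?_ b)
    fun_prop

theorem cd_ev {n : ℕ} (t : ℝ) {k : ℕ} (hk : k ≤ n) : cd (ev n t) k = t ^ k := by
  unfold cd ev mom
  split_ifs with h1 h2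
  · simp [h1]
  · simp; congr 1; omega
  · omega

theorem cd_stepSum {n : ℕ} (t σ : Fin (n+1) → ℝ) (k : ℕ) :
    cd (stepSum n t σ) k = ∑ l, σ l * cd (ev n (t l)) k := by
  unfold stepSum stp cd
  split_ifs with h1 h2
  · simp [Prod.fst_sum]
  · simp [Prod.snd_sum]
  · simp

/-- the Möbius estimate -/
theorem mobius_le {S : Set ℝ} (hS : MeasurableSet S) {b c t0 X : ℝ} (hX : 0 < X) (hc : c ≠ 0) :
    volume {t | |t - t0| ≤ X ∧ b + c / (t0 - t) ∈ S} ≤ volume S * ENNReal.ofReal (X^2/|c|) := by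
  set T : Set ℝ := {t | (|t - t0| ≤ X ∧ b + c / (t0 - t) ∈ S) ∧ t ≠ t0} with hT
  set ψ : ℝ → ℝ := fun t => b + c / (t0 - t) with hψ
  have mψ : Measurable ψ := by fun_prop
  have mT : MeasurableSet T := by
    have h1 : MeasurableSet {t : ℝ | |t - t0| ≤ X} := measurableSet_le (by fun_prop) (by fun_prop)
    exact (h1.inter (mψ hS)).inter (measurableSet_singleton t0).compl
  have e1 : volume {t | |t - t0| ≤ X ∧ b + c / (t0 - t) ∈ S} = volume T := by
    refine measure_congr ?_
    have : ∀ᵐ t : ℝ, t ≠ t0 := by simp [ae_iff]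
    filter_upwards [this] with t ht
    simp only [eq_iff_iff]
    constructor
    · intro h; exact ⟨h, ht⟩
    · intro h; exact h.1
  rw [e1]
  have key := lintegral_image_eq_lintegral_abs_deriv_mul (s := T) (f := ψ) (f' := fun t => c / (t0 - t)^2) mT ?_ ?_ (fun _ => 1)
  · simp only [lintegral_const, mul_one, MeasurableSet.univ, Measure.restrict_apply, univ_inter, one_mul] at key
    have h1 : volume (ψ '' T) ≤ volume S := measure_mono (by rintro _ ⟨t, ht, rfl⟩; exact ht.1.2)
    have h2 : ENNReal.ofReal (|c|/X^2) * volume T ≤ volume (ψ '' T) := by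
      rw [key, ← setLIntegral_const]
      refine setLIntegral_mono' mT fun t ht => ?_
      refine ENNReal.ofReal_le_ofReal ?_
      rw [abs_div, abs_of_nonneg (sq_nonneg (t0 - t))]
      have h3 : 0 < (t0 - t)^2 := by
        have : t0 - t ≠ 0 := sub_ne_zero.2 ht.2.symm
        positivity
      have h4 : (t0 - t)^2 ≤ X^2 := by
        rw [sq_le_sq, abs_of_pos hX, abs_sub_comm]; exact ht.1.1
      gcongr
    have hc' : 0 < |c| := abs_pos.2 hc
    have h5 : ENNReal.ofReal (X^2/|c|) * ENNReal.ofReal (|c|/X^2) = 1 := by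
      rw [← ENNReal.ofReal_mul (by positivity)]
      rw [show X^2/|c| * (|c|/X^2) = 1 by field_simp]; simp
    calc volume T = ENNReal.ofReal (X^2/|c|) * (ENNReal.ofReal (|c|/X^2) * volume T) := by rw [← mul_assoc, h5, one_mul]
      _ ≤ ENNReal.ofReal (X^2/|c|) * volume S := by gcongr; exact h2.trans h1
      _ = _ := mul_comm _ _
  · intro t ht
    have h0 : t0 - t ≠ 0 := sub_ne_zero.2 ht.2.symm
    have h := ((hasDerivAt_id t).const_sub t0).fun_inv h0
    have h := (h.const_mul c).const_add b
    refine HasDerivAt.hasDerivWithinAt ?_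
    convert h using 1
    · funext x; simp [hψ, div_eq_mul_inv]
    · simp; field_simp
  · intro t ht t' ht' h
    have h0 : t0 - t ≠ 0 := sub_ne_zero.2 ht.2.symm
    have h0' : t0 - t' ≠ 0 := sub_ne_zero.2 ht'.2.symm
    simp only [hψ] at h
    have h := add_left_cancel h
    rw [div_eq_div_iff h0 h0'] at h
    have := mul_left_cancel₀ hc h
    linarith

section J
variable {N : ℕ} {f : Pt (N+1) → ℝ≥0∞}

def PiP (τ : Fin N → ℝ) (t : ℝ) : ℝ := ∏ j, (t - τ j)

/-- the event of a long second step, for fixed initial data -/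
structure EE (f : Pt (N+1) → ℝ≥0∞) (z0 : Pt (N+1)) (t0 : ℝ) (lo V0 : ℝ≥0∞) (X cm : ℝ)
    (t' : Fin (N+1) → ℝ) (σ : Fin (N+2) → ℝ) : Prop where
  vv : V0 ≤ VV (N+1) (Fin.cons t0 t' : Fin (N+2) → ℝ)
  bd : ∀ j, |t' j - t0| ≤ X
  fe : lo ≤ f (z0 + stepSum (N+1) (Fin.cons t0 t' : Fin (N+2) → ℝ) σ)
  f1 : lo ≤ f (z0 + stp (N+1) (t0, σ 0))
  lo : cm ≤ |σ 1 * (t' 0 - t0) * PiP (Fin.tail t') (t' 0) / PiP (Fin.tail t') t0|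
  p0 : PiP (Fin.tail t') t0 ≠ 0
  t1 : t' 0 ≠ t0

def Bb (z0 : Pt (N+1)) (t0 : ℝ) (x : (Fin N → ℝ) × Pt (N+1)) : ℝ := DD N x.1 (cd (x.2 - z0)) 0 / PiP x.1 t0
def Cc (z0 : Pt (N+1)) (t0 : ℝ) (x : (Fin N → ℝ) × Pt (N+1)) : ℝ :=
  (DD N x.1 (cd (x.2 - z0)) 1 - t0 * DD N x.1 (cd (x.2 - z0)) 0) / PiP x.1 t0

theorem measurable_PiP (t0 : ℝ) : Measurable (fun τ : Fin N → ℝ => PiP τ t0) := by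
  unfold PiP; fun_prop

theorem measurable_Bb (z0 : Pt (N+1)) (t0 : ℝ) : Measurable (Bb z0 t0) := by
  have m1 : Measurable (fun x : (Fin N → ℝ) × Pt (N+1) => (x.1, x.2 - z0)) := by fun_prop
  exact ((measurable_DD N 0).comp m1).div ((measurable_PiP t0).comp measurable_fst)
theorem measurable_Cc (z0 : Pt (N+1)) (t0 : ℝ) : Measurable (Cc z0 t0) := by
  have m1 : Measurable (fun x : (Fin N → ℝ) × Pt (N+1) => (x.1, x.2 - z0)) := by fun_prop
  exact (((measurable_DD N 1).comp m1).sub (((measurable_DD N 0).comp m1).const_mul t0)).div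
    ((measurable_PiP t0).comp measurable_fst)

theorem DD_step (z0 : Pt (N+1)) (t0 : ℝ) (t' : Fin (N+1) → ℝ) (σ : Fin (N+2) → ℝ) {i : ℕ} (hi : i ≤ 1) :
    DD N (Fin.tail t') (cd (z0 + stepSum (N+1) (Fin.cons t0 t' : Fin (N+2) → ℝ) σ - z0)) i
      = σ 0 * (PiP (Fin.tail t') t0 * t0^i) + σ 1 * (PiP (Fin.tail t') (t' 0) * (t' 0)^i) := by
  rw [add_sub_cancel_left]
  have : cd (stepSum (N+1) (Fin.cons t0 t' : Fin (N+2) → ℝ) σ) = fun k => ∑ l, σ l * cd (ev (N+1) ((Fin.cons t0 t' : Fin (N+2) → ℝ) l)) k := by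
    funext k; exact cd_stepSum _ _ _
  rw [this, DD_sum]
  have e : ∀ l, DD N (Fin.tail t') (cd (ev (N+1) ((Fin.cons t0 t' : Fin (N+2) → ℝ) l))) i
      = PiP (Fin.tail t') ((Fin.cons t0 t' : Fin (N+2) → ℝ) l) * ((Fin.cons t0 t' : Fin (N+2) → ℝ) l)^i :=
    fun l => DD_pow _ _ N _ i fun k hk => cd_ev _ (by omega)
  simp only [e]
  rw [Fin.sum_univ_succ, Fin.sum_univ_succ]
  have z : ∀ j : Fin N, PiP (Fin.tail t') (t' j.succ) = 0 := fun j =>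
    Finset.prod_eq_zero (Finset.mem_univ j) (by simp [Fin.tail])
  simp [Fin.cons_succ, z]

theorem EE.hit {z0 : Pt (N+1)} {t0 : ℝ} {lo V0 : ℝ≥0∞} {X cm : ℝ} {t' : Fin (N+1) → ℝ} {σ : Fin (N+2) → ℝ}
    (h : EE f z0 t0 lo V0 X cm t' σ) :
    Cc z0 t0 (Fin.tail t', z0 + stepSum (N+1) (Fin.cons t0 t' : Fin (N+2) → ℝ) σ)
      = σ 1 * (t' 0 - t0) * PiP (Fin.tail t') (t' 0) / PiP (Fin.tail t') t0 ∧
    Bb z0 t0 (Fin.tail t', z0 + stepSum (N+1) (Fin.cons t0 t' : Fin (N+2) → ℝ) σ)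
     + Cc z0 t0 (Fin.tail t', z0 + stepSum (N+1) (Fin.cons t0 t' : Fin (N+2) → ℝ) σ) / (t0 - t' 0) = σ 0 := by
  have h1 := sub_ne_zero.2 h.t1.symm
  have h0 := h.p0
  unfold Bb Cc
  simp only [DD_step z0 t0 t' σ (le_refl 1), DD_step z0 t0 t' σ (zero_le_one)]
  constructor
  · field_simp; ring
  · field_simp; ring

theorem J_le (hf : Measurable f) (z0 : Pt (N+1)) (t0 : ℝ) (lo V0 : ℝ≥0∞) (hV : V0 ≠ ⊤) {X cm : ℝ} (hX : 0 < X) (hc : 0 < cm) :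
    V0 * ∫⁻ t' : Fin (N+1) → ℝ, ∫⁻ σ : Fin (N+2) → ℝ, {σ | EE f z0 t0 lo V0 X cm t' σ}.indicator 1 σ
      ≤ volume {σ : ℝ | lo ≤ f (z0 + stp (N+1) (t0, σ))} * ENNReal.ofReal (X^2/cm)
         * (ENNReal.ofReal (2*X) ^ N * volume {z | lo ≤ f z}) := by
  set S : Set ℝ := {σ : ℝ | lo ≤ f (z0 + stp (N+1) (t0, σ))} with hSd
  have mS : MeasurableSet S := measurableSet_le measurable_const (by fun_prop)
  have mB := measurable_Bb (N := N) z0 t0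
  have mC := measurable_Cc (N := N) z0 t0
  set Q : Set ((Fin N → ℝ) × Pt (N+1)) := {x | ((∀ j, |x.1 j - t0| ≤ X) ∧ lo ≤ f x.2)} with hQ
  set U : Set (ℝ × ((Fin N → ℝ) × Pt (N+1))) := {y | y.2 ∈ Q ∧ cm ≤ |Cc z0 t0 y.2| ∧ |y.1 - t0| ≤ X ∧
     Bb z0 t0 y.2 + Cc z0 t0 y.2 / (t0 - y.1) ∈ S} with hU
  have mQ : MeasurableSet Q := by
    have h2 : MeasurableSet {x : (Fin N → ℝ) × Pt (N+1) | lo ≤ f x.2} := measurableSet_le measurable_const (by fun_prop)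
    refine MeasurableSet.inter ?_ h2
    have : {x : (Fin N → ℝ) × Pt (N+1) | ∀ j, |x.1 j - t0| ≤ X} = ⋂ j, {x | |x.1 j - t0| ≤ X} := by ext; simp
    change MeasurableSet {x : (Fin N → ℝ) × Pt (N+1) | ∀ j, |x.1 j - t0| ≤ X}
    rw [this]
    refine MeasurableSet.iInter fun j => measurableSet_le (by fun_prop) (by fun_prop)
  have mU : MeasurableSet U := by
    have h1 : MeasurableSet {y : ℝ × ((Fin N → ℝ) × Pt (N+1)) | cm ≤ |Cc z0 t0 y.2|} := measurableSet_le measurable_const (by fun_prop)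
    have h2 : MeasurableSet {y : ℝ × ((Fin N → ℝ) × Pt (N+1)) | |y.1 - t0| ≤ X} := measurableSet_le (by fun_prop) measurable_const
    refine (measurable_snd mQ).inter (h1.inter (h2.inter ?_))
    have : Measurable (fun y : ℝ × ((Fin N → ℝ) × Pt (N+1)) => Bb z0 t0 y.2 + Cc z0 t0 y.2 / (t0 - y.1)) := by fun_prop
    exact this mS
  set g : (Fin (N+1) → ℝ) → Pt (N+1) → ℝ≥0∞ := fun t' z => U.indicator 1 (t' 0, (Fin.tail t', z)) with hg
  have mtail : Measurable (fun t' : Fin (N+1) → ℝ => (Fin.tail t' : Fin N → ℝ)) := by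
    refine measurable_pi_lambda _ fun j => ?_
    simp only [Fin.tail]; fun_prop
  have mI : Measurable (U.indicator (1 : ℝ × ((Fin N → ℝ) × Pt (N+1)) → ℝ≥0∞)) := measurable_one.indicator mU
  have mg : Measurable (fun x : (Fin (N+1) → ℝ) × Pt (N+1) => g x.1 x.2) := by
    exact mI.comp (by fun_prop)
  have s1 : ∀ t', V0 * ∫⁻ σ : Fin (N+2) → ℝ, {σ | EE f z0 t0 lo V0 X cm t' σ}.indicator 1 σ ≤ ∫⁻ z, g t' z := by
    intro t'
    by_cases hv : V0 ≤ VV (N+1) (Fin.cons t0 t' : Fin (N+2) → ℝ)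
    · refine le_trans (mul_le_mul' hv ?_) (lin_le (Fin.cons t0 t' : Fin (N+2) → ℝ) z0 (g t') (mg.comp measurable_prodMk_left))
      refine lintegral_mono fun σ => ?_
      by_cases he : EE f z0 t0 lo V0 X cm t' σ
      · obtain ⟨h1, h2⟩ := he.hit
        have : ((t' 0, (Fin.tail t', z0 + stepSum (N+1) (Fin.cons t0 t' : Fin (N+2) → ℝ) σ)) : ℝ × ((Fin N → ℝ) × Pt (N+1))) ∈ U := by
          refine ⟨⟨fun j => he.bd j.succ, he.fe⟩, ?_, he.bd 0, ?_⟩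
          · rw [h1]; exact he.lo
          · change _ + _ ∈ S
            rw [h2]; exact he.f1
        simp only [hg]
        rw [indicator_of_mem this, indicator_of_mem (by exact he)]
        exact le_rfl
      · rw [indicator_of_notMem (by exact he)]; exact zero_le
    · have : {σ | EE f z0 t0 lo V0 X cm t' σ} = ∅ := by
        ext σ; simp only [mem_ofPred_eq, mem_empty_iff_false, iff_false]; exact fun h => hv h.vv
      simp [this]
  rw [← lintegral_const_mul' _ _ hV]
  refine (lintegral_mono s1).trans ?_
  rw [lintegral_cons _ mg.lintegral_prod_right']
  have s2 : ∀ b : ℝ, ∫⁻ a' : Fin N → ℝ, ∫⁻ z, g (Fin.cons b a') z = ∫⁻ x : (Fin N → ℝ) × Pt (N+1), U.indicator 1 (b, x) := by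
    intro b
    have := lintegral_prod (μ := (volume : Measure (Fin N → ℝ))) (ν := (volume : Measure (Pt (N+1)))) (fun x => U.indicator 1 (b, x))
      (mI.comp measurable_prodMk_left).aemeasurable
    rw [Measure.volume_eq_prod (Fin N → ℝ), this]
    simp only [hg, Fin.cons_zero, Fin.tail_cons]
  simp only [s2]
  rw [lintegral_lintegral_swap (by exact mI.aemeasurable)]
  have s3 : ∀ x : (Fin N → ℝ) × Pt (N+1), ∫⁻ b : ℝ, U.indicator 1 (b, x) ≤ volume S * ENNReal.ofReal (X^2/cm) * Q.indicator 1 x := by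
    intro x
    by_cases hx : x ∈ Q ∧ cm ≤ |Cc z0 t0 x|
    · have e : (fun b : ℝ => U.indicator (1 : ℝ × ((Fin N → ℝ) × Pt (N+1)) → ℝ≥0∞) (b, x)) = {t | |t - t0| ≤ X ∧ Bb z0 t0 x + Cc z0 t0 x / (t0 - t) ∈ S}.indicator 1 := by
        funext b
        by_cases hb : |b - t0| ≤ X ∧ Bb z0 t0 x + Cc z0 t0 x / (t0 - b) ∈ S
        · rw [indicator_of_mem (show (b, x) ∈ U from ⟨hx.1, hx.2, hb⟩), indicator_of_mem (by exact hb)]; rfl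
        · rw [indicator_of_notMem (fun h : (b, x) ∈ U => hb h.2.2), indicator_of_notMem (by exact hb)]
      rw [e, indicator_of_mem hx.1, Pi.one_apply, mul_one]
      refine (lintegral_indicator_one_le _).trans ?_
      have c0 : 0 < |Cc z0 t0 x| := hc.trans_le hx.2
      refine (mobius_le mS hX (abs_pos.1 c0)).trans ?_
      gcongr
      exact hx.2
    · have e : ∀ b : ℝ, U.indicator (1 : ℝ × ((Fin N → ℝ) × Pt (N+1)) → ℝ≥0∞) (b, x) = 0 := fun b => indicator_of_notMem (fun h : (b, x) ∈ U => hx ⟨h.1, h.2.1⟩) _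
      simp [e]
  refine (lintegral_mono s3).trans ?_
  rw [lintegral_const_mul _ (measurable_one.indicator mQ), lintegral_indicator_one mQ]
  gcongr
  have : Q = (Set.pi univ fun _ => Icc (t0 - X) (t0 + X)) ×ˢ {z | lo ≤ f z} := by
    ext x
    simp only [hQ, mem_ofPred_eq, mem_prod, Set.mem_pi, mem_univ, true_imp_iff, mem_Icc, abs_le]
    refine and_congr_left fun _ => forall_congr' fun j => ?_
    constructor <;> rintro ⟨a, b⟩ <;> constructor <;> linarith
  rw [this, Measure.volume_eq_prod, Measure.prod_prod, volume_pi_pi]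
  simp only [Real.volume_Icc, Finset.prod_const, Finset.card_univ, Fintype.card_fin]
  rw [show t0 + X - (t0 - X) = 2*X by ring]
end J

theorem le_of_lg {x y : ℝ≥0∞} (hx : Fp x) (hy : Fp y) (h : lg x ≤ lg y) : x ≤ y := by
  rw [← ENNReal.toReal_le_toReal hx.2 hy.2]
  exact (Real.log_le_log_iff hx.pos hy.pos).1 h
theorem Fp_exp (r : ℝ) : Fp (ENNReal.ofReal (Real.exp r)) := Fp_ofReal (Real.exp_pos r)
theorem lg_exp (r : ℝ) : lg (ENNReal.ofReal (Real.exp r)) = r := by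
  rw [lg, ENNReal.toReal_ofReal (Real.exp_pos r).le, Real.log_exp]
theorem lg_ofReal {r : ℝ} (hr : 0 ≤ r) : lg (ENNReal.ofReal r) = Real.log r := by
  rw [lg, ENNReal.toReal_ofReal hr]
theorem eq_exp {x : ℝ≥0∞} (hx : Fp x) : x = ENNReal.ofReal (Real.exp (lg x)) := by
  rw [lg, Real.exp_log hx.pos, ENNReal.ofReal_toReal hx.2]
theorem exp_mul (a b : ℝ) : ENNReal.ofReal (Real.exp a) * ENNReal.ofReal (Real.exp b) = ENNReal.ofReal (Real.exp (a+b)) := by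
  rw [← ENNReal.ofReal_mul (Real.exp_pos _).le, Real.exp_add]
theorem exp_inv (a : ℝ) : (ENNReal.ofReal (Real.exp a))⁻¹ = ENNReal.ofReal (Real.exp (-a)) := by
  rw [← ENNReal.ofReal_inv_of_pos (Real.exp_pos _), Real.exp_neg]
theorem exp_pow (a : ℝ) (k : ℕ) : (ENNReal.ofReal (Real.exp a))^k = ENNReal.ofReal (Real.exp (k*a)) := by
  rw [← ENNReal.ofReal_pow (Real.exp_pos _).le, ← Real.exp_nat_mul]
theorem exp_rpow (a k : ℝ) : (ENNReal.ofReal (Real.exp a))^k = ENNReal.ofReal (Real.exp (k*a)) := by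
  rw [ENNReal.ofReal_rpow_of_pos (Real.exp_pos _), ← Real.exp_mul, mul_comm]

theorem markov {α : Type*} [MeasurableSpace α] {μ : Measure α} {g : α → ℝ≥0∞} (hg : Measurable g) {lo : ℝ≥0∞} (hl : Fp lo) :
    μ {x | lo ≤ g x} ≤ lo⁻¹ * ∫⁻ x, g x ∂μ := by
  rw [mul_comm, ← div_eq_mul_inv]
  exact meas_ge_le_lintegral_div hg.aemeasurable hl.1 hl.2

section dens
variable {n : ℕ} {f : Pt n → ℝ≥0∞} {m : Pt n × ℝ → ℝ≥0∞} {p κ : ℝ} {x : Pt n × (Fin (n+1) → ℝ × ℝ)}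

/-- log of the length scale and of the angular scale -/
def lA (f : Pt n → ℝ≥0∞) (u : Pt n × ℝ) : ℝ := lg (hX f u) - lg (f u.1)

theorem GG.u0 (_ : GG f m p κ x) : uP 0 x = (x.1, tv x 0) := by simp [uP, tv, pos_zero]

theorem GG.dens (g : GG f m p κ x) : muF m x.1 * Wt m x.1 x.2 ≤
    m (x.1, tv x 0) * ENNReal.ofReal (Real.exp (n * lg (rhoF m (tv x 0)) - (n+1) * lA f (x.1, tv x 0) + (3*n+2) * κ)) := by
  obtain ⟨fW, lW⟩ := g.g0.Wt
  have e0 := g.u0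
  have fm := (g.g0.1 0).1
  have fmu := (g.g0.1 0).2.2.2.2.1
  rw [e0] at fm fmu
  refine le_of_lg (fmu.mul fW) (fm.mul (Fp_exp _)) ?_
  rw [lg_mul fmu fW, lg_mul fm (Fp_exp _), lg_exp, lW]
  rw [Finset.sum_add_distrib]
  have s2 : ∑ l : Fin (n+1), (lg (m (vP l x)) - lg (LF m (uP l x))) ≤ ∑ l : Fin (n+1), (2 * κ - lA f (x.1, tv x 0)) := by
    refine Finset.sum_le_sum fun l _ => ?_
    rw [g.mL l]
    have a := abs_le.1 (g.df (l.1+1) (by omega))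
    have b := abs_le.1 (g.dh l)
    rw [e0] at b
    simp only [lA]
    linarith [a.1, a.2, b.1, b.2]
  have s1 : ∑ l : Fin (n+1), (lg (m (uP l x)) - lg (muF m (uP l x).1)) ≤
     (lg (m (x.1, tv x 0)) - lg (muF m x.1)) + ∑ l : Fin n, (lg (rhoF m (tv x 0)) + κ) := by
    rw [Fin.sum_univ_succ, e0]
    refine add_le_add le_rfl (Finset.sum_le_sum fun l _ => ?_)
    have a := abs_le.1 (g.dp l.succ)
    linarith [a.1, a.2]
  simp only [Finset.sum_const, Finset.card_univ, Fintype.card_fin, nsmul_eq_mul] at s1 s2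
  push_cast at s2
  linarith

theorem GG.vv (g : GG f m p κ x) : ENNReal.ofReal (Real.exp (- (D0 n * (lg (rhoF m (tv x 0)) + κ)))) ≤ VV n (tv x) := by
  rw [VV_eq]
  have F : ∀ i, ∀ k ∈ Finset.Ioi i, Fp (ENNReal.ofReal |tv x i - tv x k|) := fun i k hk =>
    Fp_ofReal (abs_pos.2 (g.g0.2 i k (Finset.mem_Ioi.1 hk)))
  have F' : ∀ i ∈ Finset.univ, Fp (∏ k ∈ Finset.Ioi i, ENNReal.ofReal |tv x i - tv x k|) := fun i _ => Fp.prod (F i)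
  refine le_of_lg (Fp_exp _) (Fp.prod F') ?_
  rw [lg_exp, lg_prod F']
  have : ∀ i, ((Finset.Ioi i).card : ℝ) * (-(lg (rhoF m (tv x 0)) + κ)) ≤ lg (∏ k ∈ Finset.Ioi i, ENNReal.ofReal |tv x i - tv x k|) := by
    intro i
    rw [lg_prod (F i), ← nsmul_eq_mul]
    refine Finset.card_nsmul_le_sum _ _ _ fun k hk => ?_
    have := abs_le.1 (g.dt i k (Finset.mem_Ioi.1 hk))
    linarith [this.1]
  refine le_trans (le_of_eq ?_) (Finset.sum_le_sum fun i _ => this i)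
  rw [← Finset.sum_mul]
  have : ∑ i : Fin (n+1), ((Finset.Ioi i).card : ℝ) = D0 n := by
    simp only [Fin.card_Ioi]
    have h2 : ∑ i : Fin (n+1), (((n + 1 - 1 - i.1 : ℕ)) : ℝ) = ∑ i ∈ Finset.range (n+1), (((n - i : ℕ)) : ℝ) := by
      rw [Finset.sum_range]; simp
    rw [h2]
    have h3 := Finset.sum_range_reflect (fun i => (i:ℝ)) (n+1)
    simp only [Nat.add_sub_cancel] at h3
    have h4 := Finset.sum_range_id_mul_two (n+1)
    have h4' : (∑ i ∈ Finset.range (n+1), (i:ℝ)) * 2 = (n+1) * n := by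
      have := congrArg (fun a : ℕ => (a:ℝ)) h4
      simpa using this
    rw [h3]; unfold D0; linarith
  rw [this]; ring
end dens

section long
variable {N : ℕ} {f : Pt (N+1) → ℝ≥0∞} {m : Pt (N+1) × ℝ → ℝ≥0∞} {p κ : ℝ}

def Lg {n : ℕ} (f : Pt n → ℝ≥0∞) (R : ℝ) : Set (Pt n × (ℝ × ℝ)) :=
  {y | ENNReal.ofReal R * hX f (y.1, y.2.1) ≤ ENNReal.ofReal |y.2.2| * f y.1}

theorem measurable_Lg {n : ℕ} {f : Pt n → ℝ≥0∞} (hf : Measurable f) (R : ℝ) : MeasurableSet (Lg f R) := by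
  have := measurable_hX hf
  exact measurableSet_le (by fun_prop) (by fun_prop)

theorem Lg_log {n : ℕ} {f : Pt n → ℝ≥0∞} {R : ℝ} (hR : 0 < R) {y : Pt n × (ℝ × ℝ)} (hy : y ∈ Lg f R)
   (h1 : Fp (hX f (y.1, y.2.1))) (h2 : Fp (f y.1)) : y.2.2 ≠ 0 ∧ Real.log R + lA f (y.1, y.2.1) ≤ Real.log |y.2.2| := by
  have hy' : ENNReal.ofReal R * hX f (y.1, y.2.1) ≤ ENNReal.ofReal |y.2.2| * f y.1 := hy
  have hF := (Fp_ofReal hR).mul h1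
  have h0 : y.2.2 ≠ 0 := by
    intro h
    rw [h] at hy'
    simp at hy'
    rcases hy' with h | h
    · linarith
    · exact h1.1 h
  refine ⟨h0, ?_⟩
  have a0 := Fp_ofReal (abs_pos.2 h0)
  have := lg_mono hF (a0.mul h2).2 hy'
  rw [lg_mul (Fp_ofReal hR) h1, lg_mul a0 h2, lg_ofReal hR.le, lg_ofReal (abs_nonneg _)] at this
  unfold lA; simp only; linarith

theorem GG.EE {z0 : Pt (N+1)} {t0 : ℝ} {t' : Fin (N+1) → ℝ} {σ : Fin (N+2) → ℝ} {R : ℝ} (hR : 0 < R)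
    (g : GG f m p κ (z0, fun i => ((Fin.cons t0 t' : Fin (N+2) → ℝ) i, σ i)))
    (hl : (pos z0 (fun i => ((Fin.cons t0 t' : Fin (N+2) → ℝ) i, σ i)) 1, (t' 0, σ 1)) ∈ Lg f R) :
    EE f z0 t0 (f z0 * ENNReal.ofReal (Real.exp (-κ))) (ENNReal.ofReal (Real.exp (- (D0 (N+1) * (lg (rhoF m t0) + κ)))))
      (Real.exp (κ - lg (rhoF m t0))) (Real.exp (Real.log R + lA f (z0, t0) - lg (rhoF m t0) - (3 + 2*N)*κ)) t' σ := by
  set x : Pt (N+1) × (Fin (N+2) → ℝ × ℝ) := (z0, fun i => ((Fin.cons t0 t' : Fin (N+2) → ℝ) i, σ i)) with hx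
  have tv0 : tv x 0 = t0 := rfl
  have tvs : ∀ j : Fin (N+1), tv x j.succ = t' j := fun j => rfl
  have u0 := g.u0
  have f0 : Fp (f z0) := by simpa [pos_zero] using g.ff 0 (by omega)
  have dt : ∀ i k : Fin (N+2), i < k → Real.exp (-lg (rhoF m t0) - κ) ≤ |tv x i - tv x k| ∧ |tv x i - tv x k| ≤ Real.exp (κ - lg (rhoF m t0)) := by
    intro i k hik
    have h := abs_le.1 (g.dt i k hik)
    have h0 := abs_pos.2 (g.g0.2 i k hik)
    rw [lg_ofReal (abs_nonneg _), tv0] at h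
    constructor
    · rw [← Real.le_log_iff_exp_le h0]; linarith [h.1]
    · rw [← Real.log_le_iff_le_exp h0]; linarith [h.2]
  have lo : ∀ k ≤ N+2, f z0 * ENNReal.ofReal (Real.exp (-κ)) ≤ f (pos x.1 x.2 k) := by
    intro k hk
    refine le_of_lg (f0.mul (Fp_exp _)) (g.ff k hk) ?_
    rw [lg_mul f0 (Fp_exp _), lg_exp]
    linarith [(abs_le.1 (g.df k hk)).1]
  have d0 : ∀ j : Fin (N+1), |t0 - t' j| ≤ Real.exp (κ - lg (rhoF m t0)) := fun j => (dt 0 j.succ (Fin.succ_pos j)).2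
  have n0 : ∀ j : Fin (N+1), t0 - t' j ≠ 0 := fun j => g.g0.2 0 j.succ (Fin.succ_pos j)
  have P0 : PiP (Fin.tail t') t0 ≠ 0 := Finset.prod_ne_zero_iff.2 fun j _ => n0 j.succ
  refine ⟨?_, ?_, ?_, ?_, ?_, P0, ?_⟩
  · have := g.vv
    rw [tv0] at this
    convert this using 2
    push_cast; rfl
  · intro j; rw [abs_sub_comm]; exact d0 j
  · have := lo (N+2) le_rfl
    have h2 := pos_last z0 x.2
    change _ ≤ f (pos z0 x.2 (N+1+1)) at this
    rwa [h2] at this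
  · have := lo 1 (by omega)
    have h2 := pos_succ z0 x.2 (0 : Fin (N+2))
    change _ ≤ f (pos z0 x.2 1) at this
    simp only [Fin.val_zero, zero_add, pos_zero] at h2
    rwa [h2] at this
  · have u1 : uP 1 x = (pos z0 x.2 1, t' 0) := rfl
    have h1 := g.fh 1
    rw [u1] at h1
    have h2 := g.ff 1 (by omega)
    obtain ⟨s0, s1⟩ := Lg_log hR hl h1 h2
    have a1 := abs_le.1 (g.df 1 (by omega))
    have a2 := abs_le.1 (g.dh 1)
    rw [u0, u1, tv0] at a2
    have s2 : Real.log R + lA f (z0, t0) - 2 * κ ≤ Real.log |σ 1| := by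
      simp only [lA] at s1 ⊢
      linarith [a1.1, a1.2, a2.1, a2.2]
    have s3 : Real.exp (Real.log R + lA f (z0, t0) - 2 * κ) ≤ |σ 1| :=
      (Real.le_log_iff_exp_le (abs_pos.2 s0)).1 s2
    have s4 : Real.exp (-lg (rhoF m t0) - κ) ≤ |t' 0 - t0| := by rw [abs_sub_comm]; exact (dt 0 1 (by simp)).1
    have s5 : Real.exp (N * (-2*κ)) ≤ |PiP (Fin.tail t') (t' 0) / PiP (Fin.tail t') t0| := by
      unfold PiP
      rw [← Finset.prod_div_distrib, Finset.abs_prod, Real.exp_nat_mul]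
      have : ∏ j : Fin N, Real.exp (-2*κ) = Real.exp (-2*κ) ^ N := by simp
      rw [← this]
      refine Finset.prod_le_prod (fun _ _ => (Real.exp_pos _).le) fun j _ => ?_
      rw [abs_div]
      change _ ≤ |t' 0 - t' j.succ| / |t0 - t' j.succ|
      rw [le_div_iff₀ (abs_pos.2 (n0 j.succ))]
      have b1 := d0 j.succ
      have b2 := (dt 1 j.succ.succ (by rw [Fin.lt_def]; simp)).1
      refine le_trans (mul_le_mul_of_nonneg_left b1 (Real.exp_pos _).le) ?_
      rw [← Real.exp_add]
      refine le_trans (Real.exp_le_exp.2 (by linarith)) b2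
    rw [mul_div_assoc, abs_mul, abs_mul]
    have : Real.log R + lA f (z0, t0) - lg (rhoF m t0) - (3 + 2*N)*κ = (Real.log R + lA f (z0, t0) - 2 * κ) + (-lg (rhoF m t0) - κ) + N * (-2*κ) := by ring
    rw [this, Real.exp_add, Real.exp_add]
    gcongr
  · have := n0 0
    intro h; apply this; rw [h]; ring

def LK (N : ℕ) (p κ : ℝ) : ℝ := κ * (D0 (N+1) + p + 6 * (N+1) + 6) + N * Real.log 2

theorem GG.slice (hf : Measurable f) (hp : 0 < p) (h1 : ∫⁻ z, f z ^ p ≤ 1) {R : ℝ} (hR : 0 < R) (z0 : Pt (N+1)) (t0 : ℝ)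
   (G : Set (Pt (N+1) × (Fin (N+2) → ℝ × ℝ)))
   (hG : ∀ x ∈ G, GG f m p κ x ∧ (pos x.1 x.2 1, x.2 1) ∈ Lg f R) :
   ∫⁻ t' : Fin (N+1) → ℝ, ∫⁻ σ : Fin (N+2) → ℝ, muF m z0 * (Wt m z0 (fun i => ((Fin.cons t0 t' : Fin (N+2) → ℝ) i, σ i))
     * G.indicator 1 (z0, fun i => ((Fin.cons t0 t' : Fin (N+2) → ℝ) i, σ i))) ≤ m (z0, t0) * ENNReal.ofReal (Real.exp (LK N p κ) / R) := by
  by_cases hw : ∃ (t' : Fin (N+1) → ℝ) (σ : Fin (N+2) → ℝ), ((z0, fun i => ((Fin.cons t0 t' : Fin (N+2) → ℝ) i, σ i)) : Pt (N+1) × (Fin (N+2) → ℝ × ℝ)) ∈ G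
  swap
  · push Not at hw
    have : ∀ (t' : Fin (N+1) → ℝ) (σ : Fin (N+2) → ℝ), G.indicator (1 : Pt (N+1) × (Fin (N+2) → ℝ × ℝ) → ℝ≥0∞) (z0, fun i => ((Fin.cons t0 t' : Fin (N+2) → ℝ) i, σ i)) = 0 := fun t' σ =>
      indicator_of_notMem (hw t' σ) _
    simp [this]
  obtain ⟨t1, σ1, hw⟩ := hw
  obtain ⟨gw, -⟩ := hG _ hw
  have fm : Fp (m (z0, t0)) := by have := (gw.g0.1 0).1; rwa [gw.u0] at this
  have f0 : Fp (f z0) := by simpa [pos_zero] using gw.ff 0 (by omega)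
  have fh : Fp (hX f (z0, t0)) := by have := gw.fh 0; rwa [gw.u0] at this
  have sc := gw.sc
  rw [gw.u0] at sc
  have tv0 : tv ((z0, fun i => ((Fin.cons t0 t1 : Fin (N+2) → ℝ) i, σ1 i)) : Pt (N+1) × (Fin (N+2) → ℝ × ℝ)) 0 = t0 := rfl
  rw [tv0] at sc
  set a := lg (rhoF m t0) with ha
  set b := lA f (z0, t0) with hb
  set lo := f z0 * ENNReal.ofReal (Real.exp (-κ)) with hlo
  set V0 := ENNReal.ofReal (Real.exp (- (D0 (N+1) * (a + κ)))) with hV0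
  set X := Real.exp (κ - a) with hXX
  set cm := Real.exp (Real.log R + b - a - (3 + 2*N)*κ) with hcm
  set D := ENNReal.ofReal (Real.exp ((N+1:ℕ) * a - ((N+1:ℕ)+1) * b + (3*(N+1:ℕ)+2) * κ)) with hD
  have flo : Fp lo := f0.mul (Fp_exp _)
  have step : ∀ (t' : Fin (N+1) → ℝ) (σ : Fin (N+2) → ℝ), muF m z0 * (Wt m z0 (fun i => ((Fin.cons t0 t' : Fin (N+2) → ℝ) i, σ i))
     * G.indicator 1 (z0, fun i => ((Fin.cons t0 t' : Fin (N+2) → ℝ) i, σ i))) ≤ m (z0, t0) * D * {σ | _root_.EE f z0 t0 lo V0 X cm t' σ}.indicator 1 σ := by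
    intro t' σ
    by_cases hx : ((z0, fun i => ((Fin.cons t0 t' : Fin (N+2) → ℝ) i, σ i)) : Pt (N+1) × (Fin (N+2) → ℝ × ℝ)) ∈ G
    · obtain ⟨g, hl⟩ := hG _ hx
      rw [indicator_of_mem hx, Pi.one_apply, mul_one]
      have e := GG.EE hR g hl
      rw [indicator_of_mem (by exact e), Pi.one_apply, mul_one]
      exact g.dens
    · rw [indicator_of_notMem hx]; simp
  refine (lintegral_mono fun t' => lintegral_mono fun σ => step t' σ).trans ?_
  have cT : m (z0, t0) * D ≠ ⊤ := (fm.mul (Fp_exp _)).2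
  simp only [lintegral_const_mul' _ _ cT]
  rw [mul_assoc]
  refine mul_le_mul_right ?_ _
  have J := J_le hf z0 t0 lo V0 (Fp_exp _).2 (Real.exp_pos (κ - a)) (Real.exp_pos (Real.log R + b - a - (3 + 2*N)*κ))
  set I := ∫⁻ t' : Fin (N+1) → ℝ, ∫⁻ σ : Fin (N+2) → ℝ, {σ | _root_.EE f z0 t0 lo V0 X cm t' σ}.indicator (1 : (Fin (N+2) → ℝ) → ℝ≥0∞) σ with hI
  have lgf : f z0 = ENNReal.ofReal (Real.exp (lg (f z0))) := eq_exp f0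
  have hlo' : lo = ENNReal.ofReal (Real.exp (lg (f z0) - κ)) := by rw [hlo]; nth_rewrite 1 [lgf]; rw [exp_mul]; rfl
  have vS : volume {σ : ℝ | lo ≤ f (z0 + stp (N+1) (t0, σ))} ≤ ENNReal.ofReal (Real.exp (b + κ)) := by
    refine (markov (by fun_prop) flo).trans ?_
    change lo⁻¹ * hX f (z0, t0) ≤ _
    rw [hlo', exp_inv, eq_exp fh, exp_mul]
    refine le_of_eq ?_
    congr 2; rw [hb, lA]; ring
  have vf : volume {z | lo ≤ f z} ≤ ENNReal.ofReal (Real.exp (p*κ + κ + (N+2)*b - D0 (N+1) * a)) := by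
    have : {z | lo ≤ f z} = {z | lo ^ p ≤ f z ^ p} := by
      ext z; simp only [mem_ofPred_eq]; exact (ENNReal.rpow_le_rpow_iff hp).symm
    rw [this]
    refine (markov (by fun_prop) (flo.rpow p)).trans ?_
    refine (mul_le_mul_right h1 _).trans ?_
    rw [mul_one, hlo', exp_rpow, exp_inv]
    refine ENNReal.ofReal_le_ofReal (Real.exp_le_exp.2 ?_)
    have := (abs_le.1 sc).1
    rw [hb, lA]
    push_cast at this
    simp only
    nlinarith
  have J2 := J.trans (mul_le_mul' (mul_le_mul' vS le_rfl) (mul_le_mul' le_rfl vf))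
  have x1 : ENNReal.ofReal (Real.exp (κ - a)^2 / Real.exp (Real.log R + b - a - (3 + 2*N)*κ)) = ENNReal.ofReal (Real.exp (2*(κ-a) - (Real.log R + b - a - (3 + 2*N)*κ))) := by
    rw [← Real.exp_nat_mul, ← Real.exp_sub]; norm_num
  have x2 : ENNReal.ofReal (2 * Real.exp (κ - a)) ^ N = ENNReal.ofReal (Real.exp (N * (Real.log 2 + (κ - a)))) := by
    rw [← exp_pow, Real.exp_add, Real.exp_log two_pos]
  rw [x1, x2, exp_mul, exp_mul, exp_mul] at J2
  have J3 : I ≤ V0⁻¹ * ENNReal.ofReal (Real.exp (b + κ + (2*(κ-a) - (Real.log R + b - a - (3 + 2*N)*κ)) + (N * (Real.log 2 + (κ - a)) + (p*κ + κ + (N+2)*b - D0 (N+1) * a)))) := by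
    have : I = V0⁻¹ * (V0 * I) := by
      rw [← mul_assoc, ENNReal.inv_mul_cancel (Fp_exp _).1 (Fp_exp _).2, one_mul]
    rw [this]
    exact mul_le_mul_right J2 _
  rw [hV0, exp_inv, exp_mul] at J3
  refine (mul_le_mul_right J3 _).trans ?_
  rw [hD, exp_mul]
  have : Real.exp (LK N p κ) / R = Real.exp (LK N p κ - Real.log R) := by rw [Real.exp_sub, Real.exp_log hR]
  rw [this]
  refine ENNReal.ofReal_le_ofReal (Real.exp_le_exp.2 (le_of_eq ?_))
  unfold LK
  push_cast
  ring
end long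

section sym
variable {n : ℕ}

structure SymS (φ : Pt n → Pt n) (J a b t0 : ℝ) : Prop where
  ha : 0 < a
  hb : 0 < b
  hJ : J = a ^ (n+1) * b ^ (n*(n+1)/2)
  hφ : Continuous φ
  st : ∀ z t σ, φ (z + stp n (t, σ)) = φ z + stp n (t0 + b*t, a*σ)

theorem Gmat_add (t : ℝ) (x y : Fin n → ℝ) : Gmat n t (x + y) = Gmat n t x + Gmat n t y := by
  funext m; simp [Gmat, mul_add, Finset.sum_add_distrib]
theorem Gmat_smul (t c : ℝ) (x : Fin n → ℝ) : Gmat n t (c • x) = c • Gmat n t x := by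
  funext m; simp only [Gmat, Pi.smul_apply, smul_eq_mul, Finset.mul_sum]
  refine Finset.sum_congr rfl fun i _ => by ring
theorem Gmat_mom (t0 t : ℝ) : Gmat n t0 (mom n t) + mom n t0 = mom n (t0 + t) := by
  funext m
  simp only [Gmat, mom, Pi.add_apply]
  rw [add_comm t0 t, add_pow, Finset.sum_range_succ']
  simp only [pow_zero, Nat.choose_zero_right, Nat.cast_one, one_mul, mul_one, Nat.sub_zero]
  congr 1
  have h1 : ∀ k : ℕ, t ^ (k+1) * t0 ^ (m.1+1-(k+1)) * ((m.1+1).choose (k+1)) = ((m.1+1).choose (k+1)) * t0^(m.1-k) * t^(k+1) := by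
    intro k
    rw [Nat.add_sub_add_right]; ring
  simp only [h1]
  refine Finset.sum_bij' (fun i _ => i.1) (fun k hk => ⟨k, lt_of_lt_of_le (Finset.mem_range.1 hk) m.2⟩) ?_ ?_ ?_ ?_ ?_
  · intro i hi; simp only [Finset.mem_filter, Finset.mem_univ, true_and] at hi
    exact Finset.mem_range.2 (Nat.lt_succ_of_le hi)
  · intro k hk; simp only [Finset.mem_filter, Finset.mem_univ, true_and]
    exact Fin.le_def.2 (Nat.lt_succ_iff.1 (Finset.mem_range.1 hk))
  · intro i _; rfl
  · intro k _; rfl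
  · intro i _; rfl

theorem IsSymJ.sym {φ : Pt n → Pt n} {J : ℝ} (h : IsSymJ n φ J) : ∃ a b t0, SymS φ J a b t0 := by
  induction h with
  | translation v =>
    refine ⟨1, 1, 0, one_pos, one_pos, by simp, by fun_prop, fun z t σ => ?_⟩
    simp only [stp, ev, zero_add, one_mul]
    ext <;> simp; ring
  | scaling α β hα hβ =>
    refine ⟨α, β, 0, hα, hβ, rfl, by fun_prop, fun z t σ => ?_⟩
    simp only [stp, ev, zero_add]
    ext i
    · simp; ring
    · simp [mom, mul_pow]; ring
  | shift s₀ t₀ =>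
    refine ⟨1, 1, t₀, one_pos, one_pos, by simp, ?_, fun z t σ => ?_⟩
    · unfold Gmat; fun_prop
    · simp only [stp, ev, one_mul]
      refine Prod.ext ?_ ?_
      · simp; ring
      · simp only [Prod.snd_add, Prod.smul_snd, Prod.fst_add, Prod.smul_fst, smul_eq_mul, mul_one]
        rw [Gmat_add, Gmat_smul, ← Gmat_mom]
        module
  | comp φ ψ J₁ J₂ _ _ h1 h2 =>
    obtain ⟨a1, b1, t1, g1⟩ := h1
    obtain ⟨a2, b2, t2, g2⟩ := h2
    refine ⟨a1*a2, b1*b2, t1 + b1*t2, mul_pos g1.ha g2.ha, mul_pos g1.hb g2.hb, ?_, g1.hφ.comp g2.hφ, fun z t σ => ?_⟩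
    · rw [g1.hJ, g2.hJ, mul_pow, mul_pow]; ring
    · simp only [Function.comp_apply, g2.st, g1.st]
      congr 3
      · ring
      · ring

theorem sum_Ioi_card : ∑ i : Fin (n+1), (Finset.Ioi i).card = n*(n+1)/2 := by
  simp only [Fin.card_Ioi]
  have h2 : ∑ i : Fin (n+1), (n + 1 - 1 - i.1 : ℕ) = ∑ i ∈ Finset.range (n+1), (n - i : ℕ) := by
    rw [Finset.sum_range]; simp
  rw [h2]
  have h3 := Finset.sum_range_reflect (fun i => i) (n+1)
  simp only [Nat.add_sub_cancel] at h3
  have h4 := Finset.sum_range_id_mul_two (n+1)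
  rw [h3]
  simp only [Nat.add_sub_cancel] at h4
  have : n*(n+1) = (∑ i ∈ Finset.range (n+1), i) * 2 := by rw [h4]; ring
  rw [this]; simp

theorem lint_smul {E : Type*} [NormedAddCommGroup E] [NormedSpace ℝ E] [FiniteDimensional ℝ E] [MeasureSpace E] [BorelSpace E]
    [(volume : Measure E).IsAddHaarMeasure] {a : ℝ} (ha : 0 < a) (g : E → ℝ≥0∞) (hg : Measurable g) :
    ENNReal.ofReal (a ^ Module.finrank ℝ E) * ∫⁻ x, g (a • x) = ∫⁻ x, g x := by
  have h := Measure.map_addHaar_smul (volume : Measure E) ha.ne'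
  have h2 : ∫⁻ x, g (a • x) = ∫⁻ x, g x ∂(Measure.map (a • ·) (volume : Measure E)) :=
    (lintegral_map hg (measurable_const_smul a)).symm
  rw [h2, h, lintegral_smul_measure, smul_eq_mul, ← mul_assoc, ← ENNReal.ofReal_mul (by positivity), abs_of_pos (by positivity),
    mul_inv_cancel₀ (by positivity)]
  simp

theorem SymS.stepSum {φ : Pt n → Pt n} {J a b t0 : ℝ} (h : SymS φ J a b t0) (z : Pt n) (t σ : Fin (n+1) → ℝ) :
    φ (z + stepSum n t σ) = φ z + stepSum n (fun i => t0 + b * t i) (fun i => a * σ i) := by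
  have : ∀ s : Finset (Fin (n+1)), φ (z + ∑ i ∈ s, stp n (t i, σ i)) = φ z + ∑ i ∈ s, stp n (t0 + b * t i, a * σ i) := by
    intro s
    induction s using Finset.cons_induction with
    | empty => simp
    | cons i s hi ih =>
      rw [Finset.sum_cons, Finset.sum_cons, add_comm (stp n _), ← add_assoc, h.st, ih]
      rw [add_assoc]; congr 1; exact add_comm _ _
  exact this _

theorem SymS.vol {φ : Pt n → Pt n} {J a b t0 : ℝ} (h : SymS φ J a b t0) (g : Pt n → ℝ≥0∞) (hg : Measurable g) :
    ENNReal.ofReal J * ∫⁻ z, g (φ z) = ∫⁻ z, g z := by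
  have ha := h.ha
  have hb := h.hb
  set t : Fin (n+1) → ℝ := fun i => (i.1 : ℝ) with ht
  have inj : Function.Injective t := fun i j hij => Fin.ext (by simp only [ht] at hij; exact_mod_cast hij)
  have d1 : (Matrix.vandermonde t).det ≠ 0 := Matrix.det_vandermonde_ne_zero_iff.2 inj
  have d2 : (Matrix.vandermonde (fun i => t0 + b * t i)).det ≠ 0 := Matrix.det_vandermonde_ne_zero_iff.2
    (fun i j hij => inj (mul_left_cancel₀ hb.ne' (add_left_cancel hij)))
  have e1 := lin_eq t d1 0 (fun z => g (φ z)) (hg.comp h.hφ.measurable)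
  have e2 := lin_eq _ d2 (φ 0) g hg
  simp only [h.stepSum] at e1
  have vv : VV n (fun i => t0 + b * t i) = ENNReal.ofReal (b ^ (n*(n+1)/2)) * VV n t := by
    rw [VV_eq, VV_eq, ← sum_Ioi_card, ← Finset.prod_pow_eq_pow_sum, ENNReal.ofReal_prod_of_nonneg (fun i _ => by positivity), ← Finset.prod_mul_distrib]
    refine Finset.prod_congr rfl fun i _ => ?_
    rw [ENNReal.ofReal_pow hb.le, ← Finset.prod_const, ← Finset.prod_mul_distrib]
    refine Finset.prod_congr rfl fun k _ => ?_
    rw [← ENNReal.ofReal_mul hb.le]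
    congr 1
    rw [← abs_of_pos hb, ← abs_mul, abs_of_pos hb]; congr 1; ring
  have sc : ∫⁻ σ : Fin (n+1) → ℝ, g (φ 0 + _root_.stepSum n (fun i => t0 + b * t i) σ)
     = ENNReal.ofReal (a^(n+1)) * ∫⁻ σ : Fin (n+1) → ℝ, g (φ 0 + _root_.stepSum n (fun i => t0 + b * t i) (fun i => a * σ i)) := by
    have hm : Measurable (fun σ : Fin (n+1) → ℝ => g (φ 0 + _root_.stepSum n (fun i => t0 + b * t i) σ)) := by
      unfold _root_.stepSum; fun_prop
    have := lint_smul ha _ hm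
    rw [Module.finrank_fin_fun] at this
    exact this.symm
  rw [← e1, ← e2, sc, vv, h.hJ, ENNReal.ofReal_mul (by positivity)]
  ring
end sym

section kp1
variable {n : ℕ}

theorem sym_exists (z0 : Pt n) (t0 : ℝ) {a b : ℝ} (ha : 0 < a) (hb : 0 < b) :
    ∃ φ : Pt n → Pt n, IsSymJ n φ (a ^ (n+1) * b ^ (n*(n+1)/2)) ∧ SymS φ (a ^ (n+1) * b ^ (n*(n+1)/2)) a b t0 ∧ φ 0 = z0 := by
  have h := IsSymJ.comp _ _ _ _ (IsSymJ.translation (n := n) (z0.2 - z0.1 • mom n t0)) (IsSymJ.comp _ _ _ _ (IsSymJ.shift z0.1 t0) (IsSymJ.scaling a b ha hb))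
  rw [one_mul, one_mul] at h
  refine ⟨_, h, ⟨ha, hb, rfl, ?_, fun z t σ => ?_⟩, ?_⟩
  · unfold Gmat; fun_prop
  · simp only [stp, ev, Function.comp_apply]
    refine Prod.ext ?_ ?_
    · simp; ring
    · have e : (fun i : Fin n => a * b ^ (i.1+1) * (z + σ • ((1, mom n t) : Pt n)).2 i) = (fun i => a * b ^ (i.1+1) * z.2 i) + (a*σ) • mom n (b*t) := by
        funext i; simp [mom, mul_pow]; ring
      simp only [Prod.snd_add, Prod.smul_snd, Prod.fst_add, Prod.smul_fst, smul_eq_mul, mul_one] at e ⊢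
      rw [e, Gmat_add, Gmat_smul, ← Gmat_mom]
      module
  · simp only [Function.comp_apply]
    refine Prod.ext ?_ ?_
    · simp
    · have : (fun i : Fin n => a * b ^ (i.1+1) * (0 : Pt n).2 i) = (0:ℝ) • (0 : Fin n → ℝ) := by
        funext i; simp
      simp only [this, Gmat_smul]
      simp

theorem stepSum_bij (t : Fin (n+1) → ℝ) (hd : (Matrix.vandermonde t).det ≠ 0) : Function.Bijective (stepSum n t) := by
  have e : stepSum n t = (MeasurableEquiv.piFinSuccAbove (fun _ : Fin (n+1) => ℝ) 0) ∘ (Matrix.mulVec (Matrix.vandermonde t).transpose) := by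
    funext σ; rw [stepSum_eq]; rfl
  have hu : IsUnit (Matrix.vandermonde t).transpose := by
    rw [Matrix.isUnit_iff_isUnit_det, Matrix.det_transpose]; exact hd.isUnit
  rw [e]
  exact (MeasurableEquiv.bijective _).comp ⟨Matrix.mulVec_injective_iff_isUnit.2 hu, Matrix.mulVec_surjective_iff_isUnit.2 hu⟩

theorem SymS.inj {φ : Pt n → Pt n} {J a b t0 : ℝ} (h : SymS φ J a b t0) : Function.Injective φ := by
  have ha := h.ha
  have hb := h.hb
  set t : Fin (n+1) → ℝ := fun i => (i.1 : ℝ) with ht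
  have inj : Function.Injective t := fun i j hij => Fin.ext (by simp only [ht] at hij; exact_mod_cast hij)
  have d1 : (Matrix.vandermonde t).det ≠ 0 := Matrix.det_vandermonde_ne_zero_iff.2 inj
  have d2 : (Matrix.vandermonde (fun i => t0 + b * t i)).det ≠ 0 := Matrix.det_vandermonde_ne_zero_iff.2
    (fun i j hij => inj (mul_left_cancel₀ hb.ne' (add_left_cancel hij)))
  intro z w hzw
  obtain ⟨σ, rfl⟩ := (stepSum_bij t d1).2 z
  obtain ⟨σ', rfl⟩ := (stepSum_bij t d1).2 w
  rw [← zero_add (_root_.stepSum n t σ), ← zero_add (_root_.stepSum n t σ'), h.stepSum, h.stepSum] at hzw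
  have := (stepSum_bij _ d2).1 (add_left_cancel hzw)
  congr 1
  funext i
  exact mul_left_cancel₀ ha.ne' (congrFun this i)

theorem norm_ev_le {τ T : ℝ} (hT : 1 ≤ T) (h : |τ| ≤ T) : ‖ev n τ‖ ≤ T ^ n := by
  have h1 : (1:ℝ) ≤ T ^ n := one_le_pow₀ hT
  rw [ev, Prod.norm_def, max_le_iff]
  refine ⟨by simpa using h1, (pi_norm_le_iff_of_nonneg (by linarith)).2 fun i => ?_⟩
  change ‖τ ^ (i.1+1)‖ ≤ _
  rw [Real.norm_eq_abs, abs_pow]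
  calc |τ| ^ (i.1+1) ≤ T ^ (i.1+1) := by gcongr
    _ ≤ T ^ n := pow_le_pow_right₀ hT i.2

theorem norm_stepSum_le {t σ : Fin (n+1) → ℝ} {T S : ℝ} (hT : 1 ≤ T) (h : ∀ i, |t i| ≤ T) (hs : ∀ i, |σ i| ≤ S) :
    ‖stepSum n t σ‖ ≤ (n+1) * (S * T ^ n) := by
  have : ∀ i ∈ Finset.univ, ‖stp n (t i, σ i)‖ ≤ S * T ^ n := by
    intro i _
    rw [stp, norm_smul, Real.norm_eq_abs]
    have hS := (abs_nonneg _).trans (hs i)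
    exact mul_le_mul (hs i) (norm_ev_le hT (h i)) (norm_nonneg _) hS
  refine (norm_sum_le_of_le _ this).trans (le_of_eq ?_)
  simp

variable {m : Pt n × ℝ → ℝ≥0∞}
def slc (m : Pt n × ℝ → ℝ≥0∞) (G : Set (Pt n × (Fin (n+1) → ℝ × ℝ))) (z0 : Pt n) (t0 : ℝ) : ℝ≥0∞ :=
  ∫⁻ t' : Fin n → ℝ, ∫⁻ σ : Fin (n+1) → ℝ, muF m z0 * (Wt m z0 (fun i => ((Fin.cons t0 t' : Fin (n+1) → ℝ) i, σ i))
     * G.indicator 1 (z0, fun i => ((Fin.cons t0 t' : Fin (n+1) → ℝ) i, σ i)))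

theorem Pm_slice (hm : Measurable m) {G : Set (Pt n × (Fin (n+1) → ℝ × ℝ))} (hG : MeasurableSet G) :
    Pm m (n+1) G = ∫⁻ z0, ∫⁻ t0, slc m G z0 t0 := by
  rw [← lintegral_indicator_one hG, lintegral_Pm hm _ _ (measurable_one.indicator hG), PE]
  refine lintegral_congr fun z0 => ?_
  have hF : Measurable (fun a : Fin (n+1) → ℝ × ℝ => muF m z0 * Wt m z0 a * G.indicator 1 (z0, a)) := by
    have h1 : Measurable (fun x : Pt n × (Fin (n+1) → ℝ × ℝ) => (muF m x.1 * Wt m x.1 x.2) * G.indicator (1 : Pt n × (Fin (n+1) → ℝ × ℝ) → ℝ≥0∞) x) :=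
      (measurable_dens hm (n+1)).mul (measurable_one.indicator hG)
    exact h1.comp measurable_prodMk_left
  rw [lintegral_split _ hF, lintegral_cons]
  · simp only [mul_assoc, slc]
  · refine Measurable.lintegral_prod_right' (f := fun x : (Fin (n+1) → ℝ) × (Fin (n+1) → ℝ) => muF m z0 * Wt m z0 (fun i => (x.1 i, x.2 i)) * G.indicator 1 (z0, fun i => (x.1 i, x.2 i))) ?_
    exact hF.comp (measurable_pi_iff.2 fun i => by fun_prop)

theorem Reg.mass2 (h : Reg m) : ∫⁻ z0, ∫⁻ t0, m (z0, t0) = 1 := h.mass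
end kp1

section kp2
variable {N : ℕ} {f : Pt (N+1) → ℝ≥0∞} {m : Pt (N+1) × ℝ → ℝ≥0∞} {p κ : ℝ}

def LgI (f : Pt (N+1) → ℝ≥0∞) (R : ℝ) (i : Fin (N+2)) : Set (Pt (N+1) × (Fin (N+2) → ℝ × ℝ)) :=
  (fun x => (pos x.1 x.2 i.1, x.2 i)) ⁻¹' (Lg f R)

theorem allshort (h : Reg m) (hf : Measurable f) (hp : 0 < p) (h1 : ∫⁻ z, f z ^ p ≤ 1) {R : ℝ} (hR : 0 < R)
    {G0 : Set (Pt (N+1) × (Fin (N+2) → ℝ × ℝ))} (hm0 : MeasurableSet G0) (hG0 : ∀ x ∈ G0, GG f m p κ x)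
    (bad : Pm m (N+2) G0ᶜ ≤ ENNReal.ofReal (1/(4*(N+3)))) (hR2 : Real.exp (LK N p κ) / R ≤ 1/(4*(N+3))) :
    1/2 ≤ Pm m (N+2) (G0 ∩ ⋂ i, (LgI f R i)ᶜ) := by
  have P := h.prob_Pm (N+2)
  have mL : ∀ i, MeasurableSet (LgI f R i) := fun i => (measurable_Lg hf R).preimage (h.mp_step i).measurable
  have l1 : Pm m (N+2) (G0 ∩ LgI f R 1) ≤ ENNReal.ofReal (1/(4*(N+3))) := by
    rw [Pm_slice h.meas (hm0.inter (mL 1))]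
    calc _ ≤ ∫⁻ z0, ∫⁻ t0, m (z0, t0) * ENNReal.ofReal (Real.exp (LK N p κ) / R) :=
          lintegral_mono fun z0 => lintegral_mono fun t0 => GG.slice hf hp h1 hR z0 t0 _ fun x hx => ⟨hG0 x hx.1, hx.2⟩
      _ = ENNReal.ofReal (Real.exp (LK N p κ) / R) := by
          simp only [lintegral_mul_const' _ _ ENNReal.ofReal_ne_top, h.mass2, one_mul]
      _ ≤ _ := ENNReal.ofReal_le_ofReal hR2
  have l2 : ∀ i, Pm m (N+2) (LgI f R i) ≤ ENNReal.ofReal (1/(4*(N+3))) + ENNReal.ofReal (1/(4*(N+3))) := by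
    intro i
    have e : ∀ i : Fin (N+2), Pm m (N+2) (LgI f R i) = nu1 m (Lg f R) := fun i =>
      (h.mp_step i).measure_preimage (measurable_Lg hf R).nullMeasurableSet
    rw [e, ← e 1]
    calc _ ≤ Pm m (N+2) ((G0 ∩ LgI f R 1) ∪ G0ᶜ) := measure_mono fun x hx => by
          by_cases h : x ∈ G0
          · exact Or.inl ⟨h, hx⟩
          · exact Or.inr h
      _ ≤ _ := (measure_union_le _ _).trans (add_le_add l1 bad)
  set G := G0 ∩ ⋂ i, (LgI f R i)ᶜ with hG
  have mG : MeasurableSet G := hm0.inter (MeasurableSet.iInter fun i => (mL i).compl)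
  have l3 : Pm m (N+2) Gᶜ ≤ 1/2 := by
    have : Gᶜ ⊆ G0ᶜ ∪ ⋃ i, LgI f R i := by
      intro x hx
      by_contra hc
      simp only [mem_union, mem_compl_iff, not_or, not_not, mem_iUnion, not_exists] at hc
      exact hx ⟨hc.1, mem_iInter.2 fun i => hc.2 i⟩
    refine (measure_mono this).trans ((measure_union_le _ _).trans ((add_le_add bad ((measure_iUnion_le _).trans (ENNReal.tsum_le_tsum l2))).trans ?_))
    rw [tsum_fintype, Finset.sum_const, Finset.card_univ, Fintype.card_fin, nsmul_eq_mul, ← ENNReal.ofReal_add (by positivity) (by positivity)]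
    have c : ((N+2:ℕ):ℝ≥0∞) = ENNReal.ofReal (N+2) := by
      rw [← ENNReal.ofReal_natCast]; push_cast; rfl
    have c2 : (1/2 : ℝ≥0∞) = ENNReal.ofReal (1/2) := by
      rw [ENNReal.ofReal_div_of_pos two_pos]; simp
    rw [c, ← ENNReal.ofReal_mul (by positivity), ← ENNReal.ofReal_add (by positivity) (by positivity), c2]
    refine ENNReal.ofReal_le_ofReal ?_
    have : (0:ℝ) < N + 3 := by positivity
    field_simp
    nlinarith
  have l4 := prob_add_prob_compl (μ := Pm m (N+2)) mG
  by_contra hlt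
  push Not at hlt
  have := ENNReal.add_lt_add_of_lt_of_le (by exact ne_top_of_le_ne_top (by simp) l3) hlt l3
  rw [l4, ENNReal.add_halves] at this
  exact lt_irrefl _ this
end kp2

section kp3
variable {N : ℕ} {f : Pt (N+1) → ℝ≥0∞} {m : Pt (N+1) × ℝ → ℝ≥0∞} {p κ : ℝ}

def KPset {n : ℕ} (f : Pt n → ℝ≥0∞) (φ : Pt n → Pt n) (J p K : ℝ) : Set (Pt n) :=
  {w | ‖w‖ ≤ K ∧ ENNReal.ofReal K⁻¹ ≤ ENNReal.ofReal (J ^ (1/p)) * f (φ w) ∧ ENNReal.ofReal (J ^ (1/p)) * f (φ w) ≤ ENNReal.ofReal K}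

def kpC (n : ℕ) (κ R : ℝ) : ℝ :=
  (n+1) * (R * Real.exp (2*κ) * Real.exp κ ^ n) + Real.exp (2*κ) + Real.exp (Real.log 4 + n * Real.log 2 + (4*n+2+D0 n)*κ)

theorem D0_nat (n : ℕ) : ((n*(n+1)/2 : ℕ) : ℝ) = D0 n := by
  rw [Nat.cast_div (even_iff_two_dvd.1 (Nat.even_mul_succ_self n)) (by norm_num)]
  unfold D0; push_cast; rfl

theorem notLg {n : ℕ} {f : Pt n → ℝ≥0∞} {R : ℝ} (hR : 0 < R) {y : Pt n × (ℝ × ℝ)} (hy : y ∉ Lg f R)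
   (h1 : Fp (hX f (y.1, y.2.1))) (h2 : Fp (f y.1)) : |y.2.2| ≤ R * Real.exp (lA f (y.1, y.2.1)) := by
  have hy' : ENNReal.ofReal |y.2.2| * f y.1 < ENNReal.ofReal R * hX f (y.1, y.2.1) := not_le.1 hy
  by_cases h0 : y.2.2 = 0
  · rw [h0, abs_zero]; positivity
  have a0 := Fp_ofReal (abs_pos.2 h0)
  have := lg_mono (a0.mul h2) ((Fp_ofReal hR).mul h1).2 hy'.le
  rw [lg_mul (Fp_ofReal hR) h1, lg_mul a0 h2, lg_ofReal hR.le, lg_ofReal (abs_nonneg _)] at this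
  rw [← Real.log_le_log_iff (abs_pos.2 h0) (by positivity), Real.log_mul hR.ne' (Real.exp_ne_zero _), Real.log_exp, lA]
  linarith

theorem select (h : Reg m) (hf : Measurable f) (hp : 1 ≤ p) {R : ℝ} (hR : 0 < R) (hκ : 0 ≤ κ)
    {G0 : Set (Pt (N+1) × (Fin (N+2) → ℝ × ℝ))} (hm0 : MeasurableSet G0) (hG0 : ∀ x ∈ G0, GG f m p κ x)
    (hh : 1/2 ≤ Pm m (N+2) (G0 ∩ ⋂ i, (LgI f R i)ᶜ)) :
    ∃ φ J, IsSymJ (N+1) φ J ∧ ENNReal.ofReal (kpC (N+1) κ R)⁻¹ ≤ volume (KPset f φ J p (kpC (N+1) κ R)) := by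
  have mL : ∀ i, MeasurableSet (LgI f R i) := fun i => (measurable_Lg hf R).preimage (h.mp_step i).measurable
  set G := G0 ∩ ⋂ i, (LgI f R i)ᶜ with hG
  have mG : MeasurableSet G := hm0.inter (MeasurableSet.iInter fun i => (mL i).compl)
  obtain ⟨z0, t0, hz⟩ : ∃ z0 t0, m (z0, t0) * ENNReal.ofReal (1/4) < slc m G z0 t0 := by
    by_contra hc
    push Not at hc
    rw [Pm_slice h.meas mG] at hh
    have := hh.trans (lintegral_mono fun z0 => lintegral_mono fun t0 => hc z0 t0)
    simp only [lintegral_mul_const' _ _ ENNReal.ofReal_ne_top, h.mass2, one_mul] at this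
    have c2 : (1/2 : ℝ≥0∞) = ENNReal.ofReal (1/2) := by
      rw [ENNReal.ofReal_div_of_pos two_pos]; simp
    rw [c2, ENNReal.ofReal_le_ofReal_iff (by norm_num)] at this
    norm_num at this
  obtain ⟨t1, σ1, hw⟩ : ∃ (t' : Fin (N+1) → ℝ) (σ : Fin (N+2) → ℝ), ((z0, fun i => ((Fin.cons t0 t' : Fin (N+2) → ℝ) i, σ i)) : Pt (N+1) × (Fin (N+2) → ℝ × ℝ)) ∈ G := by
    by_contra hw
    push Not at hw
    have : ∀ (t' : Fin (N+1) → ℝ) (σ : Fin (N+2) → ℝ), G.indicator (1 : Pt (N+1) × (Fin (N+2) → ℝ × ℝ) → ℝ≥0∞) (z0, fun i => ((Fin.cons t0 t' : Fin (N+2) → ℝ) i, σ i)) = 0 := fun t' σ =>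
      indicator_of_notMem (hw t' σ) _
    simp [slc, this] at hz
  have gw := hG0 _ hw.1
  have fm : Fp (m (z0, t0)) := by have := (gw.g0.1 0).1; rwa [gw.u0] at this
  have f0 : Fp (f z0) := by simpa [pos_zero] using gw.ff 0 (by omega)
  have fh : Fp (hX f (z0, t0)) := by have := gw.fh 0; rwa [gw.u0] at this
  have sc := gw.sc
  rw [gw.u0] at sc
  have tv0 : ∀ (t' : Fin (N+1) → ℝ) (σ : Fin (N+2) → ℝ), tv ((z0, fun i => ((Fin.cons t0 t' : Fin (N+2) → ℝ) i, σ i)) : Pt (N+1) × (Fin (N+2) → ℝ × ℝ)) 0 = t0 := fun _ _ => rfl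
  rw [tv0] at sc
  set a := lg (rhoF m t0) with ha
  set b := lA f (z0, t0) with hb
  set V0 := ENNReal.ofReal (Real.exp (- (D0 (N+1) * (a + κ)))) with hV0
  set X := Real.exp (κ - a) with hXX
  set D := ENNReal.ofReal (Real.exp ((N+1:ℕ) * a - ((N+1:ℕ)+1) * b + (3*(N+1:ℕ)+2) * κ)) with hD
  obtain ⟨φ, sJ, sS, s0⟩ := sym_exists z0 t0 (Real.exp_pos b) (Real.exp_pos (-a))
  set J := Real.exp b ^ (N+1+1) * Real.exp (-a) ^ ((N+1)*(N+1+1)/2) with hJ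
  have eJ : J = Real.exp ((N+2) * b - D0 (N+1) * a) := by
    rw [hJ, ← Real.exp_nat_mul, ← Real.exp_nat_mul, ← Real.exp_add, D0_nat]
    congr 1; push_cast; ring
  set K := kpC (N+1) κ R with hK
  have K1 : ((N+1:ℕ)+1) * (R * Real.exp (2*κ) * Real.exp κ ^ (N+1)) ≤ K := by
    rw [hK, kpC]; have := Real.exp_pos (2*κ); have := Real.exp_pos (Real.log 4 + (N+1:ℕ) * Real.log 2 + (4*(N+1:ℕ)+2+D0 (N+1))*κ)
    linarith
  have K2 : Real.exp (2*κ) ≤ K := by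
    rw [hK, kpC]; have : 0 ≤ ((N+1:ℕ)+1) * (R * Real.exp (2*κ) * Real.exp κ ^ (N+1)) := by positivity
    have := Real.exp_pos (Real.log 4 + (N+1:ℕ) * Real.log 2 + (4*(N+1:ℕ)+2+D0 (N+1))*κ)
    linarith
  have K3 : Real.exp (Real.log 4 + (N+1:ℕ) * Real.log 2 + (4*(N+1:ℕ)+2+D0 (N+1))*κ) ≤ K := by
    rw [hK, kpC]; have : 0 ≤ ((N+1:ℕ)+1) * (R * Real.exp (2*κ) * Real.exp κ ^ (N+1)) := by positivity
    have := Real.exp_pos (2*κ)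
    linarith
  have Kp : 0 < K := (Real.exp_pos _).trans_le K2
  refine ⟨φ, J, sJ, ?_⟩
  set Z : Set (Pt (N+1)) := φ '' (Metric.closedBall 0 K) ∩ {z | ENNReal.ofReal K⁻¹ ≤ ENNReal.ofReal (J ^ (1/p)) * f z ∧ ENNReal.ofReal (J ^ (1/p)) * f z ≤ ENNReal.ofReal K} with hZ
  have mZ : MeasurableSet Z := by
    refine ((isCompact_closedBall 0 K).image sS.hφ).measurableSet.inter ?_
    have h1 : MeasurableSet {z | ENNReal.ofReal K⁻¹ ≤ ENNReal.ofReal (J ^ (1/p)) * f z} := measurableSet_le (by fun_prop) (by fun_prop)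
    have h2 : MeasurableSet {z | ENNReal.ofReal (J ^ (1/p)) * f z ≤ ENNReal.ofReal K} := measurableSet_le (by fun_prop) (by fun_prop)
    exact h1.inter h2
  have eZ : KPset f φ J p K = φ ⁻¹' Z := by
    ext w
    simp only [KPset, hZ, mem_preimage, mem_inter_iff, sS.inj.mem_set_image, mem_ofPred_eq, mem_closedBall_zero_iff]
  have vZ : ENNReal.ofReal J * volume (KPset f φ J p K) = volume Z := by
    have := sS.vol (Z.indicator 1) (measurable_one.indicator mZ)
    rw [lintegral_indicator_one mZ] at this
    rw [← this, eZ, ← lintegral_indicator_one (mZ.preimage sS.hφ.measurable)]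
    rfl
  -- the endpoints
  have key : ∀ (t' : Fin (N+1) → ℝ) (σ : Fin (N+2) → ℝ), ((z0, fun i => ((Fin.cons t0 t' : Fin (N+2) → ℝ) i, σ i)) : Pt (N+1) × (Fin (N+2) → ℝ × ℝ)) ∈ G →
      V0 ≤ VV (N+1) (Fin.cons t0 t') ∧ t' ∈ Metric.closedBall (fun _ => t0) X ∧ z0 + stepSum (N+1) (Fin.cons t0 t') σ ∈ Z := by
    intro t' σ hx
    have g := hG0 _ hx.1
    have hl := mem_iInter.1 hx.2
    set x : Pt (N+1) × (Fin (N+2) → ℝ × ℝ) := (z0, fun i => ((Fin.cons t0 t' : Fin (N+2) → ℝ) i, σ i)) with hxx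
    have u0 := g.u0
    have dt : ∀ k : Fin (N+2), |t0 - (Fin.cons t0 t' : Fin (N+2) → ℝ) k| ≤ X := by
      intro k
      by_cases hk : 0 < k
      · have h := abs_le.1 (g.dt 0 k hk)
        have h0 := abs_pos.2 (g.g0.2 0 k hk)
        rw [lg_ofReal (abs_nonneg _)] at h
        change |tv x 0 - tv x k| ≤ X
        rw [← Real.log_le_iff_le_exp h0]
        have : rhoF m (tv x 0) = rhoF m t0 := rfl
        rw [this] at h
        linarith [h.2]
      · have : k = 0 := by simpa using hk
        rw [this, Fin.cons_zero, sub_self, abs_zero]; exact (Real.exp_pos _).le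
    refine ⟨g.vv, ?_, ?_⟩
    · rw [mem_closedBall_iff_norm, pi_norm_le_iff_of_nonneg (Real.exp_pos _).le]
      intro j
      have := dt j.succ
      rw [abs_sub_comm] at this
      simpa using this
    · have sx : ∀ i, |σ i| ≤ R * Real.exp (b + 2*κ) := by
        intro i
        have h1 := g.fh i
        have h2 := g.ff i.1 (by omega)
        have := notLg hR (hl i) h1 h2
        refine le_trans this ?_
        refine mul_le_mul_of_nonneg_left (Real.exp_le_exp.2 ?_) hR.le
        have a1 := abs_le.1 (g.df i.1 (by omega))
        have a2 := abs_le.1 (g.dh i)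
        rw [u0] at a2
        change lA f (uP i x) ≤ _
        have e1 : lA f (uP i x) = lg (hX f (uP i x)) - lg (f (pos x.1 x.2 i.1)) := rfl
        have e2 : b = lg (hX f (x.1, tv x 0)) - lg (f x.1) := rfl
        rw [e1, e2]
        linarith [a1.1, a1.2, a2.1, a2.2]
      have ew : z0 + stepSum (N+1) (Fin.cons t0 t') σ = φ (stepSum (N+1) (fun i => Real.exp a * ((Fin.cons t0 t' : Fin (N+2) → ℝ) i - t0)) (fun i => Real.exp (-b) * σ i)) := by
        rw [← zero_add (stepSum (N+1) (fun i => Real.exp a * ((Fin.cons t0 t' : Fin (N+2) → ℝ) i - t0)) _), sS.stepSum, s0]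
        congr 2
        · funext i
          rw [← mul_assoc, ← Real.exp_add]; simp
        · funext i
          rw [← mul_assoc, ← Real.exp_add]; simp
      refine ⟨⟨_, ?_, ew.symm⟩, ?_⟩
      · rw [mem_closedBall_zero_iff]
        refine (norm_stepSum_le (T := Real.exp κ) (S := R * Real.exp (2*κ)) (Real.one_le_exp hκ) ?_ ?_).trans K1
        · intro i
          rw [abs_mul, abs_of_pos (Real.exp_pos _), abs_sub_comm]
          refine (mul_le_mul_of_nonneg_left (dt i) (Real.exp_pos _).le).trans (le_of_eq ?_)
          rw [hXX, ← Real.exp_add]; congr 1; ring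
        · intro i
          rw [abs_mul, abs_of_pos (Real.exp_pos _)]
          refine (mul_le_mul_of_nonneg_left (sx i) (Real.exp_pos _).le).trans (le_of_eq ?_)
          rw [mul_left_comm, ← Real.exp_add]; congr 2; ring
      · have pl : z0 + stepSum (N+1) (Fin.cons t0 t') σ = pos x.1 x.2 (N+2) := (pos_last z0 x.2).symm
        rw [pl]
        have h2 := g.ff (N+2) le_rfl
        have a1 := abs_le.1 (g.df (N+2) le_rfl)
        have fJ : ENNReal.ofReal (J ^ (1/p)) = ENNReal.ofReal (Real.exp (((N+2) * b - D0 (N+1) * a) * (1/p))) := by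
          rw [eJ, ← Real.exp_mul]
        rw [mem_ofPred_eq, fJ, eq_exp h2, exp_mul]
        have s1 := abs_le.1 sc
        have e2 : b = lg (hX f (z0, t0)) - lg (f z0) := rfl
        have hc : ((N+2) * b - D0 (N+1) * a) * (1/p) + lg (f z0) = (((N+1:ℕ)+1) * (lg (hX f (z0, t0)) - lg (f z0)) + p * lg (f z0) - D0 (N+1) * a) * (1/p) := by
          rw [← e2]; push_cast; field_simp; ring
        have p1 : 1/p ≤ 1 := by rw [div_le_one (by linarith)]; exact hp
        have p0 : 0 < 1/p := by positivity
        have b1 : ((N+2) * b - D0 (N+1) * a) * (1/p) + lg (f z0) ≤ κ := by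
          rw [hc]
          calc _ ≤ κ * (1/p) := mul_le_mul_of_nonneg_right s1.2 p0.le
            _ ≤ κ * 1 := mul_le_mul_of_nonneg_left p1 hκ
            _ = κ := mul_one _
        have b2 : -κ ≤ ((N+2) * b - D0 (N+1) * a) * (1/p) + lg (f z0) := by
          rw [hc]
          calc -κ = (-κ) * 1 := by ring
            _ ≤ -κ * (1/p) := mul_le_mul_of_nonpos_left p1 (by linarith)
            _ ≤ _ := mul_le_mul_of_nonneg_right s1.1 p0.le
        have c1 : lg (f x.1) = lg (f z0) := rfl
        rw [c1] at a1
        constructor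
        · refine ENNReal.ofReal_le_ofReal ?_
          rw [inv_le_comm₀ Kp (Real.exp_pos _), ← Real.exp_neg]
          refine le_trans (Real.exp_le_exp.2 ?_) K2
          linarith [a1.1]
        · refine ENNReal.ofReal_le_ofReal (le_trans (Real.exp_le_exp.2 ?_) K2)
          linarith [a1.2]
  have step : ∀ (t' : Fin (N+1) → ℝ) (σ : Fin (N+2) → ℝ), muF m z0 * (Wt m z0 (fun i => ((Fin.cons t0 t' : Fin (N+2) → ℝ) i, σ i))
     * G.indicator 1 (z0, fun i => ((Fin.cons t0 t' : Fin (N+2) → ℝ) i, σ i))) ≤ m (z0, t0) * D * G.indicator 1 (z0, fun i => ((Fin.cons t0 t' : Fin (N+2) → ℝ) i, σ i)) := by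
    intro t' σ
    by_cases hx : ((z0, fun i => ((Fin.cons t0 t' : Fin (N+2) → ℝ) i, σ i)) : Pt (N+1) × (Fin (N+2) → ℝ × ℝ)) ∈ G
    · rw [indicator_of_mem hx, Pi.one_apply, mul_one, mul_one]
      exact (hG0 _ hx.1).dens
    · rw [indicator_of_notMem hx]; simp
  have cT : m (z0, t0) * D ≠ ⊤ := (fm.mul (Fp_exp _)).2
  have s2 := hz.le.trans (lintegral_mono fun t' => lintegral_mono fun σ => step t' σ)
  simp only [lintegral_const_mul' _ _ cT] at s2
  rw [mul_assoc, ENNReal.mul_le_mul_iff_right fm.1 fm.2] at s2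
  set I := ∫⁻ t' : Fin (N+1) → ℝ, ∫⁻ σ : Fin (N+2) → ℝ, G.indicator (1 : Pt (N+1) × (Fin (N+2) → ℝ × ℝ) → ℝ≥0∞) (z0, fun i => ((Fin.cons t0 t' : Fin (N+2) → ℝ) i, σ i)) with hI
  have s3 : V0 * I ≤ volume Z * ENNReal.ofReal (Real.exp ((N+1:ℕ) * (Real.log 2 + (κ - a)))) := by
    rw [hI, ← lintegral_const_mul' _ _ (Fp_exp _).2]
    have : ∀ t' : Fin (N+1) → ℝ, V0 * ∫⁻ σ : Fin (N+2) → ℝ, G.indicator (1 : Pt (N+1) × (Fin (N+2) → ℝ × ℝ) → ℝ≥0∞) (z0, fun i => ((Fin.cons t0 t' : Fin (N+2) → ℝ) i, σ i))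
        ≤ volume Z * (Metric.closedBall (fun _ => t0) X).indicator (1 : (Fin (N+1) → ℝ) → ℝ≥0∞) t' := by
      intro t'
      by_cases ht : ∃ σ : Fin (N+2) → ℝ, ((z0, fun i => ((Fin.cons t0 t' : Fin (N+2) → ℝ) i, σ i)) : Pt (N+1) × (Fin (N+2) → ℝ × ℝ)) ∈ G
      · obtain ⟨σ2, h2⟩ := ht
        obtain ⟨k1, k2, -⟩ := key t' σ2 h2
        rw [indicator_of_mem k2, Pi.one_apply, mul_one]
        have := lin_le (Fin.cons t0 t') z0 (Z.indicator 1) (measurable_one.indicator mZ)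
        rw [lintegral_indicator_one mZ] at this
        refine le_trans (mul_le_mul' k1 (lintegral_mono fun σ => ?_)) this
        by_cases hx : ((z0, fun i => ((Fin.cons t0 t' : Fin (N+2) → ℝ) i, σ i)) : Pt (N+1) × (Fin (N+2) → ℝ × ℝ)) ∈ G
        · rw [indicator_of_mem hx, indicator_of_mem (key t' σ hx).2.2]; rfl
        · rw [indicator_of_notMem hx]; exact zero_le
      · push Not at ht
        have : ∀ (σ : Fin (N+2) → ℝ), G.indicator (1 : Pt (N+1) × (Fin (N+2) → ℝ × ℝ) → ℝ≥0∞) (z0, fun i => ((Fin.cons t0 t' : Fin (N+2) → ℝ) i, σ i)) = 0 := fun σ =>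
          indicator_of_notMem (ht σ) _
        simp [this]
    refine (lintegral_mono this).trans ?_
    rw [lintegral_const_mul _ (measurable_one.indicator Metric.isClosed_closedBall.measurableSet), lintegral_indicator_one Metric.isClosed_closedBall.measurableSet,
      Real.volume_pi_closedBall _ (Real.exp_pos _).le]
    refine mul_le_mul_right (le_of_eq ?_) _
    rw [Fintype.card_fin, Real.exp_nat_mul, Real.exp_add, Real.exp_log two_pos]
  have s4 : V0 * ENNReal.ofReal (1/4) ≤ D * (ENNReal.ofReal J * volume (KPset f φ J p K) * ENNReal.ofReal (Real.exp ((N+1:ℕ) * (Real.log 2 + (κ - a))))) := by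
    rw [vZ]
    refine (mul_le_mul_right s2 _).trans ?_
    rw [mul_left_comm]
    exact mul_le_mul_right s3 _
  have e4 : ENNReal.ofReal (1/4) = ENNReal.ofReal (Real.exp (- Real.log 4)) := by
    rw [Real.exp_neg, Real.exp_log (by norm_num)]; norm_num
  rw [e4, hV0, exp_mul, hD, eJ] at s4
  set v := volume (KPset f φ (Real.exp ((N+2) * b - D0 (N+1) * a)) p K)
  have s5 : ENNReal.ofReal (Real.exp ((N+1:ℕ) * a - ((N+1:ℕ)+1) * b + (3*(N+1:ℕ)+2) * κ)) * (ENNReal.ofReal (Real.exp ((N+2) * b - D0 (N+1) * a)) * v * ENNReal.ofReal (Real.exp ((N+1:ℕ) * (Real.log 2 + (κ - a)))))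
     = v * ENNReal.ofReal (Real.exp (((N+1:ℕ) * a - ((N+1:ℕ)+1) * b + (3*(N+1:ℕ)+2) * κ) + ((N+2) * b - D0 (N+1) * a) + ((N+1:ℕ) * (Real.log 2 + (κ - a))))) := by
    have aux : ∀ (x y z : ℝ) (v : ℝ≥0∞), ENNReal.ofReal (Real.exp x) * (ENNReal.ofReal (Real.exp y) * v * ENNReal.ofReal (Real.exp z)) = v * ENNReal.ofReal (Real.exp (x+y+z)) := by
      intro x y z v
      rw [← exp_mul, ← exp_mul]; ring
    exact aux _ _ _ _
  rw [s5] at s4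
  have s6 := mul_le_mul_left s4 (ENNReal.ofReal (Real.exp (-(((N+1:ℕ) * a - ((N+1:ℕ)+1) * b + (3*(N+1:ℕ)+2) * κ) + ((N+2) * b - D0 (N+1) * a) + ((N+1:ℕ) * (Real.log 2 + (κ - a)))))))
  rw [mul_assoc, exp_mul, exp_mul, add_neg_cancel, Real.exp_zero, ENNReal.ofReal_one, mul_one] at s6
  rw [eJ]
  refine le_trans (ENNReal.ofReal_le_ofReal ?_) s6
  rw [inv_le_comm₀ Kp (Real.exp_pos _), ← Real.exp_neg]
  refine le_trans (Real.exp_le_exp.2 (le_of_eq ?_)) K3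
  push_cast; ring
end kp3

section kpn
theorem ggK_nonneg {n : ℕ} (hn : 2 ≤ n) {s Λ B : ℝ} (hs : D0 n < s) (hΛ : 0 < Λ) (hB : 0 ≤ B) : 0 ≤ ggK n s Λ B := by
  have hn2 : (2:ℝ) ≤ n := by exact_mod_cast hn
  have hD := D0_ge hn
  have h1 : 0 < s - 1 := by linarith
  have h2 : 0 < s := by linarith
  have h3 : 0 ≤ D0 n := by linarith
  unfold ggK
  positivity

theorem KPnice {n : ℕ} (hn : 2 ≤ n) {s : ℝ} (hs : D0 n < s) (B : ℝ) : ∃ K : ℝ, 0 < K ∧ ∀ (f : Pt n → ℝ≥0∞) (c C : ℝ≥0∞) (R : ℝ), Nice f c C R →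
    ∫⁻ z, f z ^ pp n s ≤ 1 → ∀ j, Mj f (rr n s) (ee n s) j ≠ 0 → |lg (Mj f (rr n s) (ee n s) j)| ≤ B →
    ∃ φ J, IsSymJ n φ J ∧ ENNReal.ofReal K⁻¹ ≤ volume (KPset f φ J (pp n s) K) := by
  obtain ⟨N, rfl⟩ : ∃ N, n = N+1 := ⟨n-1, by omega⟩
  have hn2 : (2:ℝ) ≤ (N+1:ℕ) := by exact_mod_cast hn
  have hD := D0_ge hn
  set B' := max B 0
  set Q := (2*((N+1:ℕ)+1)^2 + 4*((N+1:ℕ)+1)) * |pinK (N+1) s B'| with hQ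
  have Q0 : 0 ≤ Q := by positivity
  set Λ := 1 + Q * (4*(N+3)) with hΛ
  have Λ0 : 0 < Λ := by positivity
  set κ := ggK (N+1) s Λ B' with hκ
  have κ0 : 0 ≤ κ := ggK_nonneg hn hs Λ0 (le_max_right _ _)
  set R1 := Real.exp (LK N (pp (N+1) s) κ) * (4*(N+3)) with hR1
  have R0 : 0 < R1 := by positivity
  have hp : 1 ≤ pp (N+1) s := by rw [pp, one_le_div (by linarith)]; linarith
  refine ⟨kpC (N+1) κ R1, by unfold kpC; positivity, fun f c C R h h1 j M0 hB => ?_⟩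
  have hB' : |lg (Mj f (rr (N+1) s) (ee (N+1) s) j)| ≤ B' := hB.trans (le_max_left _ _)
  have hr := (rr_gt hn hs).le
  set m := mj f (rr (N+1) s) (ee (N+1) s) j with hm
  have hL : LI m := h.LI hr j M0
  have hR : Reg m := hL.toReg
  have mF : Measurable (fun z => f z ^ pp (N+1) s) := h.meas.pow_const _
  have mG := measurable_GoodL hR.meas mF Λ
  have hG : ∀ x ∈ {x | GoodL m (fun z => f z ^ pp (N+1) s) Λ x}, GG f m (pp (N+1) s) κ x := fun x hx => h.GG hn hs hm M0 hB' Λ0 hx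
  refine select hR h.meas hp R0 κ0 mG hG ?_
  refine allshort hR h.meas (by linarith) h1 R0 mG hG ?_ ?_
  · refine (h.bad hn hs h1 hm M0 (B := B') (by linarith [(abs_le.1 hB').1]) Λ0).trans (ENNReal.ofReal_le_ofReal ?_)
    rw [mul_div_assoc', div_le_div_iff₀ Λ0 (by positivity)]
    have : (2*((N+1:ℕ)+1)^2 + 4*((N+1:ℕ)+1)) * pinK (N+1) s B' ≤ Q := by
      rw [hQ]; exact mul_le_mul_of_nonneg_left (le_abs_self _) (by positivity)
    calc _ ≤ Q * (4*(N+3)) := mul_le_mul_of_nonneg_right this (by positivity)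
      _ ≤ 1 * Λ := by rw [hΛ]; linarith
  · rw [hR1]
    have := Real.exp_ne_zero (LK N (pp (N+1) s) κ)
    exact le_of_eq (by field_simp)
end kpn

section gen
variable {n : ℕ}
def XE (F : Pt n → ℝ≥0∞) (u : ℝ × (Fin n → ℝ)) : ℝ≥0∞ := ∫⁻ s : ℝ, F (s, u.2 + s • mom n u.1)
def Mf (F : Pt n → ℝ≥0∞) (r e : ℝ) : ℝ≥0∞ := ∫⁻ t : ℝ, (∫⁻ z, F z * hX F (z, t) ^ (r-1)) ^ e

theorem measurable_XE {F : Pt n → ℝ≥0∞} (hF : Measurable F) : Measurable (XE F) := by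
  refine Measurable.lintegral_prod_right' (f := fun x : (ℝ × (Fin n → ℝ)) × ℝ => F (x.2, x.1.2 + x.2 • mom n x.1.1)) ?_
  fun_prop

theorem hX_XE {F : Pt n → ℝ≥0∞} (s : ℝ) (x : Fin n → ℝ) (t : ℝ) : hX F ((s, x), t) = XE F (t, x - s • mom n t) := by
  unfold hX XE
  rw [← lintegral_add_right_eq_self (μ := volume) (fun σ => F (σ, (t, x - s • mom n t).2 + σ • mom n (t, x - s • mom n t).1)) s]
  refine lintegral_congr fun σ => ?_
  congr 1
  simp only [stp, ev]
  refine Prod.ext ?_ ?_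
  · simp; ring
  · simp only [Prod.snd_add, Prod.smul_snd]; module

theorem rpow_split {a : ℝ≥0∞} {r : ℝ} (hr : 1 ≤ r) : a * a ^ (r-1) = a ^ r := by
  nth_rewrite 1 [← ENNReal.rpow_one a]
  rw [← ENNReal.rpow_add_of_nonneg _ _ zero_le_one (by linarith)]; congr 1; ring

theorem Mf_inner {F : Pt n → ℝ≥0∞} (hF : Measurable F) {r : ℝ} (hr : 1 ≤ r) (t : ℝ) :
    ∫⁻ z, F z * hX F (z, t) ^ (r-1) = ∫⁻ y, XE F (t, y) ^ r := by
  have h1 := measurable_hX hF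
  have h2 := measurable_XE hF
  rw [Measure.volume_eq_prod, lintegral_prod _ (by fun_prop)]
  have : ∀ s : ℝ, ∫⁻ x : Fin n → ℝ, F (s, x) * hX F ((s, x), t) ^ (r-1) = ∫⁻ y : Fin n → ℝ, F (s, y + s • mom n t) * XE F (t, y) ^ (r-1) := by
    intro s
    rw [← lintegral_add_right_eq_self (μ := volume) _ (s • mom n t)]
    refine lintegral_congr fun y => ?_
    rw [hX_XE]; simp
  simp only [this]
  rw [lintegral_lintegral_swap (by fun_prop)]
  refine lintegral_congr fun y => ?_
  rw [lintegral_mul_const _ (by fun_prop), ← rpow_split hr]; rfl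

def cutf (F : Pt n → ℝ≥0∞) (k : ℕ) : Pt n → ℝ≥0∞ := {z | (k:ℝ≥0∞)⁻¹ ≤ F z ∧ F z ≤ k ∧ ‖z‖ ≤ k}.indicator F
theorem cutf_nice {F : Pt n → ℝ≥0∞} (hF : Measurable F) (k : ℕ) : Nice (cutf F k) (k:ℝ≥0∞)⁻¹ k k := by
  refine ⟨?_, by simp, by simp, fun z hz => ?_⟩
  · refine hF.indicator ?_
    have h1 : MeasurableSet {z | (k:ℝ≥0∞)⁻¹ ≤ F z} := measurableSet_le (by fun_prop) (by fun_prop)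
    have h2 : MeasurableSet {z | F z ≤ k} := measurableSet_le (by fun_prop) (by fun_prop)
    have h3 : MeasurableSet {z : Pt n | ‖z‖ ≤ k} := measurableSet_le (by fun_prop) (by fun_prop)
    exact h1.inter (h2.inter h3)
  · have := mem_of_indicator_ne_zero hz
    rw [cutf, indicator_of_mem this]; exact this
theorem cutf_le (F : Pt n → ℝ≥0∞) (k : ℕ) (z : Pt n) : cutf F k z ≤ F z := indicator_le_self _ _ _
theorem cutf_mono (F : Pt n → ℝ≥0∞) (z : Pt n) : Monotone (fun k => cutf F k z) := by
  intro k l hkl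
  refine indicator_le_indicator_of_subset (fun w hw => ?_) (fun _ => zero_le) z
  obtain ⟨h1, h2, h3⟩ := hw
  have c : (k:ℝ≥0∞) ≤ l := by exact_mod_cast hkl
  have c' : (k:ℝ) ≤ l := by exact_mod_cast hkl
  exact ⟨(ENNReal.inv_le_inv.2 c).trans h1, h2.trans c, h3.trans c'⟩
theorem ev_inv_le {x : ℝ≥0∞} (hx : x ≠ 0) : ∀ᶠ k : ℕ in atTop, (k:ℝ≥0∞)⁻¹ ≤ x := by
  have := ENNReal.tendsto_inv_nat_nhds_zero
  exact this.eventually_le_const (pos_iff_ne_zero.2 hx)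
theorem cutf_tendsto {F : Pt n → ℝ≥0∞} {z : Pt n} (hz : F z ≠ ⊤) : Tendsto (fun k => cutf F k z) atTop (nhds (F z)) := by
  by_cases h0 : F z = 0
  · have : ∀ k, cutf F k z = 0 := fun k => le_antisymm ((cutf_le F k z).trans_eq h0) zero_le
    simp [this, h0]
  · refine tendsto_const_nhds.congr' ?_
    have h1 := ev_inv_le h0
    have h2 : ∀ᶠ k : ℕ in atTop, F z ≤ k := by
      obtain ⟨N, hN⟩ := ENNReal.exists_nat_gt hz
      filter_upwards [eventually_ge_atTop N] with k hk
      exact hN.le.trans (by exact_mod_cast hk)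
    have h3 : ∀ᶠ k : ℕ in atTop, ‖z‖ ≤ k := tendsto_natCast_atTop_atTop.eventually_ge_atTop _
    filter_upwards [h1, h2, h3] with k a b c
    rw [cutf, indicator_of_mem (by exact ⟨a, b, c⟩)]

theorem cut_tendsto {g x : ℕ → ℝ≥0∞} {L : ℝ≥0∞} {e : ℝ} (he : 0 < e) (hg : Tendsto g atTop (nhds L))
    (hx : ∀ᶠ k : ℕ in atTop, (k:ℝ≥0∞)⁻¹ ≤ g k → x k = g k ^ e) (hx0 : ∀ k, x k ≤ g k ^ e) : Tendsto x atTop (nhds (L ^ e)) := by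
  have hg2 := (ENNReal.continuous_rpow_const (y := e)).continuousAt.tendsto.comp hg
  by_cases h0 : L = 0
  · rw [h0, ENNReal.zero_rpow_of_pos he] at hg2 ⊢
    exact tendsto_of_tendsto_of_tendsto_of_le_of_le tendsto_const_nhds hg2 (fun _ => zero_le) hx0
  · refine hg2.congr' ?_
    obtain ⟨c, hc0, hc⟩ := exists_between (pos_iff_ne_zero.2 h0)
    filter_upwards [hx, hg.eventually (lt_mem_nhds hc), ev_inv_le hc0.ne'] with k a b d
    exact (a (d.trans b.le)).symm
theorem cut_mono {g x : ℕ → ℝ≥0∞} {P : ℕ → Prop} {e : ℝ} (he : 0 < e) (hg : Monotone g) (hP : ∀ k l, k ≤ l → P k → P l)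
    (hx : ∀ k, P k → x k = g k ^ e) (hx0 : ∀ k, ¬ P k → x k = 0) : Monotone x := by
  intro k l hkl
  by_cases h : P k
  · rw [hx k h, hx l (hP k l hkl h)]; exact ENNReal.rpow_le_rpow (hg hkl) he.le
  · rw [hx0 k h]; exact zero_le

theorem Mj_tendsto {F : Pt n → ℝ≥0∞} (hF : Measurable F) (hT : ∀ z, F z ≠ ⊤) {r e : ℝ} (hr : 1 < r) (he : 0 < e) :
    Tendsto (fun k => Mj (cutf F k) r e k) atTop (nhds (Mf F r e)) := by
  have mC := fun k => (cutf_nice hF k).meas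
  have inv_mono : ∀ k l : ℕ, k ≤ l → (l:ℝ≥0∞)⁻¹ ≤ (k:ℝ≥0∞)⁻¹ := fun k l h => ENNReal.inv_le_inv.2 (by exact_mod_cast h)
  -- line integrals
  have hm : ∀ u, Monotone (fun k => hX (cutf F k) u) := fun u k l hkl => lintegral_mono fun σ => cutf_mono F _ hkl
  have ht : ∀ u, Tendsto (fun k => hX (cutf F k) u) atTop (nhds (hX F u)) := fun u =>
    lintegral_tendsto_of_tendsto_of_monotone (fun k => by have := mC k; fun_prop) (ae_of_all _ fun σ => cutf_mono F _) (ae_of_all _ fun σ => cutf_tendsto (hT _))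
  have jm : ∀ u, Monotone (fun k => hj (cutf F k) r k u) := fun u => by
    refine cut_mono (P := fun k => u ∈ Scut (cutf F k) k) (g := fun k => hX (cutf F k) u) (e := r-1) (by linarith) (hm u) ?_ ?_ ?_
    · intro k l hkl h
      obtain ⟨h1, h2⟩ := h
      have c' : (k:ℝ) ≤ l := by exact_mod_cast hkl
      exact ⟨((inv_mono k l hkl).trans h1).trans (hm u hkl), h2.trans c'⟩
    · intro k hk; rw [hj, indicator_of_mem hk]
    · intro k hk; rw [hj, indicator_of_notMem hk]
  have jt : ∀ u, Tendsto (fun k => hj (cutf F k) r k u) atTop (nhds (hX F u ^ (r-1))) := fun u => by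
    refine cut_tendsto (by linarith) (ht u) ?_ ?_
    · filter_upwards [tendsto_natCast_atTop_atTop.eventually_ge_atTop |u.2|] with k hk h
      rw [hj, indicator_of_mem (by exact ⟨h, hk⟩)]
    · intro k; exact indicator_le_self _ _ _
  have nm : ∀ t, Monotone (fun k => Nj (cutf F k) r k t) := fun t k l hkl => lintegral_mono fun z =>
    mul_le_mul' (cutf_mono F z hkl) (jm _ hkl)
  have nt : ∀ t, Tendsto (fun k => Nj (cutf F k) r k t) atTop (nhds (∫⁻ z, F z * hX F (z, t) ^ (r-1))) := fun t => by
    refine lintegral_tendsto_of_tendsto_of_monotone (fun k => ?_) (ae_of_all _ fun z => ?_) (ae_of_all _ fun z => ?_)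
    · have := mC k
      have := measurable_hj (mC k) r k
      fun_prop
    · intro k l hkl; exact mul_le_mul' (cutf_mono F z hkl) (jm _ hkl)
    · by_cases h0 : F z = 0
      · have : ∀ k, cutf F k z = 0 := fun k => le_antisymm ((cutf_le F k z).trans_eq h0) zero_le
        simp [this, h0]
      · have : Tendsto (fun k => F z * hj (cutf F k) r k (z, t)) atTop (nhds (F z * hX F (z, t) ^ (r-1))) :=
          ENNReal.Tendsto.const_mul (jt _) (Or.inr (hT z))
        refine this.congr' ?_
        have h1 := ev_inv_le h0
        have h2 : ∀ᶠ k : ℕ in atTop, F z ≤ k := by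
          obtain ⟨N, hN⟩ := ENNReal.exists_nat_gt (hT z)
          filter_upwards [eventually_ge_atTop N] with k hk
          exact hN.le.trans (by exact_mod_cast hk)
        have h3 : ∀ᶠ k : ℕ in atTop, ‖z‖ ≤ k := tendsto_natCast_atTop_atTop.eventually_ge_atTop _
        filter_upwards [h1, h2, h3] with k a b c
        rw [cutf, indicator_of_mem (by exact ⟨a, b, c⟩)]
  refine lintegral_tendsto_of_tendsto_of_monotone (fun k => (measurable_NT (mC k) r k e).aemeasurable) (ae_of_all _ fun t => ?_) (ae_of_all _ fun t => ?_)
  · refine cut_mono (P := fun k => t ∈ Tcut (cutf F k) r k) (g := fun k => Nj (cutf F k) r k t) he (nm t) ?_ ?_ ?_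
    · intro k l hkl h
      exact ((inv_mono k l hkl).trans h).trans (nm t hkl)
    · intro k hk; rw [NT, indicator_of_mem hk]
    · intro k hk; rw [NT, indicator_of_notMem hk]
  · refine cut_tendsto he (nt t) ?_ ?_
    · refine Eventually.of_forall fun k h => ?_
      rw [NT, indicator_of_mem (by exact h)]
    · intro k; exact indicator_le_self _ _ _

theorem ee_pos {n : ℕ} (hn : 2 ≤ n) {s : ℝ} (hs : D0 n < s) : 0 < ee n s := by
  have hD := D0_ge hn
  have hn2 : (2:ℝ) ≤ n := by exact_mod_cast hn
  unfold ee
  exact div_pos (by linarith) (by linarith)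

theorem cutf_int {F : Pt n → ℝ≥0∞} {p : ℝ} (hp : 0 ≤ p) (h1 : ∫⁻ z, F z ^ p ≤ 1) (k : ℕ) : ∫⁻ z, cutf F k z ^ p ≤ 1 :=
  (lintegral_mono fun z => ENNReal.rpow_le_rpow (cutf_le F k z) hp).trans h1

theorem pp_ge {n : ℕ} (hn : 2 ≤ n) {s : ℝ} (hs : D0 n < s) : 1 ≤ pp n s := by
  have hD := D0_ge hn
  have hn2 : (2:ℝ) ≤ n := by exact_mod_cast hn
  rw [pp, one_le_div (by linarith)]; linarith

theorem Mf_le (hn : 2 ≤ n) {s : ℝ} (hs : D0 n < s) {F : Pt n → ℝ≥0∞} (hF : Measurable F) (hT : ∀ z, F z ≠ ⊤)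
    (h1 : ∫⁻ z, F z ^ pp n s ≤ 1) : Mf F (rr n s) (ee n s) ≤ ENNReal.ofReal (Real.exp (totC n (s - D0 n) / D0 n)) := by
  have hp := pp_ge hn hs
  exact le_of_tendsto' (Mj_tendsto hF hT (rr_gt hn hs) (ee_pos hn hs)) fun k =>
    (cutf_nice hF k).M_le hn hs (cutf_int (by linarith) h1 k) k

theorem KPgen (hn : 2 ≤ n) {s : ℝ} (hs : D0 n < s) {ε : ℝ≥0∞} (hε : ε ≠ 0) : ∃ K : ℝ, 0 < K ∧ ∀ F : Pt n → ℝ≥0∞, Measurable F →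
    (∀ z, F z ≠ ⊤) → ∫⁻ z, F z ^ pp n s ≤ 1 → ε < Mf F (rr n s) (ee n s) →
    ∃ φ J, IsSymJ n φ J ∧ ENNReal.ofReal K⁻¹ ≤ volume (KPset F φ J (pp n s) K) := by
  set T := totC n (s - D0 n) / D0 n with hTd
  obtain ⟨K, K0, hK⟩ := KPnice hn hs (max |T| |lg ε|)
  refine ⟨K, K0, fun F hF hT h1 hM => ?_⟩
  have hp := pp_ge hn hs
  have hp0 : 0 ≤ pp n s := by linarith
  obtain ⟨k, hk⟩ := ((Mj_tendsto hF hT (rr_gt hn hs) (ee_pos hn hs)).eventually (lt_mem_nhds hM)).exists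
  have up := (cutf_nice hF k).M_le hn hs (cutf_int hp0 h1 k) k
  have fM : Fp (Mj (cutf F k) (rr n s) (ee n s) k) := ⟨(pos_of_gt hk).ne', ne_top_of_le_ne_top ENNReal.ofReal_ne_top up⟩
  have fe : Fp ε := ⟨hε, (lt_of_lt_of_le hk le_top).ne⟩
  have hB : |lg (Mj (cutf F k) (rr n s) (ee n s) k)| ≤ max |T| |lg ε| := by
    have l1 := lg_mono fe fM.2 hk.le
    have l2 := lg_mono fM ENNReal.ofReal_ne_top up
    rw [lg_exp] at l2
    exact abs_le_max_abs_abs l1 l2 |>.trans_eq (max_comm _ _)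
  obtain ⟨φ, J, hJ, hv⟩ := hK _ _ _ _ (cutf_nice hF k) (cutf_int hp0 h1 k) k fM.1 hB
  refine ⟨φ, J, hJ, hv.trans (measure_mono fun w hw => ?_)⟩
  obtain ⟨a, b, c⟩ := hw
  have : cutf F k (φ w) = F (φ w) := by
    by_contra hc
    have h0 : cutf F k (φ w) = 0 := by
      by_contra h0
      have := mem_of_indicator_ne_zero h0
      exact hc (indicator_of_mem this _)
    rw [h0, mul_zero] at b
    have := le_antisymm b zero_le
    rw [ENNReal.ofReal_eq_zero] at this
    have := inv_pos.2 K0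
    linarith
  rw [this] at b c
  exact ⟨a, b, c⟩
end gen

section mixed
variable {n : ℕ}
def inn (r : ℝ) (g : Pt n → ℝ≥0∞) (t : ℝ) : ℝ≥0∞ := (∫⁻ y : Fin n → ℝ, g (t, y) ^ r) ^ (1/r)
def mxn (q r : ℝ) (g : Pt n → ℝ≥0∞) : ℝ≥0∞ := (∫⁻ t : ℝ, inn r g t ^ q) ^ (1/q)

theorem mixedNorm_eq (q r : ℝ) (g : Pt n → ℝ≥0∞) : mixedNorm n q r g = mxn q r g := by
  unfold mixedNorm mixedNormG mxn inn
  simp only [← ENNReal.rpow_mul]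
  congr! 4 
  ring
theorem measurable_inn {r : ℝ} {g : Pt n → ℝ≥0∞} (hg : Measurable g) : Measurable (inn r g) := by
  unfold inn
  refine Measurable.pow_const ?_ _
  exact Measurable.lintegral_prod_right' (f := fun x : ℝ × (Fin n → ℝ) => g x ^ r) (hg.pow_const _)
theorem mxn_mono {q r : ℝ} (hq : 0 < q) (hr : 0 < r) {g h : Pt n → ℝ≥0∞} (H : ∀ u, g u ≤ h u) : mxn q r g ≤ mxn q r h := by
  unfold mxn inn
  refine ENNReal.rpow_le_rpow (lintegral_mono fun t => ENNReal.rpow_le_rpow (ENNReal.rpow_le_rpow (lintegral_mono fun y => 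
    ENNReal.rpow_le_rpow (H _) hr.le) (by positivity)) hq.le) (by positivity)
theorem rpow_inv_cancel {a : ℝ≥0∞} {q : ℝ} (hq : 0 < q) : (a ^ q) ^ (1/q) = a := by
  rw [← ENNReal.rpow_mul, mul_one_div_cancel hq.ne', ENNReal.rpow_one]
theorem rpow_inv_cancel' {a : ℝ≥0∞} {q : ℝ} (hq : 0 < q) : (a ^ (1/q)) ^ q = a := by
  rw [← ENNReal.rpow_mul, one_div_mul_cancel hq.ne', ENNReal.rpow_one]
theorem mxn_const_mul {q r : ℝ} (hq : 0 < q) (hr : 0 < r) {g : Pt n → ℝ≥0∞} (hg : Measurable g) (c : ℝ≥0∞) :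
    mxn q r (fun u => c * g u) = c * mxn q r g := by
  have h1 : ∀ t, inn r (fun u => c * g u) t = c * inn r g t := fun t => by
    unfold inn
    simp only [ENNReal.mul_rpow_of_nonneg _ _ hr.le]
    rw [lintegral_const_mul _ (by fun_prop), ENNReal.mul_rpow_of_nonneg _ _ (by positivity), rpow_inv_cancel hr]
  unfold mxn
  simp only [h1, ENNReal.mul_rpow_of_nonneg _ _ hq.le]
  have := measurable_inn (r := r) hg
  rw [lintegral_const_mul _ (by fun_prop), ENNReal.mul_rpow_of_nonneg _ _ (by positivity), rpow_inv_cancel hq]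
theorem mxn_add {q r : ℝ} (hq : 1 ≤ q) (hr : 1 ≤ r) {g h : Pt n → ℝ≥0∞} (hg : Measurable g) (hh : Measurable h) :
    mxn q r (fun u => g u + h u) ≤ mxn q r g + mxn q r h := by
  have h1 : ∀ t, inn r (fun u => g u + h u) t ≤ inn r g t + inn r h t := fun t => by
    unfold inn
    exact ENNReal.lintegral_Lp_add_le (by fun_prop) (by fun_prop) hr
  have m1 := measurable_inn (r := r) hg
  have m2 := measurable_inn (r := r) hh
  refine le_trans ?_ (ENNReal.lintegral_Lp_add_le m1.aemeasurable m2.aemeasurable hq)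
  exact ENNReal.rpow_le_rpow (lintegral_mono fun t => ENNReal.rpow_le_rpow (h1 t) (by linarith)) (by positivity)
theorem mxn_pow {q r v : ℝ} (hv : 0 < v) (g : Pt n → ℝ≥0∞) : mxn (q/v) (r/v) (fun u => g u ^ v) = mxn q r g ^ v := by
  unfold mxn inn
  simp only [← ENNReal.rpow_mul]
  have h1 : v * (r/v) = r := by field_simp
  have h2 : 1 / (r/v) * (q/v) = 1/r*q := by field_simp
  have h3 : 1/(q/v) = 1/q * v := by field_simp
  rw [h1, h2, h3]
theorem mxn_max {q r v : ℝ} (hv : 0 < v) (hq : v ≤ q) (hr : v ≤ r) {g h : Pt n → ℝ≥0∞} (hg : Measurable g) (hh : Measurable h) :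
    mxn q r (fun u => max (g u) (h u)) ^ v ≤ mxn q r g ^ v + mxn q r h ^ v := by
  rw [← mxn_pow hv, ← mxn_pow hv, ← mxn_pow hv]
  have hq' : 1 ≤ q/v := by rwa [one_le_div hv]
  have hr' : 1 ≤ r/v := by rwa [one_le_div hv]
  refine le_trans (mxn_mono (by linarith) (by linarith) fun u => ?_) (mxn_add hq' hr' (hg.pow_const _) (hh.pow_const _))
  rcases le_total (g u) (h u) with H | H
  · rw [max_eq_right H]; exact le_add_self
  · rw [max_eq_left H]; exact le_self_add
theorem mxn_XE {F : Pt n → ℝ≥0∞} (hF : Measurable F) {q r : ℝ} (hr : 1 ≤ r) : mxn q r (XE F) = (Mf F r (q/r)) ^ (1/q) := by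
  unfold mxn inn Mf
  simp only [Mf_inner hF hr, ← ENNReal.rpow_mul]
  congr! 4
  ring
theorem XE_add {F G : Pt n → ℝ≥0∞} (hF : Measurable F) (u : Pt n) : XE (fun z => F z + G z) u = XE F u + XE G u := by
  unfold XE
  exact lintegral_add_left (by fun_prop) _
theorem XE_const_mul {F : Pt n → ℝ≥0∞} (hF : Measurable F) (c : ℝ≥0∞) (u : Pt n) : XE (fun z => c * F z) u = c * XE F u := by
  unfold XE
  exact lintegral_const_mul _ (by fun_prop)
theorem XE_mono {F G : Pt n → ℝ≥0∞} (H : ∀ z, F z ≤ G z) (u : Pt n) : XE F u ≤ XE G u := lintegral_mono fun s => H _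
theorem int_XE {F : Pt n → ℝ≥0∞} (hF : Measurable F) (t : ℝ) : ∫⁻ y, XE F (t, y) = ∫⁻ z, F z := by
  have := Mf_inner hF le_rfl t
  simpa using this.symm

/-- the domination lemma -/
theorem dom {q r : ℝ} (hq : 0 < q) (hr : 0 < r) {H : Pt n → ℝ≥0∞} (hH : Measurable H) (hT : mxn q r H ≠ ⊤) {ε : ℝ≥0∞} (hε : 0 < ε) :
    ∃ m : ℕ, 0 < m ∧ ∀ g : Pt n → ℝ≥0∞, Measurable g → (∀ u, g u ≤ H u) →
      ∫⁻ u in Metric.closedBall 0 m, g u ≤ ENNReal.ofReal ((1/2)^m) → mxn q r g ≤ ε := by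
  by_contra hc
  push Not at hc
  have hc' : ∀ m : ℕ, ∃ g : Pt n → ℝ≥0∞, Measurable g ∧ (∀ u, g u ≤ H u) ∧
      ∫⁻ u in Metric.closedBall 0 ((m+1:ℕ):ℝ), g u ≤ ENNReal.ofReal ((1/2)^(m+1)) ∧ ε < mxn q r g := by
    intro m
    obtain ⟨g, a, b, c, d⟩ := hc (m+1) (by omega)
    exact ⟨g, a, b, c, d⟩
  choose g mg gH gi gε using hc'
  have hsum : ∫⁻ u, ∑' m, (Metric.closedBall (0 : Pt n) ((m+1:ℕ):ℝ)).indicator (g m) u ≠ ⊤ := by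
    rw [lintegral_tsum fun m => ((mg m).indicator measurableSet_closedBall).aemeasurable]
    have hs : Summable (fun m : ℕ => ((1/2:ℝ))^(m+1)) := (summable_nat_add_iff 1).2 (summable_geometric_of_lt_one (by norm_num) (by norm_num))
    refine ne_top_of_le_ne_top (b := ∑' m : ℕ, ENNReal.ofReal ((1/2:ℝ)^(m+1))) ?_ (ENNReal.tsum_le_tsum fun m => ?_)
    · exact hs.tsum_ofReal_ne_top
    · rw [lintegral_indicator measurableSet_closedBall]; exact gi m
  have hae : ∀ᵐ u : Pt n, Tendsto (fun m => g m u) atTop (nhds 0) := by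
    have := ae_lt_top' (Measurable.ennreal_tsum fun m => (mg m).indicator measurableSet_closedBall).aemeasurable hsum
    filter_upwards [this] with u hu
    have h0 := ENNReal.tendsto_atTop_zero_of_tsum_ne_top hu.ne
    refine h0.congr' ?_
    filter_upwards [tendsto_natCast_atTop_atTop.eventually_ge_atTop ‖u‖] with m hm
    rw [indicator_of_mem]
    rw [mem_closedBall_zero_iff]; push_cast; linarith
  rw [Measure.volume_eq_prod] at hae
  have hae2 := Measure.ae_ae_of_ae_prod hae
  have hTT : ∫⁻ t, inn r H t ^ q ≠ ⊤ := by
    intro h; apply hT; rw [mxn, h, ENNReal.top_rpow_of_pos (by positivity)]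
  have mH := measurable_inn (r := r) hH
  have hfin := ae_lt_top (mH.pow_const q) hTT
  have key : Tendsto (fun m => ∫⁻ t, inn r (g m) t ^ q) atTop (nhds (∫⁻ t : ℝ, 0)) := by
    refine tendsto_lintegral_of_dominated_convergence _ (fun m => (measurable_inn (mg m)).pow_const q) (fun m => ae_of_all _ fun t => ?_) hTT ?_
    · exact ENNReal.rpow_le_rpow (ENNReal.rpow_le_rpow (lintegral_mono fun y => ENNReal.rpow_le_rpow (gH m _) hr.le) (by positivity)) hq.le
    · filter_upwards [hae2, hfin] with t ht hf
      have hf2 : ∫⁻ y, H (t, y) ^ r ≠ ⊤ := by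
        intro h; apply hf.ne; rw [inn, h, ENNReal.top_rpow_of_pos (by positivity), ENNReal.top_rpow_of_pos hq]
      have : Tendsto (fun m => ∫⁻ y, g m (t, y) ^ r) atTop (nhds (∫⁻ y : Fin n → ℝ, 0)) := by
        refine tendsto_lintegral_of_dominated_convergence _ (fun m => by have := mg m; fun_prop) (fun m => ae_of_all _ fun y => ENNReal.rpow_le_rpow (gH m _) hr.le) hf2 ?_
        filter_upwards [ht] with y hy
        have := ((ENNReal.continuous_rpow_const (y := r)).tendsto 0).comp hy
        rwa [ENNReal.zero_rpow_of_pos hr] at this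
      rw [lintegral_zero] at this
      have h2 := ((ENNReal.continuous_rpow_const (y := q)).tendsto 0).comp ((((ENNReal.continuous_rpow_const (y := 1/r)).tendsto 0).comp this).trans_eq (by rw [ENNReal.zero_rpow_of_pos (by positivity)]))
      rwa [ENNReal.zero_rpow_of_pos hq] at h2
  rw [lintegral_zero] at key
  have k2 := ((ENNReal.continuous_rpow_const (y := 1/q)).tendsto 0).comp key
  rw [ENNReal.zero_rpow_of_pos (by positivity)] at k2
  obtain ⟨m, hm⟩ := (k2.eventually (gt_mem_nhds hε)).exists
  exact absurd hm (not_lt.2 (gε m).le)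
end mixed

section expo
variable {n : ℕ}
def qq (n : ℕ) (s : ℝ) : ℝ := (s+n)/D0 n
def ssd (n : ℕ) (θ : ℝ) : ℝ := n*(n+3)/(2*θ) - n

theorem ssd_gt (hn : 2 ≤ n) {θ : ℝ} (h : θ ∈ Ioo (0:ℝ) 1) : D0 n < ssd n θ := by
  have hn2 : (2:ℝ) ≤ n := by exact_mod_cast hn
  have : n*(n+3)/2 < n*(n+3)/(2*θ) := by
    refine div_lt_div_of_pos_left (by positivity) (by linarith [h.1]) (by linarith [h.2])
  unfold ssd D0
  linarith
theorem pExp_eq (hn : 2 ≤ n) {θ : ℝ} (h : θ ∈ Ioo (0:ℝ) 1) : pExp (n+1) θ = pp n (ssd n θ) := by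
  have hn2 : (2:ℝ) ≤ n := by exact_mod_cast hn
  have h0 := h.1
  have := ssd_gt hn h
  have hD := D0_ge hn
  have hs : 0 < ssd n θ := by linarith
  unfold pExp pp
  rw [inv_eq_iff_eq_inv, inv_div, _root_.eq_div_iff (by linarith)]
  unfold ssd
  push_cast
  field_simp
  ring
theorem rExp_eq (hn : 2 ≤ n) {θ : ℝ} (h : θ ∈ Ioo (0:ℝ) 1) : rExp (n+1) θ = rr n (ssd n θ) := by
  have hn2 : (2:ℝ) ≤ n := by exact_mod_cast hn
  have h0 := h.1
  have := ssd_gt hn h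
  have hD := D0_ge hn
  have hs : 0 < ssd n θ := by linarith
  have h2 : ((n+1:ℕ):ℝ)^2 + (n+1:ℕ) - 2 = n*(n+3) := by push_cast; ring
  have h3 : ((n+1:ℕ):ℝ)^2 - (n+1:ℕ) - 2 = n^2+n-2 := by push_cast; ring
  unfold rExp rr
  rw [inv_eq_iff_eq_inv, inv_div, _root_.eq_div_iff (by linarith), h2, h3]
  unfold ssd
  field_simp
  ring
theorem qExp_eq (hn : 2 ≤ n) {θ : ℝ} (h : θ ∈ Ioo (0:ℝ) 1) : qExp (n+1) θ = qq n (ssd n θ) := by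
  have hn2 : (2:ℝ) ≤ n := by exact_mod_cast hn
  have h0 := h.1
  have := ssd_gt hn h
  have hD := D0_ge hn
  have hs : 0 < ssd n θ := by linarith
  unfold qExp qq
  rw [inv_eq_iff_eq_inv, inv_div, _root_.eq_div_iff (by linarith)]
  unfold ssd D0
  push_cast
  field_simp
  ring
theorem qq_gt (hn : 2 ≤ n) {s : ℝ} (hs : D0 n < s) : pp n s < qq n s := by
  have hD := D0_ge hn
  have hn2 : (2:ℝ) ≤ n := by exact_mod_cast hn
  unfold pp qq
  exact div_lt_div_of_pos_left (by linarith) (by linarith) hs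
theorem rr_gt_pp (hn : 2 ≤ n) {s : ℝ} (hs : D0 n < s) : pp n s < rr n s := by
  have hD := D0_ge hn
  have hn2 : (2:ℝ) ≤ n := by exact_mod_cast hn
  unfold pp rr
  exact div_lt_div_of_pos_left (by linarith) (by linarith) (by linarith)
theorem pp_gt (hn : 2 ≤ n) {s : ℝ} (hs : D0 n < s) : 1 < pp n s := by
  have hD := D0_ge hn
  have hn2 : (2:ℝ) ≤ n := by exact_mod_cast hn
  rw [pp, one_lt_div (by linarith)]; linarith
theorem qr_ee (hn : 2 ≤ n) {s : ℝ} (hs : D0 n < s) : qq n s / rr n s = ee n s := by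
  have hD := D0_ge hn
  have hn2 : (2:ℝ) ≤ n := by exact_mod_cast hn
  have h1 : s + n ≠ 0 := by linarith
  have h2 : s - 1 ≠ 0 := by linarith
  have h3 : D0 n ≠ 0 := by linarith
  unfold qq rr ee
  field_simp

/-- the mixed norm of the transform, at the exponents attached to `s` -/
def NX (n : ℕ) (s : ℝ) (F : Pt n → ℝ≥0∞) : ℝ≥0∞ := mxn (qq n s) (rr n s) (XE F)
def PN (n : ℕ) (s : ℝ) (F : Pt n → ℝ≥0∞) : ℝ≥0∞ := ∫⁻ z, F z ^ pp n s

theorem NX_Mf (hn : 2 ≤ n) {s : ℝ} (hs : D0 n < s) {F : Pt n → ℝ≥0∞} (hF : Measurable F) :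
    NX n s F = Mf F (rr n s) (ee n s) ^ (1/qq n s) := by
  rw [NX, mxn_XE hF (rr_gt hn hs).le, qr_ee hn hs]
theorem NX_le_const (hn : 2 ≤ n) {s : ℝ} (hs : D0 n < s) : ∃ C : ℝ≥0∞, C ≠ ⊤ ∧ ∀ F : Pt n → ℝ≥0∞, Measurable F → (∀ z, F z ≠ ⊤) →
    PN n s F ≤ 1 → NX n s F ≤ C := by
  have hq : 0 < qq n s := by linarith [qq_gt hn hs, pp_gt hn hs]
  refine ⟨_, ENNReal.rpow_ne_top_of_nonneg (by positivity : 0 ≤ 1/qq n s) (ENNReal.ofReal_ne_top (r := Real.exp (totC n (s - D0 n) / D0 n))), fun F hF hT h1 => ?_⟩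
  rw [NX_Mf hn hs hF]
  exact ENNReal.rpow_le_rpow (Mf_le hn hs hF hT h1) (by positivity)
theorem NX_const_mul (hn : 2 ≤ n) {s : ℝ} (hs : D0 n < s) {F : Pt n → ℝ≥0∞} (hF : Measurable F) (c : ℝ≥0∞) :
    NX n s (fun z => c * F z) = c * NX n s F := by
  have hq : 0 < qq n s := by linarith [qq_gt hn hs, pp_gt hn hs]
  have hr : 0 < rr n s := by linarith [rr_gt hn hs]
  unfold NX
  rw [← mxn_const_mul hq hr (measurable_XE hF)]
  congr 1; funext u; exact XE_const_mul hF c u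
theorem PN_const_mul (hn : 2 ≤ n) {s : ℝ} (hs : D0 n < s) {F : Pt n → ℝ≥0∞} (hF : Measurable F) (c : ℝ≥0∞) :
    PN n s (fun z => c * F z) = c ^ pp n s * PN n s F := by
  have hp : 0 < pp n s := by linarith [pp_gt hn hs]
  unfold PN
  simp only [ENNReal.mul_rpow_of_nonneg _ _ hp.le]
  exact lintegral_const_mul _ (by fun_prop)
theorem NX_add (hn : 2 ≤ n) {s : ℝ} (hs : D0 n < s) {F G : Pt n → ℝ≥0∞} (hF : Measurable F) (hG : Measurable G) :
    NX n s (fun z => F z + G z) ≤ NX n s F + NX n s G := by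
  have hq : 1 ≤ qq n s := by linarith [qq_gt hn hs, pp_gt hn hs]
  have hr : 1 ≤ rr n s := by linarith [rr_gt hn hs]
  unfold NX
  have : XE (fun z => F z + G z) = fun u => XE F u + XE G u := funext fun u => XE_add hF u
  rw [this]
  exact mxn_add hq hr (measurable_XE hF) (measurable_XE hG)
theorem NX_mono (hn : 2 ≤ n) {s : ℝ} (hs : D0 n < s) {F G : Pt n → ℝ≥0∞} (H : ∀ z, F z ≤ G z) : NX n s F ≤ NX n s G := by
  have hq : 1 ≤ qq n s := by linarith [qq_gt hn hs, pp_gt hn hs]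
  have hr : 1 ≤ rr n s := by linarith [rr_gt hn hs]
  exact mxn_mono (by linarith) (by linarith) fun u => XE_mono H u
theorem NX_pos (hn : 2 ≤ n) {s : ℝ} (hs : D0 n < s) {F : Pt n → ℝ≥0∞} (hF : Measurable F) (h : NX n s F = 0) : PN n s F = 0 := by
  have hq : 1 ≤ qq n s := by linarith [qq_gt hn hs, pp_gt hn hs]
  have hr : 1 ≤ rr n s := by linarith [rr_gt hn hs]
  have hp : 0 < pp n s := by linarith [pp_gt hn hs]
  have m1 := measurable_inn (r := rr n s) (measurable_XE hF)
  rw [NX, mxn, ENNReal.rpow_eq_zero_iff_of_pos (by positivity), lintegral_eq_zero_iff (m1.pow_const _)] at h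
  obtain ⟨t, ht⟩ := h.exists
  have mX := measurable_XE hF
  simp only [Pi.zero_apply] at ht
  rw [ENNReal.rpow_eq_zero_iff_of_pos (by positivity), inn, ENNReal.rpow_eq_zero_iff_of_pos (by positivity), lintegral_eq_zero_iff (by fun_prop)] at ht
  have h0 : ∫⁻ y, XE F (t, y) = 0 := by
    rw [lintegral_eq_zero_iff (by fun_prop)]
    filter_upwards [ht] with y hy
    simp only [Pi.zero_apply] at hy ⊢
    rwa [ENNReal.rpow_eq_zero_iff_of_pos (by linarith)] at hy
  rw [int_XE hF, lintegral_eq_zero_iff hF] at h0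
  rw [PN, lintegral_eq_zero_iff (by fun_prop)]
  filter_upwards [h0] with z hz
  simp only [Pi.zero_apply] at hz ⊢
  rw [hz, ENNReal.zero_rpow_of_pos hp]

/-- the operator constant -/
structure OpC (n : ℕ) (s : ℝ) (A : ℝ≥0∞) : Prop where
  pos : A ≠ 0
  top : A ≠ ⊤
  bd : ∀ F : Pt n → ℝ≥0∞, Measurable F → (∀ z, F z ≠ ⊤) → NX n s F ≤ A * PN n s F ^ (1/pp n s)

theorem opc_of (hn : 2 ≤ n) {s : ℝ} (hs : D0 n < s) {A : ℝ≥0∞}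
    (h1 : ∀ F : Pt n → ℝ≥0∞, Measurable F → (∀ z, F z ≠ ⊤) → PN n s F = 1 → NX n s F ≤ A)
    (h2 : ∀ C : ℝ≥0∞, (∀ F : Pt n → ℝ≥0∞, Measurable F → (∀ z, F z ≠ ⊤) → PN n s F = 1 → NX n s F ≤ C) → A ≤ C)
    (F0 : Pt n → ℝ≥0∞) (m0 : Measurable F0) (t0 : ∀ z, F0 z ≠ ⊤) (p0 : PN n s F0 = 1) : OpC n s A := by
  have hp : 0 < pp n s := by linarith [pp_gt hn hs]
  obtain ⟨C, hC, hCb⟩ := NX_le_const hn hs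
  have hA0 : A ≠ 0 := by
    intro h
    have := h1 F0 m0 t0 p0
    rw [h] at this
    have := NX_pos hn hs m0 (le_antisymm this zero_le)
    rw [p0] at this; exact one_ne_zero this
  refine ⟨hA0, ne_top_of_le_ne_top hC (h2 C fun F a b c => hCb F a b c.le), fun F hF hT => ?_⟩
  by_cases hz : PN n s F = 0
  · have : ∀ k : ℕ, (k:ℝ≥0∞) * NX n s F ≤ C := fun k => by
      rw [← NX_const_mul hn hs hF]
      refine hCb _ (by fun_prop) (fun z => ENNReal.mul_ne_top (by simp) (hT z)) ?_
      rw [PN_const_mul hn hs hF, hz]; simp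
    have h0 : NX n s F = 0 := by
      by_contra h0
      obtain ⟨k, hk⟩ := ENNReal.exists_nat_mul_gt h0 hC
      exact absurd (this k) (not_le.2 hk)
    rw [h0]; exact zero_le
  by_cases ht : PN n s F = ⊤
  · rw [ht, ENNReal.top_rpow_of_pos (by positivity), ENNReal.mul_top hA0]; exact le_top
  set c := PN n s F ^ (1/pp n s) with hc
  have c0 : c ≠ 0 := by
    rw [hc]; intro h; rw [ENNReal.rpow_eq_zero_iff_of_pos (by positivity)] at h; exact hz h
  have ct : c ≠ ⊤ := ENNReal.rpow_ne_top_of_nonneg (by positivity) ht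
  have := h1 (fun z => c⁻¹ * F z) (by fun_prop) (fun z => ENNReal.mul_ne_top (by simpa using c0) (hT z)) (by
    rw [PN_const_mul hn hs hF, ENNReal.inv_rpow, hc, rpow_inv_cancel' hp, ENNReal.inv_mul_cancel hz ht])
  rw [NX_const_mul hn hs hF] at this
  rw [mul_comm A, ← ENNReal.div_le_iff' c0 ct, div_eq_mul_inv, mul_comm]
  exact this
end expo

section inv
variable {n : ℕ}
theorem SymS.hX {φ : Pt n → Pt n} {J a b t0 : ℝ} (h : SymS φ J a b t0) {F : Pt n → ℝ≥0∞} (hF : Measurable F) (z : Pt n) (t : ℝ) :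
    ENNReal.ofReal a * hX (fun w => F (φ w)) (z, t) = hX F (φ z, t0 + b*t) := by
  have hc := continuous_stp n
  have := lint_smul h.ha (fun σ : ℝ => F (φ z + stp n (t0 + b*t, σ))) (by fun_prop)
  simp only [Module.finrank_self, pow_one, smul_eq_mul] at this
  unfold _root_.hX
  simp only [h.st]
  exact this
theorem SymS.PN {φ : Pt n → Pt n} {J a b t0 : ℝ} (h : SymS φ J a b t0) (hn : 2 ≤ n) {s : ℝ} (hs : D0 n < s) {F : Pt n → ℝ≥0∞} (hF : Measurable F) :
    PN n s (fun z => ENNReal.ofReal (J ^ (1/pp n s)) * F (φ z)) = PN n s F := by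
  have hp : 0 < pp n s := by linarith [pp_gt hn hs]
  have hφ := h.hφ.measurable
  have hJ : 0 < J := by rw [h.hJ]; have := h.ha; have := h.hb; positivity
  rw [PN_const_mul hn hs (F := fun z => F (φ z)) (hF.comp hφ), ← ENNReal.ofReal_rpow_of_pos hJ, rpow_inv_cancel' hp]
  exact h.vol (fun z => F z ^ pp n s) (by fun_prop)
theorem SymS.Mf {φ : Pt n → Pt n} {J a b t0 : ℝ} (h : SymS φ J a b t0) (hn : 2 ≤ n) {s : ℝ} (hs : D0 n < s) {F : Pt n → ℝ≥0∞} (hF : Measurable F) :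
    Mf (fun z => ENNReal.ofReal (J ^ (1/pp n s)) * F (φ z)) (rr n s) (ee n s) = Mf F (rr n s) (ee n s) := by
  have hD := D0_ge hn
  have hn2 : (2:ℝ) ≤ n := by exact_mod_cast hn
  have hφ := h.hφ.measurable
  have ha := h.ha
  have hb := h.hb
  have hJ : 0 < J := by rw [h.hJ]; positivity
  have hr := rr_gt hn hs
  have he := ee_pos hn hs
  have mh := measurable_hX hF
  have mφ : Measurable (fun z => F (φ z)) := hF.comp hφ
  set c := J ^ (1/pp n s) with hc
  have c0 : 0 < c := Real.rpow_pos_of_pos hJ _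
  set k := ENNReal.ofReal (c ^ rr n s * a ^ (1 - rr n s) * J⁻¹) with hk
  have inner : ∀ t, ∫⁻ z, ENNReal.ofReal c * F (φ z) * _root_.hX (fun z => ENNReal.ofReal c * F (φ z)) (z, t) ^ (rr n s - 1)
      = k * ∫⁻ z, F z * _root_.hX F (z, t0 + b*t) ^ (rr n s - 1) := by
    intro t
    have e1 : ∀ z, _root_.hX (fun z => ENNReal.ofReal c * F (φ z)) (z, t) = ENNReal.ofReal (c * a⁻¹) * _root_.hX F (φ z, t0 + b*t) := fun z => by
      rw [← h.hX hF, ← mul_assoc, ← ENNReal.ofReal_mul (by positivity)]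
      have : c * a⁻¹ * a = c := by field_simp
      rw [this]
      have hc := continuous_stp n
      exact lintegral_const_mul _ (by fun_prop)
    have := h.vol (fun z => F z * _root_.hX F (z, t0 + b*t) ^ (rr n s - 1)) (by fun_prop)
    rw [← this, ← mul_assoc, hk, ← ENNReal.ofReal_mul (by positivity), ← lintegral_const_mul _ (by fun_prop)]
    refine lintegral_congr fun z => ?_
    rw [e1, ENNReal.mul_rpow_of_nonneg _ _ (by linarith), ENNReal.ofReal_rpow_of_pos (by positivity)]
    have : c ^ rr n s * a ^ (1 - rr n s) * J⁻¹ * J = c * (c*a⁻¹)^(rr n s - 1) := by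
      rw [Real.mul_rpow c0.le (by positivity), Real.inv_rpow ha.le, ← Real.rpow_neg ha.le, neg_sub, mul_assoc, inv_mul_cancel₀ hJ.ne', mul_one, ← mul_assoc]
      congr 1
      rw [Real.rpow_sub_one c0.ne']; field_simp
    rw [this, ENNReal.ofReal_mul c0.le]
    ring
  have kk : c ^ rr n s * a ^ (1 - rr n s) * J⁻¹ = b ^ (D0 n / (s-1)) := by
    have h1 : s - 1 ≠ 0 := by linarith
    have h2 : s ≠ 0 := by linarith
    have h3 : s + n ≠ 0 := by linarith
    have hJ' : J = a ^ ((n:ℝ)+1) * b ^ D0 n := by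
      rw [h.hJ, ← D0_nat n, Real.rpow_natCast]; congr 1; rw [← Real.rpow_natCast]; push_cast; rfl
    rw [hc, ← Real.rpow_mul hJ.le, ← Real.rpow_neg_one J, mul_right_comm, ← Real.rpow_add hJ]
    have e1 : 1/pp n s * rr n s + -1 = 1/(s-1) := by unfold pp rr; field_simp; ring
    have e2 : 1 - rr n s = -((n+1)/(s-1)) := by unfold rr; field_simp; ring
    rw [e1, e2, hJ', Real.mul_rpow (by positivity) (by positivity), ← Real.rpow_mul ha.le, ← Real.rpow_mul hb.le, mul_right_comm, ← Real.rpow_add ha]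
    have : ((n:ℝ)+1)*(1/(s-1)) + -((n+1)/(s-1)) = 0 := by ring
    rw [this, Real.rpow_zero, one_mul]; congr 1; ring
  have mm : Measurable (fun t : ℝ => (∫⁻ z, F z * _root_.hX F (z, t) ^ (rr n s - 1)) ^ ee n s) := by
    refine Measurable.pow_const ?_ _
    refine Measurable.lintegral_prod_right' (f := fun x : ℝ × Pt n => F x.2 * _root_.hX F (x.2, x.1) ^ (rr n s - 1)) ?_
    fun_prop
  unfold _root_.Mf
  simp only [inner, ENNReal.mul_rpow_of_nonneg _ _ he.le]
  have mm2 : Measurable (fun t : ℝ => (∫⁻ z, F z * _root_.hX F (z, t0 + b * t) ^ (rr n s - 1)) ^ ee n s) :=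
    mm.comp (g := fun t => (∫⁻ z, F z * _root_.hX F (z, t) ^ (rr n s - 1)) ^ ee n s) (f := fun t : ℝ => t0 + b*t) (by fun_prop)
  rw [lintegral_const_mul _ mm2, hk, kk, ENNReal.ofReal_rpow_of_pos (by positivity), ← Real.rpow_mul hb.le]
  have e3 : D0 n / (s-1) * ee n s = 1 := by
    have h1 : s - 1 ≠ 0 := by linarith
    have h3 : D0 n ≠ 0 := by linarith
    unfold ee; field_simp
  rw [e3, Real.rpow_one]
  have := lint_smul hb (fun t : ℝ => (∫⁻ z, F z * _root_.hX F (z, t0 + t) ^ (rr n s - 1)) ^ ee n s)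
    (mm.comp (g := fun t => (∫⁻ z, F z * _root_.hX F (z, t) ^ (rr n s - 1)) ^ ee n s) (f := fun t : ℝ => t0 + t) (by fun_prop))
  simp only [Module.finrank_self, pow_one, smul_eq_mul] at this
  rw [this]
  exact lintegral_add_left_eq_self (fun t : ℝ => (∫⁻ z, F z * _root_.hX F (z, t) ^ (rr n s - 1)) ^ ee n s) t0
theorem SymS.NX {φ : Pt n → Pt n} {J a b t0 : ℝ} (h : SymS φ J a b t0) (hn : 2 ≤ n) {s : ℝ} (hs : D0 n < s) {F : Pt n → ℝ≥0∞} (hF : Measurable F) :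
    NX n s (fun z => ENNReal.ofReal (J ^ (1/pp n s)) * F (φ z)) = NX n s F := by
  have hφ := h.hφ.measurable
  rw [NX_Mf hn hs hF, NX_Mf hn hs (by fun_prop), h.Mf hn hs hF]
end inv

section tight
variable {n : ℕ}
def adj (E : Set (Pt n)) (z : Pt n) : ℝ≥0∞ := ∫⁻ t : ℝ, E.indicator (fun _ => (1:ℝ≥0∞)) (t, z.2 - z.1 • mom n t)
theorem measurable_adj {E : Set (Pt n)} (hE : MeasurableSet E) : Measurable (adj E) := by
  have hm := measurable_mom n
  have h1 : Measurable (E.indicator (fun _ => (1:ℝ≥0∞))) := measurable_const.indicator hE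
  refine Measurable.lintegral_prod_right' (f := fun x : Pt n × ℝ => E.indicator (fun _ => (1:ℝ≥0∞)) (x.2, x.1.2 - x.1.1 • mom n x.2)) ?_
  fun_prop
theorem adj_eq {E : Set (Pt n)} (hE : MeasurableSet E) {F : Pt n → ℝ≥0∞} (hF : Measurable F) :
    ∫⁻ u in E, XE F u = ∫⁻ z, F z * adj E z := by
  have hm := measurable_mom n
  have mX := measurable_XE hF
  have h1 : Measurable (E.indicator (fun _ => (1:ℝ≥0∞))) := measurable_const.indicator hE
  set χ := E.indicator (fun _ => (1:ℝ≥0∞)) with hχ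
  have e1 : ∫⁻ u in E, XE F u = ∫⁻ u, χ u * XE F u := by
    rw [← lintegral_indicator hE]
    refine lintegral_congr fun u => ?_
    by_cases h : u ∈ E <;> simp [hχ, h]
  rw [e1, Measure.volume_eq_prod, lintegral_prod _ (by fun_prop)]
  have e2 : ∀ t : ℝ, ∫⁻ y : Fin n → ℝ, χ (t, y) * XE F (t, y) = ∫⁻ z : Pt n, F z * χ (t, z.2 - z.1 • mom n t) := by
    intro t
    rw [Measure.volume_eq_prod, lintegral_prod _ (by fun_prop)]
    have : ∀ s : ℝ, ∫⁻ x : Fin n → ℝ, F (s, x) * χ (t, x - s • mom n t) = ∫⁻ y : Fin n → ℝ, χ (t, y) * F (s, y + s • mom n t) := by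
      intro s
      rw [← lintegral_add_right_eq_self (μ := volume) _ (s • mom n t)]
      refine lintegral_congr fun y => ?_
      simp [mul_comm]
    simp only [this]
    rw [lintegral_lintegral_swap (by fun_prop)]
    refine lintegral_congr fun y => ?_
    rw [lintegral_const_mul _ (by fun_prop)]; rfl
  simp only [e2]
  rw [lintegral_lintegral_swap (by fun_prop), ← Measure.volume_eq_prod]
  refine lintegral_congr fun z => ?_
  rw [lintegral_const_mul _ (by fun_prop)]; rfl
theorem adj_le (m : ℕ) (z : Pt n) : adj (Metric.closedBall 0 m) z ≤ ENNReal.ofReal (2*m) := by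
  have : ∀ t : ℝ, (Metric.closedBall (0 : Pt n) m).indicator (fun _ => (1:ℝ≥0∞)) (t, z.2 - z.1 • mom n t) ≤ (Icc (-(m:ℝ)) m).indicator (fun _ => 1) t := by
    intro t
    by_cases h : (t, z.2 - z.1 • mom n t) ∈ Metric.closedBall (0 : Pt n) m
    · rw [mem_closedBall_zero_iff] at h
      have : |t| ≤ m := (norm_fst_le _).trans h
      rw [indicator_of_mem (a := t) (s := Icc (-(m:ℝ)) m) (abs_le.1 this)]
      exact indicator_le_self _ _ _
    · rw [indicator_of_notMem h]; exact zero_le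
  refine (lintegral_mono this).trans ?_
  rw [lintegral_indicator measurableSet_Icc]
  simp only [lintegral_const, Measure.restrict_apply MeasurableSet.univ, univ_inter, Real.volume_Icc, one_mul]
  exact ENNReal.ofReal_le_ofReal (by linarith)

theorem hold_set {α : Type*} [MeasurableSpace α] (μ : Measure α) {B : Set α} (hB : MeasurableSet B) (hT : μ B ≠ ⊤) {r : ℝ} (hr : 1 < r) :
    ∃ C : ℝ≥0∞, C ≠ ⊤ ∧ ∀ f : α → ℝ≥0∞, Measurable f → ∫⁻ x in B, f x ∂μ ≤ C * (∫⁻ x, f x ^ r ∂μ) ^ (1/r) := by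
  have hc : r.HolderConjugate (r.conjExponent) := Real.HolderConjugate.conjExponent hr
  have h0 := hc.symm.pos
  refine ⟨(μ B) ^ (1/r.conjExponent), ENNReal.rpow_ne_top_of_nonneg (by positivity) hT, fun f hf => ?_⟩
  have := ENNReal.lintegral_mul_le_Lp_mul_Lq (μ.restrict B) hc hf.aemeasurable (g := fun _ => 1) aemeasurable_const
  simp only [Pi.mul_apply, mul_one, ENNReal.one_rpow, lintegral_const, Measure.restrict_apply MeasurableSet.univ, univ_inter, one_mul] at this
  refine this.trans ?_
  rw [mul_comm]
  refine mul_le_mul_right (ENNReal.rpow_le_rpow (setLIntegral_le_lintegral _ _) (by positivity)) _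

theorem loc_le {q r : ℝ} (hq : 1 < q) (hr : 1 < r) (m : ℕ) : ∃ C : ℝ≥0∞, C ≠ ⊤ ∧ ∀ g : Pt n → ℝ≥0∞, Measurable g →
    ∫⁻ u in Metric.closedBall 0 m, g u ≤ C * mxn q r g := by
  obtain ⟨C1, t1, h1⟩ := hold_set (volume : Measure (Fin n → ℝ)) (B := Metric.closedBall 0 m) measurableSet_closedBall measure_closedBall_lt_top.ne hr
  obtain ⟨C2, t2, h2⟩ := hold_set (volume : Measure ℝ) (B := Metric.closedBall 0 m) measurableSet_closedBall measure_closedBall_lt_top.ne hq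
  refine ⟨C2*C1, ENNReal.mul_ne_top t2 t1, fun g hg => ?_⟩
  have mi := measurable_inn (r := r) hg
  have : Metric.closedBall (0 : Pt n) m = Metric.closedBall (0:ℝ) m ×ˢ Metric.closedBall (0 : Fin n → ℝ) m := by
    rw [closedBall_prod_same]; rfl
  rw [this, Measure.volume_eq_prod, ← Measure.prod_restrict, lintegral_prod _ (by fun_prop)]
  calc _ ≤ ∫⁻ t in Metric.closedBall (0:ℝ) m, C1 * inn r g t := lintegral_mono fun t => h1 (fun y => g (t, y)) (by fun_prop)
    _ ≤ C2 * (∫⁻ t, (C1 * inn r g t) ^ q) ^ (1/q) := h2 _ (by fun_prop)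
    _ = C2 * (C1 * mxn q r g) := by
      congr 1
      simp only [ENNReal.mul_rpow_of_nonneg _ _ (by linarith : 0 ≤ q)]
      rw [lintegral_const_mul _ (by fun_prop), ENNReal.mul_rpow_of_nonneg _ _ (by positivity), rpow_inv_cancel (by linarith)]; rfl
    _ = _ := by ring

theorem adj_Lp (hn : 2 ≤ n) {s : ℝ} (hs : D0 n < s) {A : ℝ≥0∞} (hA : OpC n s A) (m : ℕ) :
    ∫⁻ z, adj (Metric.closedBall (0 : Pt n) m) z ^ (pp n s).conjExponent ≠ ⊤ := by
  have hp := pp_gt hn hs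
  have hc : (pp n s).HolderConjugate ((pp n s).conjExponent) := Real.HolderConjugate.conjExponent hp
  set p := pp n s with hpd
  set p' := p.conjExponent with hp'
  have p0 : 0 < p := hc.pos
  have p0' : 0 < p' := hc.symm.pos
  have p1' : 1 < p' := hc.symm.lt
  set a := adj (Metric.closedBall (0 : Pt n) m) with ha
  have ma : Measurable a := measurable_adj measurableSet_closedBall
  have ab : ∀ z, a z ≤ ENNReal.ofReal (2*m) := adj_le m
  have at' : ∀ z, a z ≠ ⊤ := fun z => ne_top_of_le_ne_top ENNReal.ofReal_ne_top (ab z)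
  obtain ⟨C, hC, hCb⟩ := loc_le (n := n) (hp.trans (qq_gt hn hs)) (rr_gt hn hs) m
  have mB : ∀ j : ℕ, MeasurableSet (Metric.closedBall (0 : Pt n) j) := fun j => measurableSet_closedBall
  have key : ∀ j : ℕ, ∫⁻ z, (Metric.closedBall (0 : Pt n) j).indicator (fun z => a z ^ p') z ≤ (C*A) ^ p' := by
    intro j
    set F := (Metric.closedBall (0 : Pt n) j).indicator (fun z => a z ^ (p'-1)) with hF
    have mF : Measurable F := (ma.pow_const _).indicator (mB j)
    have FT : ∀ z, F z ≠ ⊤ := fun z => ne_top_of_le_ne_top (ENNReal.rpow_ne_top_of_nonneg (by linarith) (at' z)) (indicator_le_self _ _ z)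
    have e1 : PN n s F = ∫⁻ z, (Metric.closedBall (0 : Pt n) j).indicator (fun z => a z ^ p') z := by
      refine lintegral_congr fun z => ?_
      by_cases h : z ∈ Metric.closedBall (0 : Pt n) j
      · rw [hF, indicator_of_mem h, indicator_of_mem h, ← ENNReal.rpow_mul, ← hpd, hc.symm.sub_one_mul_conj]
      · rw [hF, indicator_of_notMem h, indicator_of_notMem h, ENNReal.zero_rpow_of_pos p0]
    have e2 : ∫⁻ z, F z * a z = ∫⁻ z, (Metric.closedBall (0 : Pt n) j).indicator (fun z => a z ^ p') z := by
      refine lintegral_congr fun z => ?_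
      by_cases h : z ∈ Metric.closedBall (0 : Pt n) j
      · rw [hF, indicator_of_mem h, indicator_of_mem h, mul_comm, rpow_split p1'.le]
      · rw [hF, indicator_of_notMem h, indicator_of_notMem h, zero_mul]
    have h1 := (hCb (XE F) (measurable_XE mF)).trans (mul_le_mul_right (hA.bd F mF FT) C)
    rw [adj_eq measurableSet_closedBall mF, e2, e1, ← mul_assoc] at h1
    set I := ∫⁻ z, (Metric.closedBall (0 : Pt n) j).indicator (fun z => a z ^ p') z with hI
    have IT : I ≠ ⊤ := by
      rw [hI, lintegral_indicator (mB j)]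
      refine ne_top_of_le_ne_top ?_ (lintegral_mono fun z => ENNReal.rpow_le_rpow (ab z) p0'.le)
      rw [lintegral_const, Measure.restrict_apply MeasurableSet.univ, univ_inter]
      exact ENNReal.mul_ne_top (ENNReal.rpow_ne_top_of_nonneg p0'.le ENNReal.ofReal_ne_top) measure_closedBall_lt_top.ne
    by_cases I0 : I = 0
    · rw [I0]; exact zero_le
    have h2 : I = I ^ (1/p') * I ^ (1/p) := by
      rw [← ENNReal.rpow_add _ _ I0 IT]
      have : 1/p' + 1/p = 1 := by rw [one_div, one_div, add_comm]; exact hc.inv_add_inv_eq_one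
      rw [this, ENNReal.rpow_one]
    nth_rewrite 1 [h2] at h1
    have h3 : I ^ (1/p') ≤ C * A := by
      refine (ENNReal.mul_le_mul_iff_left ?_ ?_).1 h1
      · rw [Ne, ENNReal.rpow_eq_zero_iff_of_pos (by positivity)]; exact I0
      · exact ENNReal.rpow_ne_top_of_nonneg (by positivity) IT
    have := ENNReal.rpow_le_rpow h3 p0'.le
    rwa [rpow_inv_cancel' p0'] at this
  refine ne_top_of_le_ne_top (ENNReal.rpow_ne_top_of_nonneg p0'.le (ENNReal.mul_ne_top hC hA.top)) (le_of_tendsto' (x := atTop) ?_ key)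
  refine lintegral_tendsto_of_tendsto_of_monotone (fun j => ((ma.pow_const _).indicator (mB j)).aemeasurable) (ae_of_all _ fun z => ?_) (ae_of_all _ fun z => ?_)
  · intro i j hij
    exact indicator_le_indicator_of_subset (Metric.closedBall_subset_closedBall (by exact_mod_cast hij)) (fun _ => zero_le) z
  · refine tendsto_const_nhds.congr' ?_
    filter_upwards [tendsto_natCast_atTop_atTop.eventually_ge_atTop ‖z‖] with j hj
    rw [indicator_of_mem]; rwa [mem_closedBall_zero_iff]

def Sk (G : Pt n → ℝ≥0∞) (k : ℕ) : Set (Pt n) := {z | ‖z‖ ≤ k ∧ G z ≤ k}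
theorem measurableSet_Sk {G : Pt n → ℝ≥0∞} (hG : Measurable G) (k : ℕ) : MeasurableSet (Sk G k) := by
  have h2 : MeasurableSet {z | G z ≤ k} := measurableSet_le (by fun_prop) (by fun_prop)
  have h3 : MeasurableSet {z : Pt n | ‖z‖ ≤ k} := measurableSet_le (by fun_prop) (by fun_prop)
  exact h3.inter h2
theorem Sk_mono (G : Pt n → ℝ≥0∞) {k l : ℕ} (h : k ≤ l) : Sk G k ⊆ Sk G l := fun z hz =>
  ⟨hz.1.trans (by exact_mod_cast h), hz.2.trans (by exact_mod_cast h)⟩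
def lo (G : Pt n → ℝ≥0∞) (k : ℕ) : Pt n → ℝ≥0∞ := (Sk G k).indicator G
def hi (G : Pt n → ℝ≥0∞) (k : ℕ) : Pt n → ℝ≥0∞ := (Sk G k)ᶜ.indicator G

theorem hi_small (hn : 2 ≤ n) {s : ℝ} (hs : D0 n < s) {A : ℝ≥0∞} (hA : OpC n s A) (m : ℕ) {η : ℝ≥0∞} (hη : 0 < η) :
    ∃ k0 : ℕ, ∀ k ≥ k0, ∀ G : Pt n → ℝ≥0∞, Measurable G → PN n s G ≤ 1 → ∫⁻ u in Metric.closedBall 0 m, XE (hi G k) u ≤ η := by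
  have hp := pp_gt hn hs
  have hc : (pp n s).HolderConjugate ((pp n s).conjExponent) := Real.HolderConjugate.conjExponent hp
  have hL := adj_Lp hn hs hA m
  set p := pp n s with hpd
  set p' := p.conjExponent with hp'
  have p0 : 0 < p := hc.pos
  have p0' : 0 < p' := hc.symm.pos
  set a := adj (Metric.closedBall (0 : Pt n) m) with ha
  have ma : Measurable a := measurable_adj measurableSet_closedBall
  have ab : ∀ z, a z ≤ ENNReal.ofReal (2*m) := adj_le m
  have mB : ∀ j : ℕ, MeasurableSet (Metric.closedBall (0 : Pt n) j)ᶜ := fun j => measurableSet_closedBall.compl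
  have T1 : Tendsto (fun k : ℕ => (∫⁻ z, (Metric.closedBall (0 : Pt n) k)ᶜ.indicator (fun z => a z ^ p') z) ^ (1/p')) atTop (nhds 0) := by
    have : Tendsto (fun k : ℕ => ∫⁻ z, (Metric.closedBall (0 : Pt n) k)ᶜ.indicator (fun z => a z ^ p') z) atTop (nhds (∫⁻ z : Pt n, 0)) := by
      refine tendsto_lintegral_of_dominated_convergence _ (fun k => (ma.pow_const _).indicator (mB k)) (fun k => ae_of_all _ fun z => indicator_le_self _ _ z) hL (ae_of_all _ fun z => ?_)
      refine tendsto_const_nhds.congr' ?_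
      filter_upwards [tendsto_natCast_atTop_atTop.eventually_ge_atTop ‖z‖] with j hj
      rw [indicator_of_notMem]; rw [mem_compl_iff, not_not]; rwa [mem_closedBall_zero_iff]
    rw [lintegral_zero] at this
    have h2 := ((ENNReal.continuous_rpow_const (y := 1/p')).tendsto 0).comp this
    rwa [ENNReal.zero_rpow_of_pos (by positivity)] at h2
  have T2 : Tendsto (fun k : ℕ => ENNReal.ofReal (2*m) * ((k:ℝ≥0∞)⁻¹) ^ (p-1)) atTop (nhds 0) := by
    have h2 := ((ENNReal.continuous_rpow_const (y := p-1)).tendsto 0).comp ENNReal.tendsto_inv_nat_nhds_zero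
    rw [ENNReal.zero_rpow_of_pos (by linarith)] at h2
    have := ENNReal.Tendsto.const_mul h2 (Or.inr (ENNReal.ofReal_ne_top (r := 2*m)))
    rwa [mul_zero] at this
  have T3 := T1.add T2
  rw [add_zero] at T3
  obtain ⟨k0, hk0⟩ := eventually_atTop.1 (T3.eventually (gt_mem_nhds hη))
  refine ⟨max k0 1, fun k hk G hG h1 => ?_⟩
  have kk : 1 ≤ k := (le_max_right _ _).trans hk
  have mh : Measurable (hi G k) := hG.indicator (measurableSet_Sk hG k).compl
  rw [adj_eq measurableSet_closedBall mh]
  refine le_trans ?_ (hk0 k ((le_max_left _ _).trans hk)).le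
  have pt : ∀ z, hi G k z * a z ≤ G z * (Metric.closedBall (0 : Pt n) k)ᶜ.indicator a z + ENNReal.ofReal (2*m) * ((k:ℝ≥0∞)⁻¹) ^ (p-1) * G z ^ p := by
    intro z
    by_cases hz : z ∈ (Sk G k)ᶜ
    · rw [hi, indicator_of_mem hz]
      by_cases h2 : z ∈ (Metric.closedBall (0 : Pt n) k)ᶜ
      · rw [indicator_of_mem h2]; exact le_self_add
      · refine le_trans ?_ le_add_self
        have h3 : (k:ℝ≥0∞) < G z := by
          by_contra h4
          rw [not_lt] at h4
          rw [mem_compl_iff, not_not, mem_closedBall_zero_iff] at h2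
          exact hz ⟨h2, h4⟩
        have h5 : G z ≤ ((k:ℝ≥0∞)⁻¹) ^ (p-1) * G z ^ p := by
          rw [← rpow_split hp.le, mul_left_comm, ← ENNReal.mul_rpow_of_nonneg _ _ (by linarith : 0 ≤ p-1)]
          refine le_mul_of_one_le_right zero_le (ENNReal.one_le_rpow ?_ (by linarith))
          rw [mul_comm, ← div_eq_mul_inv, ENNReal.le_div_iff_mul_le (Or.inl (by simp; omega)) (Or.inl (by simp)), one_mul]
          exact h3.le
        calc G z * a z ≤ (((k:ℝ≥0∞)⁻¹) ^ (p-1) * G z ^ p) * ENNReal.ofReal (2*m) := mul_le_mul' h5 (ab z)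
          _ = _ := by ring
    · rw [hi, indicator_of_notMem hz, zero_mul]; exact zero_le
  have mI := ma.indicator (mB k)
  refine (lintegral_mono pt).trans ?_
  rw [lintegral_add_left (by fun_prop), lintegral_const_mul _ (by fun_prop)]
  refine add_le_add ?_ ?_
  · refine (ENNReal.lintegral_mul_le_Lp_mul_Lq volume hc hG.aemeasurable mI.aemeasurable).trans ?_
    have : ∀ z, (Metric.closedBall (0 : Pt n) k)ᶜ.indicator a z ^ p' = (Metric.closedBall (0 : Pt n) k)ᶜ.indicator (fun z => a z ^ p') z := by
      intro z
      by_cases h : z ∈ (Metric.closedBall (0 : Pt n) k)ᶜ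
      · rw [indicator_of_mem h, indicator_of_mem h]
      · rw [indicator_of_notMem h, indicator_of_notMem h, ENNReal.zero_rpow_of_pos p0']
    simp only [this]
    refine mul_le_of_le_one_left zero_le ?_
    exact ENNReal.rpow_le_one h1 (by positivity)
  · exact mul_le_of_le_one_right zero_le h1
end tight

section tight2
variable {n : ℕ}
theorem PN_ind (hn : 2 ≤ n) {s : ℝ} (hs : D0 n < s) (G : Pt n → ℝ≥0∞) {S : Set (Pt n)} (hS : MeasurableSet S) :
    PN n s (S.indicator G) = volume.withDensity (fun z => G z ^ pp n s) S := by
  have hp := pp_gt hn hs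
  rw [withDensity_apply _ hS, ← lintegral_indicator hS]
  refine lintegral_congr fun z => ?_
  by_cases h : z ∈ S
  · rw [indicator_of_mem h, indicator_of_mem h]
  · rw [indicator_of_notMem h, indicator_of_notMem h, ENNReal.zero_rpow_of_pos (by linarith)]

theorem lo_fin (G : Pt n → ℝ≥0∞) (k : ℕ) (z : Pt n) : lo G k z ≤ (Metric.closedBall (0 : Pt n) k).indicator (fun _ => (k:ℝ≥0∞)) z := by
  by_cases h : z ∈ Sk G k
  · rw [lo, indicator_of_mem h, indicator_of_mem (by rw [mem_closedBall_zero_iff]; exact h.1)]; exact h.2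
  · rw [lo, indicator_of_notMem h]; exact zero_le

/-- the dominating function -/
def Hk (n k : ℕ) : Pt n → ℝ≥0∞ := (Metric.closedBall (0 : Pt n) k).indicator (fun _ => (k:ℝ≥0∞))
theorem measurable_Hk (k : ℕ) : Measurable (Hk n k) := measurable_const.indicator measurableSet_closedBall
theorem Hk_top (k : ℕ) (z : Pt n) : Hk n k z ≠ ⊤ := ne_top_of_le_ne_top (b := (k:ℝ≥0∞)) (by simp) (indicator_le_self _ _ z)
theorem NX_Hk (hn : 2 ≤ n) {s : ℝ} (hs : D0 n < s) {A : ℝ≥0∞} (hA : OpC n s A) (k : ℕ) : NX n s (Hk n k) ≠ ⊤ := by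
  have hp := pp_gt hn hs
  refine ne_top_of_le_ne_top ?_ (hA.bd _ (measurable_Hk k) (Hk_top k))
  refine ENNReal.mul_ne_top hA.top (ENNReal.rpow_ne_top_of_nonneg (by positivity) ?_)
  rw [Hk, PN_ind hn hs _ measurableSet_closedBall, withDensity_apply _ measurableSet_closedBall, lintegral_const, Measure.restrict_apply MeasurableSet.univ, univ_inter]
  exact ENNReal.mul_ne_top (ENNReal.rpow_ne_top_of_nonneg (by linarith) (by simp)) measure_closedBall_lt_top.ne

theorem cross (hn : 2 ≤ n) {s : ℝ} (hs : D0 n < s) {A : ℝ≥0∞} (hA : OpC n s A) (k0 : ℕ) {ε : ℝ≥0∞} (hε : 0 < ε) :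
    ∃ k1 : ℕ, k0 ≤ k1 ∧ ∀ G : Pt n → ℝ≥0∞, Measurable G → PN n s G ≤ 1 →
      mxn (qq n s) (rr n s) (fun u => min (XE (lo G k0) u) (XE (hi G k1) u)) ≤ ε := by
  have hp := pp_gt hn hs
  have hq := qq_gt hn hs
  have hr := rr_gt hn hs
  obtain ⟨m, m0, hm⟩ := dom (by linarith) (by linarith) (measurable_XE (measurable_Hk (n := n) k0)) (NX_Hk hn hs hA k0) hε
  obtain ⟨k1, hk1⟩ := hi_small hn hs hA m (η := ENNReal.ofReal ((1/2)^m)) (by simp)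
  refine ⟨max k0 k1, le_max_left _ _, fun G hG h1 => ?_⟩
  have m1 : Measurable (XE (lo G k0)) := measurable_XE (hG.indicator (measurableSet_Sk hG k0))
  have m2 : Measurable (XE (hi G (max k0 k1))) := measurable_XE (hG.indicator (measurableSet_Sk hG _).compl)
  refine hm _ (m1.min m2) (fun u => (min_le_left _ _).trans (XE_mono (lo_fin G k0) u)) ?_
  exact (lintegral_mono fun u => min_le_right _ _).trans (hk1 _ (le_max_right _ _) G hG h1)

theorem split (hn : 2 ≤ n) {s : ℝ} (hs : D0 n < s) {A : ℝ≥0∞} (hA : OpC n s A) {G : Pt n → ℝ≥0∞} (hG : Measurable G) (hT : ∀ z, G z ≠ ⊤) (h1 : PN n s G ≤ 1)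
    {k0 k1 : ℕ} (hk : k0 ≤ k1) {ε : ℝ≥0∞} (hε : mxn (qq n s) (rr n s) (fun u => min (XE (lo G k0) u) (XE (hi G k1) u)) ≤ ε)
    {κ : ℝ≥0∞} (hx : PN n s (lo G k0) ≤ κ) (hy : PN n s (hi G k1) ≤ κ) {μ : ℝ≥0∞} (hμ : PN n s ((Sk G k1 \ Sk G k0).indicator G) ≤ μ) :
    NX n s G ≤ A * κ ^ (1/pp n s - 1/min (qq n s) (rr n s)) + ε + A * μ ^ (1/pp n s) := by
  have hp := pp_gt hn hs
  have hq := qq_gt hn hs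
  have hr := rr_gt hn hs
  have hrp := rr_gt_pp hn hs
  set p := pp n s with hpd
  set v := min (qq n s) (rr n s) with hv
  have hvp : p < v := lt_min hq hrp
  have S0 := measurableSet_Sk hG k0
  have S1 := measurableSet_Sk hG k1
  have ml : Measurable (lo G k0) := hG.indicator S0
  have mh : Measurable (hi G k1) := hG.indicator S1.compl
  have mm : Measurable ((Sk G k1 \ Sk G k0).indicator G) := hG.indicator (S1.diff S0)
  have hi_top : ∀ {S : Set (Pt n)} z, S.indicator G z ≠ ⊤ := fun z => ne_top_of_le_ne_top (hT z) (indicator_le_self _ _ z)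
  have dec : G = fun z => (lo G k0 z + hi G k1 z) + (Sk G k1 \ Sk G k0).indicator G z := by
    funext z
    have hss := Sk_mono G hk
    unfold lo hi
    by_cases a : z ∈ Sk G k0
    · have b := hss a
      simp [a, b]
    · by_cases b : z ∈ Sk G k1 <;> simp [a, b]
  have hxy : PN n s (lo G k0) + PN n s (hi G k1) ≤ 1 := by
    have hdj : Disjoint (Sk G k0) (Sk G k1)ᶜ := disjoint_left.2 fun z a b => b (Sk_mono G hk a)
    unfold lo hi
    rw [PN_ind hn hs G S0, PN_ind hn hs G S1.compl, ← measure_union hdj S1.compl]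
    refine (measure_mono (subset_univ _)).trans ?_
    rw [withDensity_apply _ MeasurableSet.univ, Measure.restrict_univ]; exact h1
  have step1 : NX n s G ≤ NX n s (fun z => lo G k0 z + hi G k1 z) + NX n s ((Sk G k1 \ Sk G k0).indicator G) := by
    conv_lhs => rw [dec]
    exact NX_add hn hs (ml.add mh) mm
  have step2 : NX n s ((Sk G k1 \ Sk G k0).indicator G) ≤ A * μ ^ (1/p) :=
    (hA.bd _ mm hi_top).trans (mul_le_mul_right (ENNReal.rpow_le_rpow hμ (by positivity)) A)
  have mX1 := measurable_XE ml
  have mX2 := measurable_XE mh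
  have step3 : NX n s (fun z => lo G k0 z + hi G k1 z) ≤ mxn (qq n s) (rr n s) (fun u => max (XE (lo G k0) u) (XE (hi G k1) u)) + ε := by
    have : XE (fun z => lo G k0 z + hi G k1 z) = fun u => max (XE (lo G k0) u) (XE (hi G k1) u) + min (XE (lo G k0) u) (XE (hi G k1) u) := by
      funext u; rw [XE_add ml, max_add_min]
    rw [NX, this]
    exact (mxn_add (by linarith) (by linarith) (mX1.max mX2) (mX1.min mX2)).trans (add_le_add le_rfl hε)
  have step4 : mxn (qq n s) (rr n s) (fun u => max (XE (lo G k0) u) (XE (hi G k1) u)) ≤ A * κ ^ (1/p - 1/v) := by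
    have v0 : 0 < v := by linarith
    have h5 := mxn_max v0 (min_le_left _ _) (min_le_right _ _) mX1 mX2
    have pw : ∀ x : ℝ≥0∞, x ≤ κ → (A * x ^ (1/p)) ^ v ≤ A ^ v * κ ^ (v/p - 1) * x := by
      intro x hx
      rw [ENNReal.mul_rpow_of_nonneg _ _ v0.le, ← ENNReal.rpow_mul, mul_assoc]
      refine mul_le_mul_right ?_ _
      have hv1 : 1 ≤ v/p := by rw [one_le_div (by linarith)]; exact hvp.le
      have : 1/p*v = v/p := by ring
      rw [this, ← rpow_split hv1, mul_comm]
      exact mul_le_mul_left (ENNReal.rpow_le_rpow hx (by linarith)) _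
    have h6 : mxn (qq n s) (rr n s) (fun u => max (XE (lo G k0) u) (XE (hi G k1) u)) ^ v ≤ A ^ v * κ ^ (v/p - 1) := by
      refine h5.trans ?_
      refine (add_le_add ((ENNReal.rpow_le_rpow (hA.bd _ ml hi_top) v0.le).trans (pw _ hx)) ((ENNReal.rpow_le_rpow (hA.bd _ mh hi_top) v0.le).trans (pw _ hy))).trans ?_
      rw [← mul_add]
      exact mul_le_of_le_one_right zero_le hxy
    have h7 := ENNReal.rpow_le_rpow h6 (by positivity : 0 ≤ 1/v)
    rw [rpow_inv_cancel v0, ENNReal.mul_rpow_of_nonneg _ _ (by positivity), rpow_inv_cancel v0, ← ENNReal.rpow_mul] at h7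
    have : (v/p-1)*(1/v) = 1/p - 1/v := by
      have : p ≠ 0 := by linarith
      field_simp
    rwa [this] at h7
  exact step1.trans (add_le_add (step3.trans (add_le_add step4 le_rfl)) step2)

theorem sum_mid (μ : Measure (Pt n)) (S : ℕ → Set (Pt n)) (hS : ∀ i, MeasurableSet (S i)) (hm : Monotone S) (J : ℕ) :
    ∑ i ∈ Finset.range J, μ (S (i+1) \ S i) ≤ μ (S J) := by
  induction J with
  | zero => simp
  | succ J ih =>
    rw [Finset.sum_range_succ]
    refine (add_le_add ih le_rfl).trans ?_
    rw [← measure_union disjoint_sdiff_right ((hS _).diff (hS _)), union_diff_cancel (hm (Nat.le_succ J))]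

theorem tight (hn : 2 ≤ n) {s : ℝ} (hs : D0 n < s) {A : ℝ≥0∞} (hA : OpC n s A) {G : ℕ → Pt n → ℝ≥0∞} (hG : ∀ j, Measurable (G j)) (hT : ∀ j z, G j z ≠ ⊤)
    (h1 : ∀ j, PN n s (G j) = 1) (hlim : Tendsto (fun j => NX n s (G j)) atTop (nhds A)) {c : ℝ≥0∞} (hc : 0 < c) {k0 : ℕ}
    (hlow : ∀ᶠ j in atTop, c ≤ PN n s (lo (G j) k0)) {η : ℝ≥0∞} (hη : 0 < η) : ∃ k, ∀ᶠ j in atTop, PN n s (hi (G j) k) ≤ η := by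
  have hp := pp_gt hn hs
  have hvp : pp n s < min (qq n s) (rr n s) := lt_min (qq_gt hn hs) (rr_gt_pp hn hs)
  set e := 1/pp n s - 1/min (qq n s) (rr n s) with he
  have e0 : 0 < e := by rw [he, sub_pos]; exact one_div_lt_one_div_of_lt (by linarith) hvp
  set κ : ℝ≥0∞ := 1 - min c η with hκ
  have κ1 : κ < 1 := ENNReal.sub_lt_self (by simp) (by simp) (lt_min hc hη).ne'
  have ρ1 : κ ^ e < 1 := ENNReal.rpow_lt_one κ1 e0
  have Aρ : A * κ ^ e < A := by
    calc A * κ ^ e < A * 1 := (ENNReal.mul_lt_mul_iff_right hA.pos hA.top).2 ρ1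
      _ = A := mul_one A
  have lim : Tendsto (fun J : ℕ => A * κ ^ e + (J:ℝ≥0∞)⁻¹ + A * ((J:ℝ≥0∞)⁻¹) ^ (1/pp n s)) atTop (nhds (A * κ ^ e + 0 + A * 0 ^ (1/pp n s))) := by
    refine (tendsto_const_nhds.add ENNReal.tendsto_inv_nat_nhds_zero).add (ENNReal.Tendsto.const_mul ?_ (Or.inr hA.top))
    exact ((ENNReal.continuous_rpow_const (y := 1/pp n s)).tendsto 0).comp ENNReal.tendsto_inv_nat_nhds_zero
  rw [ENNReal.zero_rpow_of_pos (by positivity), mul_zero, add_zero, add_zero] at lim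
  obtain ⟨J, hJ, hJ1⟩ := ((lim.eventually (gt_mem_nhds Aρ)).and (eventually_ge_atTop 1)).exists
  have ε0 : 0 < (J:ℝ≥0∞)⁻¹ := by simp
  choose nx nx1 nx2 using fun k => cross hn hs hA k ε0
  set K : ℕ → ℕ := fun i => nx^[i] k0 with hK
  have Ks : ∀ i, K (i+1) = nx (K i) := fun i => Function.iterate_succ_apply' _ _ _
  have Km : Monotone K := monotone_nat_of_le_succ fun i => by rw [Ks]; exact nx1 _
  refine ⟨K J, ?_⟩
  filter_upwards [hlow, hlim.eventually (lt_mem_nhds hJ)] with j hj1 hj2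
  by_contra hcon
  rw [not_le] at hcon
  set μ := volume.withDensity (fun z => G j z ^ pp n s) with hμ
  have mS := fun i => measurableSet_Sk (hG j) (K i)
  have μu : μ univ = 1 := by rw [hμ, withDensity_apply _ MeasurableSet.univ, Measure.restrict_univ]; exact h1 j
  have hsum := (sum_mid μ (fun i => Sk (G j) (K i)) mS (fun a b h => Sk_mono _ (Km h)) J).trans ((measure_mono (subset_univ _)).trans_eq μu)
  obtain ⟨i, hi1, hi2⟩ : ∃ i ∈ Finset.range J, μ (Sk (G j) (K (i+1)) \ Sk (G j) (K i)) ≤ (J:ℝ≥0∞)⁻¹ := by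
    obtain ⟨i, hi1, hi2⟩ := Finset.exists_min_image (Finset.range J) (fun i => μ (Sk (G j) (K (i+1)) \ Sk (G j) (K i))) ⟨0, by simp; omega⟩
    refine ⟨i, hi1, ENNReal.le_inv_iff_mul_le.2 ?_⟩
    have h9 := (Finset.card_nsmul_le_sum _ _ _ hi2).trans hsum
    rwa [Finset.card_range, nsmul_eq_mul, mul_comm] at h9
  have hiJ : i + 1 ≤ J := by simpa using hi1
  have tot : ∀ S : Set (Pt n), MeasurableSet S → μ S + μ Sᶜ = 1 := fun S hS => by rw [measure_add_measure_compl hS, μu]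
  have c1 : c ≤ μ (Sk (G j) (K i)) := by
    rw [lo, PN_ind hn hs _ (measurableSet_Sk (hG j) k0)] at hj1
    exact hj1.trans (measure_mono (Sk_mono _ (Km (Nat.zero_le i))))
  have c2 : η ≤ μ (Sk (G j) (K (i+1)))ᶜ := by
    rw [hi, PN_ind hn hs _ (mS J).compl] at hcon
    exact hcon.le.trans (measure_mono (compl_subset_compl.2 (Sk_mono _ (Km hiJ))))
  have x1 : PN n s (lo (G j) (K i)) ≤ κ := by
    rw [lo, PN_ind hn hs _ (mS i)]
    refine ENNReal.le_sub_of_add_le_right (ne_top_of_le_ne_top (by simp : (1:ℝ≥0∞) ≠ ⊤) ?_) ?_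
    · exact (min_le_left _ _).trans (c1.trans ((measure_mono (subset_univ _)).trans_eq μu))
    · rw [← tot _ (mS i)]
      refine add_le_add le_rfl ((min_le_right _ _).trans (c2.trans (measure_mono (compl_subset_compl.2 (Sk_mono _ (Km (Nat.le_succ i)))))))
  have y1 : PN n s (hi (G j) (K (i+1))) ≤ κ := by
    rw [hi, PN_ind hn hs _ (mS (i+1)).compl]
    refine ENNReal.le_sub_of_add_le_right (ne_top_of_le_ne_top (by simp : (1:ℝ≥0∞) ≠ ⊤) ?_) ?_
    · exact (min_le_left _ _).trans (c1.trans ((measure_mono (subset_univ _)).trans_eq μu))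
    · rw [← tot _ (mS (i+1)), add_comm]
      refine add_le_add ((min_le_left _ _).trans (c1.trans (measure_mono (Sk_mono _ (Km (Nat.le_succ i)))))) le_rfl
  have cr := nx2 (K i) (G j) (hG j) (h1 j).le
  rw [← Ks] at cr
  have := split hn hs hA (hG j) (hT j) (h1 j).le (Km (Nat.le_succ i)) cr x1 y1 (μ := (J:ℝ≥0∞)⁻¹) (by rw [PN_ind hn hs _ ((mS _).diff (mS _))]; exact hi2)
  exact absurd hj2 (not_lt.2 this)
end tight2

section weak
variable {n : ℕ}
/-- averaging over all steps -/
def TT (g : Pt n → ℝ≥0∞) (z : Pt n) : ℝ≥0∞ := ∫⁻ b : ℝ × ℝ, g (z + stp n b)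
theorem measurable_TT {g : Pt n → ℝ≥0∞} (hg : Measurable g) : Measurable (TT g) := by
  have := measurable_stp n
  refine Measurable.lintegral_prod_right' (f := fun x : Pt n × (ℝ × ℝ) => g (x.1 + stp n x.2)) ?_
  fun_prop
theorem measurable_TT_it {g : Pt n → ℝ≥0∞} (hg : Measurable g) (j : ℕ) : Measurable (TT^[j] g) := by
  induction j with
  | zero => exact hg
  | succ j ih => rw [Function.iterate_succ_apply']; exact measurable_TT ih
theorem TT_mono {g h : Pt n → ℝ≥0∞} (H : ∀ z, g z ≤ h z) (z : Pt n) : TT g z ≤ TT h z := lintegral_mono fun _ => H _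

theorem TT_it {g : Pt n → ℝ≥0∞} (hg : Measurable g) (j : ℕ) (z : Pt n) :
    TT^[j] g z = ∫⁻ a : Fin j → ℝ × ℝ, g (z + ∑ i, stp n (a i)) := by
  have hst := measurable_stp n
  induction j generalizing z with
  | zero => simp [volume_pi, Measure.pi_of_empty]
  | succ j ih =>
    rw [Function.iterate_succ_apply', lintegral_cons _ (by fun_prop)]
    unfold TT
    refine lintegral_congr fun b => ?_
    change TT^[j] g (z + stp n b) = _
    rw [ih]
    refine lintegral_congr fun a => ?_
    rw [Fin.sum_univ_succ]
    simp [add_assoc]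

theorem TT_null {E : Set (Pt n)} (hE : MeasurableSet E) (h0 : volume E = 0) {j : ℕ} (hj : n + 1 ≤ j) (z : Pt n) :
    TT^[j] (E.indicator fun _ => (1:ℝ≥0∞)) z = 0 := by
  have hg : Measurable (E.indicator fun _ => (1:ℝ≥0∞)) := measurable_const.indicator hE
  have hst := measurable_stp n
  have base : TT^[n+1] (E.indicator fun _ => (1:ℝ≥0∞)) = fun _ => 0 := by
    funext z
    rw [TT_it hg, lintegral_split _ (by fun_prop), lintegral_eq_zero_iff']
    · have hV : ∀ᵐ t : Fin (n+1) → ℝ, VV n t ≠ 0 := by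
        have : ∀ i k : Fin (n+1), i ≠ k → ∀ᵐ t : Fin (n+1) → ℝ, t i ≠ t k := by
          intro i k hik
          rw [ae_iff]
          have hne : LinearMap.ker (LinearMap.proj (R := ℝ) (φ := fun _ : Fin (n+1) => ℝ) i - LinearMap.proj k) ≠ ⊤ := by
            intro h
            have : (Pi.single i 1 : Fin (n+1) → ℝ) ∈ LinearMap.ker (LinearMap.proj (R := ℝ) (φ := fun _ : Fin (n+1) => ℝ) i - LinearMap.proj k) := by rw [h]; trivial
            simp [Pi.single_apply, hik.symm] at this
          convert Measure.addHaar_submodule (volume : Measure (Fin (n+1) → ℝ)) _ hne using 2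
          ext t
          simp [sub_eq_zero]
        have h2 : ∀ᵐ t : Fin (n+1) → ℝ, ∀ i k : Fin (n+1), i ≠ k → t i ≠ t k := by
          rw [ae_all_iff]; intro i; rw [ae_all_iff]; intro k
          by_cases h : i = k
          · exact Eventually.of_forall fun t h' => absurd h h'
          · filter_upwards [this i k h] with t ht _ using ht
        filter_upwards [h2] with t ht
        have : (Matrix.vandermonde t).det ≠ 0 := Matrix.det_vandermonde_ne_zero_iff.2 fun i k h => by
          by_contra hne; exact ht i k hne h
        unfold VV
        simpa using this
      filter_upwards [hV] with t ht
      have hd : (Matrix.vandermonde t).det ≠ 0 := fun h => ht (by simp [VV, h])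
      have := lin_eq t hd z _ hg
      rw [lintegral_indicator hE, lintegral_const, Measure.restrict_apply MeasurableSet.univ, univ_inter, h0, mul_zero] at this
      exact (mul_eq_zero.1 this).resolve_left ht
    · have hm : Measurable (fun x : (Fin (n+1) → ℝ) × (Fin (n+1) → ℝ) => E.indicator (fun _ => (1:ℝ≥0∞)) (z + ∑ i, stp n (x.1 i, x.2 i))) := by fun_prop
      exact (hm.lintegral_prod_right').aemeasurable
  obtain ⟨i, rfl⟩ := Nat.exists_eq_add_of_le' hj
  rw [Function.iterate_add_apply, base]
  clear base hj
  induction i generalizing z with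
  | zero => rfl
  | succ i ih =>
    rw [Function.iterate_succ_apply', TT]
    simp_rw [ih]; simp

/-- doubling of a measure -/
def dbl (L : Measure (Pt n)) : Measure (Pt n) := (L.prod L).map fun x => x.2 - x.1
theorem dbl_fin (L : Measure (Pt n)) [IsFiniteMeasure L] : IsFiniteMeasure (dbl L) := by unfold dbl; infer_instance
def RJ (j : ℕ) (L : Measure (Pt n)) : Prop := ∀ g : Pt n → ℝ≥0∞, Measurable g → ∀ z, (∫⁻ x, g (z + x) ∂L ≤ TT^[j] g z) ∧ (∫⁻ x, g (z - x) ∂L ≤ TT^[j] g z)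

theorem RJ.dbl {j : ℕ} {L : Measure (Pt n)} [IsFiniteMeasure L] (h : RJ j L) : RJ (j + j) (dbl L) := by
  intro g hg z
  have mi := measurable_TT_it hg j
  unfold _root_.dbl
  rw [lintegral_map (by fun_prop) (by fun_prop), lintegral_map (by fun_prop) (by fun_prop), lintegral_prod _ (by fun_prop), lintegral_prod _ (by fun_prop), Function.iterate_add_apply]
  constructor
  · refine le_trans (lintegral_mono fun x => ?_) (h _ mi z).2
    refine le_trans (le_of_eq (lintegral_congr fun y => ?_)) (h g hg (z - x)).1
    congr 1; simp only; abel
  · refine le_trans (lintegral_mono fun x => ?_) (h _ mi z).1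
    refine le_trans (le_of_eq (lintegral_congr fun y => ?_)) (h g hg (z + x)).2
    congr 1; simp only; abel

/-- the law of one step -/
def nuS (n : ℕ) (T K : ℝ) : Measure (Pt n) := (volume.restrict (Icc (-T) T ×ˢ Icc (-K) K)).map (stp n)
instance nuS_fin (T K : ℝ) : IsFiniteMeasure (nuS n T K) := by
  haveI : IsFiniteMeasure ((volume : Measure (ℝ × ℝ)).restrict (Icc (-T) T ×ˢ Icc (-K) K)) := ⟨by
    rw [Measure.restrict_apply MeasurableSet.univ, univ_inter]
    exact (isCompact_Icc.prod isCompact_Icc).measure_lt_top⟩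
  unfold nuS; infer_instance

theorem RJ_nuS (T K : ℝ) : RJ 1 (nuS n T K) := by
  intro g hg z
  have hst := measurable_stp n
  unfold nuS
  rw [lintegral_map (by fun_prop) hst, lintegral_map (by fun_prop) hst]
  refine ⟨setLIntegral_le_lintegral _ _, (setLIntegral_le_lintegral _ _).trans ?_⟩
  refine le_of_eq ?_
  change _ = ∫⁻ b : ℝ × ℝ, g (z + stp n b)
  rw [Measure.volume_eq_prod, lintegral_prod _ (by fun_prop), lintegral_prod _ (by fun_prop)]
  refine lintegral_congr fun t => ?_
  rw [← lintegral_neg_eq_self (fun σ => g (z + stp n (t, σ)))]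
  refine lintegral_congr fun σ => ?_
  rw [stp_neg, sub_eq_add_neg]

def nuI (n : ℕ) (T K : ℝ) : ℕ → Measure (Pt n)
  | 0 => nuS n T K
  | m+1 => dbl (nuI n T K m)
theorem nuI_fin (T K : ℝ) (m : ℕ) : IsFiniteMeasure (nuI n T K m) := by
  induction m with
  | zero => exact nuS_fin T K
  | succ m ih => exact dbl_fin _
theorem RJ_nuI (T K : ℝ) (m : ℕ) : RJ (2^m) (nuI n T K m) := by
  induction m with
  | zero => exact RJ_nuS T K
  | succ m ih =>
    haveI := nuI_fin (n := n) T K m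
    have := ih.dbl
    rw [pow_succ, mul_two]; exact this
theorem nuI_ac (T K : ℝ) : nuI n T K (n+1) ≪ volume := by
  refine Measure.AbsolutelyContinuous.mk fun E hE h0 => ?_
  have := (RJ_nuI (n := n) T K (n+1) _ (measurable_const.indicator (f := fun _ => (1:ℝ≥0∞)) hE) 0).1
  rw [TT_null hE h0 (Nat.lt_two_pow_self.le)] at this
  simp only [zero_add] at this
  rw [lintegral_indicator hE, lintegral_const, Measure.restrict_apply MeasurableSet.univ, univ_inter, one_mul] at this
  exact le_antisymm this zero_le
end weak

section weak2
variable {n : ℕ}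
/-- bounded functions with bounded support -/
structure BW (k : ℝ) (w : Pt n → ℝ) : Prop where
  k0 : 0 ≤ k
  meas : Measurable w
  bd : ∀ z, |w z| ≤ k
  supp : ∀ z, k < ‖z‖ → w z = 0

theorem BW.integrable {k : ℝ} {w : Pt n → ℝ} (h : BW k w) : Integrable w := by
  have h1 : Integrable ((Metric.closedBall (0 : Pt n) k).indicator fun _ => k) :=
    (integrable_indicator_iff measurableSet_closedBall).2 (integrableOn_const measure_closedBall_lt_top.ne)
  refine h1.mono' h.meas.aestronglyMeasurable (Eventually.of_forall fun z => ?_)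
  by_cases hz : z ∈ Metric.closedBall (0 : Pt n) k
  · rw [indicator_of_mem hz]; exact h.bd z
  · rw [indicator_of_notMem hz, h.supp z (by simpa using hz)]; simp

theorem BW.int_gen {k : ℝ} {w : Pt n → ℝ} (hw : BW k w) {α : Type*} [MeasurableSpace α] (μ : Measure α) [IsFiniteMeasure μ]
    {g h : α → Pt n} (hg : Measurable g) (hh : Measurable h) :
    Integrable (fun y : Pt n × α => w (y.1 + g y.2) * w (y.1 + h y.2)) (volume.prod μ) := by
  have hm := hw.meas
  have m1 : Measurable (fun y : Pt n × α => w (y.1 + g y.2) * w (y.1 + h y.2)) := by fun_prop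
  have ib : ∀ y, Integrable (fun z => w (z + g y) * w (z + h y)) := fun y =>
    ((hw.integrable.comp_add_right (g y)).mul_bdd (c := k) (hm.comp (measurable_add_const (h y))).aestronglyMeasurable (Eventually.of_forall fun z => hw.bd _))
  refine (integrable_prod_iff' m1.aestronglyMeasurable).2 ⟨Eventually.of_forall ib, ?_⟩
  refine (integrable_const (k * ∫ z, |w z|)).mono' (m1.norm.stronglyMeasurable.integral_prod_left').aestronglyMeasurable (Eventually.of_forall fun y => ?_)
  rw [Real.norm_eq_abs, abs_of_nonneg (integral_nonneg fun _ => norm_nonneg _), ← integral_const_mul, ← integral_add_right_eq_self (fun z => k * |w z|) (g y)]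
  refine integral_mono (ib y).norm ((hw.integrable.abs.comp_add_right (g y)).const_mul k) fun z => ?_
  simp only [norm_mul, Real.norm_eq_abs]
  rw [mul_comm]
  exact mul_le_mul_of_nonneg_right (hw.bd _) (abs_nonneg _)

theorem BW.fub {k : ℝ} {w : Pt n → ℝ} (hw : BW k w) {α : Type*} [MeasurableSpace α] (μ : Measure α) [IsFiniteMeasure μ]
    {g h : α → Pt n} (hg : Measurable g) (hh : Measurable h) :
    ∫ z, ∫ y, w (z + g y) * w (z + h y) ∂μ = ∫ z, ∫ y, w z * w (z + (h y - g y)) ∂μ := by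
  have i1 := hw.int_gen μ hg hh
  have i2 := hw.int_gen μ (g := fun _ => 0) measurable_const (hh.sub hg)
  simp only [add_zero] at i2
  rw [integral_integral_swap i1]
  rw [integral_integral_swap (f := fun z y => w z * w (z + (h y - g y))) i2]
  refine integral_congr_ae (Eventually.of_forall fun y => ?_)
  simp only
  rw [← integral_add_right_eq_self (fun z => w z * w (z + (h y - g y))) (g y)]
  refine integral_congr_ae (Eventually.of_forall fun z => ?_)
  simp only
  congr 2; abel

/-- averaging operator -/
def PL (L : Measure (Pt n)) (w : Pt n → ℝ) (z : Pt n) : ℝ := ∫ x, w (z + x) ∂L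
theorem measurable_PL (L : Measure (Pt n)) [IsFiniteMeasure L] {w : Pt n → ℝ} (hw : Measurable w) : Measurable (PL L w) := by
  have : Measurable (fun y : Pt n × Pt n => w (y.1 + y.2)) := by fun_prop
  exact this.stronglyMeasurable.integral_prod_right'.measurable
theorem BW.PL_bd {k : ℝ} {w : Pt n → ℝ} (hw : BW k w) (L : Measure (Pt n)) [IsFiniteMeasure L] (z : Pt n) : |PL L w z| ≤ k * L.real univ := by
  have := norm_integral_le_of_norm_le_const (μ := L) (f := fun x => w (z + x)) (C := k) (Eventually.of_forall fun x => hw.bd _)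
  exact this

theorem BW.dbl_id {k : ℝ} {w : Pt n → ℝ} (hw : BW k w) (L : Measure (Pt n)) [IsFiniteMeasure L] :
    Integrable (fun z => PL L w z ^ 2) ∧ ∫ z, PL L w z ^ 2 = ∫ z, w z * PL (dbl L) w z := by
  have hm := hw.meas
  have e : ∀ z, PL L w z ^ 2 = ∫ p : Pt n × Pt n, w (z + p.1) * w (z + p.2) ∂(L.prod L) := fun z => by
    rw [integral_prod_mul (fun x => w (z + x)) (fun x => w (z + x)), sq]; rfl
  have i1 := hw.int_gen (L.prod L) measurable_fst measurable_snd
  simp_rw [e]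
  refine ⟨i1.integral_prod_left, ?_⟩
  rw [hw.fub (L.prod L) measurable_fst measurable_snd]
  refine integral_congr_ae (Eventually.of_forall fun z => ?_)
  simp only
  rw [integral_const_mul, PL, dbl, integral_map (f := fun x => w (z + x)) (by fun_prop) (hm.comp (measurable_const_add z)).aestronglyMeasurable]

/-- local L1 size -/
def aE (k : ℝ) (L : Measure (Pt n)) (w : Pt n → ℝ) : ℝ≥0∞ := ∫⁻ z in Metric.closedBall (0 : Pt n) k, ENNReal.ofReal |PL L w z|

theorem BW.pair_le {k : ℝ} {w : Pt n → ℝ} (hw : BW k w) (L : Measure (Pt n)) [IsFiniteMeasure L] :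
    ENNReal.ofReal (∫ z, w z * PL L w z) ≤ ENNReal.ofReal k * aE k L w := by
  have hP := measurable_PL L hw.meas
  have i2 : IntegrableOn (fun z => |PL L w z|) (Metric.closedBall (0 : Pt n) k) :=
    Integrable.mono' (integrableOn_const (C := k * L.real univ) measure_closedBall_lt_top.ne) (by fun_prop) (Eventually.of_forall fun z => by
      rw [Real.norm_eq_abs, abs_abs]; exact hw.PL_bd L z)
  have i1 : Integrable (fun z => w z * PL L w z) := hw.integrable.mul_bdd (c := k * L.real univ) (by fun_prop) (Eventually.of_forall fun z => hw.PL_bd L z)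
  rw [aE, ← ofReal_integral_eq_lintegral_ofReal i2 (Eventually.of_forall fun _ => abs_nonneg _), ← ENNReal.ofReal_mul hw.k0]
  refine ENNReal.ofReal_le_ofReal ?_
  rw [← setIntegral_eq_integral_of_forall_compl_eq_zero (s := Metric.closedBall (0 : Pt n) k) (fun z hz => by rw [hw.supp z (by simpa using hz), zero_mul]), ← integral_const_mul]
  refine integral_mono i1.integrableOn (i2.const_mul k) fun z => ?_
  simp only
  refine (le_abs_self _).trans ?_
  rw [abs_mul]
  exact mul_le_mul_of_nonneg_right (hw.bd _) (abs_nonneg _)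

theorem aE_dbl (k : ℝ) (L : Measure (Pt n)) [IsFiniteMeasure L] : ∃ C : ℝ≥0∞, C ≠ ⊤ ∧ ∀ w, BW k w →
    aE k L w ≤ C * (ENNReal.ofReal k * aE k (dbl L) w) ^ (1/2 : ℝ) := by
  obtain ⟨C, hC, H⟩ := hold_set (volume : Measure (Pt n)) (B := Metric.closedBall (0 : Pt n) k) measurableSet_closedBall measure_closedBall_lt_top.ne (r := 2) (by norm_num)
  refine ⟨C, hC, fun w hw => ?_⟩
  haveI := dbl_fin L
  have hP := measurable_PL L hw.meas
  refine (H (fun z => ENNReal.ofReal |PL L w z|) (by fun_prop)).trans (mul_le_mul_right (ENNReal.rpow_le_rpow ?_ (by norm_num)) C)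
  obtain ⟨i, e⟩ := hw.dbl_id L
  refine le_trans (le_of_eq ?_) (hw.pair_le (dbl L))
  rw [← e, ofReal_integral_eq_lintegral_ofReal i (Eventually.of_forall fun _ => sq_nonneg _)]
  refine lintegral_congr fun z => ?_
  rw [ENNReal.ofReal_rpow_of_nonneg (abs_nonneg _) (by norm_num)]
  congr 1
  rw [Real.rpow_two, sq_abs]

theorem tends_sqrt {ι : Type*} {l : Filter ι} {u v : ι → ℝ≥0∞} {C D : ℝ≥0∞} (hC : C ≠ ⊤) (hD : D ≠ ⊤) (h : ∀ i, u i ≤ C * (D * v i) ^ (1/2 : ℝ))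
    (hv : Tendsto v l (nhds 0)) : Tendsto u l (nhds 0) := by
  refine tendsto_of_tendsto_of_tendsto_of_le_of_le tendsto_const_nhds ?_ (fun _ => zero_le) h
  have h1 : Tendsto (fun i => D * v i) l (nhds (D * 0)) := ENNReal.Tendsto.const_mul hv (Or.inr hD)
  have h2 := h1.ennrpow_const (1/2 : ℝ)
  have h3 := ENNReal.Tendsto.const_mul h2 (a := C) (Or.inr hC)
  simpa using h3

theorem aE_ac {ι : Type*} {l : Filter ι} [l.IsCountablyGenerated] (k : ℝ) (L : Measure (Pt n)) [IsFiniteMeasure L] (hL : L ≪ volume) (w : ι → Pt n → ℝ) (hw : ∀ i, BW k (w i))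
    (hweak : ∀ φ : Pt n → ℝ, Integrable φ → Tendsto (fun i => ∫ z, w i z * φ z) l (nhds 0)) : Tendsto (fun i => aE k L (w i)) l (nhds 0) := by
  have hpt : ∀ z, Tendsto (fun i => PL L (w i) z) l (nhds 0) := by
    intro z
    have hr := Measure.withDensity_rnDeriv_eq L volume hL
    have hi : Integrable (fun x => (L.rnDeriv volume x).toReal) := Measure.integrable_toReal_rnDeriv
    refine (hweak _ (hi.comp_sub_right z)).congr fun i => ?_
    rw [← integral_add_left_eq_self _ z]
    unfold PL
    conv_rhs => rw [← integral_rnDeriv_smul hL]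
    refine integral_congr_ae (Eventually.of_forall fun x => ?_)
    simp [mul_comm]
  have := tendsto_lintegral_filter_of_dominated_convergence (l := l) (μ := volume.restrict (Metric.closedBall (0 : Pt n) k)) (F := fun i z => ENNReal.ofReal |PL L (w i) z|) (f := fun _ => 0)
    (fun _ => ENNReal.ofReal (k * L.real univ)) (Eventually.of_forall fun i => by have := measurable_PL L (hw i).meas; fun_prop)
    (Eventually.of_forall fun i => Eventually.of_forall fun z => ENNReal.ofReal_le_ofReal ((hw i).PL_bd L z))
    (by rw [lintegral_const, Measure.restrict_apply MeasurableSet.univ, univ_inter]; exact ENNReal.mul_ne_top ENNReal.ofReal_ne_top measure_closedBall_lt_top.ne)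
    (Eventually.of_forall fun z => by
      have := (ENNReal.continuous_ofReal.tendsto _).comp (hpt z).abs
      rw [abs_zero, ENNReal.ofReal_zero] at this
      exact this)
  rw [lintegral_zero] at this
  exact this

theorem aE_nu {ι : Type*} {l : Filter ι} [l.IsCountablyGenerated] (k T K : ℝ) (w : ι → Pt n → ℝ) (hw : ∀ i, BW k (w i))
    (hweak : ∀ φ : Pt n → ℝ, Integrable φ → Tendsto (fun i => ∫ z, w i z * φ z) l (nhds 0)) : Tendsto (fun i => aE k (nuS n T K) (w i)) l (nhds 0) := by
  have : ∀ m ≤ n + 1, Tendsto (fun i => aE k (nuI n T K m) (w i)) l (nhds 0) := by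
    intro m hm
    obtain ⟨j, hj⟩ := Nat.exists_eq_add_of_le' hm
    induction j generalizing m with
    | zero =>
      rw [zero_add] at hj
      subst hj
      haveI := nuI_fin (n := n) T K (n+1)
      exact aE_ac k _ (nuI_ac T K) w hw hweak
    | succ j ih0 =>
      have ih := ih0 (m+1) (by omega) (by omega)
      haveI := nuI_fin (n := n) T K m
      obtain ⟨C, hC, H⟩ := aE_dbl k (nuI n T K m)
      exact tends_sqrt hC ENNReal.ofReal_ne_top (fun i => H _ (hw i)) ih
  exact this 0 (Nat.zero_le _)
end weak2

section weak3
variable {n : ℕ}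
/-- real X-ray transform -/
def XR (w : Pt n → ℝ) (u : ℝ × (Fin n → ℝ)) : ℝ := ∫ s : ℝ, w (s, u.2 + s • mom n u.1)

theorem measurable_XR {w : Pt n → ℝ} (hw : Measurable w) : Measurable (XR w) := by
  have hm := measurable_mom n
  have : Measurable (fun x : (ℝ × (Fin n → ℝ)) × ℝ => w (x.2, x.1.2 + x.2 • mom n x.1.1)) := by fun_prop
  exact this.stronglyMeasurable.integral_prod_right'.measurable

theorem BW.line {k : ℝ} {w : Pt n → ℝ} (hw : BW k w) (s : ℝ) (hs : s ∉ Icc (-k) k) (x : Fin n → ℝ) : w (s, x) = 0 := by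
  refine hw.supp _ ?_
  by_contra hc
  rw [not_lt] at hc
  have := (norm_fst_le (s, x)).trans hc
  exact hs (abs_le.1 this)

theorem BW.XR_bd {k : ℝ} {w : Pt n → ℝ} (hw : BW k w) (u : ℝ × (Fin n → ℝ)) : |XR w u| ≤ k * (2 * k) := by
  unfold XR
  have hk := hw.k0
  rw [← setIntegral_eq_integral_of_forall_compl_eq_zero (s := Icc (-k) k) (fun s hs => hw.line s hs _)]
  have := norm_setIntegral_le_of_norm_le_const (μ := volume) (s := Icc (-k) k) (f := fun s => w (s, u.2 + s • mom n u.1)) (C := k) (by simp) (fun x _ => hw.bd _)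
  refine this.trans (le_of_eq ?_)
  rw [Real.volume_real_Icc_of_le (by linarith)]; ring

theorem BW.base {k : ℝ} {w : Pt n → ℝ} (hw : BW k w) (t : ℝ) :
    Integrable (fun y => XR w (t, y) ^ 2) ∧
    ∫ y, XR w (t, y) ^ 2 = ∫ z, ∫ σ in Icc (-(2*k)) (2*k), w z * w (z + stp n (t, σ)) := by
  have hm := hw.meas
  have hX := measurable_XR hm
  have hmom := measurable_mom n
  set W : ℝ × (Fin n → ℝ) → ℝ := fun x => w (x.1, x.2 + x.1 • mom n t) with hW
  have mW : Measurable W := by fun_prop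
  have iW : Integrable W := by
    have mp : MeasurePreserving (fun x : ℝ × (Fin n → ℝ) => (x.1, x.2 + x.1 • mom n t)) volume volume := by
      rw [Measure.volume_eq_prod]
      refine MeasurePreserving.skew_product (g := fun s y => y + s • mom n t) (MeasurePreserving.id _) (by fun_prop) (Eventually.of_forall fun s => ?_)
      exact (measurePreserving_add_right volume (s • mom n t)).map_eq
    exact mp.integrable_comp_of_integrable hw.integrable
  have iP : Integrable (fun x : ℝ × (Fin n → ℝ) => W x * XR w (t, x.2)) :=
    iW.mul_bdd (c := k * (2*k)) (hX.comp (measurable_const.prodMk measurable_snd)).aestronglyMeasurable (Eventually.of_forall fun z => hw.XR_bd _)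
  have e1 : ∀ y, XR w (t, y) ^ 2 = ∫ s, W (s, y) * XR w (t, y) := fun y => by
    rw [integral_mul_const, sq]; rfl
  have iQ : Integrable (fun x : ℝ × (Fin n → ℝ) => w x * XR w (t, x.2 - x.1 • mom n t)) :=
    hw.integrable.mul_bdd (c := k * (2*k)) (hX.comp (by fun_prop : Measurable fun x : ℝ × (Fin n → ℝ) => (t, x.2 - x.1 • mom n t))).aestronglyMeasurable (Eventually.of_forall fun z => hw.XR_bd _)
  rw [Measure.volume_eq_prod] at iP iQ
  simp_rw [e1]
  refine ⟨iP.integral_prod_right, ?_⟩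
  rw [← integral_prod_symm _ iP, integral_prod _ iP]
  have e2 : ∫ s, ∫ y, W (s, y) * XR w (t, y) = ∫ s, ∫ y, w (s, y) * XR w (t, y - s • mom n t) := by
    refine integral_congr_ae (Eventually.of_forall fun s => ?_)
    simp only
    rw [← integral_add_right_eq_self (fun y => w (s, y) * XR w (t, y - s • mom n t)) (s • mom n t)]
    simp [hW]
  rw [e2, ← integral_prod _ iQ]
  refine integral_congr_ae (Eventually.of_forall fun z => ?_)
  simp only
  rw [integral_const_mul]
  by_cases hz : w z = 0
  · simp [hz]
  congr 1
  rw [setIntegral_eq_integral_of_forall_compl_eq_zero]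
  · unfold XR
    rw [← integral_add_right_eq_self _ z.1]
    refine integral_congr_ae (Eventually.of_forall fun σ => ?_)
    simp only
    congr 1
    refine Prod.ext ?_ ?_
    · simp [stp, ev]; ring
    · simp only [stp, ev, Prod.snd_add, Prod.smul_snd]; module
  · intro σ hσ
    have e3 : z + stp n (t, σ) = (z.1 + σ, (z + stp n (t, σ)).2) := by simp [stp, ev, Prod.ext_iff]
    rw [e3]
    refine hw.line _ (fun hc => hσ ?_) _
    have : z.1 ∈ Icc (-k) k := by
      by_contra hn
      exact hz (hw.line z.1 hn z.2)
    rw [mem_Icc] at *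
    constructor <;> linarith [hc.1, hc.2, this.1, this.2]

theorem BW.base2 {k : ℝ} {w : Pt n → ℝ} (hw : BW k w) (T : ℝ) :
    ∫⁻ t in Icc (-T) T, ∫⁻ y, ENNReal.ofReal (XR w (t, y) ^ 2) = ENNReal.ofReal (∫ z, w z * PL (nuS n T (2*k)) w z) := by
  have hm := hw.meas
  have hst := measurable_stp n
  set I := Icc (-T) T
  set I' := Icc (-(2*k)) (2*k)
  haveI f1 : IsFiniteMeasure ((volume : Measure ℝ).restrict I) := ⟨by simp [I]⟩
  haveI f2 : IsFiniteMeasure ((volume : Measure ℝ).restrict I') := ⟨by simp [I']⟩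
  have i1 := hw.int_gen ((volume.restrict I).prod (volume.restrict I')) (g := fun _ => 0) measurable_const hst
  simp only [add_zero] at i1
  have i2 := i1.integral_prod_right
  have e0 : ∀ t, ∫ y, XR w (t, y) ^ 2 = ∫ σ in I', ∫ z, w z * w (z + stp n (t, σ)) := fun t => by
    rw [(hw.base t).2]
    have i3 := hw.int_gen (volume.restrict I') (g := fun _ => 0) measurable_const (h := fun σ => stp n (t, σ)) (by fun_prop)
    simp only [add_zero] at i3
    exact integral_integral_swap (f := fun z σ => w z * w (z + stp n (t, σ))) i3
  have e1 : ∀ t, ∫⁻ y, ENNReal.ofReal (XR w (t, y) ^ 2) = ENNReal.ofReal (∫ y, XR w (t, y) ^ 2) := fun t =>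
    (ofReal_integral_eq_lintegral_ofReal (hw.base t).1 (Eventually.of_forall fun _ => sq_nonneg _)).symm
  simp_rw [e1]
  rw [← ofReal_integral_eq_lintegral_ofReal]
  · congr 1
    simp_rw [e0]
    rw [← integral_prod _ i2, ← integral_integral_swap (f := fun z b => w z * w (z + stp n b)) i1]
    refine integral_congr_ae (Eventually.of_forall fun z => ?_)
    simp only
    rw [integral_const_mul, PL, nuS, integral_map hst.aemeasurable (f := fun x => w (z + x)) (hm.comp (measurable_const_add z)).aestronglyMeasurable, Measure.volume_eq_prod, Measure.prod_restrict]
  · simp_rw [e0]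
    exact i2.integral_prod_left
  · exact Eventually.of_forall fun t => integral_nonneg fun _ => sq_nonneg _

/-- weak convergence of `w` gives strong local convergence of its transform -/
theorem weak_strong {ι : Type*} {l : Filter ι} [l.IsCountablyGenerated] (k : ℝ) (w : ι → Pt n → ℝ) (hw : ∀ i, BW k (w i))
    (hweak : ∀ φ : Pt n → ℝ, Integrable φ → Tendsto (fun i => ∫ z, w i z * φ z) l (nhds 0)) (m : ℕ) :
    Tendsto (fun i => ∫⁻ u in Metric.closedBall (0 : Pt n) m, ENNReal.ofReal |XR (w i) u|) l (nhds 0) := by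
  set S : Set (Pt n) := Icc (-(m:ℝ)) m ×ˢ univ with hS
  have mS : MeasurableSet S := measurableSet_Icc.prod MeasurableSet.univ
  have hsub : Metric.closedBall (0 : Pt n) m ⊆ S := by
    intro u hu
    rw [mem_closedBall_zero_iff] at hu
    exact ⟨abs_le.1 ((norm_fst_le u).trans hu), trivial⟩
  obtain ⟨C, hC, H⟩ := hold_set (volume.restrict S : Measure (Pt n)) (B := Metric.closedBall (0 : Pt n) m) measurableSet_closedBall
    (ne_top_of_le_ne_top (measure_closedBall_lt_top (x := (0 : Pt n)) (r := m)).ne (Measure.restrict_apply_le _ _)) (r := 2) (by norm_num)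
  refine tends_sqrt (D := ENNReal.ofReal k) hC ENNReal.ofReal_ne_top (fun i => ?_) (aE_nu k m (2*k) w hw hweak)
  have hX := measurable_XR (hw i).meas
  have h1 := H (fun u => ENNReal.ofReal |XR (w i) u|) (by fun_prop)
  rw [Measure.restrict_restrict measurableSet_closedBall, inter_eq_left.2 hsub] at h1
  refine h1.trans (mul_le_mul_right (ENNReal.rpow_le_rpow ?_ (by norm_num)) C)
  refine le_trans (le_of_eq ?_) ((hw i).pair_le (nuS n m (2*k)))
  rw [← (hw i).base2]
  have e : ∀ u, ENNReal.ofReal |XR (w i) u| ^ (2:ℝ) = ENNReal.ofReal (XR (w i) u ^ 2) := fun u => by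
    rw [ENNReal.ofReal_rpow_of_nonneg (abs_nonneg _) (by norm_num), Real.rpow_two, sq_abs]
  simp_rw [e]
  rw [hS, Measure.volume_eq_prod, ← Measure.prod_restrict, Measure.restrict_univ, lintegral_prod _ (by fun_prop)]
end weak3

section sub
variable {n : ℕ}
theorem bdd_mul_int {w : Pt n → ℝ} {k : ℝ} (hw : Measurable w) (hb : ∀ z, |w z| ≤ k) {φ : Pt n → ℝ} (hφ : Integrable φ) :
    Integrable (fun z => w z * φ z) ∧ |∫ z, w z * φ z| ≤ k * ∫ z, |φ z| := by
  have i1 : Integrable (fun z => w z * φ z) := hφ.bdd_mul (c := k) hw.aestronglyMeasurable (Eventually.of_forall fun z => hb z)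
  refine ⟨i1, ?_⟩
  rw [← integral_const_mul]
  refine (norm_integral_le_integral_norm _).trans (integral_mono i1.norm (hφ.abs.const_mul k) fun z => ?_)
  simp only [norm_mul, Real.norm_eq_abs]
  exact mul_le_mul_of_nonneg_right (hb _) (abs_nonneg _)

theorem weak_sub (w : ℕ → ℕ → Pt n → ℝ) (hw : ∀ j k, Measurable (w j k)) (hb : ∀ j k z, |w j k z| ≤ k) :
    ∃ σ : ℕ → ℕ, StrictMono σ ∧ ∀ k : ℕ, ∀ φ : Pt n → ℝ, Integrable φ →
      Tendsto (fun a : ℕ × ℕ => ∫ z, (w (σ a.1) k z - w (σ a.2) k z) * φ z) (atTop ×ˢ atTop) (nhds 0) := by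
  haveI : Fact ((1:ℝ≥0∞) ≠ ⊤) := ⟨by simp⟩
  set D : ℕ → Lp ℝ 1 (volume : Measure (Pt n)) := TopologicalSpace.denseSeq _ with hD
  have iD : ∀ l, Integrable (D l) := fun l => L1.integrable_coeFn _
  set x : ℕ → (ℕ × ℕ → ℝ) := fun j a => ∫ z, w j a.1 z * D a.2 z with hx
  have hK : IsCompact (Set.pi univ fun a : ℕ × ℕ => Icc (-(a.1 * ∫ z, |D a.2 z|)) (a.1 * ∫ z, |D a.2 z|)) :=
    isCompact_univ_pi fun a => isCompact_Icc
  obtain ⟨a, -, σ, hσ, ha⟩ := hK.tendsto_subseq (x := x) (fun j => fun a _ => abs_le.1 (bdd_mul_int (hw j a.1) (hb j a.1) (iD a.2)).2)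
  refine ⟨σ, hσ, fun k φ hφ => ?_⟩
  have hc : ∀ l, Tendsto (fun j => ∫ z, w (σ j) k z * D l z) atTop (nhds (a (k, l))) := fun l => (tendsto_pi_nhds.1 ha (k, l))
  rw [Metric.tendsto_nhds]
  intro ε hε
  have hk : (0:ℝ) < 2 * k + 1 := by positivity
  obtain ⟨l, hl⟩ : ∃ l, dist (hφ.toL1 φ) (D l) < ε / 2 / (2*k+1) :=
    (TopologicalSpace.denseRange_denseSeq (Lp ℝ 1 (volume : Measure (Pt n)))).exists_dist_lt _ (by positivity)
  have h2 : Tendsto (fun p : ℕ × ℕ => (∫ z, w (σ p.1) k z * D l z) - ∫ z, w (σ p.2) k z * D l z) (atTop ×ˢ atTop) (nhds 0) := by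
    have := ((hc l).comp (tendsto_fst (f := atTop) (g := (atTop : Filter ℕ)))).sub ((hc l).comp (tendsto_snd (f := (atTop : Filter ℕ)) (g := atTop)))
    rw [sub_self] at this
    exact this
  have hInt : ∫ z, |φ z - D l z| < ε / 2 / (2*k+1) := by
    rw [dist_eq_norm, L1.norm_eq_integral_norm] at hl
    refine lt_of_eq_of_lt (integral_congr_ae ?_) hl
    filter_upwards [Lp.coeFn_sub (hφ.toL1 φ) (D l), hφ.coeFn_toL1] with z h1 h2
    rw [h1, Pi.sub_apply, h2, Real.norm_eq_abs]
  filter_upwards [(Metric.tendsto_nhds.1 h2) (ε/2) (by positivity)] with p hp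
  rw [Real.dist_eq, sub_zero] at hp ⊢
  have iS : Integrable (fun z => φ z - D l z) := hφ.sub (iD l)
  have hd := bdd_mul_int (k := 2*k) ((hw (σ p.1) k).sub (hw (σ p.2) k)) (fun z => by
    have h1 := abs_le.1 (hb (σ p.1) k z)
    have h2 := abs_le.1 (hb (σ p.2) k z)
    simp only [Pi.sub_apply]
    exact abs_le.2 ⟨by linarith, by linarith⟩) iS
  have e : ∫ z, (w (σ p.1) k z - w (σ p.2) k z) * φ z = ((∫ z, w (σ p.1) k z * D l z) - ∫ z, w (σ p.2) k z * D l z) + ∫ z, (w (σ p.1) k - w (σ p.2) k) z * (φ z - D l z) := by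
    have i1 := (bdd_mul_int (hw (σ p.1) k) (hb (σ p.1) k) (iD l)).1
    have i2 := (bdd_mul_int (hw (σ p.2) k) (hb (σ p.2) k) (iD l)).1
    rw [← integral_sub i1 i2, ← integral_add (f := fun z => w (σ p.1) k z * D l z - w (σ p.2) k z * D l z) (i1.sub i2) hd.1]
    refine integral_congr_ae (Eventually.of_forall fun z => ?_)
    simp only [Pi.sub_apply]; ring
  rw [e]
  have h4 : 2 * (k:ℝ) * ∫ z, |φ z - D l z| ≤ ε / 2 := by
    have h5 : 0 ≤ ∫ z, |φ z - D l z| := integral_nonneg fun _ => abs_nonneg _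
    rw [lt_div_iff₀ hk] at hInt
    nlinarith
  calc _ ≤ _ := abs_add_le _ _
    _ < ε / 2 + ε / 2 := add_lt_add_of_lt_of_le hp (hd.2.trans h4)
    _ = ε := by ring

/-- the transforms of weakly convergent truncations are Cauchy -/
theorem X_cauchy {q r : ℝ} (hq : 0 < q) (hr : 0 < r) (k : ℕ) (hH : mxn q r (XE (Hk n k)) ≠ ⊤) (F : ℕ → Pt n → ℝ≥0∞) (hF : ∀ j, Measurable (F j))
    (hd : ∀ j z, F j z ≤ Hk n k z)
    (hweak : ∀ φ : Pt n → ℝ, Integrable φ → Tendsto (fun a : ℕ × ℕ => ∫ z, ((F a.1 z).toReal - (F a.2 z).toReal) * φ z) (atTop ×ˢ atTop) (nhds 0))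
    {ε : ℝ≥0∞} (hε : 0 < ε) : ∀ᶠ p : ℕ × ℕ in atTop ×ˢ atTop, ∃ g : Pt n → ℝ≥0∞, Measurable g ∧ (∀ u, XE (F p.1) u ≤ XE (F p.2) u + g u) ∧ mxn q r g ≤ ε := by
  have hT : ∀ j z, F j z ≠ ⊤ := fun j z => ne_top_of_le_ne_top (Hk_top k z) (hd j z)
  have hk : ∀ j z, (F j z).toReal ≤ k := fun j z => by
    have := (hd j z).trans (indicator_le_self _ _ z)
    exact ENNReal.toReal_le_of_le_ofReal (by positivity) (by simpa using this)
  have h0 : ∀ j z, (k:ℝ) < ‖z‖ → F j z = 0 := fun j z hz => by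
    have := hd j z
    rw [Hk, indicator_of_notMem (by simpa using hz)] at this
    exact le_antisymm this zero_le
  have bF : ∀ j, BW (k:ℝ) (fun z => (F j z).toReal) := fun j => ⟨by positivity, (hF j).ennreal_toReal, fun z => by
    rw [abs_of_nonneg ENNReal.toReal_nonneg]; exact hk j z, fun z hz => by simp [h0 j z hz]⟩
  set w : ℕ × ℕ → Pt n → ℝ := fun p z => (F p.1 z).toReal - (F p.2 z).toReal with hw
  have bw : ∀ p, BW (k:ℝ) (w p) := fun p => ⟨by positivity, (bF p.1).meas.sub (bF p.2).meas, fun z => by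
    have h1 := hk p.1 z
    have h2 := hk p.2 z
    have h3 : 0 ≤ (F p.1 z).toReal := ENNReal.toReal_nonneg
    have h4 : 0 ≤ (F p.2 z).toReal := ENNReal.toReal_nonneg
    exact abs_le.2 ⟨by simp only [hw]; linarith, by simp only [hw]; linarith⟩, fun z hz => by simp [hw, h0 _ z hz]⟩
  obtain ⟨m, -, hm⟩ := dom hq hr (measurable_XE (measurable_Hk k)) hH hε
  have ws := weak_strong (k:ℝ) w bw hweak m
  have hpos : (0:ℝ≥0∞) < ENNReal.ofReal ((1/2)^m) := by simp
  filter_upwards [ws.eventually (Iic_mem_nhds hpos)] with p hp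
  have mg : Measurable (fun u => ENNReal.ofReal |XR (w p) u|) := (measurable_XR (bw p).meas).abs.ennreal_ofReal
  refine ⟨_, mg, fun u => ?_, hm _ mg (fun u => ?_) hp⟩
  · have il : ∀ j, Integrable (fun s : ℝ => (F j (s, u.2 + s • mom n u.1)).toReal) := fun j => by
      have hmom := measurable_mom n
      have mj := (bF j).meas
      have h1 : Integrable ((Icc (-(k:ℝ)) k).indicator fun _ => (k:ℝ)) :=
        (integrable_indicator_iff measurableSet_Icc).2 (integrableOn_const (by simp))
      refine h1.mono' (mj.comp (by fun_prop : Measurable fun s : ℝ => (s, u.2 + s • mom n u.1))).aestronglyMeasurable (Eventually.of_forall fun s => ?_)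
      by_cases hs : s ∈ Icc (-(k:ℝ)) k
      · rw [indicator_of_mem hs]; exact (bF j).bd _
      · rw [indicator_of_notMem hs, (bF j).line s hs]; simp
    have eX : ∀ j, XE (F j) u = ENNReal.ofReal (∫ s : ℝ, (F j (s, u.2 + s • mom n u.1)).toReal) := fun j => by
      rw [ofReal_integral_eq_lintegral_ofReal (il j) (Eventually.of_forall fun _ => ENNReal.toReal_nonneg)]
      exact lintegral_congr fun s => (ENNReal.ofReal_toReal (hT j _)).symm
    have eR : XR (w p) u = (∫ s : ℝ, (F p.1 (s, u.2 + s • mom n u.1)).toReal) - ∫ s : ℝ, (F p.2 (s, u.2 + s • mom n u.1)).toReal :=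
      integral_sub (il _) (il _)
    rw [eX, eX]
    refine le_trans (ENNReal.ofReal_le_ofReal ?_) ENNReal.ofReal_add_le
    linarith [le_abs_self (XR (w p) u)]
  · have : ENNReal.ofReal |XR (w p) u| ≤ ∫⁻ s : ℝ, ‖w p (s, u.2 + s • mom n u.1)‖ₑ := by
      rw [← Real.enorm_eq_ofReal_abs]
      exact enorm_integral_le_lintegral_enorm _
    refine this.trans (lintegral_mono fun s => ?_)
    rw [Real.enorm_eq_ofReal_abs]
    by_cases hz : (s, u.2 + s • mom n u.1) ∈ Metric.closedBall (0 : Pt n) k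
    · rw [Hk, indicator_of_mem hz]
      exact (ENNReal.ofReal_le_ofReal ((bw p).bd _)).trans (by simp)
    · rw [(bw p).supp _ (by rw [mem_closedBall_zero_iff, not_le] at hz; exact hz)]; simp
end sub

section ucv
variable {n : ℕ}
theorem ucv {p ε : ℝ} (hp : 1 < p) (hε : 0 < ε) : ∃ C : ℝ, 0 < C ∧ ∀ a b : ℝ, 0 ≤ a → 0 ≤ b →
    |a - b| ^ p + C * ((a+b)/2) ^ p ≤ (ε + C/2) * (a^p + b^p) := by
  have hp0 : 0 ≤ p := by linarith
  have conv := strictConvexOn_rpow hp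
  have hv : ∀ a b : ℝ, 0 ≤ a → 0 ≤ b → ((a+b)/2)^p ≤ (a^p + b^p)/2 := fun a b ha hb => by
    have := conv.convexOn.2 (mem_Ici.2 ha) (mem_Ici.2 hb) (by norm_num : (0:ℝ) ≤ 1/2) (by norm_num : (0:ℝ) ≤ 1/2) (by norm_num)
    simp only [smul_eq_mul] at this
    rw [show (a+b)/2 = 1/2*a + 1/2*b by ring]; linarith
  have hv' : ∀ a b : ℝ, 0 ≤ a → 0 ≤ b → a ≠ b → ((a+b)/2)^p < (a^p + b^p)/2 := fun a b ha hb hab => by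
    have := conv.2 (mem_Ici.2 ha) (mem_Ici.2 hb) hab (by norm_num : (0:ℝ) < 1/2) (by norm_num : (0:ℝ) < 1/2) (by norm_num)
    simp only [smul_eq_mul] at this
    rw [show (a+b)/2 = 1/2*a + 1/2*b by ring]; linarith
  have cr : Continuous fun x : ℝ => x ^ p := Real.continuous_rpow_const hp0
  set u : ℝ → ℝ := fun x => |x - (1-x)| ^ p - ε * (x^p + (1-x)^p) with hu
  set v : ℝ → ℝ := fun x => (x^p + (1-x)^p)/2 - ((x+(1-x))/2)^p with hvd
  have cu : Continuous u := ((cr.comp (by fun_prop : Continuous fun x : ℝ => |x - (1-x)|))).sub (continuous_const.mul (cr.add (cr.comp (by fun_prop : Continuous fun x : ℝ => 1 - x))))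
  have cv : Continuous v := ((cr.add (cr.comp (by fun_prop : Continuous fun x : ℝ => 1 - x))).div_const 2).sub (cr.comp (by fun_prop : Continuous fun x : ℝ => (x+(1-x))/2))
  have key : ∃ C : ℝ, 0 < C ∧ ∀ x ∈ Icc (0:ℝ) 1, u x ≤ C * v x := by
    have hK : IsCompact (Icc (0:ℝ) 1 ∩ {x | 0 ≤ u x}) := isCompact_Icc.inter_right (isClosed_le continuous_const cu)
    have vn : ∀ x ∈ Icc (0:ℝ) 1, 0 ≤ v x := fun x hx => sub_nonneg.2 (hv x (1-x) hx.1 (by linarith [hx.2]))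
    by_cases hne : (Icc (0:ℝ) 1 ∩ {x | 0 ≤ u x}).Nonempty
    · obtain ⟨x0, hx0, hmin⟩ := hK.exists_isMinOn hne cv.continuousOn
      have hpos : 0 < v x0 := by
        refine sub_pos.2 (hv' x0 (1-x0) hx0.1.1 (by linarith [hx0.1.2]) fun h => ?_)
        have h1 : 0 ≤ u x0 := hx0.2
        simp only [hu] at h1
        rw [← h, sub_self, abs_zero, Real.zero_rpow (by linarith)] at h1
        have : 0 < x0 ^ p := Real.rpow_pos_of_pos (by linarith) p
        nlinarith
      refine ⟨1 / v x0, by positivity, fun x hx => ?_⟩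
      by_cases hux : 0 ≤ u x
      · have h2 : v x0 ≤ v x := hmin ⟨hx, hux⟩
        have h3 : u x ≤ 1 := by
          have h4 : |x - (1-x)| ^ p ≤ 1 := Real.rpow_le_one (abs_nonneg _) (abs_le.2 ⟨by linarith [hx.1], by linarith [hx.2]⟩) hp0
          have h5 : 0 ≤ x ^ p := Real.rpow_nonneg hx.1 p
          have h6 : 0 ≤ (1-x) ^ p := Real.rpow_nonneg (by linarith [hx.2]) p
          simp only [hu]; nlinarith
        calc u x ≤ 1 := h3
          _ = 1 / v x0 * v x0 := by field_simp
          _ ≤ _ := mul_le_mul_of_nonneg_left h2 (by positivity)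
      · exact (not_le.1 hux).le.trans (mul_nonneg (by positivity) (vn x hx))
    · refine ⟨1, one_pos, fun x hx => ?_⟩
      have : ¬ 0 ≤ u x := fun h => hne ⟨x, hx, h⟩
      exact (not_le.1 this).le.trans (mul_nonneg zero_le_one (vn x hx))
  obtain ⟨C, hC, H⟩ := key
  refine ⟨C, hC, fun a b ha hb => ?_⟩
  rcases (add_nonneg ha hb).eq_or_lt with h0 | h0
  · have ea : a = 0 := by linarith
    have eb : b = 0 := by linarith
    rw [ea, eb]; simp [Real.zero_rpow (by linarith : p ≠ 0)]
  · have hx := H (a/(a+b)) ⟨by positivity, by rw [div_le_one h0]; linarith⟩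
    have e1 : 1 - a/(a+b) = b/(a+b) := by field_simp; ring
    simp only [hu, hvd] at hx
    rw [e1] at hx
    have e2 : |a/(a+b) - b/(a+b)| = |a-b|/(a+b) := by rw [← sub_div, abs_div, abs_of_pos h0]
    have e3 : (a/(a+b) + b/(a+b))/2 = ((a+b)/2)/(a+b) := by field_simp
    rw [e2, e3, Real.div_rpow (abs_nonneg _) h0.le, Real.div_rpow ha h0.le, Real.div_rpow hb h0.le, Real.div_rpow (by positivity) h0.le] at hx
    have hr : 0 < (a+b)^p := Real.rpow_pos_of_pos h0 p
    have h9 := mul_le_mul_of_nonneg_right hx hr.le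
    field_simp at h9
    nlinarith

theorem near_one (hn : 2 ≤ n) {s : ℝ} (hs : D0 n < s) {A : ℝ≥0∞} (hA : OpC n s A) {G : ℕ → Pt n → ℝ≥0∞} (hG : ∀ j, Measurable (G j)) (hT : ∀ j z, G j z ≠ ⊤)
    (hlim : Tendsto (fun j => NX n s (G j)) atTop (nhds A)) (htight : ∀ η : ℝ≥0∞, 0 < η → ∃ k, ∀ᶠ j in atTop, PN n s (hi (G j) k) ≤ η)
    (hweak : ∀ k : ℕ, ∀ φ : Pt n → ℝ, Integrable φ → Tendsto (fun a : ℕ × ℕ => ∫ z, ((lo (G a.1) k z).toReal - (lo (G a.2) k z).toReal) * φ z) (atTop ×ˢ atTop) (nhds 0))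
    {ε : ℝ≥0∞} (hε : 0 < ε) : ∀ᶠ p : ℕ × ℕ in atTop ×ˢ atTop, 2 * A ≤ NX n s (fun z => G p.1 z + G p.2 z) + ε := by
  have hp := pp_gt hn hs
  have hq : 1 ≤ qq n s := by linarith [qq_gt hn hs, pp_gt hn hs]
  have hr : 1 ≤ rr n s := by linarith [rr_gt hn hs]
  set e := ε / 5 with he
  have e0 : 0 < e := ENNReal.div_pos hε.ne' (by simp)
  set η := (e / A) ^ (pp n s) with hη
  have η0 : 0 < η := ENNReal.rpow_pos_of_nonneg (ENNReal.div_pos e0.ne' hA.top) (by linarith)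
  obtain ⟨k, hk⟩ := htight η η0
  have ml : ∀ j, Measurable (lo (G j) k) := fun j => (hG j).indicator (measurableSet_Sk (hG j) k)
  have mh : ∀ j, Measurable (hi (G j) k) := fun j => (hG j).indicator (measurableSet_Sk (hG j) k).compl
  have hX := X_cauchy (q := qq n s) (r := rr n s) (by linarith) (by linarith) k (NX_Hk hn hs hA k) (fun j => lo (G j) k) ml (fun j z => lo_fin (G j) k z) (hweak k) e0
  have hnear : ∀ᶠ j in atTop, A ≤ NX n s (G j) + e := by
    filter_upwards [hlim.eventually (lt_mem_nhds (ENNReal.sub_lt_self hA.top hA.pos e0.ne'))] with j hj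
    exact tsub_le_iff_right.1 hj.le
  filter_upwards [hX, tendsto_fst.eventually (hnear.and hk)] with p hp1 hp2
  obtain ⟨g, mg, hg1, hg2⟩ := hp1
  obtain ⟨ha, hb⟩ := hp2
  have s1 : NX n s (hi (G p.1) k) ≤ e := by
    refine (hA.bd _ (mh _) fun z => ne_top_of_le_ne_top (hT p.1 z) (indicator_le_self _ _ z)).trans ?_
    refine (mul_le_mul_right (ENNReal.rpow_le_rpow hb (by positivity)) A).trans ?_
    rw [hη, rpow_inv_cancel (by linarith)]
    exact ENNReal.mul_div_le
  have s2 : NX n s (G p.1) ≤ NX n s (lo (G p.1) k) + e := by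
    have : G p.1 = fun z => lo (G p.1) k z + hi (G p.1) k z := by
      funext z; exact (congrFun (indicator_self_add_compl (Sk (G p.1) k) (G p.1)) z).symm
    conv_lhs => rw [this]
    exact (NX_add hn hs (ml _) (mh _)).trans (add_le_add le_rfl s1)
  have s3 : 2 * NX n s (lo (G p.1) k) ≤ NX n s (fun z => G p.1 z + G p.2 z) + e := by
    unfold NX
    rw [← mxn_const_mul (by linarith) (by linarith) (measurable_XE (ml _))]
    refine le_trans (mxn_mono (h := fun u => XE (fun z => G p.1 z + G p.2 z) u + g u) (by linarith) (by linarith) fun u => ?_) ((mxn_add hq hr (measurable_XE ((hG _).add (hG _))) mg).trans (add_le_add le_rfl hg2))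
    rw [XE_add (hG _), two_mul, add_assoc]
    refine add_le_add (XE_mono (fun z => indicator_le_self _ _ z) u) ((hg1 u).trans (add_le_add (XE_mono (fun z => indicator_le_self _ _ z) u) le_rfl))
  have h5 : e * 5 = ε := ENNReal.div_mul_cancel (by simp) (by simp)
  calc 2 * A ≤ 2 * (NX n s (G p.1) + e) := mul_le_mul_right ha 2
    _ ≤ 2 * (NX n s (lo (G p.1) k) + e + e) := mul_le_mul_right (add_le_add s2 le_rfl) 2
    _ = 2 * NX n s (lo (G p.1) k) + 4 * e := by ring
    _ ≤ NX n s (fun z => G p.1 z + G p.2 z) + e + 4 * e := add_le_add s3 le_rfl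
    _ = NX n s (fun z => G p.1 z + G p.2 z) + e * 5 := by ring
    _ = _ := by rw [h5]

theorem cauchyPN (hn : 2 ≤ n) {s : ℝ} (hs : D0 n < s) {A : ℝ≥0∞} (hA : OpC n s A) {G : ℕ → Pt n → ℝ≥0∞} (hG : ∀ j, Measurable (G j)) (hT : ∀ j z, G j z ≠ ⊤)
    (h1 : ∀ j, PN n s (G j) = 1)
    (hlim : Tendsto (fun j => NX n s (G j)) atTop (nhds A)) (htight : ∀ η : ℝ≥0∞, 0 < η → ∃ k, ∀ᶠ j in atTop, PN n s (hi (G j) k) ≤ η)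
    (hweak : ∀ k : ℕ, ∀ φ : Pt n → ℝ, Integrable φ → Tendsto (fun a : ℕ × ℕ => ∫ z, ((lo (G a.1) k z).toReal - (lo (G a.2) k z).toReal) * φ z) (atTop ×ˢ atTop) (nhds 0))
    {ε : ℝ} (hε : 0 < ε) : ∀ᶠ p : ℕ × ℕ in atTop ×ˢ atTop, ∫⁻ z, ENNReal.ofReal |(G p.1 z).toReal - (G p.2 z).toReal| ^ pp n s ≤ ENNReal.ofReal ε := by
  have hp := pp_gt hn hs
  have hp0 : 0 ≤ pp n s := by linarith
  obtain ⟨C, hC, H⟩ := ucv hp (ε := ε/3) (by positivity)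
  set ρ := ENNReal.ofReal (1 - ε/3/C) with hρ
  have ρ1 : ρ < 1 := by
    rw [hρ, ← ENNReal.ofReal_one, ENNReal.ofReal_lt_ofReal_iff one_pos]
    have : 0 < ε/3/C := by positivity
    linarith
  have ρA : A * ρ ^ (1/pp n s) < A := by
    have : ρ ^ (1/pp n s) < 1 := ENNReal.rpow_lt_one ρ1 (by positivity)
    calc _ < A * 1 := ENNReal.mul_lt_mul_right hA.pos hA.top this
      _ = A := mul_one A
  have e0 : 0 < A - A * ρ ^ (1/pp n s) := tsub_pos_of_lt ρA
  filter_upwards [near_one hn hs hA hG hT hlim htight hweak e0] with p hpn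
  set M : Pt n → ℝ≥0∞ := fun z => 2⁻¹ * (G p.1 z + G p.2 z) with hM
  have mM : Measurable M := ((hG _).add (hG _)).const_mul _
  have hNM : NX n s (fun z => G p.1 z + G p.2 z) = 2 * NX n s M := by
    rw [hM, NX_const_mul (F := fun z => G p.1 z + G p.2 z) hn hs ((hG _).add (hG _)), ← mul_assoc, ENNReal.mul_inv_cancel (by simp) (by simp), one_mul]
  have hPM : ρ ≤ PN n s M := by
    by_contra hc
    rw [not_le] at hc
    have b1 := hA.bd M mM fun z => ENNReal.mul_ne_top (by simp) (ENNReal.add_ne_top.2 ⟨hT _ _, hT _ _⟩)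
    have b2 := b1.trans (mul_le_mul_right (ENNReal.rpow_le_rpow hc.le (by positivity : 0 ≤ 1/pp n s)) A)
    rw [hNM] at hpn
    have b3 : 2 * A < 2 * A := by
      calc 2 * A ≤ 2 * (A * ρ ^ (1/pp n s)) + (A - A * ρ ^ (1/pp n s)) := hpn.trans (add_le_add (mul_le_mul_right b2 2) le_rfl)
        _ = A * ρ ^ (1/pp n s) + (A * ρ ^ (1/pp n s) + (A - A * ρ ^ (1/pp n s))) := by ring
        _ = A * ρ ^ (1/pp n s) + A := by rw [add_tsub_cancel_of_le ρA.le]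
        _ < A + A := ENNReal.add_lt_add_right hA.top ρA
        _ = 2 * A := by ring
    exact lt_irrefl _ b3
  have mr : ∀ j, Measurable (fun z => (G j z).toReal) := fun j => (hG j).ennreal_toReal
  have m1 := mr p.1
  have m2 := mr p.2
  have pt : ∀ z, ENNReal.ofReal |(G p.1 z).toReal - (G p.2 z).toReal| ^ pp n s + ENNReal.ofReal C * M z ^ pp n s ≤
      ENNReal.ofReal (ε/3 + C/2) * (G p.1 z ^ pp n s + G p.2 z ^ pp n s) := by
    intro z
    have ha : 0 ≤ (G p.1 z).toReal := ENNReal.toReal_nonneg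
    have hb : 0 ≤ (G p.2 z).toReal := ENNReal.toReal_nonneg
    have h := ENNReal.ofReal_le_ofReal (H _ _ ha hb)
    have eM : M z = ENNReal.ofReal (((G p.1 z).toReal + (G p.2 z).toReal)/2) := by
      rw [ENNReal.ofReal_div_of_pos (by norm_num), ENNReal.ofReal_add ha hb, ENNReal.ofReal_toReal (hT _ _), ENNReal.ofReal_toReal (hT _ _)]
      simp [hM, div_eq_mul_inv, mul_comm]
    rw [ENNReal.ofReal_add (by positivity) (by positivity), ENNReal.ofReal_mul hC.le, ENNReal.ofReal_mul (by positivity), ENNReal.ofReal_add (p := (G p.1 z).toReal ^ pp n s) (by positivity) (by positivity),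
      ← ENNReal.ofReal_rpow_of_nonneg (abs_nonneg _) hp0, ← ENNReal.ofReal_rpow_of_nonneg (by positivity) hp0, ← ENNReal.ofReal_rpow_of_nonneg ha hp0, ← ENNReal.ofReal_rpow_of_nonneg hb hp0,
      ENNReal.ofReal_toReal (hT _ _), ENNReal.ofReal_toReal (hT _ _), ← eM] at h
    exact h
  have hI := lintegral_mono pt (μ := volume)
  have g1 := hG p.1
  have g2 := hG p.2
  rw [lintegral_add_left (by fun_prop), lintegral_const_mul _ (by fun_prop), lintegral_const_mul _ (by fun_prop), lintegral_add_left (by fun_prop)] at hI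
  have q1 : ∫⁻ z, G p.1 z ^ pp n s = 1 := h1 p.1
  have q2 : ∫⁻ z, G p.2 z ^ pp n s = 1 := h1 p.2
  rw [q1, q2] at hI
  have hI2 : (∫⁻ z, ENNReal.ofReal |(G p.1 z).toReal - (G p.2 z).toReal| ^ pp n s) + ENNReal.ofReal (C - ε/3) ≤ ENNReal.ofReal ε + ENNReal.ofReal (C - ε/3) := by
    calc _ ≤ (∫⁻ z, ENNReal.ofReal |(G p.1 z).toReal - (G p.2 z).toReal| ^ pp n s) + ENNReal.ofReal C * PN n s M := by
          refine add_le_add le_rfl (le_trans (le_of_eq ?_) (mul_le_mul_right hPM _))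
          rw [hρ, ← ENNReal.ofReal_mul hC.le]
          congr 1
          field_simp
      _ ≤ _ := hI
      _ = ENNReal.ofReal (ε + (C - ε/3)) := by
          rw [one_add_one_eq_two, ← ENNReal.ofReal_ofNat, ← ENNReal.ofReal_mul (by positivity)]
          congr 1; ring
      _ ≤ _ := ENNReal.ofReal_add_le
  exact (ENNReal.add_le_add_iff_right ENNReal.ofReal_ne_top).1 hI2
end ucv

section fin
variable {n : ℕ}

theorem eLp_eq {p : ℝ} (hp : 1 < p) (h : Pt n → ℝ) :
    eLpNorm h (ENNReal.ofReal p) volume = (∫⁻ z, ENNReal.ofReal |h z| ^ p) ^ (1/p) := by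
  have h0 : 0 < p := by linarith
  rw [eLpNorm_eq_lintegral_rpow_enorm_toReal (by simpa using h0) (by simp), ENNReal.toReal_ofReal h0.le]
  simp only [Real.enorm_eq_ofReal_abs]

theorem complete_sub {p : ℝ} (hp : 1 < p) {H : ℕ → Pt n → ℝ} (hm : ∀ j, Measurable (H j)) (hpos : ∀ j z, 0 ≤ H j z)
    (h1 : ∀ j, ∫⁻ z, ENNReal.ofReal |H j z| ^ p = 1)
    (hc : ∀ ε : ℝ, 0 < ε → ∀ᶠ a : ℕ × ℕ in atTop ×ˢ atTop, ∫⁻ z, ENNReal.ofReal |H a.1 z - H a.2 z| ^ p ≤ ENNReal.ofReal ε) :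
    ∃ g : Pt n → ℝ, Measurable g ∧ (∀ z, 0 ≤ g z) ∧ ∫⁻ z, ENNReal.ofReal |g z| ^ p = 1 ∧
      Tendsto (fun j => (∫⁻ z, ENNReal.ofReal |H j z - g z| ^ p) ^ (1/p)) atTop (nhds 0) := by
  have h0 : 0 < p := by linarith
  haveI : Fact (1 ≤ ENNReal.ofReal p) := ⟨by rw [← ENNReal.ofReal_one]; exact ENNReal.ofReal_le_ofReal hp.le⟩
  have hL : ∀ j, MemLp (H j) (ENNReal.ofReal p) volume := fun j =>
    ⟨(hm j).aestronglyMeasurable, by rw [eLp_eq hp, h1]; simp⟩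
  set u : ℕ → Lp ℝ (ENNReal.ofReal p) (volume : Measure (Pt n)) := fun j => (hL j).toLp (H j) with hu
  have hcu : CauchySeq u := by
    rw [EMetric.cauchySeq_iff']
    intro ε hε
    obtain ⟨δ, hδ0, hδ⟩ : ∃ δ : ℝ, 0 < δ ∧ ENNReal.ofReal δ ^ (1/p) < ε := by
      have h3 : Tendsto (fun δ : ℝ => ENNReal.ofReal δ ^ (1/p)) (nhdsWithin 0 (Ioi 0)) (nhds 0) := by
        have : Tendsto (fun δ : ℝ => ENNReal.ofReal δ ^ (1/p)) (nhds 0) (nhds (ENNReal.ofReal 0 ^ (1/p))) :=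
          ((ENNReal.continuous_rpow_const).comp ENNReal.continuous_ofReal).tendsto 0
        rw [ENNReal.ofReal_zero, ENNReal.zero_rpow_of_pos (by positivity)] at this
        exact this.mono_left nhdsWithin_le_nhds
      obtain ⟨δ, a, b⟩ := ((h3.eventually (gt_mem_nhds hε)).and self_mem_nhdsWithin).exists
      exact ⟨δ, b, a⟩
    have := hc δ hδ0
    rw [prod_atTop_atTop_eq, eventually_atTop] at this
    obtain ⟨⟨N1, N2⟩, hN⟩ := this
    refine ⟨max N1 N2, fun j hj => lt_of_le_of_lt ?_ hδ⟩
    have h4 := hN (j, max N1 N2) ⟨le_trans (le_max_left _ _) hj, le_max_right _ _⟩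
    rw [hu, Lp.edist_toLp_toLp, eLp_eq hp]
    exact ENNReal.rpow_le_rpow h4 (by positivity)
  obtain ⟨L, hLim⟩ := cauchySeq_tendsto_of_complete hcu
  have hLm : Measurable (L : Pt n → ℝ) := (Lp.stronglyMeasurable L).measurable
  have hn1 : ‖L‖ = 1 := by
    refine tendsto_nhds_unique hLim.norm ?_
    have : ∀ j, ‖u j‖ = 1 := fun j => by
      rw [hu, Lp.norm_toLp, eLp_eq hp, h1]; simp
    simp only [this]; exact tendsto_const_nhds
  refine ⟨fun z => |L z|, hLm.abs, fun z => abs_nonneg _, ?_, ?_⟩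
  · simp only [abs_abs]
    have : eLpNorm L (ENNReal.ofReal p) volume = 1 := by
      have h5 := Lp.norm_def L
      rw [hn1] at h5
      rw [← ENNReal.ofReal_toReal (Lp.eLpNorm_ne_top L), ← h5]; simp
    rw [eLp_eq hp] at this
    have h6 := congrArg (fun x : ℝ≥0∞ => x ^ p) this
    simpa [← ENNReal.rpow_mul, h0.ne'] using h6
  · have h7 : Tendsto (fun j => edist (u j) L) atTop (nhds 0) := by
      exact tendsto_iff_edist_tendsto_0.1 hLim
    refine tendsto_of_tendsto_of_tendsto_of_le_of_le tendsto_const_nhds h7 (fun _ => zero_le) fun j => ?_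
    have h8 : edist (u j) L = (∫⁻ z, ENNReal.ofReal |H j z - L z| ^ p) ^ (1/p) := by
      rw [Lp.edist_def, ← eLp_eq hp]
      refine eLpNorm_congr_ae ?_
      filter_upwards [(hL j).coeFn_toLp] with z hz
      simp only [Pi.sub_apply, hu, hz]
    show _ ≤ edist (u j) L
    rw [h8]
    refine ENNReal.rpow_le_rpow (lintegral_mono fun z => ENNReal.rpow_le_rpow (ENNReal.ofReal_le_ofReal ?_) h0.le) (by positivity)
    have := abs_abs_sub_abs_le_abs_sub (H j z) (L z)
    rwa [abs_of_nonneg (hpos j z)] at this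

theorem core (hn : 2 ≤ n) {s : ℝ} (hs : D0 n < s) {A : ℝ≥0∞} (hA : OpC n s A) {f : ℕ → Pt n → ℝ} (hm : ∀ j, Measurable (f j)) (hpos : ∀ j z, 0 ≤ f j z)
    (h1 : ∀ j, PN n s (fun z => ENNReal.ofReal (f j z)) = 1)
    (hlim : Tendsto (fun j => NX n s (fun z => ENNReal.ofReal (f j z))) atTop (nhds A)) :
    ∃ (φ : ℕ → Pt n → Pt n) (J : ℕ → ℝ) (σ : ℕ → ℕ) (g : Pt n → ℝ), (∀ j, IsSymJ n (φ j) (J j)) ∧ StrictMono σ ∧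
      (∀ z, 0 ≤ g z) ∧ ∫⁻ z, ENNReal.ofReal |g z| ^ pp n s = 1 ∧ NX n s (fun z => ENNReal.ofReal (g z)) = A ∧
      Tendsto (fun k => (∫⁻ z, ENNReal.ofReal |J (σ k) ^ (1/pp n s) * f (σ k) (φ (σ k) z) - g z| ^ pp n s) ^ (1/pp n s)) atTop (nhds 0) := by
  have hp := pp_gt hn hs
  have hp0 : 0 < pp n s := by linarith
  have hq : 0 < qq n s := by linarith [qq_gt hn hs]
  set ε : ℝ≥0∞ := (A/2) ^ qq n s with hε
  have hA2 : A/2 ≠ 0 := by simp [hA.pos]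
  have hε0 : ε ≠ 0 := by
    intro h
    rw [hε, ENNReal.rpow_eq_zero_iff] at h
    rcases h with h | h
    · exact hA2 h.1
    · linarith [h.2]
  obtain ⟨K, K0, hK⟩ := KPgen hn hs hε0
  have hFm : ∀ j, Measurable (fun z => ENNReal.ofReal (f j z)) := fun j => (hm j).ennreal_ofReal
  have hev : ∀ᶠ j in atTop, ε < Mf (fun z => ENNReal.ofReal (f j z)) (rr n s) (ee n s) := by
    filter_upwards [hlim.eventually (lt_mem_nhds (ENNReal.half_lt_self hA.pos hA.top))] with j hj
    rw [NX_Mf hn hs (hFm j)] at hj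
    have := ENNReal.rpow_lt_rpow hj hq
    rwa [rpow_inv_cancel' hq] at this
  have hch : ∀ j, ∃ φ J, IsSymJ n φ J ∧ (ε < Mf (fun z => ENNReal.ofReal (f j z)) (rr n s) (ee n s) →
      ENNReal.ofReal K⁻¹ ≤ volume (KPset (fun z => ENNReal.ofReal (f j z)) φ J (pp n s) K)) := by
    intro j
    by_cases h : ε < Mf (fun z => ENNReal.ofReal (f j z)) (rr n s) (ee n s)
    · obtain ⟨φ, J, a, b⟩ := hK _ (hFm j) (fun z => ENNReal.ofReal_ne_top) (h1 j).le h
      exact ⟨φ, J, a, fun _ => b⟩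
    · exact ⟨_, _, IsSymJ.translation 0, fun h' => absurd h' h⟩
  choose φ J hS hKP using hch
  choose ca cb ct hsym using fun j => (hS j).sym
  have hJ : ∀ j, 0 < J j := fun j => by
    rw [(hsym j).hJ]; have := (hsym j).ha; have := (hsym j).hb; positivity
  have hφ : ∀ j, Measurable (φ j) := fun j => (hsym j).hφ.measurable
  set G : ℕ → Pt n → ℝ≥0∞ := fun j z => ENNReal.ofReal (J j ^ (1/pp n s)) * ENNReal.ofReal (f j (φ j z)) with hGd
  have hG : ∀ j, Measurable (G j) := fun j => ((hFm j).comp (hφ j)).const_mul _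
  have hT : ∀ j z, G j z ≠ ⊤ := fun j z => ENNReal.mul_ne_top ENNReal.ofReal_ne_top ENNReal.ofReal_ne_top
  have hG1 : ∀ j, PN n s (G j) = 1 := fun j => by
    rw [← h1 j]; exact (hsym j).PN hn hs (hFm j)
  have hGN : ∀ j, NX n s (G j) = NX n s (fun z => ENNReal.ofReal (f j z)) := fun j => (hsym j).NX hn hs (hFm j)
  have hGlim : Tendsto (fun j => NX n s (G j)) atTop (nhds A) := by simpa only [hGN] using hlim
  have hJp : ∀ j, 0 ≤ J j ^ (1/pp n s) := fun j => Real.rpow_nonneg (hJ j).le _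
  have hGr : ∀ j z, (G j z).toReal = J j ^ (1/pp n s) * f j (φ j z) := fun j z => by
    rw [hGd]; simp only
    rw [← ENNReal.ofReal_mul (hJp j), ENNReal.toReal_ofReal (mul_nonneg (hJp j) (hpos _ _))]
  -- lower bound
  set k0 := ⌈K⌉₊ with hk0
  set c : ℝ≥0∞ := ENNReal.ofReal K⁻¹ ^ pp n s * ENNReal.ofReal K⁻¹ with hc
  have hc0 : 0 < c := by
    have : 0 < ENNReal.ofReal K⁻¹ := by simpa using K0
    exact ENNReal.mul_pos (ENNReal.rpow_pos this ENNReal.ofReal_ne_top).ne' this.ne'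
  have hlow : ∀ᶠ j in atTop, c ≤ PN n s (lo (G j) k0) := by
    filter_upwards [hev] with j hj
    have h2 := hKP j hj
    set S := KPset (fun z => ENNReal.ofReal (f j z)) (φ j) (J j) (pp n s) K with hSd
    calc c ≤ ENNReal.ofReal K⁻¹ ^ pp n s * volume S := by rw [hc]; gcongr
      _ ≤ ENNReal.ofReal K⁻¹ ^ pp n s * volume {z | ENNReal.ofReal K⁻¹ ^ pp n s ≤ lo (G j) k0 z ^ pp n s} := by
        gcongr
        intro z hz
        have hKk : K ≤ (k0:ℝ) := Nat.le_ceil K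
        have hz2 : z ∈ Sk (G j) k0 := by
          refine ⟨hz.1.trans hKk, hz.2.2.trans ?_⟩
          rw [← ENNReal.ofReal_natCast]; exact ENNReal.ofReal_le_ofReal hKk
        show ENNReal.ofReal K⁻¹ ^ pp n s ≤ lo (G j) k0 z ^ pp n s
        rw [lo, indicator_of_mem hz2]
        exact ENNReal.rpow_le_rpow hz.2.1 hp0.le
      _ ≤ PN n s (lo (G j) k0) := by
        refine mul_meas_ge_le_lintegral₀ (μ := volume) (f := fun z => lo (G j) k0 z ^ pp n s) ?_ _
        exact (((hG j).indicator (measurableSet_Sk (hG j) k0)).pow_const _).aemeasurable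
  have htight : ∀ η : ℝ≥0∞, 0 < η → ∃ k, ∀ᶠ j in atTop, PN n s (hi (G j) k) ≤ η := fun η hη =>
    tight hn hs hA hG hT hG1 hGlim hc0 hlow hη
  obtain ⟨σ, hσ, hw⟩ := weak_sub (fun j k z => (lo (G j) k z).toReal)
    (fun j k => ((hG j).indicator (measurableSet_Sk (hG j) k)).ennreal_toReal) (by
      intro j k z
      rw [abs_of_nonneg ENNReal.toReal_nonneg]
      refine ENNReal.toReal_le_of_le_ofReal (by positivity) ?_
      rw [ENNReal.ofReal_natCast]
      refine (lo_fin (G j) k z).trans ?_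
      exact indicator_le_self' (f := fun _ : Pt n => (k:ℝ≥0∞)) (fun _ _ => zero_le) z)
  have hcau := fun (ε : ℝ) (hε : 0 < ε) => cauchyPN hn hs hA (G := fun j => G (σ j)) (fun j => hG _) (fun j => hT _) (fun j => hG1 _)
    (hGlim.comp hσ.tendsto_atTop) (fun η hη => by
      obtain ⟨k, hk⟩ := htight η hη
      exact ⟨k, hσ.tendsto_atTop.eventually hk⟩) hw hε
  set H : ℕ → Pt n → ℝ := fun k z => J (σ k) ^ (1/pp n s) * f (σ k) (φ (σ k) z) with hH
  have hHm : ∀ k, Measurable (H k) := fun k => ((hm _).comp (hφ _)).const_mul _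
  have hHp : ∀ k z, 0 ≤ H k z := fun k z => mul_nonneg (hJp _) (hpos _ _)
  have hGH : ∀ k z, ENNReal.ofReal (H k z) = G (σ k) z := fun k z => by
    rw [hH]; simp only; rw [← hGr, ENNReal.ofReal_toReal (hT _ _)]
  obtain ⟨g, gm, g0, g1, gt⟩ := complete_sub hp hHm hHp (fun k => by
    have := hG1 (σ k)
    simp only [abs_of_nonneg (hHp k _), hGH]; exact this) (fun ε hε => by
    have := hcau ε hε
    simp only [hGr] at this; exact this)
  refine ⟨φ, J, σ, g, hS, hσ, g0, g1, ?_, gt⟩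
  have hgm : Measurable (fun z => ENNReal.ofReal (g z)) := gm.ennreal_ofReal
  apply le_antisymm
  · have := hA.bd _ hgm (fun z => ENNReal.ofReal_ne_top)
    have h2 : PN n s (fun z => ENNReal.ofReal (g z)) = 1 := by
      rw [← g1, PN]; simp only [abs_of_nonneg (g0 _)]
    rwa [h2, ENNReal.one_rpow, mul_one] at this
  · have h3 : Tendsto (fun k => NX n s (fun z => ENNReal.ofReal (g z)) + A * (∫⁻ z, ENNReal.ofReal |H k z - g z| ^ pp n s) ^ (1/pp n s)) atTop
        (nhds (NX n s (fun z => ENNReal.ofReal (g z)) + A * 0)) :=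
      tendsto_const_nhds.add (ENNReal.Tendsto.const_mul gt (Or.inr hA.top))
    rw [mul_zero, add_zero] at h3
    refine le_of_tendsto_of_tendsto' (hGlim.comp hσ.tendsto_atTop) h3 fun k => ?_
    have hdm : Measurable (fun z => ENNReal.ofReal |H k z - g z|) := ((hHm k).sub gm).abs.ennreal_ofReal
    calc NX n s (G (σ k)) ≤ NX n s (fun z => ENNReal.ofReal (g z) + ENNReal.ofReal |H k z - g z|) := by
          refine NX_mono hn hs fun z => ?_
          rw [← hGH, ← ENNReal.ofReal_add (g0 z) (abs_nonneg _)]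
          exact ENNReal.ofReal_le_ofReal (by linarith [le_abs_self (H k z - g z)])
      _ ≤ _ := (NX_add hn hs hgm hdm).trans (by
          gcongr
          exact hA.bd _ hdm (fun z => ENNReal.ofReal_ne_top))
end fin

/-- precompactness of extremizing sequences modulo symmetries. -/
theorem extremizing_seq_precompact (d : ℕ) (hd : 3 ≤ d) (θ : ℝ)
    (hθ : θ ∈ Set.Ioo (0:ℝ) 1) (f : ℕ → Pt (d-1) → ℝ)
    (hmeas : ∀ n, Measurable (f n)) (hpos : ∀ n, 0 ≤ f n)
    (hnorm : ∀ n, srcNorm d θ (f n) = 1)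
    (hext : Tendsto (fun n => XNorm d θ (f n)) atTop (nhds (Aconst d θ))) :
    ∃ (φ : ℕ → Pt (d-1) → Pt (d-1)) (J : ℕ → ℝ) (σ : ℕ → ℕ) (g : Pt (d-1) → ℝ),
      (∀ n, IsSymJ (d-1) (φ n) (J n)) ∧ StrictMono σ ∧
      srcNorm d θ g = 1 ∧ XNorm d θ g = Aconst d θ ∧
      Tendsto (fun k => srcNorm d θ
          (fun z => symAct (d-1) (pExp d θ) (J (σ k)) (φ (σ k)) (f (σ k)) z - g z))
        atTop (nhds 0) := by
  obtain ⟨n, rfl⟩ : ∃ n, d = n + 1 := ⟨d - 1, by omega⟩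
  have hn : 2 ≤ n := by omega
  have hs := ssd_gt hn hθ
  have hp := pp_gt hn hs
  have hp0 : 0 < pp n (ssd n θ) := by linarith
  have hX : ∀ h : Pt n → ℝ, XNorm (n+1) θ h = NX n (ssd n θ) (fun z => ENNReal.ofReal (h z)) := fun h => by
    unfold XNorm
    rw [qExp_eq hn hθ, rExp_eq hn hθ]
    exact mixedNorm_eq _ _ _
  have hN : ∀ h : Pt n → ℝ, srcNorm (n+1) θ h = (∫⁻ z, ENNReal.ofReal |h z| ^ pp n (ssd n θ)) ^ (1/pp n (ssd n θ)) := fun h => by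
    unfold srcNorm LpN
    rw [pExp_eq hn hθ]; rfl
  have hN1 : ∀ h : Pt n → ℝ, (∀ z, 0 ≤ h z) → (srcNorm (n+1) θ h = 1 ↔ PN n (ssd n θ) (fun z => ENNReal.ofReal (h z)) = 1) := fun h h0 => by
    rw [hN]
    simp only [abs_of_nonneg (h0 _)]
    show (PN n (ssd n θ) (fun z => ENNReal.ofReal (h z))) ^ (1/pp n (ssd n θ)) = 1 ↔ _
    constructor
    · intro h
      have := congrArg (fun x : ℝ≥0∞ => x ^ pp n (ssd n θ)) h
      simp only [rpow_inv_cancel' hp0, ENNReal.one_rpow] at this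
      exact this
    · intro h; rw [h, ENNReal.one_rpow]
  have hA : OpC n (ssd n θ) (Aconst (n+1) θ) := by
    refine opc_of hn hs ?_ ?_ (fun z => ENNReal.ofReal (f 0 z)) (hmeas 0).ennreal_ofReal (fun z => ENNReal.ofReal_ne_top)
      ((hN1 (f 0) (hpos 0)).1 (hnorm 0))
    · intro F hF hT h1
      have hFe : (fun z => ENNReal.ofReal (F z).toReal) = F := funext fun z => ENNReal.ofReal_toReal (hT z)
      refine le_sSup ⟨fun z => (F z).toReal, hF.ennreal_toReal, fun z => ENNReal.toReal_nonneg, ?_, ?_⟩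
      · refine (hN1 _ fun z => ENNReal.toReal_nonneg).2 ?_
        rw [hFe]; exact h1
      · refine Eq.trans ?_ (hX _).symm
        rw [hFe]
    · intro C hC
      refine sSup_le ?_
      rintro M ⟨h, a, b, c, rfl⟩
      refine (hX h).trans_le (hC _ a.ennreal_ofReal (fun z => ENNReal.ofReal_ne_top) ((hN1 h b).1 c))
  obtain ⟨φ, J, σ, g, a, b, c, e, h, i⟩ := core hn hs hA (f := f) hmeas hpos (fun j => (hN1 (f j) (hpos j)).1 (hnorm j))
    (by simpa only [hX] using hext)
  refine ⟨φ, J, σ, g, a, b, ?_, (hX g).trans h, ?_⟩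
  · refine (hN g).trans ?_
    rw [e, ENNReal.one_rpow]
  · refine i.congr fun k => ?_
    refine Eq.trans ?_ (hN _).symm
    rw [pExp_eq hn hθ]; rfl

end
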